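/- The fifth group cohomology H^5(Γ_0(N), ℂ) vanishes for every level N in the set {2, 3, 4, 5, 6, 7, 8, 10, 12}; that is, for each such N the ℂ-vector space H^5(Γ_0(N), ℂ) is zero. -/

import Mathlib

/-- The congruence subgroup `Γ₀(N) ⊆ SL(4, ℤ)` consisting of matrices whose last row is
congruent to `(0,0,0,*)` modulo `N`, i.e. whose first three entries of the last row are
divisible by `N`. -/
def Gamma0 (N : ℕ) : Subgroup (Matrix.SpecialLinearGroup (Fin 4) ℤ) where
  carrier := {A | ∀ j : Fin 4, j ≠ 3 → (N : ℤ) ∣ A.1 3 j}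
  one_mem' := by
    intro j hj
    simp [Matrix.one_apply_ne' hj]
  mul_mem' := by
    intro A B hA hB j hj
    show (N : ℤ) ∣ (A.1 * B.1) 3 j
    rw [Matrix.mul_apply]
    refine Finset.dvd_sum fun k _ => ?_
    by_cases hk : k = 3
    · subst hk
      exact (hB j hj).mul_left _
    · exact (hA k hk).mul_right _
  inv_mem' := by
    intro A hA j hj
    have hAB : (A.1 : Matrix (Fin 4) (Fin 4) ℤ) * (A⁻¹).1 = 1 := by
      rw [← Matrix.SpecialLinearGroup.coe_mul, mul_inv_cancel,
        Matrix.SpecialLinearGroup.coe_one]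
    set f : ℤ →+* ZMod N := Int.castRingHom (ZMod N) with hf
    have hab : (A.1.map f) * ((A⁻¹).1.map f) = 1 := by
      rw [← Matrix.map_mul, hAB, Matrix.map_one f f.map_zero f.map_one]
    have ha0 : ∀ k : Fin 4, k ≠ 3 → (A.1.map f) 3 k = 0 := by
      intro k hk
      have := hA k hk
      simpa [Matrix.map_apply, hf, ZMod.intCast_zmod_eq_zero_iff_dvd] using this
    have hsum : ∀ i, ∑ k, (A.1.map f) 3 k * ((A⁻¹).1.map f) k i
        = (1 : Matrix (Fin 4) (Fin 4) (ZMod N)) 3 i := by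
      intro i
      rw [← Matrix.mul_apply, hab]
    have hsum' : ∀ i, (A.1.map f) 3 3 * ((A⁻¹).1.map f) 3 i
        = (1 : Matrix (Fin 4) (Fin 4) (ZMod N)) 3 i := by
      intro i
      have h := hsum i
      rw [Fin.sum_univ_four, ha0 0 (by decide), ha0 1 (by decide),
        ha0 2 (by decide), zero_mul, zero_mul, zero_mul, zero_add, zero_add,
        zero_add] at h
      exact h
    have hunit : (A.1.map f) 3 3 * ((A⁻¹).1.map f) 3 3 = 1 := by
      simpa [Matrix.one_apply] using hsum' 3
    have hzero : (A.1.map f) 3 3 * ((A⁻¹).1.map f) 3 j = 0 := by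
      simpa [Matrix.one_apply_ne' hj] using hsum' j
    have hb : ((A⁻¹).1.map f) 3 j = 0 := by
      calc ((A⁻¹).1.map f) 3 j
          = ((A.1.map f) 3 3 * ((A⁻¹).1.map f) 3 3) * ((A⁻¹).1.map f) 3 j := by
            rw [hunit, one_mul]
        _ = ((A⁻¹).1.map f) 3 3 * ((A.1.map f) 3 3 * ((A⁻¹).1.map f) 3 j) := by ring
        _ = 0 := by rw [hzero, mul_zero]
    show (N : ℤ) ∣ (A⁻¹).1 3 j
    rw [← ZMod.intCast_zmod_eq_zero_iff_dvd]
    simpa [Matrix.map_apply, hf] using hb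

namespace Voronoi

/-! ### Alternating even functions on lists -/

section Lists

variable {α : Type*} [InvolutiveNeg α]

/-- A function on lists that changes sign under adjacent transpositions and is unchanged when an
entry is negated. -/
structure AltEven (f : List α → ℂ) : Prop where
  swap : ∀ l₁ a b l₂, f (l₁ ++ a :: b :: l₂) = -f (l₁ ++ b :: a :: l₂)
  neg : ∀ l₁ a l₂, f (l₁ ++ (-a) :: l₂) = f (l₁ ++ a :: l₂)

omit [InvolutiveNeg α] in
theorem length_append_cons (l₁ l₂ : List α) (a : α) :
    (l₁ ++ a :: l₂).length = (l₁ ++ l₂).length + 1 := by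
  simp; omega

/-- The alternating sum of the values of `f` on the lists obtained by deleting one entry. -/
def dl : List α → (List α → ℂ) → ℂ
  | [], _ => 0
  | a :: l, f => f l - dl l fun t => f (a :: t)

omit [InvolutiveNeg α] in
@[simp] theorem dl_nil (f : List α → ℂ) : dl [] f = 0 := rfl

omit [InvolutiveNeg α] in
theorem dl_cons (a : α) (l : List α) (f : List α → ℂ) :
    dl (a :: l) f = f l - dl l fun t => f (a :: t) := rfl

omit [InvolutiveNeg α] in
theorem dl_congr {l : List α} {f g : List α → ℂ}
    (h : ∀ t, t.Sublist l → t.length + 1 = l.length → f t = g t) : dl l f = dl l g := by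
  induction l generalizing f g with
  | nil => rfl
  | cons a l ih =>
    rw [dl_cons, dl_cons, h l (List.sublist_cons_self a l) rfl]
    congr 1
    exact ih fun t ht hl => h _ (ht.cons_cons a) (by simp [hl])

omit [InvolutiveNeg α] in
theorem dl_sub (l : List α) (f g : List α → ℂ) :
    dl l (fun t => f t - g t) = dl l f - dl l g := by
  induction l generalizing f g with
  | nil => simp
  | cons a l ih => rw [dl_cons, dl_cons, dl_cons, ih]; ring

omit [InvolutiveNeg α] in
theorem dl_add (l : List α) (f g : List α → ℂ) :
    dl l (fun t => f t + g t) = dl l f + dl l g := by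
  induction l generalizing f g with
  | nil => simp
  | cons a l ih => rw [dl_cons, dl_cons, dl_cons, ih]; ring

omit [InvolutiveNeg α] in
theorem dl_smul (l : List α) (c : ℂ) (f : List α → ℂ) :
    dl l (fun t => c * f t) = c * dl l f := by
  induction l generalizing f with
  | nil => simp
  | cons a l ih => rw [dl_cons, dl_cons, ih]; ring

omit [InvolutiveNeg α] in
theorem dl_neg (l : List α) (f : List α → ℂ) : dl l (fun t => -f t) = -dl l f := by
  simpa using dl_smul l (-1) f

omit [InvolutiveNeg α] in
theorem dl_zero (l : List α) : dl l (fun _ => 0) = 0 := by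
  simpa using dl_smul l 0 fun _ => 0

omit [InvolutiveNeg α] in
theorem exists_of_dl_ne_zero {l : List α} {f : List α → ℂ} (h : dl l f ≠ 0) :
    ∃ t, t.Sublist l ∧ t.length + 1 = l.length ∧ f t ≠ 0 := by
  by_contra! hc
  exact h ((dl_congr hc).trans (dl_zero l))

omit [InvolutiveNeg α] in
theorem dl_dl (l : List α) (f : List α → ℂ) : dl l (fun t => dl t f) = 0 := by
  induction l generalizing f with
  | nil => rfl
  | cons a l ih =>
    rw [dl_cons]
    simp only [dl_cons]
    rw [dl_sub, ih]
    ring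

omit [InvolutiveNeg α] in
theorem dl_map {β : Type*} (φ : β → α) (l : List β) (f : List α → ℂ) :
    dl (l.map φ) f = dl l fun t => f (t.map φ) := by
  induction l generalizing f with
  | nil => rfl
  | cons a l ih => simp only [List.map_cons, dl_cons, ih]

namespace AltEven

variable {f g : List α → ℂ}

theorem cons (hf : AltEven f) (a : α) : AltEven fun t => f (a :: t) :=
  ⟨fun l₁ b c l₂ => hf.swap (a :: l₁) b c l₂, fun l₁ b l₂ => hf.neg (a :: l₁) b l₂⟩

theorem dl (hf : AltEven f) : AltEven fun l => dl l f := by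
  constructor
  · intro l₁ a b l₂
    induction l₁ generalizing f with
    | nil =>
      have h : (fun t => f (a :: b :: t)) = fun t => -f (b :: a :: t) :=
        funext fun t => hf.swap [] a b t
      simp only [List.nil_append, dl_cons, h, dl_neg]
      ring
    | cons c l₁ ih =>
      have h1 := hf.swap l₁ a b l₂
      have h2 := ih (hf.cons c)
      simp only [List.cons_append, dl_cons, h1, h2]
      ring
  · intro l₁ a l₂
    induction l₁ generalizing f with
    | nil =>
      have h : (fun t => f (-a :: t)) = fun t => f (a :: t) := funext fun t => hf.neg [] a t
      simp only [List.nil_append, dl_cons, h]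
    | cons c l₁ ih =>
      have h1 := hf.neg l₁ a l₂
      have h2 := ih (hf.cons c)
      simp only [List.cons_append, dl_cons, h1, h2]

theorem zero : AltEven (fun _ : List α => 0) := ⟨by simp, by simp⟩

theorem add (hf : AltEven f) (hg : AltEven g) : AltEven fun l => f l + g l :=
  ⟨fun l₁ a b l₂ => by rw [hf.swap, hg.swap]; ring, fun l₁ a l₂ => by rw [hf.neg, hg.neg]⟩

theorem smul (c : ℂ) (hf : AltEven f) : AltEven fun l => c * f l :=
  ⟨fun l₁ a b l₂ => by rw [hf.swap]; ring, fun l₁ a l₂ => by rw [hf.neg]⟩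

/-- Multiplying by a function that only depends on the set of entries up to sign. -/
theorem mul_sym (hf : AltEven f) (hs : ∀ l₁ a b l₂, g (l₁ ++ a :: b :: l₂) = g (l₁ ++ b :: a :: l₂))
    (hn : ∀ l₁ a l₂, g (l₁ ++ (-a) :: l₂) = g (l₁ ++ a :: l₂)) : AltEven fun l => g l * f l :=
  ⟨fun l₁ a b l₂ => by rw [hf.swap, hs]; ring, fun l₁ a l₂ => by rw [hf.neg, hn]⟩

theorem move (l₁ l₂ : List α) (b : α) : ∃ s : ℂ, s * s = 1 ∧
    ∀ f : List α → ℂ, AltEven f → f (l₁ ++ b :: l₂) = s * f (b :: (l₁ ++ l₂)) := by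
  induction l₁ with
  | nil => exact ⟨1, by simp, by simp⟩
  | cons a l₁ ih =>
    obtain ⟨s, hs, h⟩ := ih
    refine ⟨-s, by simpa using hs, fun f hf => ?_⟩
    have h1 := h _ (hf.cons a)
    have h2 := hf.swap [] a b (l₁ ++ l₂)
    simp only [List.nil_append] at h2
    simp only [List.cons_append, h1, h2]
    ring

theorem eq_zero_of_repeat (hf : AltEven f) {a b : α} {l : List α} (hb : b ∈ l)
    (hab : a = b ∨ a = -b) : f (a :: l) = 0 := by
  obtain ⟨l₁, l₂, rfl⟩ := List.append_of_mem hb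
  obtain ⟨s, -, h⟩ := move l₁ l₂ b
  rw [h _ (hf.cons a)]
  have h1 : f (a :: b :: (l₁ ++ l₂)) = f (b :: b :: (l₁ ++ l₂)) := by
    rcases hab with rfl | rfl
    · rfl
    · exact hf.neg [] b _
  have h2 := hf.swap [] b b (l₁ ++ l₂)
  simp only [List.nil_append] at h2
  have h3 : f (b :: b :: (l₁ ++ l₂)) = 0 := by
    linear_combination h2 / 2
  rw [h1, h3, mul_zero]

end AltEven

/-- No two entries agree up to sign. -/
def PNodup (l : List α) : Prop := l.Pairwise fun a b => a ≠ b ∧ a ≠ -b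

theorem AltEven.pnodup {f : List α → ℂ} (hf : AltEven f) {l : List α} (h : f l ≠ 0) :
    PNodup l := by
  induction l generalizing f with
  | nil => exact List.Pairwise.nil
  | cons a l ih =>
    refine List.pairwise_cons.2 ⟨fun b hb => ?_, ih (hf.cons a) h⟩
    by_contra hc
    exact h (hf.eq_zero_of_repeat hb (by tauto))

/-- Membership up to sign. -/
def PMem (a : α) (l : List α) : Prop := a ∈ l ∨ -a ∈ l

theorem PMem.neg {a : α} {l : List α} (h : PMem a l) : PMem (-a) l := by
  unfold PMem at *; rw [neg_neg]; tauto

theorem pmem_cons {a b : α} {l : List α} :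
    PMem a (b :: l) ↔ (a = b ∨ a = -b) ∨ PMem a l := by
  unfold PMem
  simp only [List.mem_cons, neg_eq_iff_eq_neg]
  tauto

theorem PMem.mono {a : α} {l l' : List α} (h : PMem a l) (hl : l ⊆ l') : PMem a l' :=
  h.imp (fun h => hl h) (fun h => hl h)

theorem AltEven.exists_sign {l' l : List α} (hn : PNodup l') (hs : ∀ a ∈ l', PMem a l)
    (hlen : l'.length = l.length) : ∃ s : ℂ, s * s = 1 ∧
      ∀ f : List α → ℂ, AltEven f → f l' = s * f l := by
  induction l' generalizing l with
  | nil =>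
    obtain rfl : l = [] := List.length_eq_zero_iff.1 hlen.symm
    exact ⟨1, by simp, by simp⟩
  | cons a t ih =>
    obtain ⟨ha, ht⟩ := List.pairwise_cons.1 hn
    obtain ⟨b, hb, hab⟩ : ∃ b ∈ l, a = b ∨ a = -b := by
      rcases hs a (by simp) with h | h
      · exact ⟨a, h, Or.inl rfl⟩
      · exact ⟨-a, h, Or.inr (by simp)⟩
    obtain ⟨l₁, l₂, rfl⟩ := List.append_of_mem hb
    obtain ⟨s, hs1, h1⟩ := AltEven.move l₁ l₂ b
    obtain ⟨s', hs1', h2⟩ := ih (l := l₁ ++ l₂) ht (by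
      intro c hc
      obtain ⟨hc1, hc2⟩ := ha c hc
      have hcb : c ≠ b ∧ c ≠ -b := by
        rcases hab with rfl | rfl
        · exact ⟨hc1.symm, fun h => hc2 (by simp [h])⟩
        · exact ⟨fun h => hc2 (by simp [h]), fun h => hc1 (by simp [h])⟩
      have hcb' : -c ≠ b := fun h => hcb.2 (by simp [← h])
      rcases hs c (List.mem_cons_of_mem _ hc) with h | h
      · left; simpa [hcb.1] using h
      · right; simpa [hcb'] using h) (by simp at hlen ⊢; omega)
    refine ⟨s' * s, by linear_combination hs1 * s' ^ 2 + hs1', fun f hf => ?_⟩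
    have h3 : f (a :: t) = f (b :: t) := by
      rcases hab with rfl | rfl
      · rfl
      · exact hf.neg [] b t
    rw [h3, h2 _ (hf.cons b), h1 f hf]
    linear_combination (-s' * f (b :: (l₁ ++ l₂))) * hs1

/-! ### Sums over lists of given length -/

/-- The sum of `F` over the lists of length `m` with entries in `S`. -/
def sumL (S : Finset α) : ℕ → (List α → ℂ) → ℂ
  | 0, F => F []
  | m + 1, F => ∑ v ∈ S, sumL S m fun l => F (v :: l)

section
omit [InvolutiveNeg α]

theorem sumL_zero_right (S : Finset α) (m : ℕ) : sumL S m (fun _ => 0) = 0 := by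
  induction m with
  | zero => rfl
  | succ m ih => simp [sumL, ih]

theorem sumL_add (S : Finset α) (m : ℕ) (F G : List α → ℂ) :
    sumL S m (fun l => F l + G l) = sumL S m F + sumL S m G := by
  induction m generalizing F G with
  | zero => rfl
  | succ m ih => simp only [sumL, ih, Finset.sum_add_distrib]

theorem sumL_mul (S : Finset α) (m : ℕ) (c : ℂ) (F : List α → ℂ) :
    sumL S m (fun l => c * F l) = c * sumL S m F := by
  induction m generalizing F with
  | zero => rfl
  | succ m ih => simp only [sumL, ih, Finset.mul_sum]

theorem sumL_neg (S : Finset α) (m : ℕ) (F : List α → ℂ) :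
    sumL S m (fun l => -F l) = -sumL S m F := by
  simpa using sumL_mul S m (-1) F

theorem sumL_sub (S : Finset α) (m : ℕ) (F G : List α → ℂ) :
    sumL S m (fun l => F l - G l) = sumL S m F - sumL S m G := by
  simp only [sub_eq_add_neg, sumL_add, sumL_neg]

theorem sumL_congr {S : Finset α} {m : ℕ} {F G : List α → ℂ}
    (h : ∀ l : List α, l.length = m → (∀ v ∈ l, v ∈ S) → F l = G l) :
    sumL S m F = sumL S m G := by
  induction m generalizing F G with
  | zero => exact h [] rfl (by simp)
  | succ m ih =>
    refine Finset.sum_congr rfl fun v hv => ih fun l hl hS => h _ (by simp [hl]) ?_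
    simpa using ⟨hv, hS⟩

theorem sumL_sum {ι : Type*} (s : Finset ι) (S : Finset α) (m : ℕ) (F : ι → List α → ℂ) :
    sumL S m (fun l => ∑ i ∈ s, F i l) = ∑ i ∈ s, sumL S m (F i) := by
  induction m generalizing F with
  | zero => rfl
  | succ m ih =>
    simp only [sumL, ih]
    exact Finset.sum_comm

theorem sumL_comm_sum (S T : Finset α) (m : ℕ) (F : α → List α → ℂ) :
    sumL S m (fun l => ∑ v ∈ T, F v l) = ∑ v ∈ T, sumL S m (F v) := sumL_sum T S m F

theorem sumL_map {β : Type*} [DecidableEq β] (S : Finset α) (φ : α → β)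
    (hφ : Function.Injective φ) (m : ℕ) (F : List β → ℂ) :
    sumL (S.image φ) m F = sumL S m fun l => F (l.map φ) := by
  induction m generalizing F with
  | zero => rfl
  | succ m ih => simp only [sumL, ih, Finset.sum_image hφ.injOn, List.map_cons]

theorem sumL_subset {S T : Finset α} (hST : S ⊆ T) {m : ℕ} {F : List α → ℂ}
    (h : ∀ l : List α, l.length = m → F l ≠ 0 → ∀ v ∈ l, v ∈ S) : sumL S m F = sumL T m F := by
  induction m generalizing F with
  | zero => rfl
  | succ m ih =>
    simp only [sumL]
    rw [← Finset.sum_subset hST]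
    · exact Finset.sum_congr rfl fun v hv => ih fun l hl h0 w hw =>
        h _ (by simp [hl]) h0 w (List.mem_cons_of_mem v hw)
    · intro v _ hv
      rw [← sumL_zero_right S m]
      rw [← ih]
      · refine sumL_congr fun l hl _ => ?_
        by_contra h0
        exact hv (h _ (by simp [hl]) h0 v (by simp))
      · intro l hl h0 w hw
        exact h _ (by simp [hl]) h0 w (List.mem_cons_of_mem v hw)

theorem exists_of_sumL_ne_zero {S : Finset α} {m : ℕ} {F : List α → ℂ} (h : sumL S m F ≠ 0) :
    ∃ l : List α, l.length = m ∧ (∀ v ∈ l, v ∈ S) ∧ F l ≠ 0 := by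
  by_contra! hc
  exact h ((sumL_congr fun l hl hS => hc l hl hS).trans (sumL_zero_right S m))

end

omit [InvolutiveNeg α] in
/-- Deleting an entry is adjoint to prepending one. -/
theorem sumL_dl_mul (S : Finset α) (m : ℕ) (f g : List α → ℂ)
    (hg : ∀ l₁ a b l₂, g (l₁ ++ a :: b :: l₂) = -g (l₁ ++ b :: a :: l₂)) :
    sumL S (m + 1) (fun l => dl l f * g l) =
      (m + 1) * sumL S m fun l => ∑ v ∈ S, f l * g (v :: l) := by
  induction m generalizing f g with
  | zero => simp [sumL, dl_cons]
  | succ m ih =>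
    rw [sumL]
    simp only [dl_cons, sub_mul, sumL_sub, Finset.sum_sub_distrib]
    have h1 : ∀ v, sumL S (m + 1) (fun l => dl l (fun t => f (v :: t)) * g (v :: l)) =
        (m + 1) * sumL S m fun l => ∑ w ∈ S, f (v :: l) * g (v :: w :: l) := fun v =>
      ih (fun t => f (v :: t)) (fun t => g (v :: t)) fun l₁ a b l₂ => hg (v :: l₁) a b l₂
    simp only [h1]
    have h2 : ∀ v, sumL S m (fun l => ∑ w ∈ S, f (v :: l) * g (v :: w :: l)) =
        -sumL S m fun l => ∑ w ∈ S, f (v :: l) * g (w :: v :: l) := by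
      intro v
      rw [← sumL_neg]
      refine sumL_congr fun l _ _ => ?_
      rw [← Finset.sum_neg_distrib]
      refine Finset.sum_congr rfl fun w _ => ?_
      have := hg [] v w l
      simp only [List.nil_append] at this
      rw [this]; ring
    simp only [h2]
    rw [← sumL_comm_sum]
    rw [← Finset.mul_sum, Finset.sum_neg_distrib]
    have h3 : (∑ v ∈ S, sumL S m fun l => ∑ w ∈ S, f (v :: l) * g (w :: v :: l)) =
        sumL S (m + 1) fun l => ∑ v ∈ S, f l * g (v :: l) := rfl
    rw [h3]
    push_cast
    ring

end Lists

end Voronoi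

namespace Voronoi

open Matrix

/-! ### Symmetric squares -/

/-- First index of the `k`-th monomial of degree two in four variables. -/
def ia : Fin 10 → Fin 4 := ![0, 0, 0, 0, 1, 1, 1, 2, 2, 3]

/-- Second index of the `k`-th monomial of degree two in four variables. -/
def ib : Fin 10 → Fin 4 := ![0, 1, 2, 3, 1, 2, 3, 2, 3, 3]

section SymSq

variable {R : Type*} [CommRing R]

/-- The vector of degree two monomials in the coordinates of `v`. -/
def sq (v : Fin 4 → R) : Fin 10 → R := fun k => v (ia k) * v (ib k)

/-- The matrix of the symmetric square. -/
def sym2 (M : Matrix (Fin 4) (Fin 4) R) : Matrix (Fin 10) (Fin 10) R := fun k l =>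
  if ia l = ib l then M (ia k) (ia l) * M (ib k) (ia l)
  else M (ia k) (ia l) * M (ib k) (ib l) + M (ia k) (ib l) * M (ib k) (ia l)

theorem sq_neg (v : Fin 4 → R) : sq (-v) = sq v := by
  funext k; simp [sq]

theorem sq_mulVec (M : Matrix (Fin 4) (Fin 4) R) (v : Fin 4 → R) :
    sq (M *ᵥ v) = sym2 M *ᵥ sq v := by
  funext k
  simp only [sq, sym2, mulVec, dotProduct]
  generalize ia k = a
  generalize ib k = b
  simp [Fin.sum_univ_succ, ia, ib]
  ring

theorem dotProduct_sq (c : Fin 10 → R) (v : Fin 4 → R) : c ⬝ᵥ sq v =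
    c 0 * (v 0 * v 0) + c 1 * (v 0 * v 1) + c 2 * (v 0 * v 2) + c 3 * (v 0 * v 3) +
    c 4 * (v 1 * v 1) + c 5 * (v 1 * v 2) + c 6 * (v 1 * v 3) + c 7 * (v 2 * v 2) +
    c 8 * (v 2 * v 3) + c 9 * (v 3 * v 3) := by
  simp [sq, dotProduct, Fin.sum_univ_succ, ia, ib]
  ring

theorem eq_zero_of_dotProduct_sq {c : Fin 10 → R} (h : ∀ v, c ⬝ᵥ sq v = 0) : c = 0 := by
  have h0 := h ![1, 0, 0, 0]
  have h4 := h ![0, 1, 0, 0]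
  have h7 := h ![0, 0, 1, 0]
  have h9 := h ![0, 0, 0, 1]
  have h1 := h ![1, 1, 0, 0]
  have h2 := h ![1, 0, 1, 0]
  have h3 := h ![1, 0, 0, 1]
  have h5 := h ![0, 1, 1, 0]
  have h6 := h ![0, 1, 0, 1]
  have h8 := h ![0, 0, 1, 1]
  simp [dotProduct_sq] at h0 h1 h2 h3 h4 h5 h6 h7 h8 h9
  simp [h0, h4, h7, h9] at h1 h2 h3 h5 h6 h8
  funext k
  fin_cases k <;> assumption

theorem eq_of_mulVec_sq {A B : Matrix (Fin 10) (Fin 10) R} (h : ∀ v, A *ᵥ sq v = B *ᵥ sq v) :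
    A = B := by
  have : ∀ k, A k - B k = 0 := fun k => eq_zero_of_dotProduct_sq fun v => by
    rw [sub_dotProduct, sub_eq_zero]
    exact congrFun (h v) k
  funext k
  exact sub_eq_zero.1 (this k)

theorem sym2_mul (M N : Matrix (Fin 4) (Fin 4) R) : sym2 (M * N) = sym2 M * sym2 N := by
  refine eq_of_mulVec_sq fun v => ?_
  rw [← sq_mulVec, ← mulVec_mulVec, sq_mulVec, sq_mulVec, mulVec_mulVec]

theorem sym2_one : sym2 (1 : Matrix (Fin 4) (Fin 4) R) = 1 := by
  refine eq_of_mulVec_sq fun v => ?_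
  rw [← sq_mulVec, one_mulVec, one_mulVec]

theorem sym2_diagonal (D : Fin 4 → R) : sym2 (diagonal D) = diagonal (sq D) := by
  refine eq_of_mulVec_sq fun v => ?_
  rw [← sq_mulVec]
  funext k
  simp [sq, mulVec_diagonal]
  ring

theorem sym2_map {S : Type*} [CommRing S] (f : R →+* S) (M : Matrix (Fin 4) (Fin 4) R) :
    sym2 (M.map f) = (sym2 M).map f := by
  ext k l
  simp only [sym2, map_apply]
  split_ifs <;> simp

end SymSq

theorem det_sym2_pos {M : Matrix (Fin 4) (Fin 4) ℚ} (hM : 0 < M.det) : 0 < (sym2 M).det := by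
  suffices h : 0 < M.det * (sym2 M).det from (pos_iff_pos_of_mul_pos h).1 hM
  refine diagonal_transvection_induction_of_det_ne_zero
    (fun M : Matrix (Fin 4) (Fin 4) ℚ => 0 < M.det * (sym2 M).det) M hM.ne' ?_ ?_ ?_
  · intro D hD
    have h0 : ∏ i, D i ≠ 0 := by rwa [← det_diagonal]
    have h : (diagonal D).det * (sym2 (diagonal D)).det = ((∏ i, D i) ^ 3) ^ 2 := by
      rw [sym2_diagonal, det_diagonal, det_diagonal]
      simp [Fin.prod_univ_succ, sq, ia, ib]
      ring
    rw [h]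
    positivity
  · intro t
    have h : t.toMatrix = transvection t.i t.j (t.c / 2) * transvection t.i t.j (t.c / 2) := by
      rw [transvection_mul_transvection_same _ _ t.hij, add_halves]
      rfl
    have h1 : (1 : ℚ) = (sym2 t.toMatrix).det *
        (sym2 (transvection t.i t.j (-t.c))).det := by
      rw [← det_mul, ← sym2_mul, TransvectionStruct.toMatrix,
        transvection_mul_transvection_same _ _ t.hij, add_neg_cancel, transvection_zero,
        sym2_one, det_one]
    have h2 : (sym2 t.toMatrix).det ≠ 0 := left_ne_zero_of_mul (h1 ▸ one_ne_zero)
    rw [TransvectionStruct.det, one_mul]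
    rw [h, sym2_mul, det_mul] at h2 ⊢
    exact lt_of_le_of_ne (mul_self_nonneg _) h2.symm
  · intro A B _ _ hA hB
    rw [sym2_mul, det_mul, det_mul]
    calc 0 < (A.det * (sym2 A).det) * (B.det * (sym2 B).det) := mul_pos hA hB
      _ = _ := by ring

theorem det_sym2 (g : SpecialLinearGroup (Fin 4) ℤ) : (sym2 g.1).det = 1 := by
  have h0 : g.1 * (g⁻¹).1 = 1 := congrArg Subtype.val (mul_inv_cancel g)
  have h1 : (sym2 g.1).det * (sym2 (g⁻¹).1).det = 1 := by
    rw [← det_mul, ← sym2_mul, h0, sym2_one, det_one]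
  have h2 : 0 < (sym2 g.1).det := by
    have h3 : 0 < (g.1.map (Int.castRingHom ℚ)).det := by
      have : (g.1.map (Int.castRingHom ℚ)).det = 1 := by
        have := (Int.castRingHom ℚ).map_det g.1
        rw [g.2, map_one] at this
        exact this.symm
      rw [this]; exact one_pos
    have h4 := det_sym2_pos h3
    rw [sym2_map] at h4
    have h5 := (Int.castRingHom ℚ).map_det (sym2 g.1)
    rw [RingHom.mapMatrix_apply] at h5
    rw [← h5, eq_intCast] at h4
    exact_mod_cast h4
  rcases Int.eq_one_or_neg_one_of_mul_eq_one h1 with h | h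
  · exact h
  · omega

/-! ### Determinants of lists of rows -/

/-- The determinant of the matrix with the given rows. -/
def rowDet (L : List (Fin 10 → ℤ)) : ℤ :=
  det (of fun i : Fin 10 => L.getD i 0)

theorem rowDet_cons (x : Fin 10 → ℤ) (L : List (Fin 10 → ℤ)) :
    rowDet (x :: L) = cramer (of fun i : Fin 10 => (0 :: L : List (Fin 10 → ℤ)).getD i 0)ᵀ x 0 := by
  rw [cramer_transpose_apply, rowDet]
  congr 1
  funext i
  refine Fin.cases ?_ (fun i => ?_) i
  · rw [updateRow_self]; rfl
  · rw [updateRow_ne (Fin.succ_ne_zero i)]; rfl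

theorem rowDet_swap (L₁ L₂ : List (Fin 10 → ℤ)) (a b : Fin 10 → ℤ) (h : L₁.length + 1 < 10) :
    rowDet (L₁ ++ a :: b :: L₂) = -rowDet (L₁ ++ b :: a :: L₂) := by
  have hne : (⟨L₁.length, by omega⟩ : Fin 10) ≠ ⟨L₁.length + 1, h⟩ := by simp
  have := det_permute (Equiv.swap (⟨L₁.length, by omega⟩ : Fin 10) ⟨L₁.length + 1, h⟩)
    (of fun i : Fin 10 => (L₁ ++ b :: a :: L₂).getD i 0)
  rw [Equiv.Perm.sign_swap hne] at this
  simp only [Units.val_neg, Units.val_one, Int.cast_neg, Int.cast_one, neg_mul, one_mul] at this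
  rw [rowDet, rowDet, ← this]
  congr 1
  funext i
  by_cases h1 : i = ⟨L₁.length, by omega⟩
  · subst h1
    funext j
    simp [Equiv.swap_apply_left, of_apply]
  by_cases h2 : i = ⟨L₁.length + 1, h⟩
  · subst h2
    funext j
    simp [Equiv.swap_apply_right, of_apply]
  · funext j
    rw [submatrix_apply, Equiv.swap_apply_of_ne_of_ne h1 h2, of_apply, of_apply]
    have h1' : i.1 ≠ L₁.length := fun h => h1 (Fin.ext h)
    have h2' : i.1 ≠ L₁.length + 1 := fun h => h2 (Fin.ext h)
    simp only [id]
    rw [List.getD_eq_getElem?_getD, List.getD_eq_getElem?_getD]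
    rcases lt_or_ge i.1 L₁.length with hlt | hge
    · rw [List.getElem?_append_left hlt, List.getElem?_append_left hlt]
    · rw [List.getElem?_append_right hge, List.getElem?_append_right hge]
      obtain ⟨k, hk⟩ : ∃ k, i.1 - L₁.length = k + 2 := ⟨i.1 - L₁.length - 2, by omega⟩
      rw [hk]; rfl

theorem rowDet_eq_zero_of_mem {x : Fin 10 → ℤ} {L : List (Fin 10 → ℤ)} (h : x ∈ L)
    (hL : L.length < 10) : rowDet (x :: L) = 0 := by
  obtain ⟨n, hn, rfl⟩ := List.getElem_of_mem h
  refine det_zero_of_row_eq (i := 0) (j := ⟨n + 1, by omega⟩) (by simp [Fin.ext_iff]) ?_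
  funext j
  simp [of_apply, List.getD_eq_getElem?_getD, hn]

theorem exists_of_rowDet_eq_zero {L : List (Fin 10 → ℤ)} (hL : L.length = 10)
    (h : rowDet L = 0) : ∃ c ≠ 0, ∀ x ∈ L, c ⬝ᵥ x = 0 := by
  obtain ⟨c, hc, h⟩ := exists_mulVec_eq_zero_iff.2 h
  refine ⟨c, hc, fun x hx => ?_⟩
  obtain ⟨n, hn, rfl⟩ := List.getElem_of_mem hx
  have := congrFun h ⟨n, by omega⟩
  rw [dotProduct_comm]
  simpa [mulVec, of_apply, List.getD_eq_getElem?_getD, hn] using this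

theorem rowDet_map (A : Matrix (Fin 10) (Fin 10) ℤ) (L : List (Fin 10 → ℤ)) :
    rowDet (L.map (A *ᵥ ·)) = A.det * rowDet L := by
  rw [rowDet, rowDet, ← det_transpose A, mul_comm, ← det_mul]
  congr 1
  ext i j
  rw [of_apply, List.getD_eq_getElem?_getD, List.getElem?_map, mul_apply]
  simp only [of_apply, List.getD_eq_getElem?_getD, transpose_apply]
  cases L[i.1]? with
  | none => simp
  | some x => simp [mulVec, dotProduct, mul_comm]

end Voronoi

namespace Voronoi

open Matrix

/-- Integral vectors. -/
abbrev Vec := Fin 4 → ℤ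

/-! ### Quadratic forms -/

/-- `p` is an integral quadratic form. -/
def IsQuad (p : Vec → ℤ) : Prop := ∃ c : Fin 10 → ℤ, ∀ v, p v = c ⬝ᵥ sq v

namespace IsQuad

variable {p p' : Vec → ℤ}

theorem add (h : IsQuad p) (h' : IsQuad p') : IsQuad (p + p') := by
  obtain ⟨c, hc⟩ := h
  obtain ⟨c', hc'⟩ := h'
  exact ⟨c + c', fun v => by rw [Pi.add_apply, hc, hc', add_dotProduct]⟩

theorem neg (h : IsQuad p) : IsQuad (-p) := by
  obtain ⟨c, hc⟩ := h
  exact ⟨-c, fun v => by rw [Pi.neg_apply, hc, neg_dotProduct]⟩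

theorem sub (h : IsQuad p) (h' : IsQuad p') : IsQuad (p - p') := by
  rw [sub_eq_add_neg]; exact h.add h'.neg

theorem smul (n : ℤ) (h : IsQuad p) : IsQuad (n • p) := by
  obtain ⟨c, hc⟩ := h
  exact ⟨n • c, fun v => by rw [Pi.smul_apply, hc, smul_dotProduct]⟩

theorem map_neg (h : IsQuad p) (v : Vec) : p (-v) = p v := by
  obtain ⟨c, hc⟩ := h
  rw [hc, hc, sq_neg]

theorem map_zero (h : IsQuad p) : p 0 = 0 := by
  obtain ⟨c, hc⟩ := h
  rw [hc]
  simp [dotProduct_sq]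

theorem comp (h : IsQuad p) (M : Matrix (Fin 4) (Fin 4) ℤ) : IsQuad fun v => p (M *ᵥ v) := by
  obtain ⟨c, hc⟩ := h
  refine ⟨c ᵥ* sym2 M, fun v => ?_⟩
  rw [← dotProduct_mulVec, ← sq_mulVec]
  exact hc _

end IsQuad

/-- The square of a linear form. -/
theorem isQuad_square (x : Vec) : IsQuad fun v => (x ⬝ᵥ v) ^ 2 := by
  refine ⟨fun k => if ia k = ib k then x (ia k) * x (ib k) else 2 * (x (ia k) * x (ib k)),
    fun v => ?_⟩
  rw [dotProduct_sq]
  simp [dotProduct, Fin.sum_univ_succ, ia, ib]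
  ring

/-- Vectors on which a quadratic form can be tested. -/
def testVec (k : Fin 10) : Vec :=
  if ia k = ib k then Pi.single (ia k) 1 else Pi.single (ia k) 1 + Pi.single (ib k) 1

/-- The values of a form on the test vectors, ordered lexicographically. -/
def key (p : Vec → ℤ) : Lex (Fin 10 → ℤ) := toLex fun k => p (testVec k)

theorem key_add (p p' : Vec → ℤ) : key (p + p') = key p + key p' := rfl

theorem key_sub (p p' : Vec → ℤ) : key (p - p') = key p - key p' := rfl

theorem key_zero : key 0 = 0 := rfl

theorem key_nonneg {p : Vec → ℤ} (h : ∀ v, 0 ≤ p v) : 0 ≤ key p :=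
  Pi.toLex_monotone (show (0 : Fin 10 → ℤ) ≤ fun k => p (testVec k) from fun _ => h _)

theorem eq_zero_of_key {p : Vec → ℤ} (hp : IsQuad p) (h : key p = 0) : p = 0 := by
  obtain ⟨c, hc⟩ := hp
  have h' : ∀ k, p (testVec k) = 0 := fun k => congrFun (congrArg ofLex h) k
  have hc0 : c = 0 := by
    have h0 := h' 0
    have h4 := h' 4
    have h7 := h' 7
    have h9 := h' 9
    have h1 := h' 1
    have h2 := h' 2
    have h3 := h' 3
    have h5 := h' 5
    have h6 := h' 6
    have h8 := h' 8
    simp [hc, dotProduct_sq, testVec, ia, ib] at h0 h1 h2 h3 h4 h5 h6 h7 h8 h9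
    simp [h0, h4, h7, h9] at h1 h2 h3 h5 h6 h8
    funext k
    fin_cases k <;> assumption
  funext v
  rw [hc, hc0, zero_dotProduct]; rfl

theorem wf_key {Q : Set (Vec → ℤ)} (hQ : ∀ q ∈ Q, ∀ v, 0 ≤ q v) :
    WellFounded fun a b : Q => key a.1 < key b.1 := by
  let φ : Q → Lex (Fin 10 → ℕ) := fun q => toLex fun k => (q.1 (testVec k)).toNat
  refine Subrelation.wf (r := InvImage (· < ·) φ) ?_ (InvImage.wf φ wellFounded_lt)
  rintro ⟨a, ha⟩ ⟨b, hb⟩ ⟨i, h1, h2⟩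
  have h1' : ∀ j < i, a (testVec j) = b (testVec j) := h1
  have h2' : a (testVec i) < b (testVec i) := h2
  refine ⟨i, fun j hj => ?_, ?_⟩
  · show (a (testVec j)).toNat = (b (testVec j)).toNat
    rw [h1' j hj]
  · show (a (testVec i)).toNat < (b (testVec i)).toNat
    have := hQ a ha (testVec i)
    omega

/-! ### Cells -/

/-- The entries of `l` span `ℚ⁴`. -/
def Spans (l : List Vec) : Prop := ∀ x : Vec, (∀ v ∈ l, x ⬝ᵥ v = 0) → x = 0

theorem Spans.mono {l l' : List Vec} (h : Spans l) (hl : l ⊆ l') : Spans l' :=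
  fun x hx => h x fun v hv => hx v (hl hv)

/-- All entries of `l` have value one under `q`. -/
def OnMin (q : Vec → ℤ) (l : List Vec) : Prop := ∀ v ∈ l, q v = 1

theorem OnMin.mono {q : Vec → ℤ} {l l' : List Vec} (h : OnMin q l') (hl : l ⊆ l') : OnMin q l :=
  fun v hv => h v (hl hv)

theorem onMin_cons {q : Vec → ℤ} {v : Vec} {l : List Vec} :
    OnMin q (v :: l) ↔ q v = 1 ∧ OnMin q l := by
  simp [OnMin]

/-- A spanning list of vectors that are minimal for two different forms. -/
def IsCell (Q : Set (Vec → ℤ)) (l : List Vec) : Prop :=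
  Spans l ∧ ∃ q ∈ Q, ∃ q' ∈ Q, q ≠ q' ∧ OnMin q l ∧ OnMin q' l

theorem IsCell.of_subset {Q : Set (Vec → ℤ)} {l l' : List Vec} (h : IsCell Q l') (hl : l ⊆ l')
    (hs : Spans l) : IsCell Q l := by
  obtain ⟨-, q, hq, q', hq', hne, h1, h2⟩ := h
  exact ⟨hs, q, hq, q', hq', hne, h1.mono hl, h2.mono hl⟩

/-- The combinatorial description of a perfect form `q`: its minimal vectors `u i` are partitioned
into frames indexed by `R`, and the facets of its Voronoi domain are obtained by omitting one vector
from each frame. -/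
structure VertexData (Q : Set (Vec → ℤ)) (q : Vec → ℤ) where
  I : Type
  R : Type
  [fintypeI : Fintype I]
  [fintypeR : Fintype R]
  [decI : DecidableEq I]
  [decR : DecidableEq R]
  [nonemptyR : Nonempty R]
  fr : I → R
  u : I → Vec
  d : (R → I) → Vec → ℤ
  mem_iff : ∀ v, q v = 1 ↔ ∃ i, v = u i ∨ v = -u i
  u_inj : ∀ i j, u i = u j ∨ u i = -u j → i = j
  d_quad : ∀ e, (∀ r, fr (e r) = r) → IsQuad (d e)
  d_apply : ∀ e, (∀ r, fr (e r) = r) → ∀ i, d e (u i) = if e (fr i) = i then 1 else 0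
  d_mem : ∀ e, (∀ r, fr (e r) = r) → q + d e ∈ Q
  frame : ∀ p, IsQuad p → ∀ r r', ∑ i with fr i = r, p (u i) = ∑ i with fr i = r', p (u i)
  perfect : ∀ p, IsQuad p → (∀ i, p (u i) = 0) → p = 0
  card : Fintype.card I = 9 + Fintype.card R

attribute [instance] VertexData.fintypeI VertexData.fintypeR VertexData.decI VertexData.decR
  VertexData.nonemptyR

/-- The properties of the set of perfect forms that are used below. -/
structure Tess (Q : Set (Vec → ℤ)) : Prop where
  quad : ∀ q ∈ Q, IsQuad q
  pos : ∀ q ∈ Q, ∀ v, v ≠ 0 → 1 ≤ q v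
  data : ∀ q ∈ Q, Nonempty (VertexData Q q)
  fin : ∀ l, Spans l → {q | q ∈ Q ∧ OnMin q l}.Finite

theorem Tess.nonneg {Q : Set (Vec → ℤ)} (hQ : Tess Q) {q : Vec → ℤ} (hq : q ∈ Q) (v : Vec) :
    0 ≤ q v := by
  by_cases hv : v = 0
  · rw [hv, (hQ.quad q hq).map_zero]
  · exact zero_le_one.trans (hQ.pos q hq v hv)

namespace VertexData

variable {Q : Set (Vec → ℤ)} {q : Vec → ℤ} (D : VertexData Q q)

theorem apply_u (i : D.I) : q (D.u i) = 1 := (D.mem_iff _).2 ⟨i, Or.inl rfl⟩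

theorem u_ne_zero (hq : IsQuad q) (i : D.I) : D.u i ≠ 0 := by
  intro h
  have := D.apply_u i
  rw [h, hq.map_zero] at this
  exact zero_ne_one this

theorem ext {p p' : Vec → ℤ} (hp : IsQuad p) (hp' : IsQuad p')
    (h : ∀ i, p (D.u i) = p' (D.u i)) : p = p' :=
  sub_eq_zero.1 (D.perfect _ (hp.sub hp') fun i => by simp [h])

theorem apply_eq_zero_of_pmem {p : Vec → ℤ} (hp : IsQuad p) {v : Vec} {l : List Vec}
    (hl : ∀ w ∈ l, p w = 0) (h : PMem v l) : p v = 0 := by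
  rcases h with h | h
  · exact hl _ h
  · rw [← hp.map_neg, hl _ h]

theorem d_apply_of_onMin {e : D.R → D.I} (he : ∀ r, D.fr (e r) = r) {l : List Vec}
    (hl : OnMin q l) (h : ∀ r, ¬PMem (D.u (e r)) l) {v : Vec} (hv : v ∈ l) : D.d e v = 0 := by
  obtain ⟨i, hi⟩ := (D.mem_iff v).1 (hl v hv)
  have h1 : D.d e v = D.d e (D.u i) := by
    rcases hi with rfl | rfl
    · rfl
    · exact (D.d_quad e he).map_neg _
  rw [h1, D.d_apply e he, if_neg]
  intro h2
  apply h (D.fr i)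
  rw [h2]
  rcases hi with rfl | rfl
  · exact Or.inl hv
  · exact Or.inr hv

theorem onMin_neighbour {e : D.R → D.I} (he : ∀ r, D.fr (e r) = r) {l : List Vec}
    (hl : OnMin q l) (h : ∀ r, ¬PMem (D.u (e r)) l) : OnMin (q + D.d e) l := fun v hv => by
  rw [Pi.add_apply, hl v hv, D.d_apply_of_onMin he hl h hv, add_zero]

theorem d_ne_zero {e : D.R → D.I} (he : ∀ r, D.fr (e r) = r) : D.d e ≠ 0 := by
  intro h
  have r : D.R := Classical.arbitrary _
  have := D.d_apply e he (e r)
  rw [h, he r] at this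
  simp at this

/-- Forms that are nonnegative on the minimal vectors are sums of the forms `d e`. -/
theorem decomp {T : D.I → Prop} {P : (Vec → ℤ) → Prop} (h0 : P 0)
    (hadd : ∀ p e, (∀ r, D.fr (e r) = r) → (∀ r, T (e r)) → P p → P (p + D.d e))
    {p : Vec → ℤ} (hp : IsQuad p) (hnn : ∀ i, 0 ≤ p (D.u i)) (hT : ∀ i, ¬T i → p (D.u i) = 0) :
    P p := by
  obtain ⟨r₀⟩ := D.nonemptyR
  obtain ⟨n, hn⟩ : ∃ n : ℕ, ∑ i with D.fr i = r₀, p (D.u i) = n :=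
    ⟨_, (Int.toNat_of_nonneg (Finset.sum_nonneg fun i _ => hnn i)).symm⟩
  induction n generalizing p with
  | zero =>
    have : p = 0 := by
      refine D.perfect p hp fun i => ?_
      have h1 := D.frame p hp (D.fr i) r₀
      rw [hn, Nat.cast_zero, Finset.sum_eq_zero_iff_of_nonneg fun i _ => hnn i] at h1
      exact h1 i (by simp)
    rw [this]; exact h0
  | succ n ih =>
    have h1 : ∀ r, ∃ i, D.fr i = r ∧ 0 < p (D.u i) := by
      intro r
      have h1 := D.frame p hp r r₀
      rw [hn] at h1
      by_contra! hc
      have : ∑ i with D.fr i = r, p (D.u i) ≤ 0 :=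
        Finset.sum_nonpos fun i hi => hc i (Finset.mem_filter.1 hi).2
      push_cast at h1
      omega
    choose e he hpos using h1
    have hTe : ∀ r, T (e r) := fun r => by
      by_contra hc
      exact (hpos r).ne' (hT _ hc)
    have h2 : P (p - D.d e) := by
      refine ih (hp.sub (D.d_quad e he)) (fun i => ?_) (fun i hi => ?_) ?_
      · rw [Pi.sub_apply, D.d_apply e he]
        split_ifs with h
        · have := hpos (D.fr i)
          rw [h] at this; omega
        · simpa using hnn i
      · rw [Pi.sub_apply, D.d_apply e he, if_neg, hT i hi, sub_zero]
        intro h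
        exact hi (h ▸ hTe _)
      · simp only [Pi.sub_apply, Finset.sum_sub_distrib, hn, D.d_apply e he]
        rw [Finset.sum_eq_single_of_mem (e r₀) (by simp [he])]
        · simp [he]
        · intro j hj hne
          rw [if_neg]
          intro h
          rw [(Finset.mem_filter.1 hj).2] at h
          exact hne h.symm
    have := hadd _ e he hTe h2
    rwa [sub_add_cancel] at this

theorem isCell_iff (hQ : Tess Q) (hq : q ∈ Q) {l : List Vec} (hl : OnMin q l) (hs : Spans l) :
    IsCell Q l ↔ ∀ r, ∃ i, D.fr i = r ∧ ¬PMem (D.u i) l := by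
  constructor
  · rintro ⟨-, q₁, hq₁, q₂, hq₂, hne, h1, h2⟩ r
    by_contra! hc
    obtain ⟨q', hq', hne', h'⟩ : ∃ q' ∈ Q, q' ≠ q ∧ OnMin q' l := by
      by_cases h : q₁ = q
      · exact ⟨q₂, hq₂, fun h' => hne (h.trans h'.symm), h2⟩
      · exact ⟨q₁, hq₁, h, h1⟩
    apply hne'
    have hquad : IsQuad (q' - q) := (hQ.quad q' hq').sub (hQ.quad q hq)
    have hnn : ∀ i, 0 ≤ (q' - q) (D.u i) := fun i => by
      rw [Pi.sub_apply, D.apply_u, sub_nonneg]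
      exact hQ.pos q' hq' _ (D.u_ne_zero (hQ.quad q hq) i)
    have h0 : ∀ w ∈ l, (q' - q) w = 0 := fun w hw => by
      rw [Pi.sub_apply, h' w hw, hl w hw, sub_self]
    refine sub_eq_zero.1 (D.perfect _ hquad fun i => ?_)
    have h3 := D.frame _ hquad (D.fr i) r
    rw [Finset.sum_eq_zero fun j hj => apply_eq_zero_of_pmem hquad h0
      (hc j (Finset.mem_filter.1 hj).2), Finset.sum_eq_zero_iff_of_nonneg fun i _ => hnn i] at h3
    exact h3 i (by simp)
  · intro h
    choose e he hn using h
    refine ⟨hs, q, hq, q + D.d e, D.d_mem e he, ?_, hl, D.onMin_neighbour he hl hn⟩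
    intro h
    exact D.d_ne_zero he (by simpa using h.symm)

/-- All sections avoiding `σ` lower the key. -/
def Descends (σ : List Vec) : Prop :=
  ∀ e : D.R → D.I, (∀ r, D.fr (e r) = r) → (∀ r, ¬PMem (D.u (e r)) σ) → key (D.d e) < 0

variable {D}

theorem Descends.key_neg {σ : List Vec} (h : D.Descends σ) {p : Vec → ℤ} (hp : IsQuad p)
    (hnn : ∀ i, 0 ≤ p (D.u i)) (h0 : ∀ w ∈ σ, p w = 0) : p = 0 ∨ key p < 0 := by
  refine D.decomp (T := fun i => ¬PMem (D.u i) σ) (P := fun p => p = 0 ∨ key p < 0) (Or.inl rfl)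
    ?_ hp hnn fun i hi => apply_eq_zero_of_pmem hp h0 (not_not.1 hi)
  intro p e he hT hp
  right
  rw [key_add]
  have := h e he hT
  rcases hp with rfl | hp
  · rw [key_zero, zero_add]; exact this
  · exact add_neg hp this

theorem Descends.spans {σ : List Vec} (h : D.Descends σ) : Spans σ := by
  intro x hx
  have h1 := h.key_neg (isQuad_square x) (fun i => sq_nonneg _) fun w hw => by
    simp [hx w hw]
  rcases h1 with h1 | h1
  · funext i
    have := congrFun h1 (Pi.single i 1)
    simpa using this
  · exact absurd h1 (not_lt.2 (key_nonneg fun v => sq_nonneg _))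

theorem Descends.le {σ : List Vec} (h : D.Descends σ) (hQ : Tess Q) (hq : q ∈ Q)
    (hσ : OnMin q σ) {q' : Vec → ℤ} (hq' : q' ∈ Q) (h' : OnMin q' σ) : key q' ≤ key q := by
  have h1 := h.key_neg ((hQ.quad q' hq').sub (hQ.quad q hq)) (fun i => by
    rw [Pi.sub_apply, D.apply_u, sub_nonneg]
    exact hQ.pos q' hq' _ (D.u_ne_zero (hQ.quad q hq) i)) fun w hw => by
      rw [Pi.sub_apply, h' w hw, hσ w hw, sub_self]
  rcases h1 with h1 | h1
  · rw [sub_eq_zero.1 h1]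
  · rw [key_sub, sub_neg] at h1
    exact h1.le

variable (D)

theorem descends_of_le {σ : List Vec} (hl : OnMin q σ)
    (h : ∀ q' ∈ Q, OnMin q' σ → key q' ≤ key q) : D.Descends σ := by
  intro e he hn
  have h1 := h _ (D.d_mem e he) (D.onMin_neighbour he hl hn)
  rw [key_add, add_le_iff_nonpos_right] at h1
  exact lt_of_le_of_ne h1 fun h2 => D.d_ne_zero he (eq_zero_of_key (D.d_quad e he) h2)

theorem exists_min_section (h : ∀ r, ∃ i, D.fr i = r) : ∃ e : D.R → D.I, (∀ r, D.fr (e r) = r) ∧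
    ∀ e', (∀ r, D.fr (e' r) = r) → ∀ r,
      key (D.d (Function.update e' r (e r))) ≤ key (D.d e') := by
  choose e₀ he₀ using h
  have : Nonempty {e : D.R → D.I // ∀ r, D.fr (e r) = r} := ⟨⟨e₀, he₀⟩⟩
  obtain ⟨⟨e, he⟩, hmin⟩ := Finite.exists_min
    fun e : {e : D.R → D.I // ∀ r, D.fr (e r) = r} => key (D.d e.1)
  refine ⟨e, he, fun e' he' r => ?_⟩
  have hu : ∀ {a b : D.R → D.I}, (∀ r, D.fr (a r) = r) → (∀ r, D.fr (b r) = r) →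
      ∀ s, D.fr (Function.update a r (b r) s) = s := by
    intro a b ha hb s
    by_cases hs : s = r
    · subst hs; simp [hb]
    · simp [hs, ha]
  have h1 := hmin ⟨_, hu he he'⟩
  have h2 : D.d (Function.update e' r (e r)) + D.d (Function.update e r (e' r)) =
      D.d e + D.d e' := by
    refine D.ext ((D.d_quad _ (hu he' he)).add (D.d_quad _ (hu he he')))
      ((D.d_quad _ he).add (D.d_quad _ he')) fun i => ?_
    simp only [Pi.add_apply, D.d_apply _ (hu he' he), D.d_apply _ (hu he he'), D.d_apply _ he,
      D.d_apply _ he']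
    by_cases hs : D.fr i = r
    · subst hs; simp
    · simp [hs]; ring
  have h3 := congrArg key h2
  rw [key_add, key_add] at h3
  have h4 : key (D.d (Function.update e' r (e r))) =
      key (D.d e') + (key (D.d e) - key (D.d (Function.update e r (e' r)))) := by
    rw [eq_sub_of_add_eq h3]; abel
  rw [h4]
  exact add_le_of_nonpos_right (sub_nonpos.2 h1)

end VertexData

end Voronoi

namespace Voronoi

open Matrix

theorem finite_lists {α : Type*} {S : Set α} (hS : S.Finite) (n : ℕ) :
    {l : List α | l.length = n ∧ ∀ v ∈ l, v ∈ S}.Finite := by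
  induction n with
  | zero =>
    refine (Set.finite_singleton []).subset ?_
    rintro l ⟨hl, -⟩
    exact List.length_eq_zero_iff.1 hl
  | succ n ih =>
    refine (Set.Finite.image2 List.cons hS ih).subset ?_
    rintro (_ | ⟨v, l⟩) ⟨hl, h⟩
    · simp at hl
    · exact ⟨v, h v (by simp), l, ⟨by simpa using hl, fun w hw => h w (by simp [hw])⟩, rfl⟩

theorem VertexData.finite {Q : Set (Vec → ℤ)} {q : Vec → ℤ} (D : VertexData Q q) :
    {v | q v = 1}.Finite := by
  refine ((Set.finite_range D.u).union (Set.finite_range fun i => -D.u i)).subset ?_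
  intro v hv
  obtain ⟨i, rfl | rfl⟩ := (D.mem_iff v).1 hv
  · exact Or.inl ⟨i, rfl⟩
  · exact Or.inr ⟨i, rfl⟩

theorem Tess.finite {Q : Set (Vec → ℤ)} (hQ : Tess Q) {q : Vec → ℤ} (hq : q ∈ Q) :
    {v | q v = 1}.Finite := (hQ.data q hq).some.finite

theorem spans_congr {l l' : List Vec} (h : ∀ v, PMem v l ↔ PMem v l') : Spans l ↔ Spans l' := by
  suffices H : ∀ {l l' : List Vec}, (∀ v, PMem v l ↔ PMem v l') → Spans l → Spans l' from
    ⟨H h, H fun v => (h v).symm⟩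
  intro l l' h hl x hx
  refine hl x fun v hv => ?_
  rcases (h v).1 (Or.inl hv) with h | h
  · exact hx v h
  · simpa using hx _ h

theorem onMin_congr {q : Vec → ℤ} (hq : IsQuad q) {l l' : List Vec}
    (h : ∀ v, PMem v l ↔ PMem v l') : OnMin q l ↔ OnMin q l' := by
  suffices H : ∀ {l l' : List Vec}, (∀ v, PMem v l ↔ PMem v l') → OnMin q l → OnMin q l' from
    ⟨H h, H fun v => (h v).symm⟩
  intro l l' h hl v hv
  rcases (h v).2 (Or.inl hv) with h | h
  · exact hl v h
  · rw [← hq.map_neg]; exact hl _ h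

theorem isCell_congr {Q : Set (Vec → ℤ)} (hQ : ∀ q ∈ Q, IsQuad q) {l l' : List Vec}
    (h : ∀ v, PMem v l ↔ PMem v l') : IsCell Q l ↔ IsCell Q l' := by
  unfold IsCell
  rw [spans_congr h]
  refine and_congr_right fun _ => ⟨?_, ?_⟩
  · rintro ⟨q, hq, q', hq', hne, h1, h2⟩
    exact ⟨q, hq, q', hq', hne, (onMin_congr (hQ q hq) h).1 h1, (onMin_congr (hQ q' hq') h).1 h2⟩
  · rintro ⟨q, hq, q', hq', hne, h1, h2⟩
    exact ⟨q, hq, q', hq', hne, (onMin_congr (hQ q hq) h).2 h1, (onMin_congr (hQ q' hq') h).2 h2⟩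

theorem pmem_swap {α : Type*} [InvolutiveNeg α] (l₁ l₂ : List α) (a b v : α) :
    PMem v (l₁ ++ a :: b :: l₂) ↔ PMem v (l₁ ++ b :: a :: l₂) := by
  simp [PMem, or_left_comm]

theorem pmem_append_neg {α : Type*} [InvolutiveNeg α] (l₁ l₂ : List α) (a v : α) :
    PMem v (l₁ ++ (-a) :: l₂) ↔ PMem v (l₁ ++ a :: l₂) := by
  simp only [PMem, List.mem_append, List.mem_cons, neg_eq_iff_eq_neg, neg_neg]
  tauto

/-! ### Chains -/

/-- `f` is supported on cells with `9 - k` entries. -/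
def SuppOn (Q : Set (Vec → ℤ)) (k : ℕ) (f : List Vec → ℂ) : Prop :=
  ∀ l, f l ≠ 0 → IsCell Q l ∧ l.length + k = 9

open Classical in
/-- The boundary operator. -/
noncomputable def bd (Q : Set (Vec → ℤ)) (f : List Vec → ℂ) (l : List Vec) : ℂ :=
  if IsCell Q l then dl l f else 0

theorem bd_of_cell {Q : Set (Vec → ℤ)} {f : List Vec → ℂ} {l : List Vec} (h : IsCell Q l) :
    bd Q f l = dl l f := if_pos h

theorem bd_of_not_cell {Q : Set (Vec → ℤ)} {f : List Vec → ℂ} {l : List Vec} (h : ¬IsCell Q l) :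
    bd Q f l = 0 := if_neg h

theorem isCell_of_bd_ne_zero {Q : Set (Vec → ℤ)} {f : List Vec → ℂ} {l : List Vec}
    (h : bd Q f l ≠ 0) : IsCell Q l := by
  by_contra hc
  exact h (bd_of_not_cell hc)

theorem exists_of_bd_ne_zero {Q : Set (Vec → ℤ)} {f : List Vec → ℂ} {l : List Vec}
    (h : bd Q f l ≠ 0) : ∃ t, t.Sublist l ∧ t.length + 1 = l.length ∧ f t ≠ 0 := by
  rw [bd_of_cell (isCell_of_bd_ne_zero h)] at h
  exact exists_of_dl_ne_zero h

theorem bd_add (Q : Set (Vec → ℤ)) (f g : List Vec → ℂ) : bd Q (f + g) = bd Q f + bd Q g := by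
  funext l
  by_cases h : IsCell Q l
  · simp only [Pi.add_apply, bd_of_cell h]; exact dl_add l f g
  · simp [bd_of_not_cell h]

theorem bd_smul (Q : Set (Vec → ℤ)) (c : ℂ) (f : List Vec → ℂ) : bd Q (c • f) = c • bd Q f := by
  funext l
  by_cases h : IsCell Q l
  · simp only [Pi.smul_apply, bd_of_cell h]; exact dl_smul l c f
  · simp [bd_of_not_cell h]

theorem bd_sub (Q : Set (Vec → ℤ)) (f g : List Vec → ℂ) : bd Q (f - g) = bd Q f - bd Q g := by
  have h := bd_smul Q (-1) g
  rw [neg_one_smul, neg_one_smul] at h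
  rw [sub_eq_add_neg, bd_add, h, sub_eq_add_neg]

section

variable {Q : Set (Vec → ℤ)} {k : ℕ} {f : List Vec → ℂ}

theorem altEven_bd (hQ : ∀ q ∈ Q, IsQuad q) (hf : AltEven f) : AltEven (bd Q f) := by
  have hc : ∀ {l l'}, (∀ v, PMem v l ↔ PMem v l') → (IsCell Q l ↔ IsCell Q l') :=
    fun h => isCell_congr hQ h
  constructor
  · intro l₁ a b l₂
    by_cases h : IsCell Q (l₁ ++ b :: a :: l₂)
    · rw [bd_of_cell h, bd_of_cell ((hc (pmem_swap l₁ l₂ a b)).2 h)]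
      exact hf.dl.swap l₁ a b l₂
    · rw [bd_of_not_cell h, bd_of_not_cell (mt (hc (pmem_swap l₁ l₂ a b)).1 h), neg_zero]
  · intro l₁ a l₂
    by_cases h : IsCell Q (l₁ ++ a :: l₂)
    · rw [bd_of_cell h, bd_of_cell ((hc (pmem_append_neg l₁ l₂ a)).2 h)]
      exact hf.dl.neg l₁ a l₂
    · rw [bd_of_not_cell h, bd_of_not_cell (mt (hc (pmem_append_neg l₁ l₂ a)).1 h)]

theorem SuppOn.bd (hf : SuppOn Q (k + 1) f) : SuppOn Q k (bd Q f) := by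
  intro l hl
  refine ⟨isCell_of_bd_ne_zero hl, ?_⟩
  obtain ⟨t, -, ht, h⟩ := exists_of_bd_ne_zero hl
  have := (hf t h).2
  omega

theorem SuppOn.bd_eq_dl (hf : SuppOn Q k f) {l : List Vec}
    (hl : ∃ q ∈ Q, ∃ q' ∈ Q, q ≠ q' ∧ OnMin q l ∧ OnMin q' l) : Voronoi.bd Q f l = dl l f := by
  by_cases hs : Spans l
  · exact bd_of_cell ⟨hs, hl⟩
  · rw [bd_of_not_cell fun h => hs h.1]
    by_contra hne
    obtain ⟨t, ht, -, h0⟩ := exists_of_dl_ne_zero (Ne.symm hne)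
    exact hs ((hf t h0).1.1.mono ht.subset)

theorem SuppOn.bd_bd (hf : SuppOn Q k f) : Voronoi.bd Q (Voronoi.bd Q f) = 0 := by
  funext l
  by_cases h : IsCell Q l
  · rw [bd_of_cell h, Pi.zero_apply, ← dl_dl l f]
    refine dl_congr fun t ht _ => hf.bd_eq_dl ?_
    obtain ⟨-, q, hq, q', hq', hne, h1, h2⟩ := h
    exact ⟨q, hq, q', hq', hne, h1.mono ht.subset, h2.mono ht.subset⟩
  · rw [bd_of_not_cell h]; rfl

/-- Finitely supported alternating even functions on cells with `9 - k` entries. -/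
structure IsChain (Q : Set (Vec → ℤ)) (k : ℕ) (f : List Vec → ℂ) : Prop where
  alt : AltEven f
  supp : SuppOn Q k f
  fin : {l | f l ≠ 0}.Finite

theorem IsChain.zero : IsChain Q k 0 :=
  ⟨AltEven.zero, fun l hl => absurd rfl hl, by simp⟩

theorem IsChain.add {g : List Vec → ℂ} (hf : IsChain Q k f) (hg : IsChain Q k g) :
    IsChain Q k (f + g) := by
  have h : ∀ l, (f + g) l ≠ 0 → f l ≠ 0 ∨ g l ≠ 0 := by
    intro l hl
    by_contra! hc
    exact hl (by simp [hc])
  exact ⟨hf.alt.add hg.alt, fun l hl => (h l hl).elim (hf.supp l) (hg.supp l),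
    (hf.fin.union hg.fin).subset h⟩

theorem IsChain.smul (c : ℂ) (hf : IsChain Q k f) : IsChain Q k (c • f) := by
  have h : ∀ l, (c • f) l ≠ 0 → f l ≠ 0 := fun l hl h => hl (by simp [h])
  exact ⟨hf.alt.smul c, fun l hl => hf.supp l (h l hl), hf.fin.subset h⟩

theorem IsChain.sub {g : List Vec → ℂ} (hf : IsChain Q k f) (hg : IsChain Q k g) :
    IsChain Q k (f - g) := by
  rw [sub_eq_add_neg, ← neg_one_smul ℂ]
  exact hf.add (hg.smul _)

theorem IsChain.bd (hQ : Tess Q) (hf : IsChain Q (k + 1) f) : IsChain Q k (bd Q f) := by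
  refine ⟨altEven_bd hQ.quad hf.alt, hf.supp.bd, ?_⟩
  have hS : (⋃ t ∈ {t | f t ≠ 0}, ⋃ q ∈ {q | q ∈ Q ∧ OnMin q t}, {v | q v = 1}).Finite :=
    hf.fin.biUnion fun t ht => (hQ.fin t (hf.supp t ht).1.1).biUnion fun q hq => hQ.finite hq.1
  refine (finite_lists hS (9 - k)).subset fun l hl => ⟨?_, fun v hv => ?_⟩
  · have := (hf.supp.bd l hl).2
    omega
  · obtain ⟨t, ht, -, h0⟩ := exists_of_bd_ne_zero hl
    obtain ⟨-, q, hq, -, -, -, h1, -⟩ := isCell_of_bd_ne_zero hl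
    simp only [Set.mem_iUnion]
    exact ⟨t, h0, q, ⟨hq, h1.mono ht.subset⟩, h1 v hv⟩

end

/-! ### Exactness -/

/-- All forms attached to the support of `f` have key at most that of `q`. -/
def Below (Q : Set (Vec → ℤ)) (q : Vec → ℤ) (f : List Vec → ℂ) : Prop :=
  ∀ l, f l ≠ 0 → ∀ q' ∈ Q, OnMin q' l → key q' ≤ key q

section

variable {Q : Set (Vec → ℤ)} {k : ℕ} {f : List Vec → ℂ} {q : Vec → ℤ}

open Classical in
/-- The cone operator used to push a cycle off the form `q`. -/
noncomputable def cone (q : Vec → ℤ) (v : Vec) (f : List Vec → ℂ) (σ : List Vec) : ℂ :=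
  (if OnMin q σ then 1 else 0) * f (v :: σ)

theorem cone_ne_zero {v : Vec} {σ : List Vec} (h : cone q v f σ ≠ 0) :
    OnMin q σ ∧ f (v :: σ) ≠ 0 := by
  unfold cone at h
  split_ifs at h with h1
  · exact ⟨h1, by simpa using h⟩
  · simp at h

/-- A cycle below `q` can be changed by a boundary so that its support at `q` omits only the
vector `i₀ r` from the frame `r`. -/
theorem clear_frame (hQ : Tess Q) (hq : q ∈ Q) (D : VertexData Q q) {i₀ : D.R → D.I}
    (hi₀ : ∀ r, D.fr (i₀ r) = r)
    (hmin : ∀ e, (∀ r, D.fr (e r) = r) → ∀ r,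
      key (D.d (Function.update e r (i₀ r))) ≤ key (D.d e))
    (hf : IsChain Q k f) (hcyc : bd Q f = 0) (hb : Below Q q f) (A : Finset D.R)
    (hA : ∀ l, f l ≠ 0 → OnMin q l → ∀ r ∈ A, ∀ i, D.fr i = r → i ≠ i₀ r → PMem (D.u i) l)
    (r₀ : D.R) : ∃ h, IsChain Q (k + 1) h ∧ Below Q q (f - bd Q h) ∧
      ∀ l, (f - bd Q h) l ≠ 0 → OnMin q l → ∀ r ∈ insert r₀ A, ∀ i, D.fr i = r → i ≠ i₀ r →
        PMem (D.u i) l := by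
  set v := D.u (i₀ r₀) with hv
  have hqv : q v = 1 := D.apply_u _
  -- membership of `u i` in a list with `v` prepended
  have hpm : ∀ i l, PMem (D.u i) (v :: l) ↔ i = i₀ r₀ ∨ PMem (D.u i) l := by
    intro i l
    rw [pmem_cons]
    exact or_congr_left ⟨D.u_inj _ _, fun h => Or.inl (by rw [h])⟩
  have key1 : ∀ σ, cone q v f σ ≠ 0 → D.Descends σ ∧ IsCell Q (v :: σ) := by
    intro σ hσ
    obtain ⟨hσq, hne⟩ := cone_ne_zero hσ
    have hc := (hf.supp _ hne).1
    have hmq : OnMin q (v :: σ) := onMin_cons.2 ⟨hqv, hσq⟩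
    refine ⟨fun e he hn => ?_, hc⟩
    have hd := D.descends_of_le hmq (hb _ hne)
    obtain ⟨j, hj, hjn⟩ := (D.isCell_iff hQ hq hmq hc.1).1 hc r₀
    rw [hpm, not_or] at hjn
    -- the section `e` improved to avoid `v`
    by_cases h : e r₀ = i₀ r₀
    · have he' : ∀ r, D.fr (Function.update e r₀ j r) = r := by
        intro r
        by_cases hr : r = r₀
        · subst hr; simp [hj]
        · simp [hr, he]
      have h1 := hd (Function.update e r₀ j) he' (by
        intro r
        rw [hpm, not_or]
        by_cases hr : r = r₀
        · subst hr; simpa using hjn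
        · simp only [Function.update_of_ne hr]
          exact ⟨fun h => hr (by rw [← he r, h, hi₀]), hn r⟩)
      have h2 := hmin _ he' r₀
      rw [Function.update_idem, ← h, Function.update_eq_self] at h2
      exact h2.trans_lt h1
    · refine hd e he fun r => ?_
      rw [hpm, not_or]
      refine ⟨fun h' => ?_, hn r⟩
      obtain rfl : r = r₀ := by rw [← he r, h', hi₀]
      exact h h'
  have hh : IsChain Q (k + 1) (cone q v f) := by
    refine ⟨?_, ?_, ?_⟩
    · refine (hf.alt.cons v).mul_sym (fun l₁ a b l₂ => ?_) fun l₁ a l₂ => ?_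
      · rw [onMin_congr (hQ.quad q hq) (pmem_swap l₁ l₂ a b)]
      · rw [onMin_congr (hQ.quad q hq) (pmem_append_neg l₁ l₂ a)]
    · intro σ hσ
      obtain ⟨hd, hc⟩ := key1 σ hσ
      refine ⟨hc.of_subset (List.subset_cons_self v σ) hd.spans, ?_⟩
      have := (hf.supp _ (cone_ne_zero hσ).2).2
      simp at this
      omega
    · refine (hf.fin.preimage (f := List.cons v) ?_).subset fun σ hσ => (cone_ne_zero hσ).2
      exact List.cons_injective.injOn
  have hface : ∀ l, bd Q (cone q v f) l ≠ 0 → ∃ σ, σ ⊆ l ∧ OnMin q σ ∧ f (v :: σ) ≠ 0 ∧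
      D.Descends σ := by
    intro l hl
    obtain ⟨σ, hσ, -, h0⟩ := exists_of_bd_ne_zero hl
    exact ⟨σ, hσ.subset, (cone_ne_zero h0).1, (cone_ne_zero h0).2, (key1 σ h0).1⟩
  have hcases : ∀ l, (f - bd Q (cone q v f)) l ≠ 0 → f l ≠ 0 ∨ bd Q (cone q v f) l ≠ 0 := by
    intro l hl
    by_contra! hc
    exact hl (by simp [hc])
  refine ⟨cone q v f, hh, ?_, ?_⟩
  · intro l hl q' hq' hm
    rcases hcases l hl with h | h
    · exact hb l h q' hq' hm
    · obtain ⟨σ, hσ, h1, -, h2⟩ := hface l h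
      exact h2.le hQ hq h1 hq' (hm.mono hσ)
  · intro l hl hm r hr i hi hne
    have hc : IsCell Q l := by
      rcases hcases l hl with h | h
      · exact (hf.supp l h).1
      · exact isCell_of_bd_ne_zero h
    have hcone : dl l (cone q v f) = dl l fun t => f (v :: t) := by
      refine dl_congr fun t ht _ => ?_
      rw [cone, if_pos (hm.mono ht.subset), one_mul]
    have hval : (f - bd Q (cone q v f)) l = dl (v :: l) f := by
      rw [Pi.sub_apply, bd_of_cell hc, hcone, dl_cons]
    have hm' : OnMin q (v :: l) := onMin_cons.2 ⟨hqv, hm⟩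
    rw [Finset.mem_insert] at hr
    by_cases hrr : r = r₀
    · subst hrr
      by_contra hpi
      apply hl
      have hc' : IsCell Q (v :: l) := by
        rw [D.isCell_iff hQ hq hm' (hc.1.mono (List.subset_cons_self v l))]
        intro s
        by_cases hs : s = r
        · exact ⟨i, hi.trans hs.symm, by rw [hpm, not_or]; exact ⟨hne, hpi⟩⟩
        · obtain ⟨j, hj, hjn⟩ := (D.isCell_iff hQ hq hm hc.1).1 hc s
          refine ⟨j, hj, ?_⟩
          rw [hpm, not_or]
          exact ⟨fun h => hs (by rw [← hj, h, hi₀]), hjn⟩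
      rw [hval, ← bd_of_cell hc', hcyc]; rfl
    · have hrA := hr.resolve_left hrr
      rcases hcases l hl with h | h
      · exact hA l h hm r hrA i hi hne
      · obtain ⟨σ, hσ, h1, h2, -⟩ := hface l h
        have h3 := hA _ h2 (onMin_cons.2 ⟨hqv, h1⟩) r hrA i hi hne
        rw [hpm] at h3
        rcases h3 with h3 | h3
        · exact absurd (by rw [← hi, h3, hi₀]) hrr
        · exact h3.mono hσ

/-- A cycle below `q` can be changed by a boundary so that its support at `q` omits exactly the
vectors of one section. -/
theorem clear_all_frames (hQ : Tess Q) (hq : q ∈ Q) (D : VertexData Q q) {i₀ : D.R → D.I}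
    (hi₀ : ∀ r, D.fr (i₀ r) = r)
    (hmin : ∀ e, (∀ r, D.fr (e r) = r) → ∀ r,
      key (D.d (Function.update e r (i₀ r))) ≤ key (D.d e))
    (hf : IsChain Q k f) (hcyc : bd Q f = 0) (hb : Below Q q f) :
    ∃ h, IsChain Q (k + 1) h ∧ Below Q q (f - bd Q h) ∧
      ∀ l, (f - bd Q h) l ≠ 0 → OnMin q l → ∀ i, i ≠ i₀ (D.fr i) → PMem (D.u i) l := by
  suffices H : ∀ A : Finset D.R, ∃ h, IsChain Q (k + 1) h ∧ Below Q q (f - bd Q h) ∧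
      ∀ l, (f - bd Q h) l ≠ 0 → OnMin q l → ∀ r ∈ A, ∀ i, D.fr i = r → i ≠ i₀ r →
        PMem (D.u i) l by
    obtain ⟨h, h1, h2, h3⟩ := H Finset.univ
    exact ⟨h, h1, h2, fun l hl hm i hi => h3 l hl hm _ (Finset.mem_univ _) i rfl hi⟩
  have hbz : bd Q (0 : List Vec → ℂ) = 0 := by simpa using bd_smul Q 0 0
  intro A
  induction A using Finset.induction_on with
  | empty => exact ⟨0, IsChain.zero, by rwa [hbz, sub_zero], by simp⟩
  | insert r A _ ih =>
    obtain ⟨h, h1, h2, h3⟩ := ih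
    obtain ⟨h', h1', h2', h3'⟩ := clear_frame hQ hq D hi₀ hmin (hf.sub (h1.bd hQ))
      (by rw [bd_sub, hcyc, h1.supp.bd_bd, sub_zero]) h2 A h3 r
    refine ⟨h + h', h1.add h1', ?_, ?_⟩
    · rw [bd_add, ← sub_sub]; exact h2'
    · rw [bd_add, ← sub_sub]; exact h3'

theorem VertexData.card_compl (D : VertexData Q q) {i₀ : D.R → D.I} (hi₀ : ∀ r, D.fr (i₀ r) = r) :
    (Finset.univ.filter fun i => i ≠ i₀ (D.fr i)).card = 9 := by
  have h1 : (Finset.univ.filter fun i => ¬(i = i₀ (D.fr i))).card +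
      (Finset.univ.filter fun i => i = i₀ (D.fr i)).card = 9 + Fintype.card D.R := by
    rw [add_comm, Finset.card_filter_add_card_filter_not, Finset.card_univ, D.card]
  have h2 : (Finset.univ.filter fun i => i = i₀ (D.fr i)) = Finset.univ.image i₀ := by
    ext i
    simp only [Finset.mem_filter, Finset.mem_univ, true_and, Finset.mem_image]
    exact ⟨fun h => ⟨_, h.symm⟩, by rintro ⟨r, rfl⟩; rw [hi₀]⟩
  have h3 : (Finset.univ.image i₀).card = Fintype.card D.R := by
    rw [Finset.card_image_of_injective, Finset.card_univ]
    intro a b h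
    rw [← hi₀ a, h, hi₀]
  rw [h2, h3] at h1
  simpa using h1

/-- A list meeting many lines is long. -/
theorem VertexData.card_le_length (D : VertexData Q q) {s : Finset D.I} {l : List Vec}
    (h : ∀ i ∈ s, PMem (D.u i) l) : s.card ≤ l.length := by
  classical
  have h1 : ∀ i ∈ s, ∃ v ∈ l.toFinset, v = D.u i ∨ v = -D.u i := by
    intro i hi
    rcases h i hi with h | h
    · exact ⟨_, List.mem_toFinset.2 h, Or.inl rfl⟩
    · exact ⟨_, List.mem_toFinset.2 h, Or.inr rfl⟩
  choose! w hw hwu using h1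
  refine (Finset.card_le_card_of_injOn w hw fun i hi j hj hij => ?_).trans (List.toFinset_card_le l)
  apply D.u_inj
  rcases hwu i hi with h1 | h1 <;> rcases hwu j hj with h2 | h2 <;> rw [hij, h2] at h1
  · exact Or.inl h1.symm
  · exact Or.inr h1.symm
  · right; rw [h1, neg_neg]
  · left; exact (neg_injective h1).symm

theorem exists_top (hQ : Tess Q) (hf : IsChain Q k f) (h0 : f ≠ 0) :
    ∃ q ∈ Q, Below Q q f ∧ ∃ l, f l ≠ 0 ∧ OnMin q l := by
  have hS : (⋃ t ∈ {t | f t ≠ 0}, {q | q ∈ Q ∧ OnMin q t}).Finite :=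
    hf.fin.biUnion fun t ht => hQ.fin t (hf.supp t ht).1.1
  have hne : (⋃ t ∈ {t | f t ≠ 0}, {q | q ∈ Q ∧ OnMin q t}).Nonempty := by
    obtain ⟨l, hl⟩ := Function.ne_iff.1 h0
    obtain ⟨-, q, hq, -, -, -, h1, -⟩ := (hf.supp l hl).1
    exact ⟨q, by simp only [Set.mem_iUnion]; exact ⟨l, hl, hq, h1⟩⟩
  obtain ⟨q, hq, hmax⟩ := Set.exists_max_image _ key hS hne
  simp only [Set.mem_iUnion] at hq hmax
  obtain ⟨l, hl, hq, hm⟩ := hq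
  exact ⟨q, hq, fun l hl q' hq' hm' => hmax q' ⟨l, hl, hq', hm'⟩, l, hl, hm⟩

theorem exists_section (hQ : Tess Q) (hq : q ∈ Q) (D : VertexData Q q) {l : List Vec}
    (hc : IsCell Q l) (hm : OnMin q l) : ∃ i₀ : D.R → D.I, (∀ r, D.fr (i₀ r) = r) ∧
      ∀ e, (∀ r, D.fr (e r) = r) → ∀ r, key (D.d (Function.update e r (i₀ r))) ≤ key (D.d e) :=
  D.exists_min_section fun r =>
    ((D.isCell_iff hQ hq hm hc.1).1 hc r).imp fun _ h => h.1

/-- Well-founded induction on the largest form attached to a chain. -/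
theorem chain_induction (hQ : Tess Q) {k : ℕ} {P : (List Vec → ℂ) → Prop} (h0 : P 0)
    (hstep : ∀ f q, q ∈ Q → IsChain Q k f → Below Q q f → (∃ l, f l ≠ 0 ∧ OnMin q l) →
      (∀ g, IsChain Q k g → Below Q q g → (∀ l, g l ≠ 0 → ¬OnMin q l) → P g) → P f)
    (hf : IsChain Q k f) : P f := by
  suffices H : ∀ q : Q, ∀ f, IsChain Q k f → Below Q q f → P f by
    by_cases h : f = 0
    · rw [h]; exact h0
    · obtain ⟨q, hq, hb, -⟩ := exists_top hQ hf h
      exact H ⟨q, hq⟩ f hf hb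
  intro q
  induction q using (wf_key fun q hq v => hQ.nonneg hq v).induction with
  | _ q ih =>
    have ih' : ∀ g, IsChain Q k g → Below Q q g → (∀ l, g l ≠ 0 → ¬OnMin q l) → P g := by
      intro g hg hb hn
      by_cases h : g = 0
      · rw [h]; exact h0
      · obtain ⟨q', hq', hb', l, hl, hm⟩ := exists_top hQ hg h
        refine ih ⟨q', hq'⟩ (lt_of_le_of_ne (hb l hl q' hq' hm) fun he => ?_) g hg hb'
        have : q' = q := sub_eq_zero.1 (eq_zero_of_key ((hQ.quad q' hq').sub (hQ.quad q q.2))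
          (by rw [key_sub, he, sub_self]))
        exact hn l hl (this ▸ hm)
    intro f hf hb
    by_cases h : ∃ l, f l ≠ 0 ∧ OnMin q l
    · exact hstep f q q.2 hf hb h ih'
    · push Not at h
      exact ih' f hf hb h

/-- The complex of chains is exact at cells with at most eight entries. -/
theorem exact_bd (hQ : Tess Q) (hk : 1 ≤ k) (hf : IsChain Q k f) (hcyc : bd Q f = 0) :
    ∃ h, IsChain Q (k + 1) h ∧ bd Q h = f := by
  have hbz : bd Q (0 : List Vec → ℂ) = 0 := by simpa using bd_smul Q 0 0
  revert hcyc
  refine chain_induction hQ (P := fun f => bd Q f = 0 → ∃ h, IsChain Q (k + 1) h ∧ bd Q h = f)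
    (fun _ => ⟨0, IsChain.zero, hbz⟩) ?_ hf
  intro f q hq hf hb ⟨l, hl, hm⟩ ih hcyc
  obtain ⟨D⟩ := hQ.data q hq
  obtain ⟨i₀, hi₀, hmin⟩ := exists_section hQ hq D (hf.supp l hl).1 hm
  obtain ⟨h, hh, hb', h'⟩ := clear_all_frames hQ hq D hi₀ hmin hf hcyc hb
  have hg := hf.sub (hh.bd hQ)
  obtain ⟨h2, hh2, hbd⟩ := ih _ hg hb' (fun l hl hm => by
    have h1 := D.card_le_length (s := Finset.univ.filter fun i => i ≠ i₀ (D.fr i)) (l := l)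
      fun i hi => h' l hl hm i (Finset.mem_filter.1 hi).2
    rw [D.card_compl hi₀] at h1
    have := (hg.supp l hl).2
    omega) (by rw [bd_sub, hcyc, hh.supp.bd_bd, sub_zero])
  exact ⟨h2 + h, hh2.add hh, by rw [bd_add, hbd, sub_add_cancel]⟩

end

end Voronoi

namespace Voronoi

open Matrix

/-! ### The orientation of facets -/

open Classical in
/-- The vectors of value one. -/
noncomputable def mins (q : Vec → ℤ) : Finset Vec :=
  if h : {v | q v = 1}.Finite then h.toFinset else ∅

/-- The form cut out by a list of nine vectors. -/
def lam (l : List Vec) (v : Vec) : ℤ := rowDet (sq v :: l.map sq)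

/-- The orientation of a facet as seen from `q`. -/
noncomputable def omega (q : Vec → ℤ) (l : List Vec) : ℂ :=
  if l.length = 9 then
    ((∑ v ∈ mins q, lam l v : ℤ) : ℂ) / (((mins q).card : ℂ) / 2 - 9) else 0

theorem isQuad_lam (l : List Vec) : IsQuad (lam l) := by
  refine ⟨fun k => cramer (of fun i : Fin 10 => (0 :: l.map sq).getD i 0)ᵀ (Pi.single k 1) 0,
    fun v => ?_⟩
  rw [lam, rowDet_cons]
  conv_lhs => rw [pi_eq_sum_univ' (sq v)]
  rw [map_sum, Finset.sum_apply, dotProduct]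
  refine Finset.sum_congr rfl fun k _ => ?_
  rw [map_smul, Pi.smul_apply, smul_eq_mul, mul_comm]

theorem lam_eq_zero {l : List Vec} (hl : l.length = 9) {v : Vec} (h : PMem v l) :
    lam l v = 0 := by
  refine rowDet_eq_zero_of_mem ?_ (by simp [hl])
  rcases h with h | h
  · exact List.mem_map_of_mem h
  · rw [← sq_neg]; exact List.mem_map_of_mem h

theorem lam_cons (v w : Vec) (l : List Vec) :
    lam (v :: l) w = -lam (w :: l) v := rowDet_swap [] (l.map sq) (sq w) (sq v) (by simp)

theorem altEven_omega (q : Vec → ℤ) : AltEven (omega q) := by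
  constructor
  · intro l₁ a b l₂
    have hlen : (l₁ ++ b :: a :: l₂).length = (l₁ ++ a :: b :: l₂).length := by simp
    unfold omega
    rw [hlen]
    split_ifs with h
    · rw [← neg_div, ← Int.cast_neg, ← Finset.sum_neg_distrib]
      congr 2
      refine Finset.sum_congr rfl fun v _ => ?_
      simp only [lam, List.map_append, List.map_cons]
      refine rowDet_swap (sq v :: l₁.map sq) (l₂.map sq) (sq a) (sq b) ?_
      simp at h ⊢; omega
    · simp
  · intro l₁ a l₂
    have hlen : (l₁ ++ (-a) :: l₂).length = (l₁ ++ a :: l₂).length := by simp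
    unfold omega
    rw [hlen]
    simp only [lam, List.map_append, List.map_cons, sq_neg]

section

variable {Q : Set (Vec → ℤ)} {q : Vec → ℤ}

theorem mem_mins (hQ : Tess Q) (hq : q ∈ Q) {v : Vec} : v ∈ mins q ↔ q v = 1 := by
  rw [mins, dif_pos (hQ.finite hq)]; simp

theorem VertexData.sum_mins (hQ : Tess Q) (hq : q ∈ Q) (D : VertexData Q q) {M : Type*}
    [AddCommMonoid M] (F : Vec → M) : ∑ v ∈ mins q, F v = ∑ i, F (D.u i) + ∑ i, F (-D.u i) := by
  have h1 : mins q = Finset.univ.image D.u ∪ Finset.univ.image fun i => -D.u i := by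
    ext v
    rw [mem_mins hQ hq, D.mem_iff]
    simp [exists_or, eq_comm]
  have hinj : Function.Injective D.u := fun i j h => D.u_inj i j (Or.inl h)
  rw [h1, Finset.sum_union, Finset.sum_image hinj.injOn, Finset.sum_image]
  · exact fun i _ j _ h => hinj (neg_injective h)
  · rw [Finset.disjoint_left]
    intro v hv hv'
    obtain ⟨i, -, rfl⟩ := Finset.mem_image.1 hv
    obtain ⟨j, -, h⟩ := Finset.mem_image.1 hv'
    obtain rfl := D.u_inj i j (Or.inr h.symm)
    exact D.u_ne_zero (hQ.quad q hq) i (self_eq_neg.1 h.symm)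

theorem VertexData.card_mins (hQ : Tess Q) (hq : q ∈ Q) (D : VertexData Q q) :
    ((mins q).card : ℂ) / 2 - 9 = Fintype.card D.R := by
  have h := D.sum_mins hQ hq fun _ => (1 : ℕ)
  simp only [Finset.sum_const, Finset.card_univ, D.card, smul_eq_mul, mul_one] at h
  rw [h]; push_cast; ring

theorem VertexData.omega_eq (hQ : Tess Q) (hq : q ∈ Q) (D : VertexData Q q) {l : List Vec}
    (hl : l.length = 9) (r : D.R) :
    omega q l = 2 * ((∑ i with D.fr i = r, lam l (D.u i) : ℤ) : ℂ) := by
  have h1 : ∑ v ∈ mins q, lam l v =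
      2 * (Fintype.card D.R * ∑ i with D.fr i = r, lam l (D.u i)) := by
    rw [D.sum_mins hQ hq]
    simp only [(isQuad_lam l).map_neg]
    rw [← two_mul]
    congr 1
    rw [← Finset.sum_fiberwise (g := D.fr)]
    rw [Finset.sum_congr rfl fun s _ => D.frame _ (isQuad_lam l) s r]
    simp
  have h2 : (Fintype.card D.R : ℂ) ≠ 0 := by
    have := Fintype.card_pos (α := D.R)
    exact_mod_cast this.ne'
  rw [omega, if_pos hl, h1, D.card_mins hQ hq]
  push_cast
  field_simp

/-- A form vanishing on all minimal vectors outside of a section is a multiple of `d e`. -/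
theorem VertexData.eq_smul (D : VertexData Q q) {e : D.R → D.I} (he : ∀ r, D.fr (e r) = r)
    {p : Vec → ℤ} (hp : IsQuad p) (h0 : ∀ i, i ≠ e (D.fr i) → p (D.u i) = 0) :
    ∃ c : ℤ, p = c • D.d e ∧ ∀ r, ∑ i with D.fr i = r, p (D.u i) = c := by
  have h1 : ∀ r, ∑ i with D.fr i = r, p (D.u i) = p (D.u (e r)) := fun r => by
    refine Finset.sum_eq_single_of_mem (e r) (by simp [he]) fun i hi hne => h0 i fun h => ?_
    rw [(Finset.mem_filter.1 hi).2] at h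
    exact hne h
  obtain ⟨r₀⟩ := D.nonemptyR
  have h2 : ∀ r, p (D.u (e r)) = p (D.u (e r₀)) := fun r => by
    rw [← h1, ← h1, D.frame p hp]
  refine ⟨p (D.u (e r₀)), ?_, fun r => (h1 r).trans (h2 r)⟩
  refine D.ext hp ((D.d_quad e he).smul _) fun i => ?_
  rw [Pi.smul_apply, D.d_apply e he]
  split_ifs with h
  · rw [← h, h2]; simp
  · simp [h0 i fun h' => h h'.symm]

theorem VertexData.eq_smul_of_onMin (hQ : Tess Q) (hq : q ∈ Q) (D : VertexData Q q)
    {e : D.R → D.I} (he : ∀ r, D.fr (e r) = r) {l : List Vec} (hm : OnMin q l)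
    (hl : ∀ i, i ≠ e (D.fr i) → PMem (D.u i) l) {q' : Vec → ℤ} (hq' : q' ∈ Q) (h' : OnMin q' l) :
    ∃ c : ℤ, 0 ≤ c ∧ q' = q + c • D.d e := by
  have hquad := (hQ.quad q' hq').sub (hQ.quad q hq)
  obtain ⟨c, hc, -⟩ := D.eq_smul he hquad fun i hi =>
    VertexData.apply_eq_zero_of_pmem hquad
      (fun w hw => by rw [Pi.sub_apply, h' w hw, hm w hw, sub_self])
      (hl i hi)
  obtain ⟨r⟩ := D.nonemptyR
  refine ⟨c, ?_, by rw [← hc]; abel⟩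
  have h1 : (q' - q) (D.u (e r)) = c := by
    rw [hc, Pi.smul_apply, D.d_apply e he, he]; simp
  rw [← h1, Pi.sub_apply, D.apply_u, sub_nonneg]
  exact hQ.pos q' hq' _ (D.u_ne_zero (hQ.quad q hq) _)

theorem VertexData.exists_lines (D : VertexData Q q) {l : List Vec} (hm : OnMin q l)
    (hn : PNodup l) {e : D.R → D.I} (hen : ∀ r, ¬PMem (D.u (e r)) l) :
    ∃ s : Finset D.I, s.card = l.length ∧ (s ⊆ Finset.univ.filter fun i => i ≠ e (D.fr i)) ∧
      ∀ i ∈ s, PMem (D.u i) l := by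
  have : Nonempty D.I := ⟨e (Classical.arbitrary D.R)⟩
  choose! g hg using fun v (hv : v ∈ l) => (D.mem_iff v).1 (hm v hv)
  have hinj : (l.map g).Nodup := by
    rw [List.nodup_map_iff_inj_on]
    · intro a ha b hb hab
      by_contra hne
      have : Std.Symm fun a b : Vec => a ≠ b ∧ a ≠ -b :=
        ⟨fun a b h => ⟨h.1.symm, fun h' => h.2 (by rw [h', neg_neg])⟩⟩
      have h1 : a ≠ b ∧ a ≠ -b := List.Pairwise.forall hn ha hb hne
      rcases hg a ha with h2 | h2 <;> rcases hg b hb with h3 | h3 <;> rw [hab] at h2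
      · exact h1.1 (h2.trans h3.symm)
      · exact h1.2 (by rw [h3, neg_neg, h2])
      · exact h1.2 (h2.trans (congrArg Neg.neg h3).symm)
      · exact h1.1 (h2.trans h3.symm)
    · exact hn.imp fun h => h.1
  have hmem : ∀ i ∈ (l.map g).toFinset, PMem (D.u i) l := by
    intro i hi
    rw [List.mem_toFinset, List.mem_map] at hi
    obtain ⟨v, hv, rfl⟩ := hi
    rcases hg v hv with h1 | h1
    · exact Or.inl (h1 ▸ hv)
    · exact Or.inr (h1 ▸ hv)
  refine ⟨(l.map g).toFinset, by rw [List.toFinset_card_of_nodup hinj, List.length_map], ?_, hmem⟩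
  intro i hi
  rw [Finset.mem_filter]
  exact ⟨Finset.mem_univ _, fun h => hen (D.fr i) (h ▸ hmem i hi)⟩

/-- A cell with nine entries omits exactly one section. -/
theorem VertexData.exists_facet (hQ : Tess Q) (hq : q ∈ Q) (D : VertexData Q q) {l : List Vec}
    (hm : OnMin q l) (hc : IsCell Q l) (hn : PNodup l) (hl : l.length = 9) :
    ∃ e : D.R → D.I, (∀ r, D.fr (e r) = r) ∧ (∀ r, ¬PMem (D.u (e r)) l) ∧
      ∀ i, i ≠ e (D.fr i) → PMem (D.u i) l := by
  choose e he hen using (D.isCell_iff hQ hq hm hc.1).1 hc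
  refine ⟨e, he, hen, fun i hi => ?_⟩
  obtain ⟨s, hs, hsub, hmem⟩ := D.exists_lines hm hn hen
  have heq := Finset.eq_of_subset_of_card_le hsub (by rw [D.card_compl he, hs, hl])
  exact hmem i (by rw [heq]; simpa using hi)

theorem IsCell.length_le (hQ : Tess Q) {l : List Vec} (hc : IsCell Q l) (hn : PNodup l) :
    l.length ≤ 9 := by
  obtain ⟨-, q, hq, -, -, -, hm, -⟩ := id hc
  obtain ⟨D⟩ := hQ.data q hq
  choose e he hen using (D.isCell_iff hQ hq hm hc.1).1 hc
  obtain ⟨s, hs, hsub, -⟩ := D.exists_lines hm hn hen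
  rw [← hs, ← D.card_compl he]
  exact Finset.card_le_card hsub

/-- Exactly two forms meet at a facet, and they see it with opposite orientations. -/
theorem omega_add_omega (hQ : Tess Q) (hq : q ∈ Q) (D : VertexData Q q) {l : List Vec}
    (hm : OnMin q l) (hs : Spans l) (hn : PNodup l) (hl : l.length = 9)
    {e : D.R → D.I} (he : ∀ r, D.fr (e r) = r) (hen : ∀ r, ¬PMem (D.u (e r)) l)
    (hel : ∀ i, i ≠ e (D.fr i) → PMem (D.u i) l) :
    (∀ q', (q' ∈ Q ∧ OnMin q' l) ↔ q' = q ∨ q' = q + D.d e) ∧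
      omega q l + omega (q + D.d e) l = 0 := by
  have hq1 := D.d_mem e he
  have hm1 := D.onMin_neighbour he hm hen
  have hne : q ≠ q + D.d e := fun h => D.d_ne_zero he (by simpa using h.symm)
  have hc : IsCell Q l := ⟨hs, q, hq, _, hq1, hne, hm, hm1⟩
  obtain ⟨D'⟩ := hQ.data _ hq1
  obtain ⟨e', he', hen', hel'⟩ := D'.exists_facet hQ hq1 hm1 hc hn hl
  have h1 := fun q' hq' h' => D.eq_smul_of_onMin hQ hq he hm hel (q' := q') hq' h'
  have h2 := fun q' hq' h' => D'.eq_smul_of_onMin hQ hq1 he' hm1 hel' (q' := q') hq' h'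
  obtain ⟨s, hs0, hs⟩ := h2 q hq hm
  have hd : D.d e = -(s • D'.d e') := by
    rw [add_assoc, left_eq_add] at hs
    exact eq_neg_of_add_eq_zero_left hs
  have hd0 := D'.d_ne_zero he'
  have hiff : ∀ q', (q' ∈ Q ∧ OnMin q' l) ↔ q' = q ∨ q' = q + D.d e := by
    intro q'
    constructor
    · rintro ⟨hq', h'⟩
      obtain ⟨c, hc0, hc⟩ := h1 q' hq' h'
      obtain ⟨c', hc0', hc'⟩ := h2 q' hq' h'
      have h3 : (c' - (c - 1) * -s) • D'.d e' = 0 := by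
        have h4 : q + c • D.d e = q + D.d e + c' • D'.d e' := hc.symm.trans hc'
        have h5 : (c - 1) • D.d e = c' • D'.d e' := by
          rw [sub_smul, one_smul]
          exact sub_eq_of_eq_add (by
            rw [add_assoc] at h4; rw [add_left_cancel h4, add_comm])
        have aux : ∀ x x' : Vec → ℤ, x = -(s • x') → (c - 1) • x = c' • x' →
            (c' - (c - 1) * -s) • x' = 0 := by
          rintro _ x' rfl h
          rw [sub_smul, ← h, smul_neg, smul_smul, ← neg_smul, ← sub_smul, mul_neg, sub_self,
            zero_smul]
        exact aux _ _ hd h5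
      rcases smul_eq_zero.1 h3 with h4 | h4
      · have hs1 : s ≠ 0 := by
          rintro rfl
          exact D.d_ne_zero he (by simpa using hd)
        have hs2 : 0 < s := lt_of_le_of_ne hs0 hs1.symm
        have : c ≤ 1 := by
          by_contra hcc
          have h5 := mul_pos (show 0 < c - 1 by omega) hs2
          linarith
        obtain rfl | rfl : c = 0 ∨ c = 1 := by omega
        · left; simpa using hc
        · right; simpa using hc
      · exact absurd h4 hd0
    · rintro (rfl | rfl)
      · exact ⟨hq, hm⟩
      · exact ⟨hq1, hm1⟩
  refine ⟨hiff, ?_⟩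
  have hdd : D.d e = -D'.d e' := by
    rcases (hiff _).1 ⟨D'.d_mem e' he', D'.onMin_neighbour he' hm1 hen'⟩ with h | h
    · rw [add_assoc, add_eq_left] at h
      exact eq_neg_of_add_eq_zero_left h
    · rw [add_eq_left] at h
      exact absurd h hd0
  have hz : ∀ v, PMem v l → lam l v = 0 := fun v hv => lam_eq_zero hl hv
  obtain ⟨c, hc1, hc2⟩ := D.eq_smul he (isQuad_lam l) fun i hi => hz _ (hel i hi)
  obtain ⟨c', hc1', hc2'⟩ := D'.eq_smul he' (isQuad_lam l) fun i hi => hz _ (hel' i hi)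
  obtain ⟨r⟩ := D.nonemptyR
  obtain ⟨r'⟩ := D'.nonemptyR
  rw [D.omega_eq hQ hq hl r, D'.omega_eq hQ hq1 hl r', hc2, hc2']
  have h3 : (c + c') • D'.d e' = 0 := by
    have aux : ∀ x x' : Vec → ℤ, x = -x' → c • x = c' • x' → (c + c') • x' = 0 := by
      rintro _ x' rfl h
      rw [add_smul, ← h, smul_neg, add_neg_cancel]
    exact aux _ _ hdd (hc1.symm.trans hc1')
  have h4 : c + c' = 0 := (smul_eq_zero.1 h3).resolve_right hd0
  rw [← mul_add]
  exact_mod_cast (by rw [h4, mul_zero] : (2 : ℤ) * (c + c') = 0)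

theorem omega_ne_zero (hQ : Tess Q) (hq : q ∈ Q) (D : VertexData Q q) {l : List Vec}
    (hl : l.length = 9) {e : D.R → D.I} (he : ∀ r, D.fr (e r) = r)
    (hel : ∀ i, i ≠ e (D.fr i) → PMem (D.u i) l) : omega q l ≠ 0 := by
  intro h
  obtain ⟨r⟩ := D.nonemptyR
  obtain ⟨c, hc1, hc2⟩ := D.eq_smul he (isQuad_lam l) fun i hi => lam_eq_zero hl (hel i hi)
  rw [D.omega_eq hQ hq hl r, hc2] at h
  have hc : c = 0 := by simpa using h
  obtain ⟨a, ha, h0⟩ := exists_of_rowDet_eq_zero (L := sq (D.u (e r)) :: l.map sq) (by simp [hl])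
    (by change lam l _ = 0; rw [hc1, hc]; simp)
  have hp : IsQuad fun v => a ⬝ᵥ sq v := ⟨a, fun _ => rfl⟩
  obtain ⟨c', hc1', hc2'⟩ := D.eq_smul he hp fun i hi => VertexData.apply_eq_zero_of_pmem hp
    (fun w hw => h0 _ (List.mem_cons_of_mem _ (List.mem_map_of_mem hw))) (hel i hi)
  have h1 : c' = 0 := by
    have h2 := h0 _ List.mem_cons_self
    have h3 := congrFun hc1' (D.u (e r))
    rw [Pi.smul_apply, D.d_apply e he, he] at h3
    simpa [h2] using h3.symm
  rw [h1, zero_smul] at hc1'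
  exact ha (eq_zero_of_dotProduct_sq fun v => congrFun hc1' v)

end

end Voronoi

namespace Voronoi

open Matrix

/-! ### The end of the complex -/

/-- Finitely supported functions on `Q`. -/
structure IsChain₀ (Q : Set (Vec → ℤ)) (F : (Vec → ℤ) → ℂ) : Prop where
  supp : ∀ q, F q ≠ 0 → q ∈ Q
  fin : {q | F q ≠ 0}.Finite

open Classical in
/-- The boundary of a chain of facets. -/
noncomputable def bd₀ (Q : Set (Vec → ℤ)) (f : List Vec → ℂ) (q : Vec → ℤ) : ℂ :=
  if q ∈ Q then sumL (mins q) 9 fun l => f l * omega q l else 0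

/-- The augmentation. -/
noncomputable def aug (F : (Vec → ℤ) → ℂ) : ℂ := ∑ᶠ q, F q

theorem sumL_indicator {α : Type*} (S : Finset α) (m : ℕ) (p : List α → Prop) [DecidablePred p] :
    ∃ n : ℕ, sumL S m (fun l => if p l then (1 : ℂ) else 0) = n ∧
      ∀ l : List α, l.length = m → (∀ v ∈ l, v ∈ S) → p l → 0 < n := by
  induction m generalizing p with
  | zero =>
    refine ⟨if p [] then 1 else 0, by simp [sumL], fun l hl _ h => ?_⟩
    rw [List.length_eq_zero_iff.1 hl] at h
    simp [h]
  | succ m ih =>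
    choose n hn hpos using fun v => ih fun l => p (v :: l)
    refine ⟨∑ v ∈ S, n v, by simp [sumL, hn], ?_⟩
    rintro (_ | ⟨v, l⟩) hl hS h
    · simp at hl
    · exact Finset.sum_pos' (fun _ _ => Nat.zero_le _)
        ⟨v, hS v (by simp), hpos v l (by simpa using hl) (fun w hw => hS w (by simp [hw])) h⟩

section

variable {Q : Set (Vec → ℤ)} {f g : List Vec → ℂ} {F G : (Vec → ℤ) → ℂ} {q : Vec → ℤ}

theorem IsChain₀.zero : IsChain₀ Q 0 := ⟨fun q hq => absurd rfl hq, by simp⟩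

theorem IsChain₀.add (hF : IsChain₀ Q F) (hG : IsChain₀ Q G) : IsChain₀ Q (F + G) := by
  have h : ∀ l, (F + G) l ≠ 0 → F l ≠ 0 ∨ G l ≠ 0 := by
    intro l hl
    by_contra! hc
    exact hl (by simp [hc])
  exact ⟨fun l hl => (h l hl).elim (hF.supp l) (hG.supp l), (hF.fin.union hG.fin).subset h⟩

theorem IsChain₀.smul (c : ℂ) (hF : IsChain₀ Q F) : IsChain₀ Q (c • F) := by
  have h : ∀ l, (c • F) l ≠ 0 → F l ≠ 0 := fun l hl h => hl (by simp [h])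
  exact ⟨fun l hl => hF.supp l (h l hl), hF.fin.subset h⟩

theorem IsChain₀.sub (hF : IsChain₀ Q F) (hG : IsChain₀ Q G) : IsChain₀ Q (F - G) := by
  rw [sub_eq_add_neg, ← neg_one_smul ℂ]
  exact hF.add (hG.smul _)

theorem aug_add (hF : IsChain₀ Q F) (hG : IsChain₀ Q G) : aug (F + G) = aug F + aug G :=
  finsum_add_distrib hF.fin hG.fin

theorem aug_smul (c : ℂ) (F : (Vec → ℤ) → ℂ) : aug (c • F) = c * aug F :=
  (smul_finsum c F).symm

theorem aug_sub (hF : IsChain₀ Q F) (hG : IsChain₀ Q G) : aug (F - G) = aug F - aug G := by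
  rw [sub_eq_add_neg, ← neg_one_smul ℂ, aug_add hF (hG.smul _), aug_smul]; ring

theorem bd₀_of_mem (hq : q ∈ Q) : bd₀ Q f q = sumL (mins q) 9 fun l => f l * omega q l :=
  if_pos hq

theorem bd₀_of_notMem (hq : q ∉ Q) : bd₀ Q f q = 0 := if_neg hq

theorem bd₀_add (Q : Set (Vec → ℤ)) (f g : List Vec → ℂ) :
    bd₀ Q (f + g) = bd₀ Q f + bd₀ Q g := by
  funext q
  by_cases hq : q ∈ Q
  · rw [Pi.add_apply, bd₀_of_mem hq, bd₀_of_mem hq, bd₀_of_mem hq, ← sumL_add]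
    simp [add_mul]
  · simp [bd₀_of_notMem hq]

theorem bd₀_smul (Q : Set (Vec → ℤ)) (c : ℂ) (f : List Vec → ℂ) :
    bd₀ Q (c • f) = c • bd₀ Q f := by
  funext q
  by_cases hq : q ∈ Q
  · rw [Pi.smul_apply, bd₀_of_mem hq, bd₀_of_mem hq, smul_eq_mul, ← sumL_mul]
    simp [mul_assoc]
  · simp [bd₀_of_notMem hq]

theorem bd₀_sub (Q : Set (Vec → ℤ)) (f g : List Vec → ℂ) :
    bd₀ Q (f - g) = bd₀ Q f - bd₀ Q g := by
  rw [sub_eq_add_neg, ← neg_one_smul ℂ, bd₀_add, bd₀_smul, neg_one_smul, ← sub_eq_add_neg]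

theorem exists_of_bd₀_ne_zero (hQ : Tess Q) (h : bd₀ Q f q ≠ 0) :
    q ∈ Q ∧ ∃ l, f l ≠ 0 ∧ OnMin q l := by
  by_cases hq : q ∈ Q
  · rw [bd₀_of_mem hq] at h
    obtain ⟨l, -, hl, h0⟩ := exists_of_sumL_ne_zero h
    exact ⟨hq, l, left_ne_zero_of_mul h0, fun v hv => (mem_mins hQ hq).1 (hl v hv)⟩
  · exact absurd (bd₀_of_notMem hq) h

theorem IsChain.bd₀ (hQ : Tess Q) (hf : IsChain Q 0 f) : IsChain₀ Q (bd₀ Q f) := by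
  refine ⟨fun q hq => (exists_of_bd₀_ne_zero hQ hq).1, ?_⟩
  refine (hf.fin.biUnion fun t ht => hQ.fin t (hf.supp t ht).1.1).subset fun q hq => ?_
  obtain ⟨hq, l, hl, hm⟩ := exists_of_bd₀_ne_zero hQ hq
  simp only [Set.mem_iUnion]
  exact ⟨l, hl, hq, hm⟩

theorem sum_omega_cons (q : Vec → ℤ) (l : List Vec) : ∑ v ∈ mins q, omega q (v :: l) = 0 := by
  by_cases hl : l.length = 8
  · simp only [omega, List.length_cons, hl, if_true]
    rw [← Finset.sum_div, ← Int.cast_sum]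
    have h : ∑ v ∈ mins q, ∑ w ∈ mins q, lam (v :: l) w = 0 := by
      have h1 : ∑ v ∈ mins q, ∑ w ∈ mins q, lam (v :: l) w =
          -∑ v ∈ mins q, ∑ w ∈ mins q, lam (v :: l) w := by
        conv_lhs => rw [Finset.sum_comm]
        rw [← Finset.sum_neg_distrib]
        refine Finset.sum_congr rfl fun w _ => ?_
        rw [← Finset.sum_neg_distrib]
        exact Finset.sum_congr rfl fun v _ => lam_cons _ _ _
      omega
    rw [h]; simp
  · simp [omega, hl]

theorem bd₀_bd (hQ : Tess Q) (hf : IsChain Q 1 f) : Voronoi.bd₀ Q (bd Q f) = 0 := by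
  funext q
  by_cases hq : q ∈ Q
  · obtain ⟨D⟩ := hQ.data q hq
    rw [bd₀_of_mem hq]
    have h1 : sumL (mins q) 9 (fun l => bd Q f l * omega q l) =
        sumL (mins q) 9 fun l => dl l f * omega q l := by
      refine sumL_congr fun l hl hm => ?_
      have hm' : OnMin q l := fun v hv => (mem_mins hQ hq).1 (hm v hv)
      by_cases hc : IsCell Q l
      · rw [bd_of_cell hc]
      · rw [bd_of_not_cell hc, zero_mul]
        by_cases hs : Spans l
        · rw [D.isCell_iff hQ hq hm' hs] at hc
          push Not at hc
          obtain ⟨r, hr⟩ := hc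
          rw [D.omega_eq hQ hq hl r, Finset.sum_eq_zero, Int.cast_zero, mul_zero, mul_zero]
          exact fun i hi => lam_eq_zero hl (hr i (Finset.mem_filter.1 hi).2)
        · by_contra hne
          obtain ⟨t, ht, -, h0⟩ := exists_of_dl_ne_zero (left_ne_zero_of_mul (Ne.symm hne))
          exact hs ((hf.supp t h0).1.1.mono ht.subset)
    rw [h1, sumL_dl_mul _ _ _ _ (altEven_omega q).swap]
    simp only [← Finset.mul_sum, sum_omega_cons, mul_zero, sumL_zero_right]
    rfl
  · rw [bd₀_of_notMem hq]; rfl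

theorem aug_bd₀ (hQ : Tess Q) (hf : IsChain Q 0 f) : aug (Voronoi.bd₀ Q f) = 0 := by
  classical
  have hS := hf.fin.biUnion fun t ht => hQ.fin t (hf.supp t ht).1.1
  have hT := hS.biUnion fun q hq => hQ.finite (q := q) (by
    simp only [Set.mem_iUnion] at hq
    obtain ⟨l, hl, hq, -⟩ := hq
    exact hq)
  set S := hS.toFinset with hSdef
  have hmemS : ∀ q, q ∈ S ↔ ∃ l, f l ≠ 0 ∧ q ∈ Q ∧ OnMin q l := fun q => by
    simp [S]; tauto
  set T := hT.toFinset with hTdef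
  have hmemT : ∀ v, v ∈ T ↔ ∃ q ∈ S, q v = 1 := fun v => by simp [T, S]
  have h1 : aug (Voronoi.bd₀ Q f) = ∑ q ∈ S, Voronoi.bd₀ Q f q := by
    refine finsum_eq_sum_of_support_subset _ fun q hq => ?_
    obtain ⟨hq, l, hl, hm⟩ := exists_of_bd₀_ne_zero hQ hq
    exact (hmemS q).2 ⟨l, hl, hq, hm⟩
  have h2 : ∀ q ∈ S, Voronoi.bd₀ Q f q =
      sumL T 9 fun l => f l * if OnMin q l then omega q l else 0 := by
    intro q hq
    obtain ⟨-, -, hqQ, -⟩ := (hmemS q).1 hq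
    rw [bd₀_of_mem hqQ, ← sumL_subset (S := mins q) (T := T)]
    · refine sumL_congr fun l _ hl => ?_
      rw [if_pos (show OnMin q l from fun v hv => (mem_mins hQ hqQ).1 (hl v hv))]
    · exact fun v hv => (hmemT v).2 ⟨q, hq, (mem_mins hQ hqQ).1 hv⟩
    · intro l _ hl v hv
      rw [mem_mins hQ hqQ]
      have := right_ne_zero_of_mul hl
      split_ifs at this with h
      · exact h v hv
      · exact absurd rfl this
  rw [h1, Finset.sum_congr rfl h2,
    ← sumL_sum S T 9 fun q l => f l * if OnMin q l then omega q l else 0]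
  refine (sumL_congr (G := fun _ => 0) ?_).trans (sumL_zero_right T 9)
  intro l hl _
  rw [← Finset.mul_sum]
  by_cases h0 : f l = 0
  · rw [h0, zero_mul]
  obtain ⟨hc, -⟩ := hf.supp l h0
  obtain ⟨-, q, hq, -, -, -, hm, -⟩ := id hc
  obtain ⟨D⟩ := hQ.data q hq
  have hn := hf.alt.pnodup h0
  obtain ⟨e, he, hen, hel⟩ := D.exists_facet hQ hq hm hc hn hl
  obtain ⟨hiff, hadd⟩ := omega_add_omega hQ hq D hm hc.1 hn hl he hen hel
  have hmS : ∀ q', OnMin q' l → q' ∈ Q → q' ∈ S := fun q' h h' => (hmemS q').2 ⟨l, h0, h', h⟩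
  have hm1 := (hiff _).2 (Or.inr rfl)
  rw [← Finset.sum_filter, show (S.filter fun q => OnMin q l) = {q, q + D.d e} from ?_,
    Finset.sum_pair, hadd, mul_zero]
  · exact fun h => D.d_ne_zero he (by simpa using h.symm)
  · ext q'
    rw [Finset.mem_filter, Finset.mem_insert, Finset.mem_singleton, ← hiff]
    constructor
    · rintro ⟨h1, h2⟩
      obtain ⟨-, -, h3, -⟩ := (hmemS q').1 h1
      exact ⟨h3, h2⟩
    · rintro ⟨h1, h2⟩
      exact ⟨hmS q' h2 h1, h2⟩

/-- The value of the boundary of a chain at a form all of whose supporting facets agree. -/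
theorem bd₀_ne_zero (hQ : Tess Q) (hq : q ∈ Q) (D : VertexData Q q) (hf : IsChain Q 0 f)
    {e : D.R → D.I} (he : ∀ r, D.fr (e r) = r) {l₀ : List Vec} (h0 : f l₀ ≠ 0) (hm : OnMin q l₀)
    (h : ∀ l, f l ≠ 0 → OnMin q l → ∀ i, i ≠ e (D.fr i) → PMem (D.u i) l) :
    Voronoi.bd₀ Q f q ≠ 0 := by
  classical
  have hlen : ∀ l, f l ≠ 0 → l.length = 9 := fun l hl => (hf.supp l hl).2
  have hl₀ := h l₀ h0 hm
  have hmem : ∀ l, f l ≠ 0 → OnMin q l → ∀ v ∈ l, PMem v l₀ := by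
    intro l hl hml v hv
    obtain ⟨i, hi⟩ := (D.mem_iff v).1 (hml v hv)
    have hpi : PMem (D.u i) l := by
      rcases hi with rfl | rfl
      · exact Or.inl hv
      · exact Or.inr hv
    obtain ⟨e', he', hen', -⟩ := D.exists_facet hQ hq hml (hf.supp l hl).1 (hf.alt.pnodup hl)
      (hlen l hl)
    have hee : e' = e := by
      funext r
      by_contra hne
      exact hen' r (h l hl hml _ (by rwa [he']))
    have : PMem (D.u i) l₀ := hl₀ i fun h' => hen' (D.fr i) (by rw [hee, ← h']; exact hpi)
    rcases hi with rfl | rfl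
    · exact this
    · exact this.neg
  have hval : Voronoi.bd₀ Q f q = f l₀ * omega q l₀ * sumL (mins q) 9 fun l =>
      if f l ≠ 0 then (1 : ℂ) else 0 := by
    rw [bd₀_of_mem hq, ← sumL_mul]
    refine sumL_congr fun l hl hm' => ?_
    split_ifs with hne
    · obtain ⟨s, hs, hf'⟩ := AltEven.exists_sign (hf.alt.pnodup hne)
        (hmem l hne fun v hv => (mem_mins hQ hq).1 (hm' v hv)) (hl.trans (hlen l₀ h0).symm)
      rw [hf' f hf.alt, hf' _ (altEven_omega q), mul_one]
      linear_combination (f l₀ * omega q l₀) * hs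
    · rw [not_not.1 hne]; simp
  rw [hval]
  refine mul_ne_zero (mul_ne_zero h0 (omega_ne_zero hQ hq D (hlen _ h0) he hl₀)) ?_
  obtain ⟨n, hn, hpos⟩ := sumL_indicator (mins q) 9 fun l => f l ≠ 0
  rw [hn]
  exact_mod_cast (hpos l₀ (hlen _ h0) (fun v hv => (mem_mins hQ hq).2 (hm v hv)) h0).ne'

theorem IsChain.bd_eq_zero (hQ : Tess Q) (hf : IsChain Q 0 f) : Voronoi.bd Q f = 0 := by
  funext l
  by_contra h
  have hc := isCell_of_bd_ne_zero h
  obtain ⟨t, -, hlen, h0⟩ := exists_of_bd_ne_zero h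
  have h1 := hc.length_le hQ ((altEven_bd hQ.quad hf.alt).pnodup h)
  have h2 := (hf.supp t h0).2
  omega

theorem exact_bd₀ (hQ : Tess Q) (hf : IsChain Q 0 f) (hcyc : Voronoi.bd₀ Q f = 0) :
    ∃ h, IsChain Q 1 h ∧ Voronoi.bd Q h = f := by
  have hbz : Voronoi.bd Q (0 : List Vec → ℂ) = 0 := by simpa using bd_smul Q 0 0
  revert hcyc
  refine chain_induction hQ
    (P := fun f => Voronoi.bd₀ Q f = 0 → ∃ h, IsChain Q 1 h ∧ Voronoi.bd Q h = f)
    (fun _ => ⟨0, IsChain.zero, hbz⟩) ?_ hf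
  intro f q hq hf hb ⟨l, hl, hm⟩ ih hcyc
  obtain ⟨D⟩ := hQ.data q hq
  obtain ⟨i₀, hi₀, hmin⟩ := exists_section hQ hq D (hf.supp l hl).1 hm
  obtain ⟨h, hh, hb', h'⟩ := clear_all_frames hQ hq D hi₀ hmin hf (hf.bd_eq_zero hQ) hb
  have hg := hf.sub (hh.bd hQ)
  have hgc : Voronoi.bd₀ Q (f - Voronoi.bd Q h) = 0 := by
    rw [bd₀_sub, hcyc, bd₀_bd hQ hh, sub_zero]
  obtain ⟨h2, hh2, hbd⟩ := ih _ hg hb' (fun l hl hm =>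
    bd₀_ne_zero hQ hq D hg hi₀ hl hm h' (congrFun hgc q)) hgc
  exact ⟨h2 + h, hh2.add hh, by rw [bd_add, hbd, sub_add_cancel]⟩

/-- The chain supported on the facet omitting a section. -/
theorem exists_facet_chain (hQ : Tess Q) (hq : q ∈ Q) (D : VertexData Q q) {e : D.R → D.I}
    (he : ∀ r, D.fr (e r) = r) (hneg : key (D.d e) < 0) :
    ∃ f, IsChain Q 0 f ∧ Below Q q f ∧ Voronoi.bd₀ Q f q ≠ 0 := by
  classical
  set l₀ : List Vec := ((Finset.univ.filter fun i => i ≠ e (D.fr i)).toList.map D.u) with hl₀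
  have hmem : ∀ i, i ≠ e (D.fr i) → D.u i ∈ l₀ := fun i hi =>
    List.mem_map_of_mem (by simpa using hi)
  have hmem' : ∀ v ∈ l₀, ∃ i, i ≠ e (D.fr i) ∧ D.u i = v := fun v hv => by simpa [l₀] using hv
  have hlen : l₀.length = 9 := by rw [hl₀, List.length_map, Finset.length_toList, D.card_compl he]
  have hm₀ : OnMin q l₀ := fun v hv => by
    obtain ⟨i, -, rfl⟩ := hmem' v hv
    exact D.apply_u i
  have hpm : ∀ i, PMem (D.u i) l₀ → i ≠ e (D.fr i) := by
    intro i hi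
    rcases hi with h | h <;> obtain ⟨j, hj, hji⟩ := hmem' _ h
    · rwa [D.u_inj j i (Or.inl hji)] at hj
    · rwa [D.u_inj j i (Or.inr hji)] at hj
  have hen : ∀ r, ¬PMem (D.u (e r)) l₀ := fun r h => hpm _ h (by rw [he])
  have hdesc : D.Descends l₀ := by
    intro e' he' hen'
    have : e' = e := by
      funext r
      by_contra hne
      exact hen' r (Or.inl (hmem _ (by rwa [he'])))
    rwa [this]
  have hc₀ : IsCell Q l₀ := (D.isCell_iff hQ hq hm₀ hdesc.spans).2 fun r => ⟨e r, he r, hen r⟩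
  have hn₀ : PNodup l₀ := by
    rw [hl₀, PNodup, List.pairwise_map]
    refine (Finset.nodup_toList _).imp fun {a b} hne => ⟨fun h => hne ?_, fun h => hne ?_⟩
    · exact D.u_inj _ _ (Or.inl h)
    · exact D.u_inj _ _ (Or.inr h)
  let p : List Vec → Prop := fun l => ∀ v, PMem v l ↔ PMem v l₀
  let f : List Vec → ℂ := fun l => (if p l then 1 else 0) * omega q l
  have hfne : ∀ l, f l ≠ 0 → p l ∧ l.length = 9 := by
    intro l hl
    refine ⟨?_, ?_⟩
    · by_contra h
      exact left_ne_zero_of_mul hl (if_neg h)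
    · by_contra h
      exact right_ne_zero_of_mul hl (if_neg h)
  have hf : IsChain Q 0 f := by
    refine ⟨(altEven_omega q).mul_sym (fun l₁ a b l₂ => ?_) fun l₁ a l₂ => ?_, fun l hl => ?_, ?_⟩
    · simp only [p, pmem_swap]
    · simp only [p, pmem_append_neg]
    · exact ⟨(isCell_congr hQ.quad (hfne l hl).1).2 hc₀, (hfne l hl).2⟩
    · refine (finite_lists (hQ.finite hq) 9).subset fun l hl => ⟨(hfne l hl).2, ?_⟩
      exact (onMin_congr (hQ.quad q hq) (hfne l hl).1).2 hm₀
  refine ⟨f, hf, fun l hl q' hq' hm => ?_, ?_⟩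
  · exact hdesc.le hQ hq hm₀ hq' ((onMin_congr (hQ.quad q' hq') (hfne l hl).1).1 hm)
  · refine bd₀_ne_zero hQ hq D hf he (l₀ := l₀) ?_ hm₀ fun l hl _ i hi =>
      ((hfne l hl).1 _).2 (Or.inl (hmem i hi))
    simp only [f, p, implies_true, if_true, one_mul]
    exact omega_ne_zero hQ hq D hlen he fun i hi => Or.inl (hmem i hi)

theorem exact_aug (hQ : Tess Q) (hF : IsChain₀ Q F) (h0 : aug F = 0) :
    ∃ f, IsChain Q 0 f ∧ Voronoi.bd₀ Q f = F := by
  suffices H : ∀ q : Q, ∀ F, IsChain₀ Q F → (∀ q', F q' ≠ 0 → key q' ≤ key q.1) → aug F = 0 →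
      ∃ f, IsChain Q 0 f ∧ Voronoi.bd₀ Q f = F by
    by_cases hz : F = 0
    · exact ⟨0, IsChain.zero, by rw [hz]; simpa using bd₀_smul Q 0 0⟩
    · obtain ⟨q, hq, hmax⟩ := Set.exists_max_image _ key hF.fin (Function.ne_iff.1 hz)
      exact H ⟨q, hF.supp q hq⟩ F hF hmax h0
  rintro ⟨q, hq⟩
  induction h : (⟨q, hq⟩ : Q) using (wf_key fun q hq v => hQ.nonneg hq v).induction
    generalizing q with
  | _ q' ih =>
    subst h
    intro F hF hb h0
    have hstep : ∀ G, IsChain₀ Q G → (∀ q', G q' ≠ 0 → key q' ≤ key q) → G q = 0 → aug G = 0 →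
        ∃ f, IsChain Q 0 f ∧ Voronoi.bd₀ Q f = G := by
      intro G hG hb hGq h0
      by_cases hz : G = 0
      · exact ⟨0, IsChain.zero, by rw [hz]; simpa using bd₀_smul Q 0 0⟩
      · obtain ⟨q', hq', hmax⟩ := Set.exists_max_image _ key hG.fin (Function.ne_iff.1 hz)
        refine ih ⟨q', hG.supp q' hq'⟩ (lt_of_le_of_ne (hb q' hq') fun he => ?_) q'
          (hG.supp q' hq') rfl G hG hmax h0
        have : q' = q := sub_eq_zero.1 (eq_zero_of_key
          ((hQ.quad q' (hG.supp q' hq')).sub (hQ.quad q hq)) (by rw [key_sub, he, sub_self]))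
        exact hq' (this ▸ hGq)
    obtain ⟨D⟩ := hQ.data q hq
    by_cases hex : ∃ e : D.R → D.I, (∀ r, D.fr (e r) = r) ∧ key (D.d e) < 0
    · obtain ⟨e, he, hneg⟩ := hex
      obtain ⟨f, hf, hfb, hfq⟩ := exists_facet_chain hQ hq D he hneg
      set c := F q / Voronoi.bd₀ Q f q with hc
      have hG := hF.sub ((hf.bd₀ hQ).smul c)
      obtain ⟨g, hg, hgb⟩ := hstep _ hG (fun q' hq' => by
        by_cases h1 : F q' = 0
        · have h2 : Voronoi.bd₀ Q f q' ≠ 0 := fun h2 => hq' (by simp [h1, h2])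
          obtain ⟨h3, l, hl, hm⟩ := exists_of_bd₀_ne_zero hQ h2
          exact hfb l hl q' h3 hm
        · exact hb q' h1) (by simp [hc, hfq]) (by
          rw [aug_sub hF ((hf.bd₀ hQ).smul c), aug_smul, aug_bd₀ hQ hf, h0]; simp)
      exact ⟨g + c • f, hg.add (hf.smul c), by rw [bd₀_add, hgb, bd₀_smul, sub_add_cancel]⟩
    · push Not at hex
      refine hstep F hF hb ?_ h0
      have hle : ∀ q' ∈ Q, key q ≤ key q' := by
        intro q' hq'
        have h1 : 0 ≤ key (q' - q) := by
          refine D.decomp (T := fun _ => True) (P := fun p => 0 ≤ key p) (le_of_eq key_zero.symm)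
            (fun p e he _ hp => ?_) ((hQ.quad q' hq').sub (hQ.quad q hq)) (fun i => ?_) (by simp)
          · rw [key_add]; exact add_nonneg hp (not_lt.1 (hex e he))
          · rw [Pi.sub_apply, D.apply_u, sub_nonneg]
            exact hQ.pos q' hq' _ (D.u_ne_zero (hQ.quad q hq) i)
        rwa [key_sub, sub_nonneg] at h1
      have hsupp : ∀ q', F q' ≠ 0 → q' = q := fun q' hq' => sub_eq_zero.1 (eq_zero_of_key
        ((hQ.quad q' (hF.supp q' hq')).sub (hQ.quad q hq)) (by
          rw [key_sub, le_antisymm (hb q' hq') (hle q' (hF.supp q' hq')), sub_self]))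
      rw [← h0, aug, finsum_eq_single F q fun q' hne => by
        by_contra h
        exact hne (hsupp q' h)]

end

end Voronoi

namespace Voronoi

open Matrix

/-! ### The Voronoi complex of `SL₄(ℤ)` -/

/-- The group `SL₄(ℤ)`. -/
abbrev SL4 := Matrix.SpecialLinearGroup (Fin 4) ℤ

/-- The quadratic form with given coefficients. -/
def form (c : Fin 10 → ℤ) (v : Vec) : ℤ := c ⬝ᵥ sq v

theorem isQuad_form (c : Fin 10 → ℤ) : IsQuad (form c) := ⟨c, fun _ => rfl⟩

theorem form_add (c c' : Fin 10 → ℤ) : form c + form c' = form (c + c') :=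
  funext fun _ => (add_dotProduct _ _ _).symm

theorem form_mulVec (c : Fin 10 → ℤ) (M : Matrix (Fin 4) (Fin 4) ℤ) :
    (fun v => form c (M *ᵥ v)) = form (c ᵥ* sym2 M) := by
  funext v
  rw [form, form, sq_mulVec, dotProduct_mulVec]

/-- The action of `SL₄(ℤ)` on functions on `ℤ⁴`. -/
def act (g : SL4) (p : Vec → ℤ) : Vec → ℤ := fun v => p (g.1 *ᵥ v)

theorem act_mul (g h : SL4) (p : Vec → ℤ) : act (g * h) p = act h (act g p) := by
  funext v
  simp only [act]
  rw [mulVec_mulVec]; rfl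

theorem act_one (p : Vec → ℤ) : act 1 p = p := by
  funext v
  exact congrArg p (one_mulVec v)

theorem inv_mulVec (g : SL4) (v : Vec) : (g⁻¹).1 *ᵥ (g.1 *ᵥ v) = v := by
  rw [mulVec_mulVec, show (g⁻¹).1 * g.1 = 1 from congrArg Subtype.val (inv_mul_cancel g),
    one_mulVec]

theorem mulVec_inv (g : SL4) (v : Vec) : g.1 *ᵥ ((g⁻¹).1 *ᵥ v) = v := by
  rw [mulVec_mulVec, show g.1 * (g⁻¹).1 = 1 from congrArg Subtype.val (mul_inv_cancel g),
    one_mulVec]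

theorem mulVec_injective (g : SL4) : Function.Injective fun v : Vec => g.1 *ᵥ v :=
  Function.LeftInverse.injective (inv_mulVec g)

/-- Coefficients of the form of the root lattice `A₄`. -/
def cA : Fin 10 → ℤ := fun _ => 1

/-- Coefficients of the form of the root lattice `D₄`. -/
def cD : Fin 10 → ℤ := ![1, 1, 1, 2, 1, 1, 2, 1, 2, 2]

/-- The perfect forms in four variables. -/
def perfectForms : Set (Vec → ℤ) := {q | ∃ g, q = act g (form cA) ∨ q = act g (form cD)}

theorem act_mem {q : Vec → ℤ} (hq : q ∈ perfectForms) (g : SL4) : act g q ∈ perfectForms := by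
  obtain ⟨h, rfl | rfl⟩ := hq
  · exact ⟨h * g, Or.inl (act_mul _ _ _).symm⟩
  · exact ⟨h * g, Or.inr (act_mul _ _ _).symm⟩

/-- Transport of structure along the action of `SL₄(ℤ)`. -/
def VertexData.act {q : Vec → ℤ} (D : VertexData perfectForms q) (g : SL4) :
    VertexData perfectForms (act g q) where
  I := D.I
  R := D.R
  fr := D.fr
  u i := (g⁻¹).1 *ᵥ D.u i
  d e := Voronoi.act g (D.d e)
  mem_iff v := by
    rw [Voronoi.act, D.mem_iff]
    refine exists_congr fun i => or_congr ?_ ?_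
    · exact ⟨fun h => by rw [← h, inv_mulVec], fun h => by rw [h, mulVec_inv]⟩
    · rw [← mulVec_neg]
      exact ⟨fun h => by rw [← h, inv_mulVec], fun h => by rw [h, mulVec_inv]⟩
  u_inj i j h := D.u_inj i j <| h.imp (fun h => mulVec_injective _ h)
    fun h => mulVec_injective g⁻¹ (by rw [← mulVec_neg] at h; exact h)
  d_quad e he := (D.d_quad e he).comp _
  d_apply e he i := by rw [Voronoi.act, mulVec_inv, D.d_apply e he]
  d_mem e he := act_mem (D.d_mem e he) g
  frame p hp r r' := D.frame _ (hp.comp _) r r'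
  perfect p hp h := by
    have h' := D.perfect _ (hp.comp (g⁻¹).1) h
    funext v
    have := congrFun h' (g.1 *ᵥ v)
    simp only [inv_mulVec] at this
    exact this
  card := D.card

/-- Determinant of a matrix of size four. -/
def det4 (M : Matrix (Fin 4) (Fin 4) ℤ) : ℤ :=
  M 0 0 * (M 1 1 * (M 2 2 * M 3 3 - M 2 3 * M 3 2) - M 1 2 * (M 2 1 * M 3 3 - M 2 3 * M 3 1) +
      M 1 3 * (M 2 1 * M 3 2 - M 2 2 * M 3 1)) -
    M 0 1 * (M 1 0 * (M 2 2 * M 3 3 - M 2 3 * M 3 2) - M 1 2 * (M 2 0 * M 3 3 - M 2 3 * M 3 0) +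
      M 1 3 * (M 2 0 * M 3 2 - M 2 2 * M 3 0)) +
    M 0 2 * (M 1 0 * (M 2 1 * M 3 3 - M 2 3 * M 3 1) - M 1 1 * (M 2 0 * M 3 3 - M 2 3 * M 3 0) +
      M 1 3 * (M 2 0 * M 3 1 - M 2 1 * M 3 0)) -
    M 0 3 * (M 1 0 * (M 2 1 * M 3 2 - M 2 2 * M 3 1) - M 1 1 * (M 2 0 * M 3 2 - M 2 2 * M 3 0) +
      M 1 2 * (M 2 0 * M 3 1 - M 2 1 * M 3 0))

theorem det_eq_det4 (M : Matrix (Fin 4) (Fin 4) ℤ) : M.det = det4 M := by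
  simp [det_succ_row_zero, Fin.sum_univ_succ, det4, Fin.succAbove]
  ring

/-- The matrix whose entries, increased by two, are the decimal digits of a given number. -/
def digits (n : ℕ) : Matrix (Fin 4) (Fin 4) ℤ := fun i j =>
  ((n / 10 ^ (15 - (4 * i.1 + j.1)) % 10 : ℕ) : ℤ) - 2

theorem form_mem {c : Fin 10 → ℤ} {n : ℕ}
    (h : det4 (digits n) = 1 ∧
      ((∀ k, c k = (cA ᵥ* sym2 (digits n)) k) ∨ ∀ k, c k = (cD ᵥ* sym2 (digits n)) k)) :
    form c ∈ perfectForms := by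
  exact ⟨⟨digits n, (det_eq_det4 _).trans h.1⟩, h.2.imp
    (fun h => (congrArg form (funext h)).trans (form_mulVec _ _).symm)
    fun h => (congrArg form (funext h)).trans (form_mulVec _ _).symm⟩

/-- Minimal vectors of the form `A₄`. -/
def uA : Fin 10 → Vec := ![![0, 0, 0, 1], ![0, 0, 1, -1], ![0, 0, 1, 0], ![0, 1, -1, 0],
  ![0, 1, 0, -1], ![0, 1, 0, 0], ![1, -1, 0, 0], ![1, 0, -1, 0], ![1, 0, 0, -1], ![1, 0, 0, 0]]

/-- The dual basis of the squares of the minimal vectors of `A₄`. -/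
def dA : Fin 10 → Fin 10 → ℤ := ![![0, 0, 0, 1, 0, 0, 1, 0, 1, 1],
  ![0, 0, 0, 0, 0, 0, 0, 0, -1, 0], ![0, 0, 1, 0, 0, 1, 0, 1, 1, 0],
  ![0, 0, 0, 0, 0, -1, 0, 0, 0, 0], ![0, 0, 0, 0, 0, 0, -1, 0, 0, 0],
  ![0, 1, 0, 0, 1, 1, 1, 0, 0, 0], ![0, -1, 0, 0, 0, 0, 0, 0, 0, 0],
  ![0, 0, -1, 0, 0, 0, 0, 0, 0, 0], ![0, 0, 0, -1, 0, 0, 0, 0, 0, 0],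
  ![1, 1, 1, 1, 0, 0, 0, 0, 0, 0]]

/-- Matrices identifying the neighbours of `A₄`. -/
def gA : Fin 10 → ℕ := ![2233232312212111, 2122111122132332, 2122110122232332, 1111222321322322,
  1111212322322322, 1011222322322322, 1212122123333122, 2212122123332122, 1212222123332122,
  1212122133332122]

/-- Minimal vectors of the form `D₄`. -/
def uD : Fin 3 → Fin 4 → Vec := ![
  ![![0, 0, 1, -1], ![0, 0, 1, 0], ![1, -1, 0, 0], ![1, 1, 0, -1]],
  ![![0, 1, -1, 0], ![0, 1, 1, -1], ![1, 0, 0, -1], ![1, 0, 0, 0]],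
  ![![0, 1, 0, -1], ![0, 1, 0, 0], ![1, 0, -1, 0], ![1, 0, 1, -1]]]

/-- The equations of the facets of `D₄`. -/
def dD (a b c : Fin 4) : Fin 10 → ℤ :=
  ![0, 0, 0, 1, 0, -1, 0, 0, 0, 1] +
  (![0, ![0, 0, 1, 0, 0, 1, 0, 1, 2, 0], ![0, -1, 0, -1, 0, 0, -1, 0, 0, -1],
    ![0, 0, 0, -1, 0, 0, -1, 0, 0, -1]] : Fin 4 → Fin 10 → ℤ) a +
  (![0, ![0, 0, 0, 0, 0, 1, 0, 0, 0, 0], ![0, 0, 0, 0, 0, 1, 1, 0, 1, 1],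
    ![1, 1, 1, 2, 0, 1, 1, 0, 1, 1]] : Fin 4 → Fin 10 → ℤ) b +
  (![0, ![0, 1, 0, 0, 1, 1, 2, 0, 0, 0], ![0, 0, -1, -1, 0, 0, 0, 0, -1, -1],
    ![0, 0, 0, -1, 0, 0, 0, 0, -1, -1]] : Fin 4 → Fin 10 → ℤ) c

/-- Matrices identifying the neighbours of `D₄`. -/
def gD : Fin 4 → Fin 4 → Fin 4 → ℕ := ![
  ![![1221111021323324, 2323212211102232, 2212223321211221, 2223121122322121],
    ![1221212233342212, 1221101022323324, 1121221232232333, 1111223223233223],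
    ![1110223323233223, 1121232321113334, 1110123223233223, 2223111023232232],
    ![1121121132233334, 1111333421211221, 1121221233341221, 0110223223233223]],
  ![![1211212222323334, 1211221210103344, 2212112123333233, 2233121121212212],
    ![1211211211103344, 2333212222121110, 2233221212212111, 2223223221111211],
    ![2223111023333233, 2233232311102111, 2233221223331110, 2223212111002333],
    ![2233121111103223, 3334112121111211, 3223112111002333, 1111333422321211]],
  ![![1211223332232121, 2323112132332111, 2111322321321322, 2122121123232232],
    ![2223122132332111, 1111233332232121, 2122221223331221, 1212122123333122],
    ![2111323421211322, 2122232323331110, 2111223312212323, 2223212112112333],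
    ![2122121133341221, 2323011023333122, 3223112112112333, 1111323312212323]],
  ![![2223112122112322, 2323112121222211, 2212112123222233, 1111222321322322],
    ![2223122121222211, 2223112121112322, 2212122123332122, 1111222322322322],
    ![2223111023222233, 2323111023332122, 2223112122112333, 1111223322212323],
    ![1111323411212322, 1111333411212322, 1111223312213323, 2223112112113333]]]

theorem cA_add_dA : ∀ i, det4 (digits (gA i)) = 1 ∧
    ((∀ k, (cA + dA i) k = (cA ᵥ* sym2 (digits (gA i))) k) ∨
      ∀ k, (cA + dA i) k = (cD ᵥ* sym2 (digits (gA i))) k) := by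
  decide +kernel

theorem cD_add_dD : ∀ a b c, det4 (digits (gD a b c)) = 1 ∧
    ((∀ k, (cD + dD a b c) k = (cA ᵥ* sym2 (digits (gD a b c))) k) ∨
      ∀ k, (cD + dD a b c) k = (cD ᵥ* sym2 (digits (gD a b c))) k) := by
  decide +kernel

theorem form_cA (v : Vec) : 2 * form cA v =
    v 0 ^ 2 + v 1 ^ 2 + v 2 ^ 2 + v 3 ^ 2 + (v 0 + v 1 + v 2 + v 3) ^ 2 := by
  rw [form, dotProduct_sq]
  simp only [cA]
  ring

theorem form_cD (v : Vec) : 2 * form cD v =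
    v 0 ^ 2 + v 1 ^ 2 + v 2 ^ 2 + (v 0 + v 1 + v 2 + 2 * v 3) ^ 2 := by
  rw [form, dotProduct_sq]
  simp [cD]
  ring

theorem eq_vec (v : Vec) : v = ![v 0, v 1, v 2, v 3] := by
  funext i; fin_cases i <;> rfl

theorem form_cA_eq_one (v : Vec) : form cA v = 1 ↔ ∃ i, v = uA i ∨ v = -uA i := by
  constructor
  · intro h
    have h2 := form_cA v
    have key : ∀ a ∈ Finset.Icc (-1 : ℤ) 1, ∀ b ∈ Finset.Icc (-1 : ℤ) 1,
        ∀ c ∈ Finset.Icc (-1 : ℤ) 1, ∀ d ∈ Finset.Icc (-1 : ℤ) 1,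
        a ^ 2 + b ^ 2 + c ^ 2 + d ^ 2 + (a + b + c + d) ^ 2 = 2 →
        ∃ i, ![a, b, c, d] = uA i ∨ ![a, b, c, d] = -uA i := by decide +kernel
    rw [eq_vec v]
    rw [h] at h2
    refine key _ ?_ _ ?_ _ ?_ _ ?_ h2.symm <;> rw [Finset.mem_Icc] <;> constructor <;> nlinarith
  · have : ∀ i, form cA (uA i) = 1 := by decide +kernel
    rintro ⟨i, rfl | rfl⟩
    · exact this i
    · rw [(isQuad_form _).map_neg, this]

theorem form_cD_eq_one (v : Vec) :
    form cD v = 1 ↔ ∃ i : Fin 3 × Fin 4, v = uD i.1 i.2 ∨ v = -uD i.1 i.2 := by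
  constructor
  · intro h
    have h2 := form_cD v
    have key : ∀ a ∈ Finset.Icc (-1 : ℤ) 1, ∀ b ∈ Finset.Icc (-1 : ℤ) 1,
        ∀ c ∈ Finset.Icc (-1 : ℤ) 1, ∀ d ∈ Finset.Icc (-2 : ℤ) 2,
        a ^ 2 + b ^ 2 + c ^ 2 + (a + b + c + 2 * d) ^ 2 = 2 →
        ∃ i : Fin 3 × Fin 4, ![a, b, c, d] = uD i.1 i.2 ∨ ![a, b, c, d] = -uD i.1 i.2 := by
      decide +kernel
    rw [eq_vec v]
    rw [h] at h2
    have h0 : v 0 ∈ Finset.Icc (-1 : ℤ) 1 := by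
      rw [Finset.mem_Icc]; constructor <;> nlinarith
    have h1 : v 1 ∈ Finset.Icc (-1 : ℤ) 1 := by
      rw [Finset.mem_Icc]; constructor <;> nlinarith
    have h3 : v 2 ∈ Finset.Icc (-1 : ℤ) 1 := by
      rw [Finset.mem_Icc]; constructor <;> nlinarith
    have h4 : v 0 + v 1 + v 2 + 2 * v 3 ≤ 1 := by nlinarith
    have h5 : -1 ≤ v 0 + v 1 + v 2 + 2 * v 3 := by nlinarith
    refine key _ h0 _ h1 _ h3 _ ?_ h2.symm
    rw [Finset.mem_Icc] at *
    omega
  · have : ∀ i : Fin 3 × Fin 4, form cD (uD i.1 i.2) = 1 := by decide +kernel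
    rintro ⟨i, rfl | rfl⟩
    · exact this i
    · rw [(isQuad_form _).map_neg, this]

/-- The combinatorial data of `A₄`. -/
def vertexDataA : VertexData perfectForms (form cA) where
  I := Fin 10
  R := Unit
  fr _ := ()
  u := uA
  d e := form (dA (e ()))
  mem_iff := form_cA_eq_one
  u_inj := by decide +kernel
  d_quad _ _ := isQuad_form _
  d_apply e _ i := by
    have : ∀ j i, form (dA j) (uA i) = if j = i then 1 else 0 := by decide +kernel
    exact this _ _
  d_mem e _ := by
    rw [form_add]
    exact form_mem (cA_add_dA _)
  frame _ _ _ _ := rfl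
  perfect p hp h := by
    obtain ⟨c, hc⟩ := hp
    simp only [hc, dotProduct_sq, Fin.forall_fin_succ] at h
    simp [uA] at h
    funext v
    have hc0 : c = 0 := by
      funext k
      fin_cases k <;> simp <;> omega
    rw [hc, hc0, zero_dotProduct]; rfl
  card := rfl

/-- The combinatorial data of `D₄`. -/
def vertexDataD : VertexData perfectForms (form cD) where
  I := Fin 3 × Fin 4
  R := Fin 3
  fr := Prod.fst
  u i := uD i.1 i.2
  d e := form (dD (e 0).2 (e 1).2 (e 2).2)
  mem_iff := form_cD_eq_one
  u_inj := by decide +kernel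
  d_quad _ _ := isQuad_form _
  d_apply e he i := by
    have : ∀ a b c r k, form (dD a b c) (uD r k) = if ![a, b, c] r = k then 1 else 0 := by
      decide +kernel
    rw [this]
    obtain ⟨r, k⟩ := i
    have h : (e r = (r, k)) ↔ (e r).2 = k :=
      ⟨fun h => by rw [h], fun h => Prod.ext (he r) h⟩
    simp only [h]
    fin_cases r <;> rfl
  d_mem e _ := by
    rw [form_add]
    exact form_mem (cD_add_dD _ _ _)
  frame p hp r r' := by
    obtain ⟨c, hc⟩ := hp
    have key : ∀ r, ∑ i : Fin 3 × Fin 4 with i.1 = r, p (uD i.1 i.2) =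
        c ⬝ᵥ ∑ k, sq (uD r k) := fun r => by
      rw [dotProduct_sum, Finset.sum_filter, Fintype.sum_prod_type, Finset.sum_eq_single r]
      · simp [hc]
      · intro s _ hs
        simp [hs]
      · simp
    have h : ∀ r r' : Fin 3, ∑ k, sq (uD r k) = ∑ k, sq (uD r' k) := by decide +kernel
    rw [key, key, h r r']
  perfect p hp h := by
    obtain ⟨c, hc⟩ := hp
    simp only [hc, dotProduct_sq, Prod.forall, Fin.forall_fin_succ] at h
    simp [uD] at h
    funext v
    have hc0 : c = 0 := by
      funext k
      fin_cases k <;> simp <;> omega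
    rw [hc, hc0, zero_dotProduct]; rfl
  card := rfl

theorem form_pos {c : Fin 10 → ℤ} (h : c = cA ∨ c = cD) {v : Vec} (hv : v ≠ 0) :
    1 ≤ form c v := by
  by_contra! h0
  apply hv
  rw [eq_vec v]
  rcases h with rfl | rfl
  · have h2 := form_cA v
    have h3 : v 0 = 0 := by nlinarith
    have h4 : v 1 = 0 := by nlinarith
    have h5 : v 2 = 0 := by nlinarith
    have h6 : v 3 = 0 := by nlinarith
    rw [h3, h4, h5, h6]; decide
  · have h2 := form_cD v
    have h3 : v 0 = 0 := by nlinarith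
    have h4 : v 1 = 0 := by nlinarith
    have h5 : v 2 = 0 := by nlinarith
    have h6 : v 3 = 0 := by
      have : v 0 + v 1 + v 2 + 2 * v 3 = 0 := by nlinarith
      omega
    rw [h3, h4, h5, h6]; decide

theorem exists_act_form {q : Vec → ℤ} (hq : q ∈ perfectForms) :
    ∃ c g, (c = cA ∨ c = cD) ∧ q = act g (form c) := by
  obtain ⟨g, h | h⟩ := hq
  · exact ⟨cA, g, Or.inl rfl, h⟩
  · exact ⟨cD, g, Or.inr rfl, h⟩

theorem eq_of_map_mulVec {l : List Vec} (hl : Spans l) {g h : SL4}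
    (hgh : l.map (g.1 *ᵥ ·) = l.map (h.1 *ᵥ ·)) : g = h := by
  have h1 : ∀ v ∈ l, g.1 *ᵥ v = h.1 *ᵥ v := List.map_inj_left.1 hgh
  apply Subtype.ext
  funext i
  rw [← sub_eq_zero]
  refine hl _ fun v hv => ?_
  rw [sub_dotProduct, sub_eq_zero]
  exact congrFun (h1 v hv) i

theorem finite_setOf_mulVec_mem {l : List Vec} (hl : Spans l) {E : Set Vec} (hE : E.Finite) :
    {g : SL4 | ∀ v ∈ l, g.1 *ᵥ v ∈ E}.Finite := by
  refine Set.Finite.of_finite_image ((finite_lists hE l.length).subset ?_)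
    (f := fun g : SL4 => l.map (g.1 *ᵥ ·)) fun g _ h _ hgh => eq_of_map_mulVec hl hgh
  rintro - ⟨g, hg, rfl⟩
  refine ⟨List.length_map _, fun v hv => ?_⟩
  obtain ⟨w, hw, rfl⟩ := List.mem_map.1 hv
  exact hg w hw

theorem tess : Tess perfectForms where
  quad q hq := by
    obtain ⟨c, g, -, rfl⟩ := exists_act_form hq
    exact (isQuad_form c).comp _
  pos q hq v hv := by
    obtain ⟨c, g, hc, rfl⟩ := exists_act_form hq
    refine form_pos hc fun h => hv ?_
    exact mulVec_injective g (h.trans (mulVec_zero _).symm)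
  data q hq := by
    obtain ⟨g, rfl | rfl⟩ := hq
    · exact ⟨vertexDataA.act g⟩
    · exact ⟨vertexDataD.act g⟩
  fin l hl := by
    have key : ∀ c, {v | form c v = 1}.Finite →
        ((fun g => act g (form c)) '' {g : SL4 | ∀ v ∈ l, g.1 *ᵥ v ∈ {v | form c v = 1}}).Finite :=
      fun c hc => (finite_setOf_mulVec_mem hl hc).image _
    refine ((key cA vertexDataA.finite).union (key cD vertexDataD.finite)).subset ?_
    rintro q ⟨⟨g, rfl | rfl⟩, h⟩
    · exact Or.inl ⟨g, h, rfl⟩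
    · exact Or.inr ⟨g, h, rfl⟩

end Voronoi

namespace Voronoi

open CategoryTheory

/-! ### Group cohomology from an explicit resolution -/

section Resolution

variable {G : Type} [Group G] (X : ℕ → Rep.{0} ℂ G) (d : ∀ n, X (n + 1) ⟶ X n)

theorem rep_exact (S : ShortComplex (Rep.{0} ℂ G))
    (h : ∀ x, S.g.hom x = 0 → ∃ y, S.f.hom y = x) : S.Exact := by
  apply (forget₂ (Rep.{0} ℂ G) (ModuleCat ℂ)).reflects_exact_of_faithful
  rw [ShortComplex.moduleCat_exact_iff]
  exact h

theorem groupCohomology_eq_zero (hX : ∀ n, Projective (X n))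
    (hd : ∀ n x, (d n).hom ((d (n + 1)).hom x) = 0)
    (ε : X 0 ⟶ Rep.trivial ℂ G ℂ) (hε : ∀ x, ε.hom ((d 0).hom x) = 0)
    (exact : ∀ n x, (d n).hom x = 0 → ∃ y, (d (n + 1)).hom y = x)
    (exact₀ : ∀ x, ε.hom x = 0 → ∃ y, (d 0).hom y = x)
    (surj : Function.Surjective ε.hom) (n : ℕ)
    (H : ∀ Φ : X (n + 1) ⟶ Rep.trivial ℂ G ℂ, (∀ x, Φ.hom ((d (n + 1)).hom x) = 0) →
      ∃ Ψ : X n ⟶ Rep.trivial ℂ G ℂ, ∀ x, Φ.hom x = Ψ.hom ((d n).hom x))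
    (x : groupCohomology (Rep.trivial ℂ G ℂ) (n + 1)) : x = 0 := by
  have sq : ∀ n, d (n + 1) ≫ d n = 0 := fun n => by ext x; exact hd n x
  let C : ChainComplex (Rep.{0} ℂ G) ℕ := ChainComplex.of X d sq
  have hC : ∀ n, C.d (n + 1) n = d n := fun n => ChainComplex.of_d _ _ _
  have hε' : C.d 1 0 ≫ ε = 0 := by
    rw [hC]; ext x; exact hε x
  let π : C ⟶ (ChainComplex.single₀ (Rep.{0} ℂ G)).obj (Rep.trivial ℂ G ℂ) :=
    (C.toSingle₀Equiv _).symm ⟨ε, hε'⟩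
  have h0 : π.f 0 = ε :=
    ChainComplex.toSingle₀Equiv_symm_apply_f_zero (C := C) (X := Rep.trivial ℂ G ℂ) ε hε'
  have hπ : QuasiIso π := by
    refine ⟨fun m => ?_⟩
    cases m with
    | zero =>
      rw [ChainComplex.quasiIsoAt₀_iff, ShortComplex.quasiIso_iff_of_zeros' _ rfl rfl rfl]
      constructor
      · refine rep_exact _ fun x hx => ?_
        have hx' : (π.f 0).hom x = 0 := hx
        rw [h0] at hx'
        obtain ⟨y, hy⟩ := exact₀ x hx'
        refine ⟨y, ?_⟩
        show (C.d 1 0).hom y = x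
        rw [hC]
        exact hy
      · rw [Rep.epi_iff_surjective]
        show Function.Surjective (π.f 0).hom
        rw [h0]
        exact surj
    | succ m =>
      rw [quasiIsoAt_iff_exactAt' (hL := ChainComplex.exactAt_succ_single_obj ..),
          HomologicalComplex.exactAt_iff' _ (m + 2) (m + 1) m (by simp) (by simp)]
      refine rep_exact _ fun x hx => ?_
      have hx' : (C.d (m + 1) m).hom x = 0 := hx
      rw [hC] at hx'
      obtain ⟨y, hy⟩ := exact m x hx'
      refine ⟨y, ?_⟩
      show (C.d (m + 2) (m + 1)).hom y = x
      rw [hC]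
      exact hy
  let P : ProjectiveResolution (Rep.trivial ℂ G ℂ) :=
    { complex := C, projective := hX, π := π, quasiIso := hπ }
  suffices h : Limits.IsZero (groupCohomology (Rep.trivial ℂ G ℂ) (n + 1)) by
    have := ModuleCat.subsingleton_of_isZero h
    exact Subsingleton.elim _ _
  refine Limits.IsZero.of_iso ?_ (groupCohomologyIso _ _ P)
  rw [← HomologicalComplex.exactAt_iff_isZero_homology,
    HomologicalComplex.exactAt_iff' _ n (n + 1) (n + 2) (by simp) (by simp),
    ShortComplex.moduleCat_exact_iff]
  intro Φ hΦ
  have hΦ' : C.d (n + 2) (n + 1) ≫ (show X (n + 1) ⟶ Rep.trivial ℂ G ℂ from Φ) = 0 := hΦ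
  rw [hC] at hΦ'
  obtain ⟨Ψ, hΨ⟩ := H Φ fun x => congrArg (fun f => f.hom x) hΦ'
  refine ⟨Ψ, ?_⟩
  show C.d (n + 1) n ≫ Ψ = Φ
  rw [hC]
  ext x
  exact (hΨ x).symm

end Resolution

end Voronoi

namespace Voronoi

open CategoryTheory

/-! ### Projectivity of representations on functions -/

section Projective

variable {G : Type} [Group G]

/-- A representation on which the identity is the sum of the translates of a linear map is
projective. -/
theorem projective_of_sum_translates (P : Rep.{0} ℂ G) (W : P.V →ₗ[ℂ] P.V)
    (fin : ∀ v, {g | W (P.ρ g⁻¹ v) ≠ 0}.Finite)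
    (sum : ∀ v, ∑ᶠ g, P.ρ g (W (P.ρ g⁻¹ v)) = v) : Projective P := by
  refine ⟨fun {E X} f e _ => ?_⟩
  obtain ⟨s, hs⟩ := e.hom.toLinearMap.exists_rightInverse_of_surjective
    (LinearMap.range_eq_top.2 ((Rep.epi_iff_surjective e).1 inferInstance))
  have hs' : ∀ x, e.hom (s x) = x := fun x => LinearMap.congr_fun hs x
  have fin' : ∀ v, (Function.support fun g => E.ρ g (s (f.hom (W (P.ρ g⁻¹ v))))).Finite :=
    fun v => (fin v).subset fun g hg h => hg (by simp [h])
  let ψ : P.V →ₗ[ℂ] E.V :=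
    { toFun := fun v => ∑ᶠ g, E.ρ g (s (f.hom (W (P.ρ g⁻¹ v))))
      map_add' := fun v w => by
        rw [← finsum_add_distrib (fin' v) (fin' w)]
        exact finsum_congr fun g => by simp
      map_smul' := fun c v => by
        rw [RingHom.id_apply, smul_finsum' c (fin' v)]
        exact finsum_congr fun g => by simp }
  have hψ : ∀ (g : G) (v : P.V), ψ (P.ρ g v) = E.ρ g (ψ v) := by
    intro g v
    show ∑ᶠ h, _ = E.ρ g (∑ᶠ h, _)
    rw [map_finsum _ (fin' v), ← finsum_comp_equiv (Equiv.mulLeft g)]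
    refine finsum_congr fun h => ?_
    rw [Equiv.coe_mulLeft, mul_inv_rev, map_mul, map_mul]
    simp
  refine ⟨Rep.ofHom (LinearMap.intertwiningMap_of_isIntertwiningMap P.ρ E.ρ ψ hψ), ?_⟩
  ext v
  show e.hom (∑ᶠ g, E.ρ g (s (f.hom (W (P.ρ g⁻¹ v))))) = f.hom v
  rw [map_finsum _ (fin' v)]
  conv_rhs => rw [← sum v, map_finsum f.hom ((fin v).subset fun g hg h => hg (by simp [h]))]
  refine finsum_congr fun g => ?_
  rw [Rep.hom_comm_apply, Rep.hom_comm_apply, hs']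

variable {α : Type} (σ : G →* Equiv.Perm α) (V : Submodule ℂ (α → ℂ))
  (hV : ∀ g, ∀ f ∈ V, (fun x => f (σ g⁻¹ x)) ∈ V)

/-- The representation on a space of functions stable under a permutation action. -/
def funRho : Representation ℂ G V :=
  { toFun := fun g =>
      { toFun := fun f => ⟨fun x => f.1 (σ g⁻¹ x), hV g f.1 f.2⟩
        map_add' := fun _ _ => rfl
        map_smul' := fun _ _ => rfl }
    map_one' := by ext f x; simp
    map_mul' := fun g h => by ext f x; simp }

/-- The representation on a space of functions stable under a permutation action. -/
abbrev funRep : Rep.{0} ℂ G := Rep.of (funRho σ V hV)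

theorem projective_funRep (hfin : ∀ f ∈ V, (Function.support f).Finite) (w : α → ℂ)
    (hw : ∀ f ∈ V, (fun x => w x * f x) ∈ V)
    (fin : ∀ f ∈ V, ∀ x, f x ≠ 0 → {g : G | w (σ g⁻¹ x) ≠ 0}.Finite)
    (sum : ∀ f ∈ V, ∀ x, f x ≠ 0 → ∑ᶠ g : G, w (σ g⁻¹ x) = 1) :
    Projective (funRep σ V hV) := by
  let W : V →ₗ[ℂ] V :=
    { toFun := fun f => ⟨fun x => w x * f.1 x, hw f.1 f.2⟩
      map_add' := fun f f' => Subtype.ext <| funext fun x => mul_add _ _ _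
      map_smul' := fun c f => Subtype.ext <| funext fun x => mul_left_comm _ _ _ }
  have hW : ∀ f : V, {g : G | W ((funRep σ V hV).ρ g⁻¹ f) ≠ 0}.Finite := by
    intro f
    refine ((hfin f.1 f.2).biUnion (t := fun x => {g : G | w (σ g⁻¹ x) ≠ 0})
      fun x hx => fin f.1 f.2 x hx).subset fun g hg => ?_
    obtain ⟨x, hx⟩ : ∃ x, w x * f.1 (σ g⁻¹⁻¹ x) ≠ 0 := by
      by_contra! h
      exact hg (Subtype.ext (funext h))
    simp only [Set.mem_iUnion]
    refine ⟨σ g x, ?_, ?_⟩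
    · rw [inv_inv] at hx
      exact right_ne_zero_of_mul hx
    · show w (σ g⁻¹ (σ g x)) ≠ 0
      simpa using left_ne_zero_of_mul hx
  refine projective_of_sum_translates _ W hW fun f => ?_
  apply Subtype.ext
  funext x
  have h1 := map_finsum ((LinearMap.proj x).comp V.subtype : V →ₗ[ℂ] ℂ)
    (f := fun g => (funRep σ V hV).ρ g (W ((funRep σ V hV).ρ g⁻¹ f)))
    ((hW f).subset fun g hg h => hg (by show (funRep σ V hV).ρ g _ = 0; rw [h]; simp))
  refine h1.trans ?_
  have h2 : ∀ g, ((LinearMap.proj x).comp V.subtype : V →ₗ[ℂ] ℂ)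
      ((funRep σ V hV).ρ g (W ((funRep σ V hV).ρ g⁻¹ f))) = w (σ g⁻¹ x) * f.1 x := fun g => by
    show w (σ g⁻¹ x) * f.1 (σ g⁻¹⁻¹ (σ g⁻¹ x)) = _
    simp
  rw [finsum_congr h2]
  by_cases hx : f.1 x = 0
  · simp [hx]
  · rw [← finsum_mul' _ _ (fin f.1 f.2 x hx), sum f.1 f.2 x hx, one_mul]

end Projective

end Voronoi

namespace Voronoi

open Matrix

/-! ### Equivariance -/

/-- The action of `SL₄(ℤ)` on lists of vectors. -/
def lact (g : SL4) (l : List Vec) : List Vec := l.map (g.1 *ᵥ ·)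

theorem lact_one (l : List Vec) : lact 1 l = l :=
  (List.map_congr_left fun v _ => one_mulVec v).trans (List.map_id l)

theorem lact_mul (g h : SL4) (l : List Vec) : lact (g * h) l = lact g (lact h l) := by
  rw [lact, lact, lact, List.map_map]
  exact List.map_congr_left fun v _ => (mulVec_mulVec v g.1 h.1).symm

theorem lact_inv_lact (g : SL4) (l : List Vec) : lact g⁻¹ (lact g l) = l := by
  rw [← lact_mul, inv_mul_cancel, lact_one]

theorem lact_lact_inv (g : SL4) (l : List Vec) : lact g (lact g⁻¹ l) = l := by
  rw [← lact_mul, mul_inv_cancel, lact_one]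

@[simp] theorem length_lact (g : SL4) (l : List Vec) : (lact g l).length = l.length :=
  List.length_map _

theorem mem_lact {g : SL4} {l : List Vec} {v : Vec} : v ∈ lact g l ↔ ∃ w ∈ l, g.1 *ᵥ w = v :=
  List.mem_map

theorem Spans.lact {l : List Vec} (h : Spans l) (g : SL4) : Spans (lact g l) := by
  intro x hx
  have h1 : x ᵥ* g.1 = 0 := h _ fun v hv => by
    rw [← dotProduct_mulVec]
    exact hx _ (mem_lact.2 ⟨v, hv, rfl⟩)
  have h2 : x ᵥ* g.1 ᵥ* (g⁻¹).1 = x := by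
    rw [vecMul_vecMul, show g.1 * (g⁻¹).1 = 1 from congrArg Subtype.val (mul_inv_cancel g),
      vecMul_one]
  rw [← h2, h1, zero_vecMul]

theorem onMin_act {q : Vec → ℤ} {g : SL4} {l : List Vec} :
    OnMin (act g q) l ↔ OnMin q (lact g l) := by
  rw [OnMin, OnMin, lact, List.forall_mem_map]
  rfl

theorem act_inv_act (g : SL4) (q : Vec → ℤ) : act g⁻¹ (act g q) = q := by
  rw [← act_mul, mul_inv_cancel, act_one]

theorem act_act_inv (g : SL4) (q : Vec → ℤ) : act g (act g⁻¹ q) = q := by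
  rw [← act_mul, inv_mul_cancel, act_one]

theorem IsCell.lact {l : List Vec} (h : IsCell perfectForms l) (g : SL4) :
    IsCell perfectForms (lact g l) := by
  obtain ⟨hs, q, hq, q', hq', hne, h1, h2⟩ := h
  refine ⟨hs.lact g, act g⁻¹ q, act_mem hq _, act g⁻¹ q', act_mem hq' _, fun h => hne ?_, ?_, ?_⟩
  · rw [← act_act_inv g q, h, act_act_inv]
  · rwa [onMin_act, lact_inv_lact]
  · rwa [onMin_act, lact_inv_lact]

theorem isCell_lact {g : SL4} {l : List Vec} :
    IsCell perfectForms (Voronoi.lact g l) ↔ IsCell perfectForms l :=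
  ⟨fun h => by simpa only [lact_inv_lact] using h.lact g⁻¹, fun h => h.lact g⟩

theorem AltEven.lact {f : List Vec → ℂ} (hf : AltEven f) (g : SL4) :
    AltEven fun l => f (lact g l) where
  swap l₁ a b l₂ := by
    simp only [Voronoi.lact, List.map_append, List.map_cons]
    exact hf.swap _ _ _ _
  neg l₁ a l₂ := by
    simp only [Voronoi.lact, List.map_append, List.map_cons, mulVec_neg]
    exact hf.neg _ _ _

/-- The permutation action of `SL₄(ℤ)` on lists of vectors. -/
def listPerm : SL4 →* Equiv.Perm (List Vec) where
  toFun g := ⟨lact g, lact g⁻¹, lact_inv_lact g, lact_lact_inv g⟩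
  map_one' := by ext1 l; exact lact_one l
  map_mul' g h := by ext1 l; exact lact_mul g h l

/-- The permutation action of `SL₄(ℤ)` on functions on `ℤ⁴`. -/
def formPerm : SL4 →* Equiv.Perm (Vec → ℤ) where
  toFun g := ⟨act g⁻¹, act g, act_act_inv g, act_inv_act g⟩
  map_one' := by ext1 l; exact (congrArg (act · l) inv_one).trans (act_one l)
  map_mul' g h := by
    ext1 l
    show act (g * h)⁻¹ l = act g⁻¹ (act h⁻¹ l)
    rw [_root_.mul_inv_rev, act_mul]

theorem formPerm_inv_apply (g : SL4) (q : Vec → ℤ) : formPerm g⁻¹ q = act g q := by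
  show act g⁻¹⁻¹ q = act g q
  rw [inv_inv]

theorem IsChain.lact {k : ℕ} {f : List Vec → ℂ} (hf : IsChain perfectForms k f) (g : SL4) :
    IsChain perfectForms k fun l => f (lact g l) where
  alt := hf.alt.lact g
  supp l hl := by
    obtain ⟨h1, h2⟩ := hf.supp _ hl
    exact ⟨isCell_lact.1 h1, by rwa [length_lact] at h2⟩
  fin := hf.fin.preimage (listPerm g).injective.injOn

theorem IsChain₀.act {F : (Vec → ℤ) → ℂ} (hF : IsChain₀ perfectForms F) (g : SL4) :
    IsChain₀ perfectForms fun q => F (act g q) where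
  supp q hq := by
    have := act_mem (hF.supp _ hq) g⁻¹
    rwa [act_inv_act] at this
  fin := hF.fin.preimage (f := fun q => Voronoi.act g q)
    fun q _ q' _ h => by
      have : Voronoi.act g⁻¹ (Voronoi.act g q) = Voronoi.act g⁻¹ (Voronoi.act g q') :=
        congrArg _ h
      rwa [act_inv_act, act_inv_act] at this

theorem dl_lact (f : List Vec → ℂ) (g : SL4) (l : List Vec) :
    dl (lact g l) f = dl l fun l => f (lact g l) := dl_map _ _ _

theorem bd_lact (f : List Vec → ℂ) (g : SL4) :
    bd perfectForms (fun l => f (lact g l)) = fun l => bd perfectForms f (lact g l) := by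
  funext l
  by_cases h : IsCell perfectForms l
  · rw [bd_of_cell h, bd_of_cell (h.lact g), dl_lact]
  · rw [bd_of_not_cell h, bd_of_not_cell fun h' => h (isCell_lact.1 h')]

theorem rowDet_lact (g : SL4) (l : List Vec) :
    rowDet ((lact g l).map sq) = rowDet (l.map sq) := by
  have : (lact g l).map sq = (l.map sq).map (sym2 g.1 *ᵥ ·) := by
    rw [lact, List.map_map, List.map_map]
    exact List.map_congr_left fun v _ => sq_mulVec _ _
  rw [this, rowDet_map, det_sym2, one_mul]

theorem mins_act {q : Vec → ℤ} (hq : q ∈ perfectForms) (g : SL4) :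
    mins q = (mins (act g q)).image (g.1 *ᵥ ·) := by
  ext v
  rw [mem_mins tess hq, Finset.mem_image]
  constructor
  · intro h
    refine ⟨(g⁻¹).1 *ᵥ v, (mem_mins tess (act_mem hq g)).2 ?_, mulVec_inv g v⟩
    rwa [act, mulVec_inv]
  · rintro ⟨w, hw, rfl⟩
    exact (mem_mins tess (act_mem hq g)).1 hw

theorem omega_lact {q : Vec → ℤ} (hq : q ∈ perfectForms) (g : SL4) (l : List Vec) :
    omega q (lact g l) = omega (act g q) l := by
  have h1 : ∀ v, lam (lact g l) (g.1 *ᵥ v) = lam l v := fun v => rowDet_lact g (v :: l)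
  rw [omega, omega, length_lact, mins_act hq g,
    Finset.sum_image fun v _ w _ h => mulVec_injective g h,
    Finset.card_image_of_injective _ (mulVec_injective g)]
  simp only [h1]

theorem bd₀_lact (f : List Vec → ℂ) (g : SL4) :
    bd₀ perfectForms (fun l => f (lact g l)) = fun q => bd₀ perfectForms f (act g⁻¹ q) := by
  funext q
  by_cases hq : q ∈ perfectForms
  · rw [bd₀_of_mem hq, bd₀_of_mem (act_mem hq _), mins_act (act_mem hq g⁻¹) g,
      sumL_map _ _ (mulVec_injective g), act_act_inv]
    refine sumL_congr fun l _ _ => ?_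
    show _ = f (lact g l) * omega (act g⁻¹ q) (lact g l)
    rw [omega_lact (act_mem hq _), act_act_inv]
  · rw [bd₀_of_notMem hq, bd₀_of_notMem fun h => hq ?_]
    have := act_mem h g
    rwa [act_act_inv] at this

theorem aug_act (F : (Vec → ℤ) → ℂ) (g : SL4) : aug (fun q => F (act g q)) = aug F := by
  have := finsum_comp_equiv (f := F) (formPerm g⁻¹)
  simp only [formPerm_inv_apply] at this
  exact this

/-! ### Weights -/

section Weights

variable {G α : Type} [Group G] (σ : G →* Equiv.Perm α) (A : Set α)

open Classical in
/-- The weight of the points of a set `A` meeting each orbit finitely often. -/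
noncomputable def weight (x : α) : ℂ :=
  if x ∈ A then ((Set.ncard {g : G | σ g x ∈ A} : ℕ) : ℂ)⁻¹ else 0

variable {σ A}

theorem weight_of_notMem {x : α} (h : x ∉ A) : weight σ A x = 0 := if_neg h

theorem ncard_translate (h : G) (x : α) :
    Set.ncard {g : G | σ g (σ h x) ∈ A} = Set.ncard {g : G | σ g x ∈ A} := by
  have : {g : G | σ g x ∈ A} = (· * h) '' {g : G | σ g (σ h x) ∈ A} := by
    ext g
    constructor
    · intro hg
      refine ⟨g * h⁻¹, ?_, inv_mul_cancel_right g h⟩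
      show σ (g * h⁻¹) (σ h x) ∈ A
      rw [← Equiv.Perm.mul_apply, ← map_mul, inv_mul_cancel_right]
      exact hg
    · rintro ⟨g, hg, rfl⟩
      show σ (g * h) x ∈ A
      rwa [map_mul, Equiv.Perm.mul_apply]
  rw [this, Set.ncard_image_of_injective _ (mul_left_injective h)]

theorem finite_weight {x : α} (hfin : {g : G | σ g x ∈ A}.Finite) :
    {g : G | weight σ A (σ g x) ≠ 0}.Finite :=
  hfin.subset fun _ hg => by_contra fun h => hg (weight_of_notMem h)

theorem sum_weight {x : α} (hfin : {g : G | σ g x ∈ A}.Finite) (hne : ∃ g : G, σ g x ∈ A) :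
    ∑ᶠ g : G, weight σ A (σ g x) = 1 := by
  have h0 : Set.ncard {g : G | σ g x ∈ A} ≠ 0 :=
    (Set.ncard_pos hfin).2 hne |>.ne'
  classical
  have h1 : ∀ g : G, weight σ A (σ g x) =
      ∑ᶠ _ : g ∈ {g : G | σ g x ∈ A}, ((Set.ncard {g : G | σ g x ∈ A} : ℕ) : ℂ)⁻¹ := by
    intro g
    by_cases hg : σ g x ∈ A
    · rw [weight, if_pos hg, ncard_translate, finsum_eq_if, if_pos (by exact hg)]
    · rw [weight_of_notMem hg, finsum_eq_if, if_neg (by exact hg)]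
  rw [finsum_congr h1, finsum_mem_eq_finite_toFinset_sum _ hfin, Finset.sum_const,
    ← Set.ncard_eq_toFinset_card _ hfin, nsmul_eq_mul]
  exact mul_inv_cancel₀ (Nat.cast_ne_zero.2 h0)

theorem finite_weight_inv {x : α} (hfin : {g : G | σ g x ∈ A}.Finite) :
    {g : G | weight σ A (σ g⁻¹ x) ≠ 0}.Finite :=
  (finite_weight hfin).preimage (f := fun g => g⁻¹) inv_injective.injOn

theorem sum_weight_inv {x : α} (hfin : {g : G | σ g x ∈ A}.Finite) (hne : ∃ g : G, σ g x ∈ A) :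
    ∑ᶠ g : G, weight σ A (σ g⁻¹ x) = 1 := by
  rw [← sum_weight hfin hne]
  exact finsum_comp_equiv (f := fun g => weight σ A (σ g x)) (Equiv.inv G)

end Weights

/-! ### Finiteness modulo a subgroup -/

/-- A finite symmetric set of vectors containing the minimal vectors of a representative of each
orbit of perfect forms. -/
structure Fundamental (Γ : Subgroup SL4) (E : Finset Vec) : Prop where
  neg : ∀ v ∈ E, -v ∈ E
  exists_mem : ∀ q ∈ perfectForms, ∃ γ ∈ Γ, ∀ v, q v = 1 → γ.1 *ᵥ v ∈ E

theorem exists_fundamental (Γ : Subgroup SL4) [Γ.FiniteIndex] : ∃ E, Fundamental Γ E := by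
  have hA : {v | form cA v = 1}.Finite := vertexDataA.finite
  have hD : {v | form cD v = 1}.Finite := vertexDataD.finite
  let M : Set Vec := {v | form cA v = 1} ∪ {v | form cD v = 1}
  have hM : M.Finite := hA.union hD
  have hE : (⋃ r : SL4 ⧸ Γ, (fun v => (r.out⁻¹).1 *ᵥ v) '' M).Finite :=
    Set.finite_iUnion fun r => hM.image _
  refine ⟨hE.toFinset, fun v hv => ?_, fun q hq => ?_⟩
  · rw [Set.Finite.mem_toFinset, Set.mem_iUnion] at hv ⊢
    obtain ⟨r, w, hw, rfl⟩ := hv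
    refine ⟨r, -w, hw.imp (fun h => ?_) fun h => ?_, mulVec_neg _ _⟩
    · exact ((isQuad_form cA).map_neg w).trans h
    · exact ((isQuad_form cD).map_neg w).trans h
  · obtain ⟨c, g, hc, rfl⟩ := exists_act_form hq
    refine ⟨(g : SL4 ⧸ Γ).out⁻¹ * g, QuotientGroup.eq.1 (QuotientGroup.out_eq' _), fun v hv => ?_⟩
    rw [Set.Finite.mem_toFinset, Set.mem_iUnion]
    refine ⟨(g : SL4 ⧸ Γ), g.1 *ᵥ v, ?_, mulVec_mulVec _ _ _⟩
    rcases hc with rfl | rfl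
    · exact Or.inl hv
    · exact Or.inr hv

variable {Γ : Subgroup SL4} {E : Finset Vec}

/-- The action of `Γ` on lists. -/
abbrev listPermOf (Γ : Subgroup SL4) : Γ →* Equiv.Perm (List Vec) := listPerm.comp Γ.subtype

/-- The action of `Γ` on forms. -/
abbrev formPermOf (Γ : Subgroup SL4) : Γ →* Equiv.Perm (Vec → ℤ) := formPerm.comp Γ.subtype

theorem finite_lact_mem {l : List Vec} (hl : Spans l) :
    {γ : Γ | listPermOf Γ γ l ∈ {l | ∀ v ∈ l, v ∈ E}}.Finite := by
  refine ((finite_setOf_mulVec_mem hl E.finite_toSet).preimage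
    (f := Subtype.val) Subtype.val_injective.injOn).subset fun γ hγ v hv => ?_
  exact hγ _ (mem_lact.2 ⟨v, hv, rfl⟩)

theorem Fundamental.exists_lact_mem (h : Fundamental Γ E) {l : List Vec}
    (hl : IsCell perfectForms l) : ∃ γ : Γ, listPermOf Γ γ l ∈ {l | ∀ v ∈ l, v ∈ E} := by
  obtain ⟨-, q, hq, -, -, -, h1, -⟩ := hl
  obtain ⟨γ, hγ, hE⟩ := h.exists_mem q hq
  refine ⟨⟨γ, hγ⟩, fun v hv => ?_⟩
  obtain ⟨w, hw, rfl⟩ := mem_lact.1 hv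
  exact hE w (h1 w hw)

theorem spans_mins {q : Vec → ℤ} (hq : q ∈ perfectForms) : Spans (mins q).toList := by
  obtain ⟨D⟩ := tess.data q hq
  intro x hx
  have h1 := D.perfect _ (isQuad_square x) fun i => by
    rw [hx _ (Finset.mem_toList.2 ((mem_mins tess hq).2 (D.apply_u i)))]
    rfl
  have h2 : ∀ v, x ⬝ᵥ v = 0 := fun v => pow_eq_zero_iff two_ne_zero |>.1 (congrFun h1 v)
  funext i
  simpa using h2 (Pi.single i 1)

theorem finite_act_mem {q : Vec → ℤ} (hq : q ∈ perfectForms) :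
    {γ : Γ | formPermOf Γ γ q ∈ {q | ∀ v, q v = 1 → v ∈ E}}.Finite := by
  refine (finite_lact_mem (E := E) (spans_mins hq)).subset fun γ hγ v hv => ?_
  obtain ⟨w, hw, rfl⟩ := mem_lact.1 hv
  refine hγ _ ?_
  show q ((γ⁻¹).1.1 *ᵥ _) = 1
  exact (congrArg q (inv_mulVec γ.1 w)).trans ((mem_mins tess hq).1 (Finset.mem_toList.1 hw))

theorem Fundamental.exists_act_mem (h : Fundamental Γ E) {q : Vec → ℤ} (hq : q ∈ perfectForms) :
    ∃ γ : Γ, formPermOf Γ γ q ∈ {q | ∀ v, q v = 1 → v ∈ E} := by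
  obtain ⟨γ, hγ, hE⟩ := h.exists_mem q hq
  refine ⟨⟨γ, hγ⟩, fun v hv => ?_⟩
  have : γ.1 *ᵥ ((γ⁻¹).1 *ᵥ v) ∈ E := hE _ hv
  rwa [mulVec_inv] at this

end Voronoi

namespace Voronoi

open CategoryTheory

/-! ### The Voronoi resolution -/

/-- The space of chains. -/
def chains (k : ℕ) : Submodule ℂ (List Vec → ℂ) where
  carrier := {f | IsChain perfectForms k f}
  add_mem' hf hg := hf.add hg
  zero_mem' := IsChain.zero
  smul_mem' c _ hf := hf.smul c

/-- The space of chains of facets. -/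
def chains₀ : Submodule ℂ ((Vec → ℤ) → ℂ) where
  carrier := {F | IsChain₀ perfectForms F}
  add_mem' hF hG := hF.add hG
  zero_mem' := IsChain₀.zero
  smul_mem' c _ hF := hF.smul c

/-- The boundary operator on chains. -/
noncomputable def bdL (k : ℕ) : chains (k + 1) →ₗ[ℂ] chains k where
  toFun f := ⟨bd perfectForms f.1, IsChain.bd tess f.2⟩
  map_add' f g := Subtype.ext (bd_add _ f.1 g.1)
  map_smul' c f := Subtype.ext (bd_smul _ c f.1)

/-- The boundary operator on chains of ridges. -/
noncomputable def bdL₀ : chains 0 →ₗ[ℂ] chains₀ where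
  toFun f := ⟨bd₀ perfectForms f.1, IsChain.bd₀ tess f.2⟩
  map_add' f g := Subtype.ext (bd₀_add _ f.1 g.1)
  map_smul' c f := Subtype.ext (bd₀_smul _ c f.1)

/-- The augmentation on chains. -/
noncomputable def augL : chains₀ →ₗ[ℂ] ℂ where
  toFun F := aug F.1
  map_add' F G := aug_add F.2 G.2
  map_smul' c F := aug_smul c F.1

/-- Translation of chains. -/
def translate (k : ℕ) (g : SL4) : chains k →ₗ[ℂ] chains k where
  toFun f := ⟨fun l => f.1 (lact g l), IsChain.lact f.2 g⟩
  map_add' _ _ := rfl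
  map_smul' _ _ := rfl

section Resolution

variable (Γ : Subgroup SL4)

/-- The representation on chains. -/
noncomputable abbrev chainRep (k : ℕ) : Rep.{0} ℂ Γ :=
  funRep (listPermOf Γ) (chains k) fun g _ hf => IsChain.lact hf (g⁻¹).1

theorem formPermOf_inv_apply (g : Γ) (q : Vec → ℤ) : formPermOf Γ g⁻¹ q = act g.1 q :=
  formPerm_inv_apply g.1 q

/-- The representation on chains of facets. -/
noncomputable abbrev chainRep₀ : Rep.{0} ℂ Γ :=
  funRep (formPermOf Γ) chains₀ fun g F hF => by
    simp only [formPermOf_inv_apply]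
    exact IsChain₀.act hF g.1

variable {Γ} {E : Finset Vec}

/-- The weight function on lists. -/
noncomputable def listWeight (Γ : Subgroup SL4) (E : Finset Vec) : List Vec → ℂ :=
  weight (listPermOf Γ) {l | ∀ v ∈ l, v ∈ E}

theorem Fundamental.listWeight_congr (h : Fundamental Γ E) {l l' : List Vec}
    (hl : ∀ v, PMem v l ↔ PMem v l') : listWeight Γ E l = listWeight Γ E l' := by
  have key : ∀ (l : List Vec) (γ : SL4), (∀ v ∈ lact γ l, v ∈ E) ↔
      ∀ v, PMem v l → γ.1.mulVec v ∈ E := by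
    intro l γ
    rw [lact, List.forall_mem_map]
    refine ⟨fun hv v => ?_, fun hv v hvl => hv v (Or.inl hvl)⟩
    rintro (hvl | hvl)
    · exact hv v hvl
    · have := h.neg _ (hv _ hvl)
      rwa [Matrix.mulVec_neg, neg_neg] at this
  have h1 : ∀ γ : SL4, (∀ v ∈ lact γ l, v ∈ E) ↔ ∀ v ∈ lact γ l', v ∈ E := fun γ => by
    rw [key, key]
    simp only [hl]
  have h2 : (∀ v ∈ l, v ∈ E) ↔ ∀ v ∈ l', v ∈ E := by simpa only [lact_one] using h1 1
  simp only [listWeight, weight, Set.mem_ofPred_eq, h2]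
  congr 4
  ext γ
  exact h1 γ.1

theorem Fundamental.altEven_listWeight_mul (h : Fundamental Γ E) {f : List Vec → ℂ}
    (hf : AltEven f) : AltEven fun l => listWeight Γ E l * f l :=
  hf.mul_sym (fun _ _ _ _ => h.listWeight_congr (pmem_swap _ _ _ _))
    fun _ _ _ => h.listWeight_congr (pmem_append_neg _ _ _)

theorem Fundamental.projective_chainRep (h : Fundamental Γ E) (k : ℕ) :
    Projective (chainRep Γ k) := by
  refine projective_funRep _ _ _ (fun f hf => IsChain.fin hf)
    (listWeight Γ E) (fun f hf => ⟨?_, ?_, ?_⟩)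
    (fun f hf l hl => finite_weight_inv (finite_lact_mem (hf.supp l hl).1.1))
    (fun f hf l hl => sum_weight_inv (finite_lact_mem (hf.supp l hl).1.1)
      (h.exists_lact_mem (hf.supp l hl).1))
  · exact h.altEven_listWeight_mul hf.alt
  · exact fun l hl => hf.supp l (right_ne_zero_of_mul hl)
  · exact hf.fin.subset fun l hl => right_ne_zero_of_mul hl

theorem Fundamental.projective_chainRep₀ (h : Fundamental Γ E) : Projective (chainRep₀ Γ) := by
  refine projective_funRep _ _ _ (fun F hF => IsChain₀.fin hF)
    (weight (formPermOf Γ) {q | ∀ v, q v = 1 → v ∈ E}) (fun F hF => ⟨?_, ?_⟩)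
    (fun F hF q hq => finite_weight_inv (finite_act_mem (hF.supp q hq)))
    (fun F hF q hq => sum_weight_inv (finite_act_mem (hF.supp q hq))
      (h.exists_act_mem (hF.supp q hq)))
  · exact fun q hq => hF.supp q (right_ne_zero_of_mul hq)
  · exact hF.fin.subset fun q hq => right_ne_zero_of_mul hq

variable (Γ)

/-- The terms of the Voronoi resolution. -/
noncomputable def resX : ℕ → Rep.{0} ℂ Γ
  | 0 => chainRep₀ Γ
  | k + 1 => chainRep Γ k

/-- The differentials of the Voronoi resolution. -/
noncomputable def resD : ∀ n, resX Γ (n + 1) ⟶ resX Γ n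
  | 0 => Rep.ofHom (LinearMap.intertwiningMap_of_isIntertwiningMap (chainRep Γ 0).ρ
      (chainRep₀ Γ).ρ bdL₀ fun g f => Subtype.ext <| (bd₀_lact f.1 (g⁻¹).1).trans <| by
        funext q; rfl)
  | k + 1 => Rep.ofHom (LinearMap.intertwiningMap_of_isIntertwiningMap (chainRep Γ (k + 1)).ρ
      (chainRep Γ k).ρ (bdL k) fun g f => Subtype.ext (bd_lact f.1 (g⁻¹).1))

/-- The augmentation of the Voronoi resolution. -/
noncomputable def resAug : resX Γ 0 ⟶ Rep.trivial ℂ Γ ℂ :=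
  Rep.ofHom (LinearMap.intertwiningMap_of_isIntertwiningMap (chainRep₀ Γ).ρ
    (Rep.trivial ℂ Γ ℂ).ρ augL fun g F => by
      refine Eq.trans ?_ (aug_act F.1 g.1)
      show aug (fun q => F.1 (formPermOf Γ g⁻¹ q)) = _
      simp only [formPermOf_inv_apply])

theorem exists_perfectForm : form cA ∈ perfectForms := ⟨1, Or.inl (act_one _).symm⟩

theorem groupCohomology_eq_zero_of_functionals [Γ.FiniteIndex] (n : ℕ)
    (H : ∀ Φ : chains (n + 1) →ₗ[ℂ] ℂ, (∀ γ ∈ Γ, ∀ f, Φ (translate (n + 1) γ f) = Φ f) →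
      (∀ f, Φ (bdL (n + 1) f) = 0) →
      ∃ Ψ : chains n →ₗ[ℂ] ℂ, (∀ γ ∈ Γ, ∀ f, Ψ (translate n γ f) = Ψ f) ∧
        ∀ f, Φ f = Ψ (bdL n f)) (x : groupCohomology (Rep.trivial ℂ Γ ℂ) (n + 2)) : x = 0 := by
  obtain ⟨E, hE⟩ := exists_fundamental Γ
  refine groupCohomology_eq_zero (resX Γ) (resD Γ) ?_ ?_ (resAug Γ) ?_ ?_ ?_ ?_ (n + 1) ?_ x
  · rintro (_ | k)
    · exact hE.projective_chainRep₀
    · exact hE.projective_chainRep k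
  · rintro (_ | k) f
    · exact Subtype.ext (bd₀_bd tess f.2)
    · exact Subtype.ext (IsChain.supp f.2).bd_bd
  · exact fun f => aug_bd₀ tess f.2
  · rintro (_ | k) f hf
    · obtain ⟨h, hh, hf⟩ := exact_bd₀ tess f.2 (congrArg Subtype.val hf)
      exact ⟨⟨h, hh⟩, Subtype.ext hf⟩
    · obtain ⟨h, hh, hf⟩ := exact_bd tess (Nat.le_add_left 1 k) f.2 (congrArg Subtype.val hf)
      exact ⟨⟨h, hh⟩, Subtype.ext hf⟩
  · intro F hF
    obtain ⟨f, hf, h⟩ := exact_aug tess F.2 hF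
    exact ⟨⟨f, hf⟩, Subtype.ext h⟩
  · intro (c : ℂ)
    classical
    refine ⟨⟨fun q => if q = form cA then c else 0, ?_, ?_⟩, ?_⟩
    · intro q hq
      rw [show q = form cA from by_contra fun h => hq (if_neg h)]
      exact exists_perfectForm
    · exact (Set.finite_singleton (form cA)).subset fun q hq => by_contra fun h => hq (if_neg h)
    · show ∑ᶠ q, (if q = form cA then c else 0) = c
      rw [finsum_eq_single _ (form cA) fun q hq => if_neg hq, if_pos rfl]
  · intro Φ hΦ
    have inv : ∀ γ ∈ Γ, ∀ f, Φ.hom.toLinearMap (translate (n + 1) γ f) = Φ.hom f := by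
      intro γ hγ f
      have := Rep.hom_comm_apply Φ (⟨γ, hγ⟩ : Γ)⁻¹ f
      refine Eq.trans (congrArg Φ.hom (Subtype.ext (funext fun l => ?_))) this
      show f.1 (lact γ l) = f.1 (lact γ⁻¹⁻¹ l)
      rw [inv_inv]
    obtain ⟨Ψ, hΨ, h⟩ := H Φ.hom.toLinearMap inv hΦ
    refine ⟨Rep.ofHom (LinearMap.intertwiningMap_of_isIntertwiningMap (chainRep Γ n).ρ
      (Rep.trivial ℂ Γ ℂ).ρ Ψ fun g f => hΨ (g⁻¹).1 (g⁻¹).2 f), h⟩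

end Resolution

end Voronoi

namespace Voronoi

/-! ### Functionals on chains -/

/-- The lists agree up to order and signs. -/
def Sim (l l' : List Vec) : Prop := l.length = l'.length ∧ ∀ v, PMem v l ↔ PMem v l'

theorem Sim.refl (l : List Vec) : Sim l l := ⟨rfl, fun _ => Iff.rfl⟩

theorem Sim.symm {l l' : List Vec} (h : Sim l l') : Sim l' l := ⟨h.1.symm, fun v => (h.2 v).symm⟩

theorem Sim.trans {l l' l'' : List Vec} (h : Sim l l') (h' : Sim l' l'') : Sim l l'' :=
  ⟨h.1.trans h'.1, fun v => (h.2 v).trans (h'.2 v)⟩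

theorem sim_swap (l₁ l₂ : List Vec) (a b : Vec) : Sim (l₁ ++ a :: b :: l₂) (l₁ ++ b :: a :: l₂) :=
  ⟨by simp, pmem_swap _ _ _ _⟩

theorem sim_neg (l₁ l₂ : List Vec) (a : Vec) : Sim (l₁ ++ (-a) :: l₂) (l₁ ++ a :: l₂) :=
  ⟨by simp, pmem_append_neg _ _ _⟩

theorem sim_congr {l₁ l₂ : List Vec} (h : Sim l₁ l₂) (l : List Vec) : Sim l l₁ ↔ Sim l l₂ :=
  ⟨fun h' => h'.trans h, fun h' => h'.trans h.symm⟩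

theorem Sim.lact {l l' : List Vec} (h : Sim l l') (g : SL4) : Sim (lact g l) (lact g l') := by
  have key : ∀ {l l' : List Vec}, (∀ v, PMem v l ↔ PMem v l') →
      ∀ v, PMem v (Voronoi.lact g l) → PMem v (Voronoi.lact g l') := by
    intro l l' h v hv
    rcases hv with hv | hv
    · obtain ⟨w, hw, rfl⟩ := mem_lact.1 hv
      rcases (h w).1 (Or.inl hw) with h' | h'
      · exact Or.inl (mem_lact.2 ⟨w, h', rfl⟩)
      · exact Or.inr (mem_lact.2 ⟨-w, h', Matrix.mulVec_neg _ _⟩)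
    · obtain ⟨w, hw, hv⟩ := mem_lact.1 hv
      obtain rfl := neg_eq_iff_eq_neg.1 hv.symm
      rcases (h w).1 (Or.inl hw) with h' | h'
      · exact Or.inr (mem_lact.2 ⟨w, h', (neg_neg _).symm⟩)
      · exact Or.inl (mem_lact.2 ⟨-w, h', Matrix.mulVec_neg _ _⟩)
  exact ⟨by rw [length_lact, length_lact, h.1],
    fun v => ⟨key h.2 v, key (fun v => (h.2 v).symm) v⟩⟩

theorem sim_lact {l l' : List Vec} {g : SL4} :
    Sim (Voronoi.lact g l) (Voronoi.lact g l') ↔ Sim l l' :=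
  ⟨fun h => by simpa only [lact_inv_lact] using h.lact g⁻¹, fun h => h.lact g⟩

theorem finite_sim (l : List Vec) : {l' | Sim l l'}.Finite := by
  refine (finite_lists (S := {v | PMem v l}) ?_ l.length).subset fun l' h =>
    ⟨h.1.symm, fun v hv => (h.2 v).2 (Or.inl hv)⟩
  refine ((l.finite_toSet).union (l.finite_toSet.image fun v => -v)).subset ?_
  rintro v (h | h)
  · exact Or.inl h
  · exact Or.inr ⟨-v, h, neg_neg v⟩

/-- The number of lists agreeing with `l` up to order and signs. -/
noncomputable def simCard (l : List Vec) : ℂ := ((Set.ncard {l' | Sim l l'} : ℕ) : ℂ)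

theorem simCard_ne_zero (l : List Vec) : simCard l ≠ 0 :=
  Nat.cast_ne_zero.2 ((Set.ncard_pos (finite_sim l)).2 ⟨l, Sim.refl l⟩).ne'

theorem simCard_congr {l l' : List Vec} (h : Sim l l') : simCard l = simCard l' := by
  have : {m | Sim l m} = {m | Sim l' m} := by
    ext m
    exact ⟨fun h' => h.symm.trans h', fun h' => h.trans h'⟩
  rw [simCard, this, simCard]

theorem simCard_lact (l : List Vec) (g : SL4) : simCard (lact g l) = simCard l := by
  have : {m | Sim (lact g l) m} = lact g '' {m | Sim l m} := by
    ext m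
    constructor
    · intro h
      have h' := Sim.lact h g⁻¹
      rw [lact_inv_lact] at h'
      exact ⟨lact g⁻¹ m, h', lact_lact_inv g m⟩
    · rintro ⟨m, h, rfl⟩
      exact Sim.lact h g
  rw [simCard, simCard, this, Set.ncard_image_of_injective _ (f := lact g) (listPerm g).injective]

open Classical in
/-- The restriction of a function to the lists agreeing with `l` up to order and signs. -/
noncomputable def cls (l : List Vec) (f : List Vec → ℂ) (l' : List Vec) : ℂ :=
  if Sim l l' then f l' else 0

theorem cls_of_sim {l l' : List Vec} (h : Sim l l') (f : List Vec → ℂ) : cls l f l' = f l' :=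
  if_pos h

theorem cls_of_not_sim {l l' : List Vec} (h : ¬Sim l l') (f : List Vec → ℂ) : cls l f l' = 0 :=
  if_neg h

theorem altEven_cls {f : List Vec → ℂ} (hf : AltEven f) (l : List Vec) : AltEven (cls l f) where
  swap l₁ a b l₂ := by
    by_cases h : Sim l (l₁ ++ a :: b :: l₂)
    · rw [cls_of_sim h, cls_of_sim ((sim_congr (sim_swap _ _ _ _) l).1 h), hf.swap]
    · rw [cls_of_not_sim h, cls_of_not_sim (mt (sim_congr (sim_swap _ _ _ _) l).2 h), neg_zero]
  neg l₁ a l₂ := by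
    by_cases h : Sim l (l₁ ++ (-a) :: l₂)
    · rw [cls_of_sim h, cls_of_sim ((sim_congr (sim_neg _ _ _) l).1 h), hf.neg]
    · rw [cls_of_not_sim h, cls_of_not_sim (mt (sim_congr (sim_neg _ _ _) l).2 h)]

theorem isChain_cls {f : List Vec → ℂ} (hf : AltEven f) {l : List Vec} {k : ℕ}
    (hl : IsCell perfectForms l) (hk : l.length + k = 9) :
    IsChain perfectForms k (cls l f) where
  alt := altEven_cls hf l
  supp l' h := by
    have h : Sim l l' := by_contra fun h' => h (cls_of_not_sim h' f)
    exact ⟨(isCell_congr tess.quad h.2).1 hl, by rw [← h.1, hk]⟩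
  fin := (finite_sim l).subset fun l' h => by_contra fun h' => h (cls_of_not_sim h' f)

theorem AltEven.sign_of_sim {l l' : List Vec} (h : Sim l l') (hn : PNodup l) : ∃ s : ℂ, s * s = 1 ∧
    ∀ f : List Vec → ℂ, AltEven f → f l = s * f l' :=
  AltEven.exists_sign hn (fun a ha => (h.2 a).1 (Or.inl ha)) h.1

open Classical in
/-- The alternating function supported on the class of `l` taking the value `1` at `l`, if there is
such a function. -/
noncomputable def altDelta (l : List Vec) : List Vec → ℂ :=
  if h : ∃ f : List Vec → ℂ, AltEven f ∧ f l = 1 then cls l h.choose else fun _ => 0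

theorem altEven_altDelta (l : List Vec) : AltEven (altDelta l) := by
  rw [altDelta]
  split_ifs with h
  · exact altEven_cls h.choose_spec.1 l
  · exact AltEven.zero

theorem altDelta_mul {f : List Vec → ℂ} (hf : AltEven f) (l l' : List Vec) :
    f l * altDelta l l' = cls l f l' := by
  by_cases hs : Sim l l'
  · rw [cls_of_sim hs]
    by_cases h0 : f l = 0
    · rw [h0, zero_mul, eq_comm]
      by_contra h
      obtain ⟨s, -, h1⟩ := AltEven.sign_of_sim hs.symm (hf.pnodup h)
      exact h (by rw [h1 f hf, h0, mul_zero])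
    · have hex : ∃ f : List Vec → ℂ, AltEven f ∧ f l = 1 :=
        ⟨_, hf.smul (f l)⁻¹, inv_mul_cancel₀ h0⟩
      obtain ⟨hg, hg1⟩ := hex.choose_spec
      obtain ⟨s, hs1, h1⟩ := AltEven.sign_of_sim hs (hf.pnodup h0)
      have h2 := h1 f hf
      have h3 := h1 _ hg
      rw [altDelta, dif_pos hex, cls_of_sim hs, h2]
      rw [hg1] at h3
      linear_combination (-f l') * h3
  · rw [cls_of_not_sim hs, altDelta]
    split_ifs
    · rw [cls_of_not_sim hs, mul_zero]
    · exact mul_zero _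

theorem cls_altDelta (l l' : List Vec) : cls l (altDelta l) l' = altDelta l l' := by
  by_cases hs : Sim l l'
  · rw [cls_of_sim hs]
  · rw [cls_of_not_sim hs, altDelta]
    split_ifs
    · rw [cls_of_not_sim hs]
    · rfl

theorem altDelta_self {f : List Vec → ℂ} (hf : AltEven f) {l : List Vec} (h : f l ≠ 0) :
    altDelta l l = 1 := by
  have := altDelta_mul hf l l
  rw [cls_of_sim (Sim.refl l)] at this
  exact mul_left_cancel₀ h (this.trans (mul_one _).symm)

theorem altDelta_of_forall {l : List Vec} (h : ∀ f : List Vec → ℂ, AltEven f → f l = 0) :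
    altDelta l = fun _ => 0 := by
  rw [altDelta, dif_neg]
  rintro ⟨f, hf, h1⟩
  exact one_ne_zero (h1.symm.trans (h f hf))

theorem altDelta_eq_smul {l l₂ : List Vec} (hs : Sim l l₂) {c : ℂ} (hc : c * c = 1)
    (h : ∀ f : List Vec → ℂ, AltEven f → f l₂ = c * f l) :
    altDelta l₂ = fun l' => c * altDelta l l' := by
  by_cases h0 : ∃ f : List Vec → ℂ, AltEven f ∧ f l ≠ 0
  · obtain ⟨f, hf, hfl⟩ := h0
    funext l'
    have h1 := altDelta_mul (altEven_altDelta l) l₂ l'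
    rw [h _ (altEven_altDelta l), altDelta_self hf hfl, mul_one] at h1
    have h2 : cls l₂ (altDelta l) l' = altDelta l l' := by
      by_cases h' : Sim l₂ l'
      · exact cls_of_sim h' _
      · rw [cls_of_not_sim h', ← cls_altDelta, cls_of_not_sim fun h => h' (hs.symm.trans h)]
    rw [← h2, ← h1, ← mul_assoc, hc, one_mul]
  · push Not at h0
    rw [altDelta_of_forall fun f hf => h0 f hf,
      altDelta_of_forall fun f hf => by rw [h f hf, h0 f hf, mul_zero]]
    simp

theorem altDelta_lact (g : SL4) (l l' : List Vec) :
    altDelta (lact g l) (lact g l') = altDelta l l' := by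
  by_cases h0 : ∃ f : List Vec → ℂ, AltEven f ∧ f l ≠ 0
  · obtain ⟨f, hf, hfl⟩ := h0
    have h1 : altDelta (lact g l) (lact g l) = 1 :=
      altDelta_self (hf.lact g⁻¹) (by rwa [lact_inv_lact])
    have h2 := altDelta_mul ((altEven_altDelta (lact g l)).lact g) l l'
    rw [h1, one_mul] at h2
    rw [h2, ← cls_altDelta]
    by_cases h' : Sim l l'
    · rw [cls_of_sim h', cls_of_sim (h'.lact g)]
    · rw [cls_of_not_sim h', cls_of_not_sim (mt sim_lact.1 h')]
  · push Not at h0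
    rw [altDelta_of_forall h0, altDelta_of_forall fun f hf => ?_]
    exact h0 _ (hf.lact g)

theorem isChain_altDelta {l : List Vec} {k : ℕ}
    (hl : IsCell perfectForms l) (hk : l.length + k = 9) : IsChain perfectForms k (altDelta l) := by
  have := isChain_cls (altEven_altDelta l) hl hk
  rwa [show cls l (altDelta l) = altDelta l from funext fun l' => cls_altDelta l l'] at this

/-! ### Cochains -/

/-- Invariant alternating functions on the cells with `m` entries. -/
structure IsCochain (Γ : Subgroup SL4) (m : ℕ) (φ : List Vec → ℂ) : Prop where
  alt : AltEven φ
  supp : ∀ l, φ l ≠ 0 → IsCell perfectForms l ∧ l.length = m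
  inv : ∀ γ ∈ Γ, ∀ l, φ (lact γ l) = φ l

variable {Γ : Subgroup SL4} {m k : ℕ} {φ ψ : List Vec → ℂ}

theorem IsCochain.zero : IsCochain Γ m fun _ => 0 :=
  ⟨AltEven.zero, fun _ h => absurd rfl h, fun _ _ _ => rfl⟩

theorem IsCochain.add (h : IsCochain Γ m φ) (h' : IsCochain Γ m ψ) :
    IsCochain Γ m fun l => φ l + ψ l where
  alt := h.alt.add h'.alt
  supp l hl := by
    by_cases h0 : φ l = 0
    · exact h'.supp l fun h1 => hl (by rw [h0, h1, add_zero])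
    · exact h.supp l h0
  inv γ hγ l := by rw [h.inv γ hγ, h'.inv γ hγ]

theorem IsCochain.smul (h : IsCochain Γ m φ) (c : ℂ) : IsCochain Γ m fun l => c * φ l where
  alt := h.alt.smul c
  supp l hl := h.supp l (right_ne_zero_of_mul hl)
  inv γ hγ l := by rw [h.inv γ hγ]

theorem AltEven.conj (h : AltEven φ) : AltEven fun l => starRingEnd ℂ (φ l) where
  swap l₁ a b l₂ := by rw [h.swap, map_neg]
  neg l₁ a l₂ := by rw [h.neg]

theorem IsCochain.conj (h : IsCochain Γ m φ) : IsCochain Γ m fun l => starRingEnd ℂ (φ l) where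
  alt := h.alt.conj
  supp l hl := h.supp l fun h0 => hl (by rw [h0, map_zero])
  inv γ hγ l := by rw [h.inv γ hγ]

open Classical in
/-- The function on cells representing a functional on chains. -/
noncomputable def rep (Φ : chains k →ₗ[ℂ] ℂ) (l : List Vec) : ℂ :=
  if h : IsCell perfectForms l ∧ l.length + k = 9 then
    Φ ⟨altDelta l, isChain_altDelta h.1 h.2⟩ / simCard l else 0

theorem rep_of_cell (Φ : chains k →ₗ[ℂ] ℂ) {l : List Vec} (h : IsCell perfectForms l)
    (hk : l.length + k = 9) :
    rep Φ l = Φ ⟨altDelta l, isChain_altDelta h hk⟩ / simCard l := dif_pos ⟨h, hk⟩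

theorem rep_eq_mul (Φ : chains k →ₗ[ℂ] ℂ) {l l₂ : List Vec} (hs : Sim l l₂) {c : ℂ}
    (hc : c * c = 1) (h : ∀ f : List Vec → ℂ, AltEven f → f l₂ = c * f l) :
    rep Φ l₂ = c * rep Φ l := by
  have h1 := isCell_congr tess.quad hs.2
  by_cases hl : IsCell perfectForms l ∧ l.length + k = 9
  · rw [rep_of_cell Φ hl.1 hl.2, rep_of_cell Φ (h1.1 hl.1) (by rw [← hs.1, hl.2]),
      simCard_congr hs, ← mul_div_assoc, ← smul_eq_mul, ← map_smul]
    congr 2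
    exact Subtype.ext (altDelta_eq_smul hs hc h)
  · rw [rep, rep, dif_neg hl, dif_neg (by rwa [← h1, ← hs.1]), mul_zero]

theorem isCochain_rep (Φ : chains k →ₗ[ℂ] ℂ) (hk : m + k = 9)
    (hΦ : ∀ γ ∈ Γ, ∀ f, Φ (translate k γ f) = Φ f) : IsCochain Γ m (rep Φ) where
  alt := {
    swap := fun l₁ a b l₂ => by
      rw [rep_eq_mul Φ (sim_swap l₁ l₂ b a) (c := -1) (by norm_num) fun f hf => by
        rw [hf.swap, neg_one_mul], neg_one_mul]
    neg := fun l₁ a l₂ => by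
      rw [rep_eq_mul Φ (sim_neg l₁ l₂ a).symm (c := 1) (by norm_num) fun f hf => by
        rw [hf.neg, one_mul], one_mul] }
  supp l hl := by
    have : IsCell perfectForms l ∧ l.length + k = 9 := by_contra fun h => hl (dif_neg h)
    exact ⟨this.1, by omega⟩
  inv γ hγ l := by
    by_cases hl : IsCell perfectForms l ∧ l.length + k = 9
    · rw [rep_of_cell Φ hl.1 hl.2, rep_of_cell Φ (hl.1.lact γ) (by rw [length_lact, hl.2]),
        simCard_lact, ← hΦ γ hγ]
      congr 2
      exact Subtype.ext (funext fun l' => altDelta_lact γ l l')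
    · rw [rep, rep, dif_neg hl, dif_neg (by rwa [isCell_lact, length_lact])]

/-- The pairing of chains and cochains. -/
noncomputable def pair (f φ : List Vec → ℂ) : ℂ := ∑ᶠ l, f l * φ l

theorem apply_eq_pair (Φ : chains k →ₗ[ℂ] ℂ) (f : chains k) : Φ f = pair f.1 (rep Φ) := by
  have hf : IsChain perfectForms k f.1 := f.2
  have hT : ∀ l, l ∈ hf.fin.toFinset ↔ f.1 l ≠ 0 := fun l => hf.fin.mem_toFinset
  have h1 : f = ∑ l ∈ hf.fin.toFinset.attach, (f.1 l.1 / simCard l.1) •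
      (⟨altDelta l.1, isChain_altDelta (hf.supp _ ((hT _).1 l.2)).1
        (hf.supp _ ((hT _).1 l.2)).2⟩ : chains k) := by
    apply Subtype.ext
    funext l'
    rw [AddSubmonoidClass.coe_finsetSum, Finset.sum_apply]
    have h2 : ∀ l ∈ hf.fin.toFinset.attach, ((f.1 l.1 / simCard l.1) • altDelta l.1) l' =
        cls l.1 f.1 l' / simCard l' := by
      intro l _
      rw [← altDelta_mul hf.alt l.1 l']
      by_cases hs : Sim l.1 l'
      · rw [Pi.smul_apply, smul_eq_mul, simCard_congr hs]; ring
      · rw [Pi.smul_apply, ← cls_altDelta, cls_of_not_sim hs]; simp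
    refine Eq.trans ?_ (Finset.sum_congr rfl h2).symm
    rw [Finset.sum_attach _ fun l => cls l f.1 l' / simCard l', ← Finset.sum_div,
      eq_div_iff (simCard_ne_zero l')]
    by_cases h0 : f.1 l' = 0
    · rw [h0, zero_mul, Finset.sum_eq_zero]
      intro l _
      rw [cls, h0, ite_self]
    · classical
      simp only [cls]
      rw [← Finset.sum_filter, Finset.sum_const, nsmul_eq_mul, mul_comm, simCard,
        Set.ncard_eq_toFinset_card _ (finite_sim l')]
      congr 3
      ext l
      rw [Set.Finite.mem_toFinset, Finset.mem_filter, hT]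
      refine ⟨fun h => ⟨fun h1 => ?_, Sim.symm h⟩, fun h => h.2.symm⟩
      obtain ⟨s, -, h2⟩ := AltEven.sign_of_sim h (hf.alt.pnodup h0)
      exact h0 (by rw [h2 _ hf.alt, h1, mul_zero])
  rw [pair, finsum_eq_sum_of_support_subset (s := hf.fin.toFinset) _ fun l hl =>
    Finset.mem_coe.2 ((hT l).2 (left_ne_zero_of_mul hl))]
  conv_lhs => rw [h1]
  rw [map_sum, ← Finset.sum_attach hf.fin.toFinset fun l => f.1 l * rep Φ l]
  refine Finset.sum_congr rfl fun l _ => ?_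
  have h3 := hf.supp _ ((hT _).1 l.2)
  rw [map_smul, rep_of_cell Φ h3.1 h3.2, smul_eq_mul]
  ring

end Voronoi

namespace Voronoi

/-! ### The coboundary of the dual complex -/

theorem sumL_eq_finsum {α : Type*} {S : Finset α} {m : ℕ} {F : List α → ℂ}
    (h : ∀ l, F l ≠ 0 → l.length = m ∧ ∀ v ∈ l, v ∈ S) : sumL S m F = ∑ᶠ l, F l := by
  classical
  obtain ⟨T, hT, hs⟩ : ∃ T : Finset (List α), (∀ l, l ∈ T ↔ l.length = m ∧ ∀ v ∈ l, v ∈ S) ∧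
      ∀ F : List α → ℂ, sumL S m F = ∑ l ∈ T, F l := by
    clear h F
    induction m with
    | zero =>
      refine ⟨{[]}, fun l => ?_, fun F => by simp [sumL]⟩
      rw [Finset.mem_singleton, List.length_eq_zero_iff]
      exact ⟨fun h => ⟨h, by simp [h]⟩, fun h => h.1⟩
    | succ m ih =>
      obtain ⟨T, hT, hs⟩ := ih
      refine ⟨(S ×ˢ T).image fun p => p.1 :: p.2, fun l => ?_, fun F => ?_⟩
      · rw [Finset.mem_image]
        constructor
        · rintro ⟨⟨v, l⟩, hp, rfl⟩
          rw [Finset.mem_product, hT] at hp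
          exact ⟨by simp [hp.2.1], by simpa using ⟨hp.1, hp.2.2⟩⟩
        · rintro ⟨h1, h2⟩
          obtain _ | ⟨v, l⟩ := l
          · simp at h1
          · refine ⟨(v, l), ?_, rfl⟩
            rw [Finset.mem_product, hT]
            exact ⟨h2 v (by simp), by simpa using h1, fun w hw => h2 w (by simp [hw])⟩
      · rw [sumL, Finset.sum_image, Finset.sum_product]
        · exact Finset.sum_congr rfl fun v _ => hs _
        · rintro ⟨v, l⟩ - ⟨w, l'⟩ - h
          simpa using h
  rw [hs, finsum_eq_sum_of_support_subset _ fun l hl => Finset.mem_coe.2 ((hT l).2 (h l hl))]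

theorem finite_cons {l : List Vec} (hl : Spans l) : {v | IsCell perfectForms (v :: l)}.Finite := by
  refine ((tess.fin l hl).biUnion (t := fun q => {v | q v = 1 ∧ q ∈ perfectForms})
    fun q hq => (tess.finite hq.1).subset fun v hv => hv.1).subset fun v hv => ?_
  obtain ⟨-, q, hq, -, -, -, h1, -⟩ := hv
  rw [onMin_cons] at h1
  exact Set.mem_biUnion (show q ∈ {q | q ∈ perfectForms ∧ OnMin q l} from ⟨hq, h1.2⟩) ⟨h1.1, hq⟩

open Classical in
/-- The coboundary of the dual complex. -/
noncomputable def cob (φ : List Vec → ℂ) (l : List Vec) : ℂ :=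
  if IsCell perfectForms l then ∑ᶠ v, φ (v :: l) else 0

theorem cob_of_cell {φ : List Vec → ℂ} {l : List Vec} (h : IsCell perfectForms l) :
    cob φ l = ∑ᶠ v, φ (v :: l) := if_pos h

theorem cob_of_not_cell {φ : List Vec → ℂ} {l : List Vec} (h : ¬IsCell perfectForms l) :
    cob φ l = 0 := if_neg h

variable {Γ : Subgroup SL4} {m k : ℕ} {φ ψ : List Vec → ℂ}

theorem IsCochain.finite_cons (h : IsCochain Γ m φ) {l : List Vec} (hl : IsCell perfectForms l) :
    (Function.support fun v => φ (v :: l)).Finite :=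
  (Voronoi.finite_cons hl.1).subset fun _ hv => (h.supp _ hv).1

theorem IsCochain.cob (h : IsCochain Γ (m + 1) φ) : IsCochain Γ m (cob φ) where
  alt := {
    swap := fun l₁ a b l₂ => by
      have h1 := isCell_congr tess.quad (sim_swap l₁ l₂ a b).2
      by_cases hc : IsCell perfectForms (l₁ ++ a :: b :: l₂)
      · rw [cob_of_cell hc, cob_of_cell (h1.1 hc), ← finsum_neg_distrib]
        exact finsum_congr fun v => h.alt.swap (v :: l₁) a b l₂
      · rw [cob_of_not_cell hc, cob_of_not_cell (mt h1.2 hc), neg_zero]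
    neg := fun l₁ a l₂ => by
      have h1 := isCell_congr tess.quad (sim_neg l₁ l₂ a).2
      by_cases hc : IsCell perfectForms (l₁ ++ (-a) :: l₂)
      · rw [cob_of_cell hc, cob_of_cell (h1.1 hc)]
        exact finsum_congr fun v => h.alt.neg (v :: l₁) a l₂
      · rw [cob_of_not_cell hc, cob_of_not_cell (mt h1.2 hc)] }
  supp l hl := by
    have hc : IsCell perfectForms l := by_contra fun hc => hl (cob_of_not_cell hc)
    rw [cob_of_cell hc] at hl
    obtain ⟨v, hv⟩ : ∃ v, φ (v :: l) ≠ 0 := by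
      by_contra! h0
      exact hl ((finsum_congr h0).trans finsum_zero)
    exact ⟨hc, by simpa using (h.supp _ hv).2⟩
  inv γ hγ l := by
    by_cases hc : IsCell perfectForms l
    · rw [cob_of_cell hc, cob_of_cell (hc.lact γ)]
      rw [← finsum_comp (fun v : Vec => γ.1.mulVec v)
        ⟨mulVec_injective γ, fun v => ⟨_, mulVec_inv γ v⟩⟩]
      exact finsum_congr fun v => h.inv γ hγ (v :: l)
    · rw [cob_of_not_cell hc, cob_of_not_cell (mt isCell_lact.1 hc)]

theorem IsCochain.cob_add (hφ : IsCochain Γ (m + 1) φ) (hψ : IsCochain Γ (m + 1) ψ) (l : List Vec) :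
    Voronoi.cob (fun l => φ l + ψ l) l = Voronoi.cob φ l + Voronoi.cob ψ l := by
  by_cases hc : IsCell perfectForms l
  · rw [cob_of_cell hc, cob_of_cell hc, cob_of_cell hc]
    exact finsum_add_distrib (hφ.finite_cons hc) (hψ.finite_cons hc)
  · rw [cob_of_not_cell hc, cob_of_not_cell hc, cob_of_not_cell hc, add_zero]

theorem IsCochain.cob_smul (hφ : IsCochain Γ (m + 1) φ) (c : ℂ) (l : List Vec) :
    Voronoi.cob (fun l => c * φ l) l = c * Voronoi.cob φ l := by
  by_cases hc : IsCell perfectForms l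
  · rw [cob_of_cell hc, cob_of_cell hc, mul_finsum' _ _ (hφ.finite_cons hc)]
  · rw [cob_of_not_cell hc, cob_of_not_cell hc, mul_zero]

theorem IsCochain.cob_conj (hφ : IsCochain Γ (m + 1) φ) (l : List Vec) :
    Voronoi.cob (fun l => starRingEnd ℂ (φ l)) l = starRingEnd ℂ (Voronoi.cob φ l) := by
  by_cases hc : IsCell perfectForms l
  · rw [cob_of_cell hc, cob_of_cell hc, map_finsum _ (hφ.finite_cons hc)]
  · rw [cob_of_not_cell hc, cob_of_not_cell hc, map_zero]

/-- Deleting an entry is adjoint to prepending one. -/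
theorem finsum_dl_mul {α : Type*} {f g : List α → ℂ} {m : ℕ}
    (hg : ∀ l₁ a b l₂, g (l₁ ++ a :: b :: l₂) = -g (l₁ ++ b :: a :: l₂)) (S : Finset α)
    (h₁ : ∀ l, dl l f * g l ≠ 0 → l.length = m + 1 ∧ ∀ v ∈ l, v ∈ S)
    (h₂ : ∀ v l, f l * g (v :: l) ≠ 0 → l.length = m ∧ ∀ w ∈ v :: l, w ∈ S) :
    ∑ᶠ l, dl l f * g l = (m + 1) * ∑ᶠ l, ∑ᶠ v, f l * g (v :: l) := by
  have h3 : ∀ l, ∑ᶠ v, f l * g (v :: l) = ∑ v ∈ S, f l * g (v :: l) := fun l =>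
    finsum_eq_sum_of_support_subset _ fun v hv => (h₂ v l hv).2 v List.mem_cons_self
  rw [← sumL_eq_finsum h₁, sumL_dl_mul S m f g hg, finsum_congr h3, ← sumL_eq_finsum]
  intro l hl
  obtain ⟨v, -, hv⟩ := Finset.exists_ne_zero_of_sum_ne_zero hl
  exact ⟨(h₂ v l hv).1, fun w hw => (h₂ v l hv).2 w (List.mem_cons_of_mem _ hw)⟩

theorem pair_bd {f : List Vec → ℂ} (hf : IsChain perfectForms (k + 1) f)
    (hφ : IsCochain Γ (m + 1) φ) :
    pair (bd perfectForms f) φ = (m + 1) * pair f (cob φ) := by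
  classical
  have hfin : ({v | ∃ l, f l ≠ 0 ∧ v ∈ l} ∪
      {v | ∃ l, f l ≠ 0 ∧ IsCell perfectForms (v :: l)}).Finite := by
    refine Set.Finite.union ?_ ?_
    · refine (hf.fin.biUnion fun l _ => l.finite_toSet).subset ?_
      rintro v ⟨l, hl, hv⟩
      exact Set.mem_biUnion (show l ∈ {l | f l ≠ 0} from hl) hv
    · refine (hf.fin.biUnion (t := fun l => {v | IsCell perfectForms (v :: l)})
        fun l hl => finite_cons (hf.supp l hl).1.1).subset ?_
      rintro v ⟨l, hl, hv⟩
      exact Set.mem_biUnion (show l ∈ {l | f l ≠ 0} from hl) hv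
  have hS : ∀ l, (∃ t, f t ≠ 0 ∧ ∃ v, l.Perm (v :: t)) → IsCell perfectForms l →
      ∀ v ∈ l, v ∈ hfin.toFinset := by
    rintro l ⟨t, ht, v, hp⟩ hl w hw
    rw [hfin.mem_toFinset]
    rcases List.mem_cons.1 (hp.mem_iff.1 hw) with rfl | hw
    · refine Or.inr ⟨t, ht, (isCell_congr tess.quad fun v => ?_).1 hl⟩
      rw [PMem, PMem, hp.mem_iff, hp.mem_iff]
    · exact Or.inl ⟨t, ht, hw⟩
  have h1 : ∀ l, bd perfectForms f l * φ l = dl l f * φ l := by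
    intro l
    by_cases hc : IsCell perfectForms l
    · rw [bd_of_cell hc]
    · rw [not_imp_comm.1 (fun h => (hφ.supp l h).1) hc, mul_zero, mul_zero]
  have h2 : ∀ l, ∑ᶠ v, f l * φ (v :: l) = f l * cob φ l := by
    intro l
    by_cases h0 : f l = 0
    · simp [h0]
    · have hc := (hf.supp l h0).1
      rw [cob_of_cell hc, mul_finsum' _ _ (hφ.finite_cons hc)]
  rw [pair, finsum_congr h1, finsum_dl_mul hφ.alt.swap hfin.toFinset, finsum_congr h2, pair]
  · intro l hl
    obtain ⟨t, ht, hlt, hft⟩ := exists_of_dl_ne_zero (left_ne_zero_of_mul hl)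
    have hc := hφ.supp l (right_ne_zero_of_mul hl)
    refine ⟨hc.2, hS l ⟨t, hft, ?_⟩ hc.1⟩
    obtain ⟨s, hs⟩ := ht.exists_perm_append
    have hs1 : s.length = 1 := by
      have := hs.length_eq
      rw [List.length_append] at this
      omega
    obtain ⟨v, rfl⟩ := List.length_eq_one_iff.1 hs1
    exact ⟨v, hs.trans List.perm_append_comm⟩
  · intro v l hl
    have hl0 := left_ne_zero_of_mul hl
    have hc := hφ.supp _ (right_ne_zero_of_mul hl)
    exact ⟨by simpa using hc.2, hS _ ⟨l, hl0, v, List.Perm.refl _⟩ hc.1⟩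

section Weights

variable {G α : Type*} [Group G] (σ : G →* Equiv.Perm α) {F w w' : α → ℂ}

theorem finsum_weight_eq_prod (hw' : ∀ x, F x ≠ 0 → ∑ᶠ g, w' (σ g x) = 1)
    (hfin : {x | w x * F x ≠ 0}.Finite) :
    (Function.support fun p : α × G => w p.1 * F p.1 * w' (σ p.2 p.1)).Finite ∧
    ∑ᶠ x, w x * F x = ∑ᶠ p : α × G, w p.1 * F p.1 * w' (σ p.2 p.1) := by
  have h1 : ∀ x, F x ≠ 0 → (Function.support fun g => w' (σ g x)).Finite := by
    intro x hx
    by_contra h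
    have := hw' x hx
    rw [finsum_of_infinite_support h] at this
    exact zero_ne_one this
  have h2 : (Function.support fun p : α × G => w p.1 * F p.1 * w' (σ p.2 p.1)).Finite := by
    refine (hfin.biUnion (t := fun x => Prod.mk x '' {g | F x ≠ 0 ∧ w' (σ g x) ≠ 0}) fun x hx =>
      ((h1 x (right_ne_zero_of_mul hx)).subset fun g hg => hg.2).image _).subset ?_
    rintro ⟨x, g⟩ h
    have h3 : w x * F x ≠ 0 := left_ne_zero_of_mul h
    exact Set.mem_biUnion (show x ∈ {x | w x * F x ≠ 0} from h3)
      ⟨g, ⟨right_ne_zero_of_mul h3, right_ne_zero_of_mul h⟩, rfl⟩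
  refine ⟨h2, ?_⟩
  rw [finsum_curry _ h2]
  refine finsum_congr fun x => ?_
  by_cases hx : F x = 0
  · simp [hx]
  · show _ = ∑ᶠ g, w x * F x * w' (σ g x)
    rw [← mul_finsum' _ _ (h1 x hx), hw' x hx, mul_one]

/-- The sum of an invariant function does not depend on the weights. -/
theorem finsum_weight_congr (hF : ∀ g x, F (σ g x) = F x)
    (hw : ∀ x, F x ≠ 0 → ∑ᶠ g, w (σ g x) = 1) (hw' : ∀ x, F x ≠ 0 → ∑ᶠ g, w' (σ g x) = 1)
    (hfin : {x | w x * F x ≠ 0}.Finite) (hfin' : {x | w' x * F x ≠ 0}.Finite) :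
    ∑ᶠ x, w x * F x = ∑ᶠ x, w' x * F x := by
  rw [(finsum_weight_eq_prod σ hw' hfin).2, (finsum_weight_eq_prod σ hw hfin').2]
  let e : α × G ≃ α × G :=
    { toFun := fun p => (σ p.2 p.1, p.2⁻¹)
      invFun := fun p => (σ p.2 p.1, p.2⁻¹)
      left_inv := fun p => by simp
      right_inv := fun p => by simp }
  rw [← finsum_comp_equiv e (f := fun p : α × G => w' p.1 * F p.1 * w (σ p.2 p.1))]
  refine finsum_congr fun p => ?_
  show w p.1 * F p.1 * w' (σ p.2 p.1) = w' (σ p.2 p.1) * F (σ p.2 p.1) * w (σ p.2⁻¹ (σ p.2 p.1))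
  have h : σ p.2⁻¹ (σ p.2 p.1) = p.1 := by simp
  rw [hF, h]
  ring

end Weights

end Voronoi

namespace Voronoi

/-! ### Harmonic cochains -/

variable {Γ : Subgroup SL4} {E : Finset Vec} {m : ℕ} {φ ψ η : List Vec → ℂ}

theorem eq_zero_of_finsum_eq_zero {α : Type*} {f : α → ℝ} (hf : {x | f x ≠ 0}.Finite)
    (h0 : ∀ x, 0 ≤ f x) (h : ∑ᶠ x, (f x : ℂ) = 0) (x : α) : f x = 0 := by
  have h1 : ∀ x ∉ hf.toFinset, f x = 0 := fun x hx => by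
    by_contra h'
    exact hx (hf.mem_toFinset.2 h')
  rw [finsum_eq_sum_of_support_subset (s := hf.toFinset) _ fun x hx =>
    hf.mem_toFinset.2 fun h' => hx (by simp [h']), ← Complex.ofReal_sum,
    Complex.ofReal_eq_zero, Finset.sum_eq_zero_iff_of_nonneg fun x _ => h0 x] at h
  by_cases hx : x ∈ hf.toFinset
  · exact h x hx
  · exact h1 x hx

theorem Fundamental.sum_listWeight (hE : Fundamental Γ E) {l : List Vec}
    (hl : IsCell perfectForms l) : ∑ᶠ γ : Γ, listWeight Γ E (lact γ.1 l) = 1 :=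
  sum_weight (σ := listPermOf Γ) (finite_lact_mem hl.1) (hE.exists_lact_mem hl)

theorem mem_of_listWeight_ne_zero {l : List Vec} (h : listWeight Γ E l ≠ 0) : ∀ v ∈ l, v ∈ E := by
  by_contra h'
  exact h (weight_of_notMem h')

theorem exists_listWeight_eq (Γ : Subgroup SL4) (E : Finset Vec) (l : List Vec) :
    ∃ s : ℝ, listWeight Γ E l = s * s := by
  rw [listWeight, weight]
  split_ifs
  · refine ⟨Real.sqrt ((Set.ncard {γ : Γ | listPermOf Γ γ l ∈ {l | ∀ v ∈ l, v ∈ E}} : ℕ) : ℝ)⁻¹, ?_⟩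
    rw [← Complex.ofReal_mul, Real.mul_self_sqrt (by positivity)]
    simp
  · exact ⟨0, by simp⟩

/-- The square root of the weight of a list. -/
noncomputable def sqrtWeight (Γ : Subgroup SL4) (E : Finset Vec) (l : List Vec) : ℝ :=
  (exists_listWeight_eq Γ E l).choose

theorem listWeight_eq (l : List Vec) :
    listWeight Γ E l = sqrtWeight Γ E l * sqrtWeight Γ E l :=
  (exists_listWeight_eq Γ E l).choose_spec

theorem listWeight_ne_zero {l : List Vec} (hl : Spans l) (h : ∀ v ∈ l, v ∈ E) :
    listWeight Γ E l ≠ 0 := by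
  have h1 : l ∈ {l | ∀ v ∈ l, v ∈ E} := h
  rw [listWeight, weight, if_pos h1]
  refine inv_ne_zero (Nat.cast_ne_zero.2 ((Set.ncard_pos (finite_lact_mem hl)).2 ⟨1, ?_⟩).ne')
  simpa using h

variable (Γ) in
/-- The permutation action on pairs consisting of a list and a vector. -/
def consPerm : Γ →* Equiv.Perm (List Vec × Vec) where
  toFun γ := ⟨fun p => (lact γ.1 p.1, γ.1.1.mulVec p.2),
    fun p => (lact γ.1⁻¹ p.1, (γ.1⁻¹).1.mulVec p.2),
    fun _ => Prod.ext (lact_inv_lact _ _) (inv_mulVec _ _),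
    fun _ => Prod.ext (lact_lact_inv _ _) (mulVec_inv _ _)⟩
  map_one' := Equiv.ext fun p => Prod.ext (lact_one _) (Matrix.one_mulVec p.2)
  map_mul' g h := Equiv.ext fun p => Prod.ext (lact_mul _ _ _)
    (Matrix.mulVec_mulVec p.2 g.1.1 h.1.1).symm

/-- Deletion and `cob` are adjoint for the weighted pairings. -/
theorem Fundamental.finsum_dl_mul (hE : Fundamental Γ E) (hψ : IsCochain Γ m ψ)
    (hη : IsCochain Γ (m + 1) η) :
    ∑ᶠ l, dl l ψ * (listWeight Γ E l * η l) =
      (m + 1) * ∑ᶠ l, listWeight Γ E l * (ψ l * cob η l) := by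
  have hfin1 : {p : List Vec × Vec | listWeight Γ E p.1 * (ψ p.1 * η (p.2 :: p.1)) ≠ 0}.Finite := by
    refine (((finite_lists E.finite_toSet m).inter_of_left {l | IsCell perfectForms l}).biUnion
      (t := fun l => Prod.mk l '' {v | IsCell perfectForms (v :: l)})
      fun l hl => (finite_cons hl.2.1).image _).subset ?_
    rintro ⟨l, v⟩ h
    have h1 := mem_of_listWeight_ne_zero (left_ne_zero_of_mul h)
    have h2 := hψ.supp _ (left_ne_zero_of_mul (right_ne_zero_of_mul h))
    have h3 := hη.supp _ (right_ne_zero_of_mul (right_ne_zero_of_mul h))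
    exact Set.mem_biUnion (show l ∈ {l : List Vec | l.length = m ∧ ∀ v ∈ l, v ∈ (E : Set Vec)} ∩
      {l | IsCell perfectForms l} from ⟨⟨h2.2, h1⟩, h2.1⟩) ⟨v, h3.1, rfl⟩
  have hfin2 : {p : List Vec × Vec |
      listWeight Γ E (p.2 :: p.1) * (ψ p.1 * η (p.2 :: p.1)) ≠ 0}.Finite := by
    refine ((finite_lists E.finite_toSet (m + 1)).preimage
      (f := fun p : List Vec × Vec => p.2 :: p.1) ?_).subset ?_
    · rintro ⟨l, v⟩ - ⟨l', v'⟩ - h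
      simpa [and_comm] using h
    · rintro ⟨l, v⟩ h
      exact ⟨(hη.supp _ (right_ne_zero_of_mul (right_ne_zero_of_mul h))).2,
        mem_of_listWeight_ne_zero (left_ne_zero_of_mul h)⟩
  rw [Voronoi.finsum_dl_mul (hE.altEven_listWeight_mul hη.alt).swap E]
  · congr 1
    calc ∑ᶠ l, ∑ᶠ v, ψ l * (listWeight Γ E (v :: l) * η (v :: l))
        = ∑ᶠ p : List Vec × Vec, listWeight Γ E (p.2 :: p.1) * (ψ p.1 * η (p.2 :: p.1)) := by
          rw [finsum_curry _ hfin2]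
          exact finsum_congr fun l => finsum_congr fun v => by ring
      _ = ∑ᶠ p : List Vec × Vec, listWeight Γ E p.1 * (ψ p.1 * η (p.2 :: p.1)) := by
          refine finsum_weight_congr (w := fun p => listWeight Γ E (p.2 :: p.1))
            (w' := fun p => listWeight Γ E p.1) (F := fun p => ψ p.1 * η (p.2 :: p.1))
            (consPerm Γ) (fun γ p => ?_) (fun p hp => ?_) (fun p hp => ?_) hfin2 hfin1
          · exact congrArg₂ (· * ·) (hψ.inv γ γ.2 p.1) (hη.inv γ γ.2 (p.2 :: p.1))
          · exact hE.sum_listWeight (hη.supp _ (right_ne_zero_of_mul hp)).1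
          · exact hE.sum_listWeight (hψ.supp _ (left_ne_zero_of_mul hp)).1
      _ = ∑ᶠ l, listWeight Γ E l * (ψ l * cob η l) := by
          rw [finsum_curry _ hfin1]
          refine finsum_congr fun l => ?_
          by_cases h0 : ψ l = 0
          · simp [h0]
          · have hc := (hψ.supp l h0).1
            show ∑ᶠ v, listWeight Γ E l * (ψ l * η (v :: l)) = _
            rw [cob_of_cell hc, mul_finsum' _ _ (hη.finite_cons hc), mul_finsum']
            exact (hη.finite_cons hc).subset fun v hv => right_ne_zero_of_mul hv
  · intro l hl
    have h := right_ne_zero_of_mul hl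
    exact ⟨(hη.supp l (right_ne_zero_of_mul h)).2,
      mem_of_listWeight_ne_zero (left_ne_zero_of_mul h)⟩
  · intro v l hl
    have h := right_ne_zero_of_mul hl
    exact ⟨(hψ.supp l (left_ne_zero_of_mul hl)).2,
      mem_of_listWeight_ne_zero (left_ne_zero_of_mul h)⟩

open Classical in
/-- The differential of a cochain. -/
noncomputable def diff (m : ℕ) (ψ : List Vec → ℂ) (l : List Vec) : ℂ :=
  if IsCell perfectForms l ∧ l.length = m + 1 then dl l ψ else 0

theorem diff_of_cell {l : List Vec} (h : IsCell perfectForms l ∧ l.length = m + 1) :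
    diff m ψ l = dl l ψ := if_pos h

theorem diff_of_not_cell {l : List Vec} (h : ¬(IsCell perfectForms l ∧ l.length = m + 1)) :
    diff m ψ l = 0 := if_neg h

theorem isCochain_diff (hψ : IsCochain Γ m ψ) : IsCochain Γ (m + 1) (diff m ψ) where
  alt := {
    swap := fun l₁ a b l₂ => by
      have h1 := isCell_congr tess.quad (sim_swap l₁ l₂ a b).2
      have h2 := (sim_swap l₁ l₂ a b).1
      by_cases hc : IsCell perfectForms (l₁ ++ a :: b :: l₂) ∧ (l₁ ++ a :: b :: l₂).length = m + 1
      · rw [diff_of_cell hc, diff_of_cell (by rwa [← h1, ← h2]), hψ.alt.dl.swap]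
      · rw [diff_of_not_cell hc, diff_of_not_cell (by rwa [← h1, ← h2]), neg_zero]
    neg := fun l₁ a l₂ => by
      have h1 := isCell_congr tess.quad (sim_neg l₁ l₂ a).2
      have h2 := (sim_neg l₁ l₂ a).1
      by_cases hc : IsCell perfectForms (l₁ ++ (-a) :: l₂) ∧ (l₁ ++ (-a) :: l₂).length = m + 1
      · rw [diff_of_cell hc, diff_of_cell (by rwa [← h1, ← h2]), hψ.alt.dl.neg]
      · rw [diff_of_not_cell hc, diff_of_not_cell (by rwa [← h1, ← h2])] }
  supp l hl := by
    by_contra h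
    exact hl (diff_of_not_cell h)
  inv γ hγ l := by
    by_cases hc : IsCell perfectForms l ∧ l.length = m + 1
    · rw [diff_of_cell hc, diff_of_cell (by rwa [isCell_lact, length_lact]), dl_lact]
      simp only [hψ.inv γ hγ]
    · rw [diff_of_not_cell hc, diff_of_not_cell (by rwa [isCell_lact, length_lact])]

/-- The component of a cochain orthogonal to the coboundaries of `cob`. -/
theorem exists_orthogonal (Γ : Subgroup SL4) (E : Finset Vec) (m : ℕ) (φ : List Vec → ℂ) :
    ∃ η, IsCochain Γ (m + 1) η ∧ ∀ ξ, IsCochain Γ (m + 1) ξ →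
      ∑ᶠ l, listWeight Γ E l * ((φ l - cob η l) * starRingEnd ℂ (cob ξ l)) = 0 := by
  have hT := finite_lists E.finite_toSet m
  let V := EuclideanSpace ℂ {l // l ∈ hT.toFinset}
  let ι : (List Vec → ℂ) →ₗ[ℂ] V :=
    { toFun := fun ψ => WithLp.toLp 2 fun t => sqrtWeight Γ E t.1 * ψ t.1
      map_add' := fun a b => by
        ext t
        exact mul_add _ _ _
      map_smul' := fun c a => by
        ext t
        exact mul_left_comm _ _ _ }
  have hι : ∀ ψ t, ι ψ t = sqrtWeight Γ E t.1 * ψ t.1 := fun _ _ => rfl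
  let W : Submodule ℂ V :=
    { carrier := {x | ∃ η, IsCochain Γ (m + 1) η ∧ ι (cob η) = x}
      zero_mem' := ⟨_, IsCochain.zero, by
        rw [← map_zero ι]
        congr 1
        ext l
        rw [cob]
        split_ifs <;> simp⟩
      add_mem' := by
        rintro _ _ ⟨a, ha, rfl⟩ ⟨b, hb, rfl⟩
        refine ⟨_, ha.add hb, ?_⟩
        rw [← map_add]
        congr 1
        ext l
        exact ha.cob_add hb l
      smul_mem' := by
        rintro c _ ⟨a, ha, rfl⟩
        refine ⟨_, ha.smul c, ?_⟩
        rw [← map_smul]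
        congr 1
        ext l
        exact ha.cob_smul c l }
  obtain ⟨η, hη, h1⟩ := W.starProjection_apply_mem (ι φ)
  refine ⟨η, hη, fun ξ hξ => ?_⟩
  have h2 := W.starProjection_inner_eq_zero (ι φ) (ι (cob ξ)) ⟨ξ, hξ, rfl⟩
  rw [← h1, ← map_sub, ← inner_conj_symm, map_eq_zero, PiLp.inner_apply] at h2
  rw [finsum_eq_sum_of_support_subset (s := hT.toFinset) _ fun l hl => ?_, ← h2,
    ← Finset.sum_coe_sort]
  · refine Finset.sum_congr rfl fun t _ => ?_
    rw [hι, hι, RCLike.inner_apply, listWeight_eq, map_mul, Complex.conj_ofReal, Pi.sub_apply]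
    ring
  · rw [Finset.mem_coe, hT.mem_toFinset]
    exact ⟨(hξ.cob.supp l fun h => hl (by simp [h])).2,
      mem_of_listWeight_ne_zero (left_ne_zero_of_mul hl)⟩

/-- A cohomology class is represented by a cochain annihilated by `diff`. -/
theorem Fundamental.exists_harmonic (hE : Fundamental Γ E) (hφ : IsCochain Γ m φ) :
    ∃ η, IsCochain Γ (m + 1) η ∧ IsCochain Γ m (fun l => φ l - cob η l) ∧
      ∀ l, diff m (fun l => φ l - cob η l) l = 0 := by
  obtain ⟨η, hη, h1⟩ := exists_orthogonal Γ E m φ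
  have hh : IsCochain Γ m fun l => φ l - cob η l := by
    have := hφ.add (hη.cob.smul (-1))
    simpa only [neg_one_mul, ← sub_eq_add_neg] using this
  refine ⟨η, hη, hh, ?_⟩
  have hd := isCochain_diff hh
  have h2 := hE.finsum_dl_mul hh hd.conj
  have h3 := h1 _ hd
  simp only [hd.cob_conj] at h2
  rw [h3, mul_zero] at h2
  have h4 : ∀ l, dl l (fun l => φ l - cob η l) *
      (listWeight Γ E l * starRingEnd ℂ (diff m (fun l => φ l - cob η l) l)) =
      ((sqrtWeight Γ E l * sqrtWeight Γ E l *
        Complex.normSq (diff m (fun l => φ l - cob η l) l) : ℝ) : ℂ) := by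
    intro l
    by_cases hc : IsCell perfectForms l ∧ l.length = m + 1
    · rw [diff_of_cell hc, listWeight_eq, Complex.ofReal_mul, ← Complex.mul_conj,
        Complex.ofReal_mul]
      ring
    · rw [diff_of_not_cell hc]
      simp
  rw [finsum_congr h4] at h2
  have h5 := eq_zero_of_finsum_eq_zero ?_ (fun l => mul_nonneg (mul_self_nonneg _)
    (Complex.normSq_nonneg _)) h2
  · have h6 : ∀ l, (∀ v ∈ l, v ∈ E) → diff m (fun l => φ l - cob η l) l = 0 := by
      intro l hl
      by_contra hne
      have hw : listWeight Γ E l ≠ 0 := listWeight_ne_zero (hd.supp l hne).1.1 hl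
      rw [listWeight_eq, ← Complex.ofReal_mul, Complex.ofReal_ne_zero] at hw
      exact mul_ne_zero hw (fun h => hne (Complex.normSq_eq_zero.1 h)) (h5 l)
    intro l
    by_contra hne
    obtain ⟨γ, hγ⟩ := hE.exists_lact_mem (hd.supp l hne).1
    exact hne ((hd.inv γ.1 γ.2 l).symm.trans (h6 _ hγ))
  · refine (finite_lists E.finite_toSet (m + 1)).subset fun l hl => ?_
    have h6 := right_ne_zero_of_mul hl
    have h7 : listWeight Γ E l ≠ 0 := by
      rw [listWeight_eq, ← Complex.ofReal_mul]
      exact Complex.ofReal_ne_zero.2 (left_ne_zero_of_mul hl)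
    exact ⟨(hd.supp l fun h => h6 (by rw [h, map_zero])).2, mem_of_listWeight_ne_zero h7⟩

/-- The coboundary of a cochain vanishes if the cochain annihilates the boundaries. -/
theorem IsCochain.cob_eq_zero (hφ : IsCochain Γ (m + 1) φ) {k : ℕ} (hk : m + k + 1 = 9)
    (h : ∀ f, IsChain perfectForms (k + 1) f → pair (bd perfectForms f) φ = 0) (l : List Vec) :
    Voronoi.cob φ l = 0 := by
  by_contra hne
  have hl := hφ.cob.supp l hne
  have hc := isChain_cls (l := l) (k := k + 1) hφ.cob.alt.conj hl.1 (by omega)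
  have h1 := h _ hc
  have h2 : ∀ l', cls l (fun l => starRingEnd ℂ (Voronoi.cob φ l)) l' * Voronoi.cob φ l' =
      (Complex.normSq (cls l (Voronoi.cob φ) l') : ℝ) := by
    intro l'
    by_cases hs : Sim l l'
    · rw [cls_of_sim hs, cls_of_sim hs, mul_comm, Complex.mul_conj]
    · rw [cls_of_not_sim hs, cls_of_not_sim hs]
      simp
  rw [pair_bd hc hφ, pair, finsum_congr h2, mul_eq_zero] at h1
  have h3 := eq_zero_of_finsum_eq_zero ?_ (fun l => Complex.normSq_nonneg _)
    (h1.resolve_left (Nat.cast_add_one_ne_zero m)) l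
  · rw [cls_of_sim (Sim.refl l)] at h3
    exact hne (Complex.normSq_eq_zero.1 h3)
  · refine (finite_sim l).subset fun l' h' => by_contra fun hs => h' ?_
    rw [cls_of_not_sim hs, map_zero]

/-- The functional on chains given by a cochain. -/
noncomputable def pairL (k : ℕ) (φ : List Vec → ℂ) : chains k →ₗ[ℂ] ℂ where
  toFun f := pair f.1 φ
  map_add' f g := by
    have hf : IsChain perfectForms k f.1 := f.2
    have hg : IsChain perfectForms k g.1 := g.2
    rw [pair, pair, pair, ← finsum_add_distrib]
    · exact finsum_congr fun l => add_mul _ _ _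
    · exact hf.fin.subset fun l hl => left_ne_zero_of_mul hl
    · exact hg.fin.subset fun l hl => left_ne_zero_of_mul hl
  map_smul' c f := by
    have hf : IsChain perfectForms k f.1 := f.2
    rw [pair, pair, RingHom.id_apply, smul_eq_mul, mul_finsum']
    · exact finsum_congr fun l => mul_assoc _ _ _
    · exact hf.fin.subset fun l hl => left_ne_zero_of_mul hl

theorem pairL_apply {k : ℕ} (φ : List Vec → ℂ) (f : chains k) : pairL k φ f = pair f.1 φ := rfl

theorem IsCochain.pairL_translate (hφ : IsCochain Γ m φ) {k : ℕ} (f : chains k) {γ : SL4}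
    (hγ : γ ∈ Γ) : pairL k φ (translate k γ f) = pairL k φ f := by
  rw [pairL_apply, pairL_apply, pair, pair,
    ← finsum_comp_equiv (listPerm γ) (f := fun l => f.1 l * φ l)]
  exact finsum_congr fun l => congrArg (f.1 (Voronoi.lact γ l) * ·) (hφ.inv γ hγ l).symm

/-- The fifth cohomology vanishes if there are no nonzero harmonic cochains. -/
theorem groupCohomology_five_eq_zero (Γ : Subgroup SL4) [Γ.FiniteIndex]
    (H : ∀ h, IsCochain Γ 5 h → (∀ l, diff 5 h l = 0) → (∀ l, cob h l = 0) → ∀ l, h l = 0)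
    (x : groupCohomology (Rep.trivial ℂ Γ ℂ) 5) : x = 0 := by
  refine groupCohomology_eq_zero_of_functionals Γ 3 (fun Φ hΦ hΦ0 => ?_) x
  have hφ := isCochain_rep (m := 5) Φ rfl hΦ
  obtain ⟨E, hE⟩ := exists_fundamental Γ
  obtain ⟨η, hη, hh, hd⟩ := hE.exists_harmonic hφ
  have hcc : ∀ l, cob (cob η) l = 0 := hη.cob.cob_eq_zero (k := 4) rfl fun f hf => by
    have h1 := pair_bd (k := 3) (hf.bd tess) hη
    rw [hf.supp.bd_bd, pair] at h1
    simp only [Pi.zero_apply, zero_mul, finsum_zero] at h1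
    exact (mul_eq_zero.1 h1.symm).resolve_left (Nat.cast_add_one_ne_zero 5)
  have hcφ : ∀ l, cob (rep Φ) l = 0 := hφ.cob_eq_zero (k := 4) rfl fun f hf => by
    rw [← hΦ0 ⟨f, hf⟩, apply_eq_pair]
    rfl
  have hch : ∀ l, cob (fun l => rep Φ l - cob η l) l = 0 := fun l => by
    have h1 := hφ.cob_add (hη.cob.smul (-1)) l
    rw [hη.cob.cob_smul, hcc, hcφ, mul_zero, add_zero] at h1
    simpa only [neg_one_mul, ← sub_eq_add_neg] using h1
  have h0 := H _ hh hd hch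
  refine ⟨(6 : ℂ)⁻¹ • pairL 3 η, fun γ hγ f => ?_, fun f => ?_⟩
  · rw [LinearMap.smul_apply, LinearMap.smul_apply, hη.pairL_translate f hγ]
  · have h1 : rep Φ = cob η := funext fun l => sub_eq_zero.1 (h0 l)
    have h2 := pair_bd f.2 hη
    rw [apply_eq_pair, h1, LinearMap.smul_apply, pairL_apply, smul_eq_mul]
    show _ = (6 : ℂ)⁻¹ * pair (bd perfectForms f.1) η
    rw [h2, ← mul_assoc]
    norm_num

end Voronoi

namespace Voronoi

open Matrix

/-! ### Comparing explicit lists -/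

section RelSign

variable {α : Type*} [InvolutiveNeg α] [DecidableEq α]

/-- Remove an entry equal to `a` up to sign, recording the parity of its position. -/
def pull (a : α) : List α → Option (ℤ × List α)
  | [] => none
  | b :: l => if a = b ∨ a = -b then some (1, l) else (pull a l).map fun p => (-p.1, b :: p.2)

theorem pull_spec {a : α} {l : List α} {p : ℤ × List α} (h : pull a l = some p) :
    p.1 * p.1 = 1 ∧ ∀ f : List α → ℂ, AltEven f → f l = p.1 * f (a :: p.2) := by
  induction l generalizing p with
  | nil => simp [pull] at h
  | cons b l ih =>
    rw [pull] at h
    split_ifs at h with hb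
    · obtain rfl := Option.some.inj h
      refine ⟨rfl, fun f hf => ?_⟩
      rcases hb with rfl | rfl
      · simp
      · simpa using (hf.neg [] b l).symm
    · obtain ⟨p', hp', rfl⟩ := Option.map_eq_some_iff.1 h
      obtain ⟨h1, h2⟩ := ih hp'
      refine ⟨by simpa using h1, fun f hf => ?_⟩
      have h3 := hf.swap [] b a p'.2
      simp only [List.nil_append] at h3
      rw [h2 _ (hf.cons b), h3]
      push_cast
      ring

/-- The sign relating two lists that agree up to order and signs, or zero. -/
def relSign : List α → List α → ℤ
  | [], [] => 1
  | [], _ :: _ => 0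
  | a :: l, l' => match pull a l' with
    | none => 0
    | some p => p.1 * relSign l p.2

theorem relSign_spec {l l' : List α} (h : relSign l l' ≠ 0) {f : List α → ℂ} (hf : AltEven f) :
    f l = relSign l l' * f l' := by
  induction l generalizing l' f with
  | nil =>
    cases l' with
    | nil => simp [relSign]
    | cons b l' => simp [relSign] at h
  | cons a l ih =>
    cases hp : pull a l' with
    | none => simp [relSign, hp] at h
    | some p =>
      simp only [relSign, hp] at h ⊢
      obtain ⟨h1, h2⟩ := pull_spec hp
      have h3 : (p.1 : ℂ) * p.1 = 1 := by exact_mod_cast h1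
      rw [ih (right_ne_zero_of_mul h) (hf.cons a), h2 f hf]
      push_cast
      linear_combination (-(relSign l p.2 : ℂ) * f (a :: p.2)) * h3

/-- A linear combination of values of a function on lists. -/
def ev (T : List (ℤ × List α)) (f : List α → ℂ) : ℂ := (T.map fun p => (p.1 : ℂ) * f p.2).sum

/-- Two linear combinations agree up to reordering and signs in the entries of the lists. -/
def evMatch : List (ℤ × List α) → List (ℤ × List α) → Bool
  | [], [] => true
  | p :: T, p' :: T' => relSign p.2 p'.2 != 0 && p'.1 == p.1 * relSign p.2 p'.2 && evMatch T T'
  | _, _ => false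

theorem ev_eq_of_evMatch {T T' : List (ℤ × List α)} (h : evMatch T T' = true) {f : List α → ℂ}
    (hf : AltEven f) : ev T f = ev T' f := by
  induction T generalizing T' with
  | nil =>
    cases T' with
    | nil => rfl
    | cons p' T' => simp [evMatch] at h
  | cons p T ih =>
    cases T' with
    | nil => simp [evMatch] at h
    | cons p' T' =>
      simp only [evMatch, Bool.and_eq_true, bne_iff_ne, beq_iff_eq] at h
      have := ih h.2
      simp only [ev, List.map_cons, List.sum_cons] at this ⊢
      rw [this, h.1.2, relSign_spec h.1.1 hf]
      push_cast
      ring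

/-- The terms of the alternating sum `dl`. -/
def dlTerms : List α → List (ℤ × List α)
  | [] => []
  | a :: l => (1, l) :: (dlTerms l).map fun p => (-p.1, a :: p.2)

omit [InvolutiveNeg α] [DecidableEq α] in
theorem ev_map_cons (T : List (ℤ × List α)) (a : α) (f : List α → ℂ) :
    ev (T.map fun p => (-p.1, a :: p.2)) f = -ev T fun t => f (a :: t) := by
  induction T with
  | nil => simp [ev]
  | cons p T ih =>
    simp only [ev, List.map_cons, List.sum_cons] at ih ⊢
    rw [ih]
    push_cast
    ring

omit [InvolutiveNeg α] [DecidableEq α] in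
theorem ev_dlTerms (l : List α) (f : List α → ℂ) : ev (dlTerms l) f = dl l f := by
  induction l generalizing f with
  | nil => rfl
  | cons a l ih =>
    rw [dl_cons, ← ih, sub_eq_add_neg, ← ev_map_cons]
    simp [ev, dlTerms]

end RelSign

/-! ### Unimodular images of cells -/

/-- The image of a list of vectors under a matrix. -/
def mact (M : Matrix (Fin 4) (Fin 4) ℤ) (l : List Vec) : List Vec := l.map (M *ᵥ ·)

theorem mact_mul (M M' : Matrix (Fin 4) (Fin 4) ℤ) (l : List Vec) :
    mact (M * M') l = mact M (mact M' l) := by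
  simp [mact, Function.comp_def]

theorem mact_one (l : List Vec) : mact 1 l = l := by
  simp [mact]

theorem AltEven.mact {f : List Vec → ℂ} (hf : AltEven f) (M : Matrix (Fin 4) (Fin 4) ℤ) :
    AltEven fun l => f (Voronoi.mact M l) where
  swap l₁ a b l₂ := by
    simpa [Voronoi.mact] using hf.swap (Voronoi.mact M l₁) (M *ᵥ a) (M *ᵥ b) (Voronoi.mact M l₂)
  neg l₁ a l₂ := by
    simpa [Voronoi.mact, mulVec_neg] using hf.neg (Voronoi.mact M l₁) (M *ᵥ a) (Voronoi.mact M l₂)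

/-- The standard basis. -/
def basisL : List Vec := [![1, 0, 0, 0], ![0, 1, 0, 0], ![0, 0, 1, 0], ![0, 0, 0, 1]]

theorem spans_mact {M : Matrix (Fin 4) (Fin 4) ℤ} (hM : M.det ≠ 0) {l : List Vec}
    (hl : basisL ⊆ l) : Spans (mact M l) := by
  intro x hx
  refine by_contra fun hx0 => ?_
  refine absurd (exists_vecMul_eq_zero_iff.1 ⟨x, hx0, ?_⟩) hM
  have h : ∀ v ∈ basisL, (x ᵥ* M) ⬝ᵥ v = 0 := fun v hv => by
    rw [← dotProduct_mulVec]
    exact hx _ (List.mem_map_of_mem (hl hv))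
  funext i
  rw [← dotProduct_single_one (x ᵥ* M) i]
  refine h _ ?_
  fin_cases i <;> decide

/-- A reflection. -/
def reflection : Matrix (Fin 4) (Fin 4) ℤ := digits 3222232222122223

theorem det_reflection : reflection.det = -1 := by
  rw [det_eq_det4]; decide +kernel

theorem reflection_mul_self : reflection * reflection = 1 := by decide +kernel

/-- The list is sent by a matrix into the minimal vectors of `A₄`, but not onto them. -/
def FitsA (n : ℕ) (l : List Vec) : Prop := det4 (digits n) = 1 ∧
  (∀ v ∈ l, ∃ i, digits n *ᵥ v = uA i ∨ digits n *ᵥ v = -uA i) ∧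
  ∃ i, uA i ∉ mact (digits n) l ∧ -uA i ∉ mact (digits n) l

instance (n : ℕ) (l : List Vec) : Decidable (FitsA n l) := by
  unfold FitsA; infer_instance

theorem formA_mem : form cA ∈ perfectForms := ⟨1, Or.inl (act_one _).symm⟩

theorem formD_mem : form cD ∈ perfectForms := ⟨1, Or.inr (act_one _).symm⟩

theorem FitsA.isCell {n : ℕ} {l : List Vec} (h : FitsA n l) (hs : Spans l) :
    IsCell perfectForms l := by
  obtain ⟨h1, h2, i, hi, hi'⟩ := h
  obtain ⟨g, hg⟩ : ∃ g : SL4, g.1 = digits n := ⟨⟨digits n, (det_eq_det4 _).trans h1⟩, rfl⟩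
  rw [← isCell_lact (g := g)]
  rw [← hg] at hi hi' h2
  refine (vertexDataA.isCell_iff tess formA_mem ?_ (hs.lact g)).2 fun r => ⟨i, rfl, ?_⟩
  · intro v hv
    obtain ⟨w, hw, rfl⟩ := mem_lact.1 hv
    exact (form_cA_eq_one _).2 (h2 w hw)
  · rintro (h | h)
    · exact hi h
    · exact hi' h

theorem isCell_mact {M : Matrix (Fin 4) (Fin 4) ℤ} (hM : IsUnit M.det) {n n' : ℕ} {l : List Vec}
    (hl : basisL ⊆ l) (h : FitsA n l) (h' : FitsA n' (mact reflection l)) :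
    IsCell perfectForms (mact M l) := by
  rcases Int.isUnit_iff.1 hM with h1 | h1
  · refine IsCell.lact (l := l) (h.isCell ?_) (⟨M, h1⟩ : SL4)
    simpa only [mact_one] using spans_mact (M := 1) (by simp) hl
  · have h2 : (M * reflection).det = 1 := by rw [det_mul, h1, det_reflection]; rfl
    have h3 : M = M * reflection * reflection := by
      rw [Matrix.mul_assoc, reflection_mul_self, Matrix.mul_one]
    rw [h3, mact_mul]
    exact IsCell.lact (h'.isCell (spans_mact (by rw [det_reflection]; decide) hl))
      (⟨M * reflection, h2⟩ : SL4)

/-- Representatives of the types of cells with five vectors. -/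
def std : Fin 3 → List Vec := ![
  [![1, 0, 0, 0], ![0, 1, 0, 0], ![1, 1, 0, 0], ![0, 0, 1, 0], ![0, 0, 0, 1]],
  [![1, 0, 0, 0], ![0, 1, 0, 0], ![0, 0, 1, 0], ![1, 1, 1, 0], ![0, 0, 0, 1]],
  [![1, 0, 0, 0], ![0, 1, 0, 0], ![0, 0, 1, 0], ![0, 0, 0, 1], ![1, 1, 1, 1]]]

/-- A cell with six vectors. -/
def bow : List Vec :=
  [![1, 0, 0, 0], ![0, 1, 0, 0], ![1, 1, 0, 0], ![0, 0, 1, 0], ![0, 0, 0, 1], ![0, 0, 1, 1]]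

/-- A cell with six vectors. -/
def dia : List Vec :=
  [![0, 0, 0, 1], ![1, 1, 0, 0], ![1, 0, 0, 0], ![0, 1, 0, 0], ![0, 0, 1, 0], ![1, 1, 1, 0]]

/-- A cell with six vectors. -/
def house : List Vec :=
  [![1, 1, 0, 0], ![1, 0, 0, 0], ![0, 1, 0, 0], ![0, 0, 1, 0], ![0, 0, 0, 1], ![1, 1, 1, 1]]

/-- A linear combination of translates of the standard cells. -/
abbrev Relation := List (ℤ × Fin 3 × ℕ)

/-- The linear combination of lists described by a relation. -/
def Relation.lists (R : Relation) : List (ℤ × List Vec) :=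
  R.map fun p => (p.1, mact (digits p.2.2) (std p.2.1))

def bowRel : Relation := [(1, 0, 2223223332222322), (-1, 0, 2233222332222322),
  (1, 0, 2232222332222322), (-1, 0, 3222232222232233), (1, 0, 3222232222332223),
  (-1, 0, 3222232222322223)]

def diaRel : Relation := [(-1, 1, 3222232222322223), (-1, 0, 3222322323222232),
  (1, 0, 3223322223222232), (-1, 0, 3123322322232232), (1, 0, 3122322222232232)]

def houseRel : Relation := [(1, 2, 3222232222322223), (1, 1, 3222322323222232),
  (-1, 1, 3223322223222232), (-1, 0, 3123322322232233), (1, 0, 3123322322332223),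
  (-1, 0, 3122322222322223)]

/-- Representatives up to sign of the coordinates of the vectors that may be added to a basis. -/
def extra : List Vec := [![0, 0, 1, -1], ![0, 0, 1, 1], ![0, 1, -1, -1], ![0, 1, -1, 0],
  ![0, 1, -1, 1], ![0, 1, 0, -1], ![0, 1, 0, 1], ![0, 1, 1, -1], ![0, 1, 1, 0], ![0, 1, 1, 1],
  ![1, -1, -1, -1], ![1, -1, -1, 0], ![1, -1, -1, 1], ![1, -1, 0, -1], ![1, -1, 0, 0],
  ![1, -1, 0, 1], ![1, -1, 1, -1], ![1, -1, 1, 0], ![1, -1, 1, 1], ![1, 0, -1, -1], ![1, 0, -1, 0],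
  ![1, 0, -1, 1], ![1, 0, 0, -1], ![1, 0, 0, 1], ![1, 0, 1, -1], ![1, 0, 1, 0], ![1, 0, 1, 1],
  ![1, 1, -1, -1], ![1, 1, -1, 0], ![1, 1, -1, 1], ![1, 1, 0, -1], ![1, 1, 0, 0], ![1, 1, 0, 1],
  ![1, 1, 1, -1], ![1, 1, 1, 0], ![1, 1, 1, 1]]

def extraRel : Relation := [(1, 0, 2232222331221222), (1, 0, 2232222331223222),
  (-1, 1, 2223312212321222), (1, 0, 2232312212222223), (-1, 1, 2223312212323222),
  (-1, 0, 2232312222231222), (-1, 0, 2232312222233222), (-1, 1, 2223312232121222),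
  (1, 0, 2232312232222223), (-1, 1, 2223312232123222), (1, 2, 3122123212231222),
  (1, 1, 3122123212222223), (1, 2, 3122123212233222), (-1, 1, 3122123222231222),
  (1, 0, 3122122222322223), (-1, 1, 3122123222233222), (1, 2, 3122123232211222),
  (1, 1, 3122123232222223), (1, 2, 3122123232213222), (1, 1, 3122222312321222),
  (-1, 0, 3122223212222223), (1, 1, 3122222312323222), (1, 0, 3122223222231222),
  (1, 0, 3122223222233222), (1, 1, 3122222332121222), (-1, 0, 3122223232222223),
  (1, 1, 3122222332123222), (1, 2, 3122321212231222), (1, 1, 3122321212222223),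
  (1, 2, 3122321212233222), (-1, 1, 3122321222231222), (1, 0, 3122322222322223),
  (-1, 1, 3122321222233222), (1, 2, 3122321232211222), (1, 1, 3122321232222223),
  (1, 2, 3122321232213222)]

theorem dl_bow {f : List Vec → ℂ} (hf : AltEven f) : dl bow f = ev bowRel.lists f := by
  rw [← ev_dlTerms]
  exact ev_eq_of_evMatch (by decide +kernel) hf

theorem dl_dia {f : List Vec → ℂ} (hf : AltEven f) :
    dl dia f = f dia.tail + ev diaRel.lists f := by
  rw [← ev_eq_of_evMatch (T := (dlTerms dia).tail) (by decide +kernel) hf, ← ev_dlTerms]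
  simp [dia, dlTerms, ev]

theorem dl_house {f : List Vec → ℂ} (hf : AltEven f) : dl house f = ev houseRel.lists f := by
  rw [← ev_dlTerms]
  exact ev_eq_of_evMatch (by decide +kernel) hf

theorem sum_extra {f : List Vec → ℂ} (hf : AltEven f) :
    (extra.map fun v => f (v :: basisL)).sum = ev extraRel.lists f := by
  rw [← ev_eq_of_evMatch (T := extra.map fun v => (1, v :: basisL)) (by decide +kernel) hf, ev,
    List.map_map]
  simp [Function.comp_def]

theorem dia_tail_mact {h : List Vec → ℂ} {Γ : Subgroup SL4} {m : ℕ} (hh : IsCochain Γ m h)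
    (M : Matrix (Fin 4) (Fin 4) ℤ) : h (mact M dia.tail) = 0 := by
  by_contra hc
  have hs := (hh.supp _ hc).1.1
  have key : ∀ v ∈ dia.tail, v 3 = 0 := by decide
  by_cases hM : M.det = 0
  · obtain ⟨x, hx, h0⟩ := exists_vecMul_eq_zero_iff.2 hM
    refine hx (hs x fun v hv => ?_)
    obtain ⟨w, -, rfl⟩ := List.mem_map.1 hv
    rw [dotProduct_mulVec, h0, zero_dotProduct]
  · have h1 : (Pi.single 3 1 ᵥ* M.adjugate) ᵥ* M = M.det • (Pi.single 3 1 : Vec) := by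
      rw [vecMul_vecMul, adjugate_mul, vecMul_smul, vecMul_one]
    have h2 : (Pi.single 3 1 ᵥ* M.adjugate : Vec) = 0 := hs _ fun v hv => by
      obtain ⟨w, hw, rfl⟩ := List.mem_map.1 hv
      rw [dotProduct_mulVec, h1, smul_dotProduct, single_dotProduct, key w hw]
      simp
    rw [h2, zero_vecMul] at h1
    exact hM (by simpa using (congrFun h1 3).symm)

section Harmonic

variable {Γ : Subgroup SL4} {h : List Vec → ℂ}

theorem diff_mact (hd : ∀ l, diff 5 h l = 0)
    {M : Matrix (Fin 4) (Fin 4) ℤ} (hM : IsUnit M.det) {n n' : ℕ} {l : List Vec}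
    (hl : basisL ⊆ l) (h6 : l.length = 6) (h1 : FitsA n l) (h' : FitsA n' (mact reflection l)) :
    dl l (fun l => h (mact M l)) = 0 := by
  have := hd (mact M l)
  rw [diff_of_cell ⟨isCell_mact hM hl h1 h', by simp [mact, h6]⟩] at this
  rw [← this, mact, dl_map]
  rfl

theorem bow_relation (hh : IsCochain Γ 5 h) (hd : ∀ l, diff 5 h l = 0)
    {M : Matrix (Fin 4) (Fin 4) ℤ} (hM : IsUnit M.det) :
    ev bowRel.lists (fun l => h (mact M l)) = 0 := by
  rw [← dl_bow (hh.alt.mact M)]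
  exact diff_mact hd hM (n := 1212222322312322) (n' := 1211222322322322) (by decide +kernel) rfl
    (by decide +kernel) (by decide +kernel)

theorem dia_relation (hh : IsCochain Γ 5 h) (hd : ∀ l, diff 5 h l = 0)
    {M : Matrix (Fin 4) (Fin 4) ℤ} (hM : IsUnit M.det) :
    ev diaRel.lists (fun l => h (mact M l)) = 0 := by
  have := dl_dia (hh.alt.mact M)
  rw [dia_tail_mact hh, zero_add] at this
  rw [← this]
  exact diff_mact hd hM (n := 1221222322322312) (n' := 1211222322322322) (by decide +kernel) rfl
    (by decide +kernel) (by decide +kernel)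

theorem house_relation (hh : IsCochain Γ 5 h) (hd : ∀ l, diff 5 h l = 0)
    {M : Matrix (Fin 4) (Fin 4) ℤ} (hM : IsUnit M.det) :
    ev houseRel.lists (fun l => h (mact M l)) = 0 := by
  rw [← dl_house (hh.alt.mact M)]
  exact diff_mact hd hM (n := 1222221322322321) (n' := 1212222322322321) (by decide +kernel) rfl
    (by decide +kernel) (by decide +kernel)

end Harmonic

end Voronoi

namespace Voronoi

open Matrix

/-! ### Minors of cells -/

/-- The number is zero or a unit. -/
def IsSmall (n : ℤ) : Prop := n = 0 ∨ n = 1 ∨ n = -1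

instance : DecidablePred IsSmall := fun n => by unfold IsSmall; infer_instance

theorem IsSmall.mul {m n : ℤ} (hm : IsSmall m) (hn : IsSmall n) : IsSmall (m * n) := by
  unfold IsSmall at *
  rcases hm with rfl | rfl | rfl <;> rcases hn with rfl | rfl | rfl <;> simp

theorem isSmall_uA : ∀ a b c d, a < b → b < c → c < d →
    IsSmall (det4 fun i => ![uA a, uA b, uA c, uA d] i) := by
  decide +kernel

/-- The minimal vectors of the form `D₄`, indexed by a single number. -/
def wD (i : Fin 12) : Vec := uD ⟨i.1 / 4, by omega⟩ ⟨i.1 % 4, by omega⟩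

theorem wD_eq : ∀ (r : Fin 3) (k : Fin 4), wD ⟨4 * r.1 + k.1, by omega⟩ = uD r k := by
  decide +kernel

theorem isSmall_wD : ∀ a b c d, a < b → b < c → c < d →
    IsSmall (det4 fun i => ![wD a, wD b, wD c, wD d] i) ∨
      (a.1 % 4 = 0 ∧ b.1 = a.1 + 1 ∧ c.1 = a.1 + 2 ∧ d.1 = a.1 + 3) := by
  decide +kernel

theorem exists_strictMono {n : ℕ} {x : Fin 4 → Fin n} (hx : Function.Injective x) :
    ∃ σ : Equiv.Perm (Fin 4), StrictMono (x ∘ σ) :=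
  ⟨Tuple.sort x, (Tuple.monotone_sort x).strictMono_of_injective
    (hx.comp (Tuple.sort x).injective)⟩

theorem isSmall_det {n : ℕ} {u : Fin n → Vec} {x : Fin 4 → Fin n}
    (h : ∀ y : Fin 4 → Fin n, (∀ i, ∃ j, y i = x j) → y 0 < y 1 → y 1 < y 2 → y 2 < y 3 →
      IsSmall (det4 fun i => ![u (y 0), u (y 1), u (y 2), u (y 3)] i))
    {σ : Fin 4 → ℤ} (hσ : ∀ i, IsSmall (σ i)) : IsSmall (of fun i => σ i • u (x i)).det := by
  have h1 : (of fun i => σ i • u (x i)) = of fun i j => σ i * (of fun i => u (x i)) i j := rfl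
  have h2 : IsSmall (∏ i, σ i) := by
    rw [Fin.prod_univ_four]
    exact (((hσ 0).mul (hσ 1)).mul (hσ 2)).mul (hσ 3)
  rw [h1, det_mul_column]
  refine h2.mul ?_
  by_cases hx : Function.Injective x
  · obtain ⟨τ, hτ⟩ := exists_strictMono hx
    have h3 := det_permute τ (of fun i => u (x i))
    have h5 : (of fun i => ![u ((x ∘ τ) 0), u ((x ∘ τ) 1), u ((x ∘ τ) 2), u ((x ∘ τ) 3)] i) =
        (of fun i => u (x i)).submatrix τ id := by
      funext i
      fin_cases i <;> rfl
    have h4 : IsSmall (det4 ((of fun i => u (x i)).submatrix τ id)) := by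
      rw [← h5]
      exact h (x ∘ τ) (fun i => ⟨τ i, rfl⟩) (hτ (by decide)) (hτ (by decide)) (hτ (by decide))
    rw [← det_eq_det4, h3] at h4
    have h6 : ((Equiv.Perm.sign τ : ℤˣ) : ℤ) * ((Equiv.Perm.sign τ : ℤˣ) : ℤ) = 1 := by
      rw [← Units.val_mul, Int.units_mul_self, Units.val_one]
    have h7 : IsSmall ((Equiv.Perm.sign τ : ℤˣ) : ℤ) :=
      Or.inr (Int.isUnit_iff.1 (Units.isUnit _))
    have := h7.mul h4
    simp only [Int.cast_id] at this
    rwa [← mul_assoc, h6, one_mul] at this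
  · obtain ⟨i, j, hij, hne⟩ := Function.not_injective_iff.1 hx
    exact Or.inl (det_zero_of_row_eq hne (funext fun k => by simp [hij]))

theorem IsCell.isSmall_det_of_onMin {c : Fin 10 → ℤ} (hc : c = cA ∨ c = cD) {l : List Vec}
    (hl : IsCell perfectForms l) (hq : OnMin (form c) l) {f : Fin 4 → Vec} (hf : ∀ i, f i ∈ l) :
    IsSmall (of f).det := by
  rcases hc with rfl | rfl
  · have h1 : ∀ i, ∃ s : ℤ, ∃ k, IsSmall s ∧ f i = s • uA k := fun i => by
      obtain ⟨k, h | h⟩ := (form_cA_eq_one _).1 (hq _ (hf i))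
      · exact ⟨1, k, by decide, by rw [h, one_smul]⟩
      · exact ⟨-1, k, by decide, by rw [h, neg_one_smul]⟩
    choose s x hs hx using h1
    rw [show f = fun i => s i • uA (x i) from funext hx]
    exact isSmall_det (fun y _ h1 h2 h3 => isSmall_uA _ _ _ _ h1 h2 h3) hs
  · have h1 : ∀ i, ∃ s : ℤ, ∃ k, IsSmall s ∧ f i = s • wD k ∧ (f i = wD k ∨ f i = -wD k) := by
      intro i
      obtain ⟨⟨r, k⟩, h⟩ := (form_cD_eq_one _).1 (hq _ (hf i))
      have hw := wD_eq r k
      rw [← hw] at h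
      refine Or.elim h (fun h => ?_) fun h => ?_
      · exact ⟨1, _, by decide, by rw [h, one_smul], Or.inl h⟩
      · exact ⟨-1, _, by decide, by rw [h, neg_one_smul], Or.inr h⟩
    choose s x hs hx hx' using h1
    rw [show f = fun i => s i • wD (x i) from funext hx]
    refine isSmall_det (fun y hy h1 h2 h3 => ?_) hs
    refine (isSmall_wD _ _ _ _ h1 h2 h3).resolve_right fun h => ?_
    obtain ⟨⟨r, k⟩, hr, hk⟩ :=
      (vertexDataD.isCell_iff tess formD_mem hq hl.1).1 hl (⟨(y 0).1 / 4, by omega⟩ : Fin 3)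
    refine hk ?_
    have key : ∀ a b c d : Fin 12, (a.1 % 4 = 0 ∧ b.1 = a.1 + 1 ∧ c.1 = a.1 + 2 ∧ d.1 = a.1 + 3) →
        ∀ k : Fin 4, ∃ i, uD ⟨a.1 / 4, by omega⟩ k = wD (![a, b, c, d] i) := by
      rintro a b c d ⟨h0, hb, hc, hd⟩
      intro k
      refine ⟨k, ?_⟩
      rw [← wD_eq]
      refine congrArg wD (Fin.ext ?_)
      fin_cases k <;> simp [hb, hc, hd] <;> omega
    obtain ⟨i, hi⟩ := key _ _ _ _ h k
    obtain ⟨j, hj⟩ : ∃ j, wD (![y 0, y 1, y 2, y 3] i) = wD (x j) := by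
      obtain ⟨j, hj⟩ := hy i
      refine ⟨j, ?_⟩
      rw [← hj]
      fin_cases i <;> rfl
    have hu : vertexDataD.u (r, k) = wD (x j) := by
      rw [← hj, ← hi, ← hr]
      rfl
    rw [hu]
    rcases hx' j with h' | h'
    · exact Or.inl (h' ▸ hf j)
    · exact Or.inr (h' ▸ hf j)

theorem IsCell.isSmall_det {l : List Vec} (hl : IsCell perfectForms l) {f : Fin 4 → Vec}
    (hf : ∀ i, f i ∈ l) : IsSmall (of f).det := by
  obtain ⟨-, q, hq, -, -, -, hl1, -⟩ := id hl
  obtain ⟨c, g, hc, rfl⟩ := exists_act_form hq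
  have h1 : (of fun i => g.1 *ᵥ f i) = of f * g.1ᵀ := by
    ext i j
    simp [mulVec, mul_apply, dotProduct, mul_comm]
  have h2 : (of fun i => g.1 *ᵥ f i).det = (of f).det := by
    rw [h1, det_mul, det_transpose, g.2, mul_one]
  rw [← h2]
  exact (hl.lact g).isSmall_det_of_onMin hc (onMin_act.1 hl1) fun i => mem_lact.2 ⟨_, hf i, rfl⟩

/-- The coordinates of an entry of a cell with respect to a basis contained in it are small. -/
theorem IsCell.isSmall_coord {l : List Vec} (hl : IsCell perfectForms l)
    {M : Matrix (Fin 4) (Fin 4) ℤ} (hM : IsUnit M.det) (hMl : ∀ i, M.col i ∈ l) {c : Vec}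
    (hc : M *ᵥ c ∈ l) (i : Fin 4) : IsSmall (c i) := by
  have h1 : cramer M (M *ᵥ c) = M.det • c := by
    rw [cramer_eq_adjugate_mulVec, mulVec_mulVec, adjugate_mul, smul_mulVec, one_mulVec]
  have h2 : M.det * c i = (of fun j => if j = i then M *ᵥ c else M.col j).det := by
    have := congrFun h1 i
    rw [cramer_apply, ← det_transpose] at this
    rw [← smul_eq_mul, ← Pi.smul_apply, ← this]
    congr 1
    ext j k
    by_cases hj : j = i
    · simp [hj]
    · simp [hj, updateCol_ne]
  have h3 : IsSmall (M.det * c i) := by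
    rw [h2]
    refine hl.isSmall_det fun j => ?_
    split_ifs
    · exact hc
    · exact hMl j
  rcases Int.isUnit_iff.1 hM with h | h <;> rw [h] at h3 <;> unfold IsSmall at * <;> omega

theorem small_cases {c : Vec} (hc : ∀ i, IsSmall (c i)) :
    c = 0 ∨ (∃ b ∈ basisL, c = b ∨ c = -b) ∨ c ∈ extra ++ extra.map (-·) := by
  have key : ∀ x ∈ Finset.Icc (-1 : ℤ) 1, ∀ y ∈ Finset.Icc (-1 : ℤ) 1,
      ∀ z ∈ Finset.Icc (-1 : ℤ) 1, ∀ w ∈ Finset.Icc (-1 : ℤ) 1,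
      (![x, y, z, w] : Vec) = 0 ∨ (∃ b ∈ basisL, ![x, y, z, w] = b ∨ ![x, y, z, w] = -b) ∨
        ![x, y, z, w] ∈ extra ++ extra.map (-·) := by decide +kernel
  have h1 : ∀ i, c i ∈ Finset.Icc (-1 : ℤ) 1 := fun i => by
    rw [Finset.mem_Icc]
    rcases hc i with h | h | h <;> rw [h] <;> decide
  rw [eq_vec c]
  exact key _ (h1 0) _ (h1 1) _ (h1 2) _ (h1 3)

end Voronoi

namespace Voronoi

open Matrix

/-! ### Harmonic cochains and unimodular bases -/

theorem IsCell.ne_zero {l : List Vec} (hl : IsCell perfectForms l) {v : Vec} (hv : v ∈ l) :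
    v ≠ 0 := by
  rintro rfl
  obtain ⟨-, q, hq, -, -, -, h1, -⟩ := hl
  have := h1 0 hv
  rw [(tess.quad q hq).map_zero] at this
  exact zero_ne_one this

theorem exists_inverse {M : Matrix (Fin 4) (Fin 4) ℤ} (hM : IsUnit M.det) :
    ∃ M' : Matrix (Fin 4) (Fin 4) ℤ, M * M' = 1 ∧ M' * M = 1 :=
  ⟨M⁻¹, mul_nonsing_inv M hM, nonsing_inv_mul M hM⟩

theorem exists_eq_mulVec {M : Matrix (Fin 4) (Fin 4) ℤ} (hM : IsUnit M.det) (v : Vec) :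
    ∃ c, v = M *ᵥ c := by
  obtain ⟨M', h, -⟩ := exists_inverse hM
  exact ⟨M' *ᵥ v, by rw [mulVec_mulVec, h, one_mulVec]⟩

theorem mulVec_bijective {M : Matrix (Fin 4) (Fin 4) ℤ} (hM : IsUnit M.det) :
    Function.Bijective fun v : Vec => M *ᵥ v := by
  refine ⟨fun v w hvw => ?_, fun v => (exists_eq_mulVec hM v).imp fun _ h => h.symm⟩
  obtain ⟨M', -, h⟩ := exists_inverse hM
  have := congrArg (M' *ᵥ ·) hvw
  simpa [h] using this

theorem col_mem_mact (M : Matrix (Fin 4) (Fin 4) ℤ) (i : Fin 4) : M.col i ∈ mact M basisL := by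
  have h : M.col i = M *ᵥ Pi.single i 1 := by rw [mulVec_single_one]
  rw [h]
  refine List.mem_map_of_mem ?_
  fin_cases i <;> decide

theorem isCell_basis {M : Matrix (Fin 4) (Fin 4) ℤ} (hM : IsUnit M.det) :
    IsCell perfectForms (mact M basisL) :=
  isCell_mact hM (n := 1212222322312322) (n' := 1211222322322322) (fun _ h => h)
    (by decide +kernel) (by decide +kernel)

variable {Γ : Subgroup SL4} {h : List Vec → ℂ}

theorem small_of_ne_zero {m : ℕ} (hh : IsCochain Γ m h) {M : Matrix (Fin 4) (Fin 4) ℤ}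
    (hM : IsUnit M.det) {c : Vec} (hc : h (mact M (c :: basisL)) ≠ 0) :
    c ∈ extra ++ extra.map (-·) := by
  have hl := (hh.supp _ hc).1
  have hcm : M *ᵥ c ∈ mact M (c :: basisL) := List.mem_map_of_mem List.mem_cons_self
  rcases small_cases (hl.isSmall_coord hM (fun i => List.mem_cons_of_mem _ (col_mem_mact M i)) hcm)
    with rfl | ⟨b, hb, hcb⟩ | h1
  · exact absurd (mulVec_zero M) (hl.ne_zero hcm)
  · exact absurd ((hh.alt.mact M).eq_zero_of_repeat hb hcb) hc
  · exact h1

theorem extra_relation (hh : IsCochain Γ 5 h) (hc : ∀ l, cob h l = 0)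
    {M : Matrix (Fin 4) (Fin 4) ℤ} (hM : IsUnit M.det) :
    ev extraRel.lists (fun l => h (mact M l)) = 0 := by
  rw [← sum_extra (hh.alt.mact M)]
  have h1 := hc (mact M basisL)
  rw [cob_of_cell (isCell_basis hM), ← finsum_comp _ (mulVec_bijective hM),
    finsum_eq_sum_of_support_subset (s := (extra ++ extra.map (-·)).toFinset) _
      (fun c hc => by simpa using small_of_ne_zero hh hM hc),
    List.sum_toFinset _ (by decide +kernel), List.map_append, List.sum_append, List.map_map] at h1
  have h2 : (extra.map ((fun c : Vec => h (M *ᵥ c :: mact M basisL)) ∘ fun c => -c)) =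
      extra.map fun c => h (M *ᵥ c :: mact M basisL) :=
    List.map_congr_left fun c _ => (hh.alt.mact M).neg [] c basisL
  rw [h2, ← two_mul] at h1
  exact (mul_eq_zero.1 h1).resolve_left two_ne_zero

theorem det_sum_smul {n : ℕ} (c : Fin 4 → Fin n → ℤ) (u : Fin n → Vec) :
    (of fun i => ∑ k, c i k • u k).det =
      ∑ r : Fin 4 → Fin n, (∏ i, c i (r i)) * (of fun i => u (r i)).det := by
  have h1 := (detRowAlternating (n := Fin 4) (R := ℤ)).toMultilinearMap.map_sum
    (fun i k => c i k • u k)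
  refine h1.trans (Finset.sum_congr rfl fun r _ => ?_)
  exact (detRowAlternating (n := Fin 4) (R := ℤ)).toMultilinearMap.map_smul_univ
    (fun i => c i (r i)) fun i => u (r i)

/-- A spanning list contains linearly independent vectors. -/
theorem Spans.exists_det_ne_zero {l : List Vec} (hl : Spans l) :
    ∃ f : Fin 4 → Vec, (∀ i, f i ∈ l) ∧ (of f).det ≠ 0 := by
  by_contra! hc
  have h1 : (of fun i => ∑ k : Fin l.length, l.get k i • l.get k).det = 0 := by
    rw [det_sum_smul]
    exact Finset.sum_eq_zero fun r _ => mul_eq_zero_of_right _ (hc _ fun i => l.get_mem (r i))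
  obtain ⟨x, hx, h0⟩ := exists_mulVec_eq_zero_iff.2 h1
  refine hx (hl x fun v hv => ?_)
  have h2 : ∑ k : Fin l.length, (x ⬝ᵥ l.get k) * (x ⬝ᵥ l.get k) = 0 := by
    have h3 : x ⬝ᵥ ((of fun i => ∑ k : Fin l.length, l.get k i • l.get k) *ᵥ x) = 0 := by
      rw [h0, dotProduct_zero]
    rw [← h3]
    simp only [dotProduct, mulVec, of_apply, Finset.sum_apply, Pi.smul_apply, smul_eq_mul,
      Finset.sum_mul, Finset.mul_sum]
    rw [Finset.sum_comm]
    refine Finset.sum_congr rfl fun i _ => ?_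
    rw [Finset.sum_comm]
    refine Finset.sum_congr rfl fun j _ => Finset.sum_congr rfl fun k _ => ?_
    ring
  obtain ⟨k, rfl⟩ := List.mem_iff_get.1 hv
  exact mul_self_eq_zero.1
    ((Finset.sum_eq_zero_iff_of_nonneg fun k _ => mul_self_nonneg _).1 h2 k (Finset.mem_univ k))

theorem PNodup.mact {M : Matrix (Fin 4) (Fin 4) ℤ} (hM : IsUnit M.det) {l : List Vec}
    (hl : PNodup l) : PNodup (mact M l) := by
  refine List.pairwise_map.2 (hl.imp fun h => ⟨fun h1 => h.1 ((mulVec_bijective hM).1 h1),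
    fun h1 => h.2 ((mulVec_bijective hM).1 ?_)⟩)
  simpa [mulVec_neg] using h1

theorem PNodup.exists_not_pmem {l l' : List Vec} (hl : PNodup l) (hlen : l'.length < l.length) :
    ∃ v ∈ l, ¬PMem v l' := by
  by_contra! hc
  have h1 : ∀ k : Fin l.length, ∃ j : Fin l'.length, l.get k = l'.get j ∨ l.get k = -l'.get j := by
    intro k
    rcases hc _ (l.get_mem k) with h | h
    · obtain ⟨j, hj⟩ := List.mem_iff_get.1 h
      exact ⟨j, Or.inl hj.symm⟩
    · obtain ⟨j, hj⟩ := List.mem_iff_get.1 h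
      exact ⟨j, Or.inr (by rw [hj, neg_neg])⟩
  choose x hx using h1
  obtain ⟨a, b, hab, hxab⟩ := Fintype.exists_ne_map_eq_of_card_lt x (by simpa using hlen)
  have h2 : ∀ a b, a < b → x a ≠ x b := fun a b hlt hxab => by
    have h3 := List.pairwise_iff_get.1 hl a b hlt
    have ha := hx a
    have hb := hx b
    rw [hxab] at ha
    rcases ha with ha | ha <;> rcases hb with hb | hb <;> rw [ha, hb] at h3 <;> simp at h3
  rcases lt_or_gt_of_ne hab with h | h
  · exact h2 a b h hxab
  · exact h2 b a h hxab.symm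

theorem extra_std : ∀ w ∈ extra, ∃ p ∈ extraRel, IsUnit (det4 (digits p.2.2)) ∧
    relSign (w :: basisL) (mact (digits p.2.2) (std p.2.1)) ≠ 0 := by
  simp only [Int.isUnit_iff]
  decide +kernel

/-- A cochain vanishing on the images of the standard cells vanishes. -/
theorem IsCochain.eq_zero (hh : IsCochain Γ 5 h)
    (h0 : ∀ M : Matrix (Fin 4) (Fin 4) ℤ, IsUnit M.det → ∀ t, h (mact M (std t)) = 0)
    (l : List Vec) : h l = 0 := by
  by_contra hc
  obtain ⟨hl, hlen⟩ := hh.supp l hc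
  obtain ⟨f, hf, hdet⟩ := hl.1.exists_det_ne_zero
  have hM : IsUnit (of f)ᵀ.det := by
    rw [det_transpose]
    have := hl.isSmall_det hf
    unfold IsSmall at this
    rw [Int.isUnit_iff]
    tauto
  set M := (of f)ᵀ with hMdef
  have hMb : ∀ v ∈ mact M basisL, v ∈ l := by
    have : mact M basisL = [f 0, f 1, f 2, f 3] := by
      have h1 : ∀ i, M *ᵥ Pi.single i 1 = f i := fun i => by
        rw [mulVec_single_one]
        rfl
      have h2 : basisL = [Pi.single 0 1, Pi.single 1 1, Pi.single 2 1, Pi.single 3 1] := by decide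
      rw [h2]
      simp only [mact, List.map_cons, List.map_nil, h1]
    rw [this]
    simp only [List.mem_cons, List.not_mem_nil, or_false]
    rintro v (rfl | rfl | rfl | rfl) <;> exact hf _
  obtain ⟨v, hv, hvn⟩ := (hh.alt.pnodup hc).exists_not_pmem (l' := mact M basisL)
    (by rw [hlen]; exact Nat.lt_succ_self 4)
  obtain ⟨c, rfl⟩ := exists_eq_mulVec hM v
  have hn : PNodup (mact M (c :: basisL)) := by
    refine List.pairwise_cons.2 ⟨fun b hb => ⟨?_, ?_⟩, PNodup.mact hM ?_⟩
    · rintro rfl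
      exact hvn (Or.inl hb)
    · intro h1
      exact hvn (Or.inr (by rwa [show M *ᵥ c = -b from h1, neg_neg]))
    · unfold PNodup
      decide
  obtain ⟨s, hs, h1⟩ := AltEven.exists_sign (l := l) hn
    (fun a ha => Or.inl ((List.mem_cons.1 ha).elim (fun h => h ▸ hv) (hMb a)))
    (by rw [hlen]; rfl)
  have h2 : h (mact M (c :: basisL)) ≠ 0 := by
    rw [h1 h hh.alt]
    exact mul_ne_zero (left_ne_zero_of_mul (hs.trans_ne one_ne_zero)) hc
  obtain ⟨w, hw, hcw⟩ : ∃ w ∈ extra, h (mact M (c :: basisL)) = h (mact M (w :: basisL)) := by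
    rcases List.mem_append.1 (small_of_ne_zero hh hM h2) with h3 | h3
    · exact ⟨c, h3, rfl⟩
    · obtain ⟨w, hw, rfl⟩ := List.mem_map.1 h3
      exact ⟨w, hw, (hh.alt.mact M).neg [] w basisL⟩
  obtain ⟨p, -, hp, hp'⟩ := extra_std w hw
  refine h2 ?_
  rw [hcw, relSign_spec hp' (hh.alt.mact M), ← mact_mul, h0 _ ?_, mul_zero]
  rw [det_mul, det_eq_det4 (digits _)]
  exact hM.mul hp

end Voronoi

namespace Voronoi

open Matrix

/-! ### Relations between the cells of the first type -/

/-- A linear combination of values, with signs, of functions of a matrix. The entries of the list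
are the parity of the sign, the parity of the sign of the determinant of a matrix, and the code of
the matrix. -/
def evX (T : List (ℕ × ℕ × ℕ)) (Y : Matrix (Fin 4) (Fin 4) ℤ → ℂ) : ℂ :=
  (T.map fun p => (-1) ^ p.1 * Y (digits p.2.2)).sum

/-- The relation `bowRel`. -/
def bowX : List (ℕ × ℕ × ℕ) := [(0, 1, 2223223332222322), (1, 0, 2233222332222322), (0, 0,
  2232222332222322), (1, 1, 3222232222232233), (0, 0, 3222232222332223), (1, 0, 3222232222322223)]

/-- The relation `extraRel`, with the cells of the other types eliminated. -/
def extraX : List (ℕ × ℕ × ℕ) := [(0, 1, 2232222331221222), (0, 0, 2232222331223222), (0, 1,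
  2232222113221222), (1, 0, 2232222313211221), (0, 0, 2232212213221321), (1, 0, 2232212213231322),
  (0, 1, 2232312212222223), (0, 0, 2232222113223222), (1, 1, 2232222313213223), (0, 1,
  2232212213223123), (1, 1, 2232212213233122), (1, 0, 2232312222231222), (1, 1, 2232312222233222),
  (0, 0, 2232222131221222), (1, 1, 2232222331231221), (0, 1, 2232212231221321), (1, 1,
  2232212231211322), (0, 0, 2232312232222223), (0, 1, 2232222131223222), (1, 0, 2232222331233223),
  (0, 0, 2232212231223123), (1, 0, 2232212231213122), (0, 1, 2212222313221222), (1, 0,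
  2212222113211221), (0, 0, 2212232213221321), (1, 0, 2212232213231322), (1, 0, 2232221313121212),
  (0, 1, 2232221113111211), (1, 1, 2232231213121311), (0, 1, 2232231213131312), (0, 0,
  2122132213321321), (1, 1, 2122133213221321), (0, 1, 2122133213231322), (1, 0, 2221132212222232),
  (0, 1, 2223132112212232), (1, 1, 2122132213212232), (0, 1, 2122132313222232), (0, 0,
  2212222313223222), (1, 1, 2212222113213223), (0, 1, 2212232213223123), (1, 1, 2212232213233122),
  (1, 1, 2232221313123232), (0, 0, 2232221113113233), (1, 0, 2232231213123133), (0, 0,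
  2232231213133132), (0, 1, 2122132213323123), (1, 0, 2122133213223123), (0, 0, 2122133213233122),
  (0, 1, 2221132222321222), (1, 0, 2223132122321221), (0, 0, 2122132222321321), (1, 0,
  2122132322321322), (0, 1, 3122122222322223), (0, 0, 2221132222323222), (1, 1, 2223132122323223),
  (0, 1, 2122132222323123), (1, 1, 2122132322323122), (0, 0, 2212222331221222), (1, 1,
  2212222131231221), (0, 1, 2212232231221321), (1, 1, 2212232231211322), (1, 1, 2232221331321212),
  (0, 0, 2232221131331211), (1, 0, 2232231231321311), (0, 0, 2232231231311312), (0, 1,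
  2122132231121321), (1, 0, 2122133231221321), (0, 0, 2122133231211322), (1, 1, 2221132232222232),
  (0, 0, 2223132132232232), (1, 0, 2122132231232232), (0, 0, 2122132331222232), (0, 1,
  2212222331223222), (1, 0, 2212222131233223), (0, 0, 2212232231223123), (1, 0, 2212232231213122),
  (1, 0, 2232221331323232), (0, 1, 2232221131333233), (1, 1, 2232231231323133), (0, 1,
  2232231231313132), (0, 0, 2122132231123123), (1, 1, 2122133231223123), (0, 1, 2122133231213122),
  (1, 0, 2221223213221222), (0, 1, 2223223213211221), (1, 1, 2122223213221321), (0, 1,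
  2122223213231322), (1, 0, 3122223212222223), (1, 1, 2221223213223222), (0, 0, 2223223213213223),
  (1, 0, 2122223213223123), (0, 0, 2122223213233122), (0, 1, 3122223222231222), (0, 0,
  3122223222233222), (1, 1, 2221223231221222), (0, 0, 2223223231231221), (1, 0, 2122223231221321),
  (0, 0, 2122223231211322), (1, 1, 3122223232222223), (1, 0, 2221223231223222), (0, 1,
  2223223231233223), (1, 1, 2122223231223123), (0, 1, 2122223231213122), (0, 0, 2212222113221222),
  (1, 1, 2212222313211221), (0, 1, 2212212213221321), (1, 1, 2212212213231322), (1, 1,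
  2232223113121212), (0, 0, 2232223313111211), (1, 0, 2232213213121311), (0, 0, 2232213213131312),
  (0, 1, 2122312213321321), (1, 0, 2122311213221321), (0, 0, 2122311213231322), (1, 1,
  2221312212222232), (0, 0, 2223312312212232), (1, 0, 2122312213212232), (0, 0, 2122312113222232),
  (0, 1, 2212222113223222), (1, 0, 2212222313213223), (0, 0, 2212212213223123), (1, 0,
  2212212213233122), (1, 0, 2232223113123232), (0, 1, 2232223313113233), (1, 1, 2232213213123133),
  (0, 1, 2232213213133132), (0, 0, 2122312213323123), (1, 1, 2122311213223123), (0, 1,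
  2122311213233122), (0, 0, 2221312222321222), (1, 1, 2223312322321221), (0, 1, 2122312222321321),
  (1, 1, 2122312122321322), (0, 0, 3122322222322223), (0, 1, 2221312222323222), (1, 0,
  2223312322323223), (0, 0, 2122312222323123), (1, 0, 2122312122323122), (0, 1, 2212222131221222),
  (1, 0, 2212222331231221), (0, 0, 2212212231221321), (1, 0, 2212212231211322), (1, 0,
  2232223131321212), (0, 1, 2232223331331211), (1, 1, 2232213231321311), (0, 1, 2232213231311312),
  (0, 0, 2122312231121321), (1, 1, 2122311231221321), (0, 1, 2122311231211322), (1, 0,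
  2221312232222232), (0, 1, 2223312332232232), (1, 1, 2122312231232232), (0, 1, 2122312131222232),
  (0, 0, 2212222131223222), (1, 1, 2212222331233223), (0, 1, 2212212231223123), (1, 1,
  2212212231213122), (1, 1, 2232223131323232), (0, 0, 2232223331333233), (1, 0, 2232213231323133),
  (0, 0, 2232213231313132), (0, 1, 2122312231123123), (1, 0, 2122311231223123), (0, 0,
  2122311231213122)]

/-- Symmetries of the first standard cell acting on the first two coordinates. -/
def groupA : List (ℕ × ℕ × ℕ) := [(1, 1, 1222132222322223), (0, 0, 1222212222322223), (0, 0,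
  1322122222322223), (1, 1, 1322232222322223), (1, 1, 2122122222322223), (0, 0, 2122312222322223),
  (0, 0, 2322132222322223), (1, 1, 2322322222322223), (1, 1, 3122212222322223), (0, 0,
  3122322222322223), (0, 0, 3222232222322223), (1, 1, 3222312222322223)]

/-- Symmetries of the first standard cell acting on the last two coordinates. -/
def groupB : List (ℕ × ℕ × ℕ) := [(0, 0, 3222232222122221), (0, 1, 3222232222122223), (1, 1,
  3222232222212212), (1, 0, 3222232222212232), (1, 0, 3222232222232212), (1, 1, 3222232222232232),
  (0, 1, 3222232222322221), (0, 0, 3222232222322223)]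

/-- Linear combinations of translates of the standard cells, with explicit matrices. -/
abbrev MatRel := List (ℤ × Fin 3 × Matrix (Fin 4) (Fin 4) ℤ)

/-- The value of a linear combination. -/
def MatRel.eval (T : MatRel) (Y : Fin 3 → Matrix (Fin 4) (Fin 4) ℤ → ℂ) : ℂ :=
  (T.map fun p => (p.1 : ℂ) * Y p.2.1 p.2.2).sum

/-- The linear combination with explicit matrices. -/
def Relation.toMat (R : Relation) : MatRel := R.map fun p => (p.1, p.2.1, digits p.2.2)

/-- Express a translate of a standard cell by translates of cells of simpler types. -/
def expandTerm (p : ℤ × Fin 3 × Matrix (Fin 4) (Fin 4) ℤ) : MatRel :=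
  match p.2.1 with
  | 0 => [p]
  | 1 => diaRel.tail.map fun q => (p.1 * q.1, q.2.1, p.2.2 * digits q.2.2)
  | 2 => houseRel.tail.map fun q => (-p.1 * q.1, q.2.1, p.2.2 * digits q.2.2)

theorem ev_lists (R : Relation) (f : List Vec → ℂ) (M : Matrix (Fin 4) (Fin 4) ℤ) :
    ev R.lists (fun l => f (mact M l)) =
      (R.map fun q => (q.1 : ℂ) * f (mact (M * digits q.2.2) (std q.2.1))).sum := by
  simp [ev, Relation.lists, Function.comp_def, mact_mul]

variable {Γ : Subgroup SL4} {h : List Vec → ℂ}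

theorem eval_expandTerm (hh : IsCochain Γ 5 h) (hd : ∀ l, diff 5 h l = 0)
    {M : Matrix (Fin 4) (Fin 4) ℤ} (hM : IsUnit M.det)
    {p : ℤ × Fin 3 × Matrix (Fin 4) (Fin 4) ℤ} (hp : IsUnit p.2.2.det) :
    (expandTerm p).eval (fun t D => h (mact (M * D) (std t))) =
      p.1 * h (mact (M * p.2.2) (std p.2.1)) := by
  have hMp : IsUnit (M * p.2.2).det := by
    rw [det_mul]
    exact hM.mul hp
  have h1 : digits 3222232222322223 = 1 := by decide +kernel
  obtain ⟨c, t, D⟩ := p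
  fin_cases t
  · simp [expandTerm, MatRel.eval]
  · have h2 := dia_relation hh hd hMp
    rw [ev_lists] at h2
    simp only [diaRel, List.map_cons, List.sum_cons, h1, Matrix.mul_one,
      List.map_nil, List.sum_nil] at h2
    simp only [expandTerm, MatRel.eval, diaRel, List.tail, List.map_cons, List.sum_cons,
      List.map_nil, List.sum_nil, ← Matrix.mul_assoc]
    push_cast at h2 ⊢
    linear_combination (c : ℂ) * h2
  · have h2 := house_relation hh hd hMp
    rw [ev_lists] at h2
    simp only [houseRel, List.map_cons, List.sum_cons, h1, Matrix.mul_one,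
      List.map_nil, List.sum_nil] at h2
    simp only [expandTerm, MatRel.eval, houseRel, List.tail, List.map_cons, List.sum_cons,
      List.map_nil, List.sum_nil, ← Matrix.mul_assoc]
    push_cast at h2 ⊢
    linear_combination -(c : ℂ) * h2

theorem eval_expand (hh : IsCochain Γ 5 h) (hd : ∀ l, diff 5 h l = 0)
    {M : Matrix (Fin 4) (Fin 4) ℤ} (hM : IsUnit M.det) {T : MatRel}
    (hT : ∀ p ∈ T, IsUnit p.2.2.det) :
    MatRel.eval (T.flatMap expandTerm) (fun t D => h (mact (M * D) (std t))) =
      T.eval fun t D => h (mact (M * D) (std t)) := by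
  induction T with
  | nil => rfl
  | cons p T ih =>
    have h1 := eval_expandTerm hh hd hM (hT p List.mem_cons_self)
    have h2 := ih fun q hq => hT q (List.mem_cons_of_mem _ hq)
    simp only [MatRel.eval, List.flatMap_cons, List.map_append, List.sum_append, List.map_cons,
      List.sum_cons] at h1 h2 ⊢
    rw [h1, h2]

/-- The functions of unimodular matrices satisfying the relations between translates of the first
standard cell. -/
structure IsHarmonic (Y : Matrix (Fin 4) (Fin 4) ℤ → ℂ) : Prop where
  bow : ∀ M : Matrix (Fin 4) (Fin 4) ℤ, IsUnit M.det → evX bowX (fun D => Y (M * D)) = 0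
  extra : ∀ M : Matrix (Fin 4) (Fin 4) ℤ, IsUnit M.det → evX extraX (fun D => Y (M * D)) = 0
  symm : ∀ M : Matrix (Fin 4) (Fin 4) ℤ, ∀ p ∈ groupA ++ groupB,
    Y (M * digits p.2.2) = (-1) ^ p.1 * Y M

/-- The signs of the determinants are correct. -/
def DetSigns (T : List (ℕ × ℕ × ℕ)) : Prop := ∀ p ∈ T, det4 (digits p.2.2) = (-1) ^ p.2.1

theorem detSigns_bowX : DetSigns bowX := by unfold DetSigns; decide +kernel

theorem detSigns_extraX : DetSigns extraX := by unfold DetSigns; decide +kernel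

theorem detSigns_groupA : DetSigns groupA := by unfold DetSigns; decide +kernel

theorem detSigns_groupB : DetSigns groupB := by unfold DetSigns; decide +kernel

theorem evX_eq_eval {T : List (ℕ × ℕ × ℕ)} (Y : Fin 3 → Matrix (Fin 4) (Fin 4) ℤ → ℂ) :
    evX T (Y 0) = MatRel.eval (T.map fun p => ((-1) ^ p.1, 0, digits p.2.2)) Y := by
  simp [evX, MatRel.eval, Function.comp_def]

theorem Relation.toMat_isUnit {R : Relation} (h : ∀ p ∈ R, IsUnit (det4 (digits p.2.2))) :
    ∀ p ∈ R.toMat, IsUnit p.2.2.det := by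
  intro p hp
  obtain ⟨q, hq, rfl⟩ := List.mem_map.1 hp
  rw [det_eq_det4]
  exact h q hq

theorem expandTerm_isUnit {p : ℤ × Fin 3 × Matrix (Fin 4) (Fin 4) ℤ} (hp : IsUnit p.2.2.det) :
    ∀ q ∈ expandTerm p, IsUnit q.2.2.det := by
  have h1 : ∀ q ∈ diaRel, IsUnit (det4 (digits q.2.2)) := by
    simp only [Int.isUnit_iff]; decide +kernel
  have h2 : ∀ q ∈ houseRel, IsUnit (det4 (digits q.2.2)) := by
    simp only [Int.isUnit_iff]; decide +kernel
  obtain ⟨c, t, D⟩ := p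
  intro q hq
  fin_cases t
  · rw [List.mem_singleton.1 hq]
    exact hp
  · obtain ⟨r, hr, rfl⟩ := List.mem_map.1 hq
    rw [det_mul, det_eq_det4 (digits _)]
    exact hp.mul (h1 r (List.mem_of_mem_tail hr))
  · obtain ⟨r, hr, rfl⟩ := List.mem_map.1 hq
    rw [det_mul, det_eq_det4 (digits _)]
    exact hp.mul (h2 r (List.mem_of_mem_tail hr))

theorem extraX_eq : (extraX.map fun p => (((-1) ^ p.1, 0, digits p.2.2) :
    ℤ × Fin 3 × Matrix (Fin 4) (Fin 4) ℤ)) =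
      (extraRel.toMat.flatMap expandTerm).flatMap expandTerm := by
  decide +kernel

theorem toMat_eval (R : Relation) (f : List Vec → ℂ) (M : Matrix (Fin 4) (Fin 4) ℤ) :
    R.toMat.eval (fun t D => f (mact (M * D) (std t))) = ev R.lists fun l => f (mact M l) := by
  rw [ev_lists]
  simp [MatRel.eval, Relation.toMat, Function.comp_def]

theorem relSign_symm : ∀ p ∈ groupA ++ groupB,
    relSign (mact (digits p.2.2) (std 0)) (std 0) = (-1) ^ p.1 := by
  decide +kernel

theorem IsCochain.isHarmonic (hh : IsCochain Γ 5 h) (hd : ∀ l, diff 5 h l = 0)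
    (hc : ∀ l, Voronoi.cob h l = 0) : IsHarmonic fun M => h (mact M (std 0)) where
  bow M hM := by
    rw [evX_eq_eval (Y := fun t D => h (mact (M * D) (std t))), ← bow_relation hh hd hM,
      ← toMat_eval]
    congr 1
  extra M hM := by
    have h1 : ∀ p ∈ extraRel.toMat, IsUnit p.2.2.det :=
      Relation.toMat_isUnit (by simp only [Int.isUnit_iff]; decide +kernel)
    have h2 : ∀ p ∈ extraRel.toMat.flatMap expandTerm, IsUnit p.2.2.det := fun p hp => by
      obtain ⟨q, hq, hp⟩ := List.mem_flatMap.1 hp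
      exact expandTerm_isUnit (h1 q hq) p hp
    rw [evX_eq_eval (Y := fun t D => h (mact (M * D) (std t))), extraX_eq,
      eval_expand hh hd hM h2, eval_expand hh hd hM h1, toMat_eval, extra_relation hh hc hM]
  symm M p hp := by
    have h1 := relSign_symm p hp
    have h2 := relSign_spec (by rw [h1]; exact pow_ne_zero _ (by decide)) (hh.alt.mact M)
    rw [h1, ← mact_mul] at h2
    push_cast at h2
    exact h2

/-- A harmonic cochain vanishing on the translates of the first standard cell vanishes. -/
theorem IsCochain.eq_zero_of_std_zero (hh : IsCochain Γ 5 h) (hd : ∀ l, diff 5 h l = 0)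
    (h0 : ∀ M : Matrix (Fin 4) (Fin 4) ℤ, IsUnit M.det → h (mact M (std 0)) = 0) (l : List Vec) :
    h l = 0 := by
  have key : ∀ p : ℤ × Fin 3 × Matrix (Fin 4) (Fin 4) ℤ, IsUnit p.2.2.det →
      (∀ q ∈ expandTerm p, h (mact q.2.2 (std q.2.1)) = 0) →
      p.1 * h (mact p.2.2 (std p.2.1)) = 0 := fun p hp hq => by
    have := eval_expandTerm hh hd (M := 1) (by simp) hp
    simp only [Matrix.one_mul] at this
    rw [← this]
    exact List.sum_eq_zero fun y hy => by
      obtain ⟨q, hq', rfl⟩ := List.mem_map.1 hy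
      exact mul_eq_zero_of_right _ (hq q hq')
  have h1 : ∀ M : Matrix (Fin 4) (Fin 4) ℤ, IsUnit M.det → h (mact M (std 1)) = 0 := fun M hM => by
    have := key (1, 1, M) hM fun q hq => by
      have h2 := expandTerm_isUnit (p := (1, 1, M)) hM q hq
      obtain ⟨r, hr, rfl⟩ := List.mem_map.1 hq
      have h3 : ∀ r ∈ diaRel.tail, r.2.1 = 0 := by decide
      simp only [h3 r hr]
      exact h0 _ h2
    simpa using this
  refine hh.eq_zero (fun M hM t => ?_) l
  fin_cases t
  · exact h0 M hM
  · exact h1 M hM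
  · have := key (1, 2, M) hM fun q hq => by
      have h2 := expandTerm_isUnit (p := (1, 2, M)) hM q hq
      obtain ⟨r, hr, rfl⟩ := List.mem_map.1 hq
      have h3 : ∀ r ∈ houseRel.tail, r.2.1 = 0 ∨ r.2.1 = 1 := by decide
      rcases h3 r hr with h4 | h4 <;> simp only [h4]
      · exact h0 _ h2
      · exact h1 _ h2
    simpa using this

end Voronoi

namespace Voronoi

open Matrix

/-! ### Functions of the last row -/

/-- The reduction of an integral matrix. -/
def red (N : ℕ) (D : Matrix (Fin 4) (Fin 4) ℤ) : Matrix (Fin 4) (Fin 4) (ZMod N) :=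
  D.map (Int.castRingHom (ZMod N))

theorem red_mul (N : ℕ) (D D' : Matrix (Fin 4) (Fin 4) ℤ) : red N (D * D') = red N D * red N D' :=
  Matrix.map_mul

theorem red_one (N : ℕ) : red N 1 = 1 :=
  Matrix.map_one _ (map_zero _) (map_one _)

/-- The reduction of the last row. -/
def lab (N : ℕ) (M : Matrix (Fin 4) (Fin 4) ℤ) : Fin 4 → ZMod N := fun j => (M 3 j : ZMod N)

theorem lab_eq (N : ℕ) (M : Matrix (Fin 4) (Fin 4) ℤ) : lab N M = Pi.single 3 1 ᵥ* red N M := by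
  rw [single_one_vecMul]
  rfl

theorem lab_mul (N : ℕ) (M D : Matrix (Fin 4) (Fin 4) ℤ) : lab N (M * D) = lab N M ᵥ* red N D := by
  rw [lab_eq, lab_eq, red_mul, vecMul_vecMul]

/-- The function depends only on the determinant and on the last row modulo `N`, up to units. -/
def IsLabelled (N : ℕ) (Y : Matrix (Fin 4) (Fin 4) ℤ → ℂ) : Prop :=
  ∀ M M' : Matrix (Fin 4) (Fin 4) ℤ, IsUnit M.det → M.det = M'.det →
    (∃ u : (ZMod N)ˣ, lab N M' = u • lab N M) → Y M' = Y M

theorem IsCochain.isLabelled {N : ℕ} {m : ℕ} {h : List Vec → ℂ} (hh : IsCochain (Gamma0 N) m h)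
    (l : List Vec) : IsLabelled N fun M => h (mact M l) := by
  rintro M M' hM hdet ⟨u, hu⟩
  obtain ⟨D, hD, -⟩ := exists_inverse hM
  have h1 : D.det = M.det := by
    have := congrArg det hD
    rw [det_mul, det_one] at this
    rcases Int.isUnit_iff.1 hM with h | h <;> rw [h] at this ⊢ <;> omega
  have h2 : (M' * D).det = 1 := by
    rw [det_mul, ← hdet, h1]
    rcases Int.isUnit_iff.1 hM with h | h <;> rw [h] <;> rfl
  have h3 : lab N (M' * D) = u • (Pi.single 3 1 : Fin 4 → ZMod N) := by
    rw [lab_mul, hu, smul_vecMul, ← lab_mul, hD, lab_eq, red_one, vecMul_one]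
  have h4 : (⟨M' * D, h2⟩ : SL4) ∈ Gamma0 N := fun j hj => by
    have := congrFun h3 j
    rw [Pi.smul_apply, Pi.single_eq_of_ne hj, smul_zero] at this
    exact (ZMod.intCast_zmod_eq_zero_iff_dvd _ _).1 this
  have h5 : D * M = 1 := mul_eq_one_comm.1 hD
  have h6 : h (mact (M' * D) (mact M l)) = h (mact M l) := hh.inv _ h4 (mact M l)
  rw [← mact_mul, Matrix.mul_assoc, h5, Matrix.mul_one] at h6
  exact h6

/-- The reflection changing the sign of the first row. -/
def rowFlip : Matrix (Fin 4) (Fin 4) ℤ := digits 1222232222322223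

theorem det_rowFlip : rowFlip.det = -1 := by
  rw [det_eq_det4]; decide +kernel

theorem rowFlip_mul_self : rowFlip * rowFlip = 1 := by decide +kernel

theorem lab_rowFlip_mul (N : ℕ) (M : Matrix (Fin 4) (Fin 4) ℤ) : lab N (rowFlip * M) = lab N M := by
  have h1 : lab N rowFlip = lab N 1 := by
    have h2 : rowFlip 3 = (1 : Matrix (Fin 4) (Fin 4) ℤ) 3 := by decide +kernel
    funext j
    simp only [lab, h2]
  rw [lab_mul, h1, ← lab_mul, Matrix.one_mul]

section Labelled

variable {N : ℕ} {Y : Matrix (Fin 4) (Fin 4) ℤ → ℂ} {s : ℂ} {a : Fin 4 → ZMod N}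
  {M : Matrix (Fin 4) (Fin 4) ℤ}

/-- The matrix has the given last row, up to units. -/
def HasLab (a : Fin 4 → ZMod N) (M : Matrix (Fin 4) (Fin 4) ℤ) : Prop :=
  ∃ u : (ZMod N)ˣ, lab N M = u • a

theorem HasLab.mul (h : HasLab a M) (D : Matrix (Fin 4) (Fin 4) ℤ) :
    HasLab (a ᵥ* red N D) (M * D) := by
  obtain ⟨u, hu⟩ := h
  exact ⟨u, by rw [lab_mul, hu, smul_vecMul]⟩

theorem HasLab.rowFlip (h : HasLab a M) : HasLab a (rowFlip * M) := by
  obtain ⟨u, hu⟩ := h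
  exact ⟨u, by rw [lab_rowFlip_mul, hu]⟩

theorem HasLab.smul (h : HasLab a M) (v : (ZMod N)ˣ) : HasLab (v • a) M := by
  obtain ⟨u, hu⟩ := h
  exact ⟨u * v⁻¹, by rw [hu, smul_smul, inv_mul_cancel_right]⟩

theorem IsLabelled.eq (hY : IsLabelled N Y) {M' : Matrix (Fin 4) (Fin 4) ℤ} (hM : IsUnit M.det)
    (hdet : M.det = M'.det) (h : HasLab a M) (h' : HasLab a M') : Y M' = Y M := by
  obtain ⟨u, hu⟩ := h
  obtain ⟨v, hv⟩ := h'
  exact hY M M' hM hdet ⟨v * u⁻¹, by rw [hv, hu, smul_smul, inv_mul_cancel_right]⟩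

open Classical in
/-- The combination of the values on matrices of determinants `1` and `-1`, as a function of the
last row. -/
noncomputable def xval (Y : Matrix (Fin 4) (Fin 4) ℤ → ℂ) (s : ℂ) (a : Fin 4 → ZMod N) : ℂ :=
  if h : ∃ M : Matrix (Fin 4) (Fin 4) ℤ, M.det = 1 ∧ HasLab a M then
    Y h.choose + s * Y (rowFlip * h.choose) else 0

theorem IsLabelled.xval_of_det_one (hY : IsLabelled N Y) (hM : M.det = 1) (h : HasLab a M) :
    xval Y s a = Y M + s * Y (rowFlip * M) := by
  have h1 : ∃ M : Matrix (Fin 4) (Fin 4) ℤ, M.det = 1 ∧ HasLab a M := ⟨M, hM, h⟩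
  rw [xval, dif_pos h1]
  obtain ⟨h2, h3⟩ := h1.choose_spec
  rw [hY.eq (by simp [hM]) (hM.trans h2.symm) h h3,
    hY.eq (M := rowFlip * M) (by simp [det_mul, det_rowFlip, hM])
      (by rw [det_mul, det_mul, hM, h2]) h.rowFlip h3.rowFlip]

theorem IsLabelled.xval_of_det_neg_one (hY : IsLabelled N Y) (hs : s * s = 1) (hM : M.det = -1)
    (h : HasLab a M) : s * xval Y s a = Y M + s * Y (rowFlip * M) := by
  rw [hY.xval_of_det_one (M := rowFlip * M) (by rw [det_mul, hM, det_rowFlip]; rfl) h.rowFlip,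
    ← Matrix.mul_assoc, rowFlip_mul_self, Matrix.one_mul]
  linear_combination Y M * hs

theorem IsLabelled.xval_eq (hY : IsLabelled N Y) (hs : s * s = 1) {δ : ℕ} (hM : M.det = (-1) ^ δ)
    (h : HasLab a M) : s ^ δ * xval Y s a = Y M + s * Y (rowFlip * M) := by
  rcases δ.even_or_odd with ⟨k, rfl⟩ | ⟨k, rfl⟩
  · rw [← two_mul, pow_mul, pow_two, hs, one_pow, one_mul]
    rw [← two_mul, pow_mul, neg_one_sq, one_pow] at hM
    exact hY.xval_of_det_one hM h
  · rw [pow_succ, pow_mul, pow_two, hs, one_pow, one_mul]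
    rw [pow_succ, pow_mul, neg_one_sq, one_pow, one_mul] at hM
    exact hY.xval_of_det_neg_one hs hM h

theorem exists_det_one (hM : IsUnit M.det) (h : HasLab a M) :
    ∃ M : Matrix (Fin 4) (Fin 4) ℤ, M.det = 1 ∧ HasLab a M := by
  rcases Int.isUnit_iff.1 hM with h1 | h1
  · exact ⟨M, h1, h⟩
  · exact ⟨rowFlip * M, by rw [det_mul, h1, det_rowFlip]; rfl, h.rowFlip⟩

theorem exists_of_xval_ne_zero (h : xval Y s a ≠ 0) :
    ∃ M : Matrix (Fin 4) (Fin 4) ℤ, M.det = 1 ∧ HasLab a M := by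
  by_contra hc
  exact h (dif_neg hc)

theorem isUnit_of_det_eq {M : Matrix (Fin 4) (Fin 4) ℤ} {δ : ℕ} (h : M.det = (-1) ^ δ) :
    IsUnit M.det := by
  rw [h]
  exact IsUnit.pow _ (by simp)

theorem IsLabelled.sum_eq_zero (hY : IsLabelled N Y) (hs : s * s = 1) {T : List (ℕ × ℕ × ℕ)}
    (hT : DetSigns T)
    (h : ∀ M : Matrix (Fin 4) (Fin 4) ℤ, IsUnit M.det → evX T (fun D => Y (M * D)) = 0)
    (a : Fin 4 → ZMod N) :
    (T.map fun p => (-1) ^ p.1 * (s ^ p.2.1 * xval Y s (a ᵥ* red N (digits p.2.2)))).sum = 0 := by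
  by_cases ha : ∃ M : Matrix (Fin 4) (Fin 4) ℤ, M.det = 1 ∧ HasLab a M
  · obtain ⟨M, hM, hMa⟩ := ha
    have h1 : (T.map fun p =>
        (-1) ^ p.1 * (s ^ p.2.1 * xval Y s (a ᵥ* red N (digits p.2.2)))) =
        T.map fun p => (-1) ^ p.1 * Y (M * digits p.2.2) +
          s * ((-1) ^ p.1 * Y (rowFlip * M * digits p.2.2)) := by
      refine List.map_congr_left fun p hp => ?_
      rw [hY.xval_eq (M := M * digits p.2.2) hs (by rw [det_mul, hM, one_mul, det_eq_det4, hT p hp])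
        (hMa.mul _), ← Matrix.mul_assoc]
      ring
    rw [h1, List.sum_map_add, List.sum_map_mul_left]
    have h2 := h M (by simp [hM])
    have h3 := h (rowFlip * M) (by simp [det_mul, det_rowFlip, hM])
    rw [evX] at h2 h3
    rw [h2, h3, mul_zero, add_zero]
  · refine List.sum_eq_zero fun y hy => ?_
    obtain ⟨p, hp, rfl⟩ := List.mem_map.1 hy
    have h1 : xval Y s (a ᵥ* red N (digits p.2.2)) = 0 := by
      by_contra hc
      obtain ⟨M, hM, hMa⟩ := exists_of_xval_ne_zero hc
      have hD : IsUnit (digits p.2.2).det := isUnit_of_det_eq ((det_eq_det4 _).trans (hT p hp))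
      obtain ⟨D, hD1, hD2⟩ := exists_inverse hD
      refine ha (exists_det_one (M := M * D) ?_ ?_)
      · rw [det_mul, hM, one_mul]
        exact IsUnit.of_mul_eq_one _ (by rw [← det_mul, hD2, det_one])
      · have := hMa.mul D
        rwa [vecMul_vecMul, ← red_mul, hD1, red_one, vecMul_one] at this
    rw [h1, mul_zero, mul_zero]

theorem IsLabelled.xval_smul (hY : IsLabelled N Y) (u : (ZMod N)ˣ) (a : Fin 4 → ZMod N) :
    xval Y s (u • a) = xval Y s a := by
  by_cases h : ∃ M : Matrix (Fin 4) (Fin 4) ℤ, M.det = 1 ∧ HasLab a M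
  · obtain ⟨M, hM, hMa⟩ := h
    rw [hY.xval_of_det_one hM hMa, hY.xval_of_det_one hM (hMa.smul u)]
  · have h1 : xval Y s a = 0 := dif_neg h
    rw [h1]
    refine dif_neg fun ⟨M, hM, hMa⟩ => h ⟨M, hM, ?_⟩
    simpa using hMa.smul u⁻¹

theorem xval_eq_zero_of_smul_eq_zero {c : ZMod N} (hc : c ≠ 0) (h : c • a = 0) :
    xval Y s a = 0 := by
  by_contra hx
  obtain ⟨M, hM, u, hu⟩ := exists_of_xval_ne_zero hx
  obtain ⟨D, hD, -⟩ := exists_inverse (M := M) (by simp [hM])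
  have h1 : c • lab N M = 0 := by
    rw [hu, smul_comm, h, smul_zero]
  have h2 : c • lab N (M * D) = 0 := by
    rw [lab_mul, ← smul_vecMul, h1, zero_vecMul]
  rw [hD] at h2
  exact hc (by simpa [lab] using congrFun h2 3)

theorem IsLabelled.eq_zero_of_xval (hY : IsLabelled N Y) (h1 : ∀ a : Fin 4 → ZMod N, xval Y 1 a = 0)
    (h2 : ∀ a : Fin 4 → ZMod N, xval Y (-1) a = 0) (hM : IsUnit M.det) : Y M = 0 := by
  have hMa : HasLab (lab N M) M := ⟨1, (one_smul _ _).symm⟩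
  have key : ∀ s : ℂ, s * s = 1 → xval Y s (lab N M) = 0 → Y M + s * Y (rowFlip * M) = 0 := by
    intro s hs hx
    rcases Int.isUnit_iff.1 hM with h | h
    · rw [← hY.xval_of_det_one h hMa, hx]
    · rw [← hY.xval_of_det_neg_one hs h hMa, hx, mul_zero]
  have h3 := key 1 (by norm_num) (h1 _)
  have h4 := key (-1) (by norm_num) (h2 _)
  linear_combination (h3 + h4) / 2

theorem IsLabelled.xval_symm (hY : IsLabelled N Y) (hH : IsHarmonic Y) (hs : s * s = 1)
    {p : ℕ × ℕ × ℕ} (hp : p ∈ groupA ++ groupB) (a : Fin 4 → ZMod N) :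
    (-1) ^ p.1 * (s ^ p.2.1 * xval Y s (a ᵥ* red N (digits p.2.2))) = xval Y s a := by
  have h1 : digits 3222232222322223 = 1 := by decide +kernel
  have h2 : DetSigns [p, (1, 0, 3222232222322223)] := by
    intro q hq
    rcases List.mem_cons.1 hq with rfl | hq
    · rcases List.mem_append.1 hp with h | h
      · exact detSigns_groupA _ h
      · exact detSigns_groupB _ h
    · rw [List.mem_singleton.1 hq]
      decide +kernel
  have h3 := hY.sum_eq_zero hs h2 (fun M hM => ?_) a
  · simp only [List.map_cons, List.map_nil, List.sum_cons, List.sum_nil, h1, red_one,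
      vecMul_one] at h3
    linear_combination h3
  · have h4 : ((-1 : ℂ) ^ p.1) * (-1) ^ p.1 = 1 := by rw [← mul_pow]; simp
    simp only [evX, List.map_cons, List.map_nil, List.sum_cons, List.sum_nil, h1, Matrix.mul_one,
      hH.symm M p hp]
    linear_combination Y M * h4

end Labelled

end Voronoi

namespace Voronoi

open Matrix

/-! ### Certificates -/

/-- An entry of a table, written in base `1000`. -/
def entry (T i : ℕ) : ℕ := T / Nat.pow 1000 i % 1000

/-- The product of the row `(a, b, c, d)` and of column `j` of `digits D`, modulo `N`. -/
def coord (N D a b c d j : ℕ) : ℕ :=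
  (a * (D / Nat.pow 10 (15 - j) % 10) + b * (D / Nat.pow 10 (11 - j) % 10) +
    c * (D / Nat.pow 10 (7 - j) % 10) + d * (D / Nat.pow 10 (3 - j) % 10) +
    2 * (N - 1) * (a + b + c + d)) % N

/-- Evaluation at a natural number that the kernel has to compute first. -/
def forceNat {α : Type} (n : ℕ) (k : ℕ → α) : α := Nat.rec (k 0) (fun m _ => k (m + 1)) n

theorem forceNat_eq {α : Type} (n : ℕ) (k : ℕ → α) : forceNat n k = k n := by
  cases n <;> rfl

/-- Evaluation at a list that the kernel has to compute first. -/
def forceList {α : Type} : List ℕ → (List ℕ → α) → α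
  | [], k => k []
  | a :: l, k => forceNat a fun a' => forceList l fun l' => k (a' :: l')

theorem forceList_eq {α : Type} (l : List ℕ) (k : List ℕ → α) : forceList l k = k l := by
  induction l generalizing k with
  | nil => rfl
  | cons a l ih => rw [forceList, forceNat_eq, ih]

/-- A proof that a labelled harmonic function vanishes. The pairs of residues modulo `N` have their
orbits numbered from `1`; the number `0` means that the function vanishes. An orbit and a sign
are encoded as the double of the number of the orbit plus the parity of the sign.
The fields are: the level, the parity of the sign `s`, a prime number, the number of unknown
values, the numbers of orbits of pairs plus one, the tables of the orbits of the first and of the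
last two residues, with the tables of their representatives, the table of unknown values, the table
of their representatives, the relations and the inverse of their matrix modulo `p`. -/
structure Cert where
  N : ℕ
  e : ℕ
  p : ℕ
  n : ℕ
  V : ℕ
  W : ℕ
  tA : ℕ
  rA : ℕ
  tB : ℕ
  rB : ℕ
  t2 : ℕ
  xs : ℕ
  rows : List ℕ
  inverse : List ℕ

namespace Cert

variable (C : Cert)

/-- The orbit of the first two residues. -/
def orbA (a b : ℕ) : ℕ := entry C.tA (a * C.N + b)

/-- The orbit of the last two residues. -/
def orbB (c d : ℕ) : ℕ := entry C.tB (c * C.N + d)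

/-- The unknown value of a pair of orbits. -/
def orb (i j : ℕ) : ℕ := entry C.t2 (i * C.W + j)

/-- The representative of the `i`-th orbit or, if `i` is zero, the given pair. -/
def repA (i a b : ℕ) : ℕ × ℕ :=
  Nat.rec (a, b) (fun _ _ => (entry C.rA i / C.N, entry C.rA i % C.N)) i

/-- The representative of the `i`-th orbit or, if `i` is zero, the given pair. -/
def repB (i c d : ℕ) : ℕ × ℕ :=
  Nat.rec (c, d) (fun _ _ => (entry C.rB i / C.N, entry C.rB i % C.N)) i

/-- The parity of a code or, if it encodes zero, an odd number. -/
def parity (x : ℕ) : ℕ := Nat.rec 1 (fun _ _ => x % 2) (x / 2)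

/-- The verification of `orbA`. -/
def checkA (a b : ℕ) : Bool :=
  forceNat (C.orbA a b) fun x =>
  Nat.blt (x / 2) C.V &&
  groupA.any fun g =>
    Nat.beq (coord C.N g.2.2 (C.repA (x / 2) a b).1 (C.repA (x / 2) a b).2 0 0 0) a &&
    Nat.beq (coord C.N g.2.2 (C.repA (x / 2) a b).1 (C.repA (x / 2) a b).2 0 0 1) b &&
    Nat.beq ((g.1 + C.e * g.2.1) % 2) (parity x)

/-- The verification of `orbB`. -/
def checkB (c d : ℕ) : Bool :=
  forceNat (C.orbB c d) fun x =>
  Nat.blt (x / 2) C.W &&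
  groupB.any fun g =>
    Nat.beq (coord C.N g.2.2 0 0 (C.repB (x / 2) c d).1 (C.repB (x / 2) c d).2 2) c &&
    Nat.beq (coord C.N g.2.2 0 0 (C.repB (x / 2) c d).1 (C.repB (x / 2) c d).2 3) d &&
    Nat.beq ((g.1 + C.e * g.2.1) % 2) (parity x)

/-- The verification of `orb` for a product of orbits of vectors that are not primitive. -/
def checkMul (r s : ℕ × ℕ) : Bool :=
  (List.range C.N).any fun u =>
    Nat.blt 0 u && Nat.beq (u * r.1 % C.N) 0 && Nat.beq (u * r.2 % C.N) 0 &&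
    Nat.beq (u * s.1 % C.N) 0 && Nat.beq (u * s.2 % C.N) 0

/-- The verification of `orb` by multiplication by a unit, where `y` is the expected pair of
orbits. -/
def checkUnit (r s y : ℕ × ℕ) (x : ℕ) : Bool :=
  (List.range C.N).any fun u => Nat.beq (Nat.gcd u C.N) 1 &&
    forceNat (C.orbA (u * r.1 % C.N) (u * r.2 % C.N)) fun cA =>
    forceNat (C.orbB (u * s.1 % C.N) (u * s.2 % C.N)) fun cB =>
    Nat.beq (cA / 2) y.1 && Nat.beq (cB / 2) y.2 && Nat.beq ((cA + cB) % 2) (parity x)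

/-- The orbits of the representative of an unknown value or, if it is zero, the given pair. -/
def repX (k i j : ℕ) : ℕ × ℕ :=
  Nat.rec (i, j) (fun _ _ => (entry C.xs k / C.W, entry C.xs k % C.W)) k

/-- The verification of `orb`. -/
def check (i j : ℕ) : Bool :=
  forceNat (C.orb i j) fun x =>
  Nat.ble (x / 2) C.n &&
  Nat.rec (Nat.beq (x / 2) 0) (fun _ _ =>
    (Nat.beq (x / 2) 0 && C.checkMul (C.repA i 0 0) (C.repB j 0 0)) ||
    C.checkUnit (C.repA i 0 0) (C.repB j 0 0) (C.repX (x / 2) i j) x) (i * j)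

/-- A term of a relation between the unknown values. The coefficients are the digits in
base `2 ^ 32`. -/
def term (p : ℕ × ℕ × ℕ) (a b c d : ℕ) : ℕ :=
  forceNat (C.orbA (coord C.N p.2.2 a b c d 0) (coord C.N p.2.2 a b c d 1)) fun cA =>
  forceNat (C.orbB (coord C.N p.2.2 a b c d 2) (coord C.N p.2.2 a b c d 3)) fun cB =>
  forceNat (C.orb (cA / 2) (cB / 2)) fun x =>
  (1 + (C.p - 2) * ((p.1 + C.e * p.2.1 + cA + cB + x) % 2)) * Nat.pow 4294967296 (x / 2)

/-- A relation between the unknown values. -/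
def rel (a b c d : ℕ) : List (ℕ × ℕ × ℕ) → ℕ
  | [] => 0
  | p :: T => C.term p a b c d + rel a b c d T

/-- The relation with the given code. -/
def row (r : ℕ) : ℕ :=
  C.rel (r / 2 / C.N / C.N / C.N) (r / 2 / C.N / C.N % C.N) (r / 2 / C.N % C.N) (r / 2 % C.N)
    (Nat.rec bowX (fun _ _ => extraX) (r % 2))

/-- A combination of relations. -/
def dot (p : ℕ) : ℕ → List ℕ → ℕ
  | _, [] => 0
  | L, r :: l => L % p * r + dot p (L / p) l

/-- The verification that a combination of relations is, modulo `p`, an unknown value. -/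
def checkRow (i S : ℕ) : Bool :=
  (List.range C.n).all fun k =>
    Nat.beq (S / Nat.pow 4294967296 (k + 1) % 4294967296 % C.p)
      (Nat.rec 1 (fun _ _ => 0) (i - k + (k - i)))

/-- The verification of the inverse matrix. -/
def checkInverse (l : List ℕ) : ℕ → List ℕ → Bool
  | i, [] => Nat.beq i C.n
  | i, L :: t => (forceNat (dot C.p L l) fun S => C.checkRow i S) && checkInverse l (i + 1) t

/-- The verification of a certificate. -/
def valid : Bool :=
  Nat.blt 1 C.p && Nat.blt 0 C.N && Nat.blt (200 * C.rows.length * C.p * C.p) 4294967296 &&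
  ((List.range C.N).all fun a => (List.range C.N).all fun b => C.checkA a b && C.checkB a b) &&
  ((List.range C.V).all fun i => (List.range C.W).all fun j => C.check i j) &&
  forceList (C.rows.map C.row) fun l => C.checkInverse l 0 C.inverse

end Cert

end Voronoi

namespace Voronoi

open Matrix

theorem cast_coord {N : ℕ} (hN : 0 < N) (D a b c d : ℕ) (j : Fin 4) :
    (coord N D a b c d j : ZMod N) =
      (![(a : ZMod N), (b : ZMod N), (c : ZMod N), (d : ZMod N)] ᵥ* red N (digits D)) j := by
  have h1 : ((N - 1 : ℕ) : ZMod N) = -1 := by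
    rw [Nat.cast_pred hN, ZMod.natCast_self, zero_sub]
  simp only [coord, vecMul, dotProduct, Fin.sum_univ_four, ZMod.natCast_mod, Nat.cast_add,
    Nat.cast_mul, h1, red, digits, map_apply, map_sub, eq_intCast, Int.cast_natCast,
    cons_val]
  fin_cases j <;> simp <;> ring

theorem digits_groupA : ∀ p ∈ groupA, digits p.2.2 0 2 = 0 ∧ digits p.2.2 0 3 = 0 ∧
    digits p.2.2 1 2 = 0 ∧ digits p.2.2 1 3 = 0 ∧ digits p.2.2 2 0 = 0 ∧ digits p.2.2 2 1 = 0 ∧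
    digits p.2.2 3 0 = 0 ∧ digits p.2.2 3 1 = 0 ∧ digits p.2.2 2 2 = 1 ∧ digits p.2.2 2 3 = 0 ∧
    digits p.2.2 3 2 = 0 ∧ digits p.2.2 3 3 = 1 := by decide +kernel

theorem digits_groupB : ∀ p ∈ groupB, digits p.2.2 0 2 = 0 ∧ digits p.2.2 0 3 = 0 ∧
    digits p.2.2 1 2 = 0 ∧ digits p.2.2 1 3 = 0 ∧ digits p.2.2 2 0 = 0 ∧ digits p.2.2 2 1 = 0 ∧
    digits p.2.2 3 0 = 0 ∧ digits p.2.2 3 1 = 0 ∧ digits p.2.2 0 0 = 1 ∧ digits p.2.2 0 1 = 0 ∧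
    digits p.2.2 1 0 = 0 ∧ digits p.2.2 1 1 = 1 := by decide +kernel

namespace Cert

variable {C : Cert} {Y : Matrix (Fin 4) (Fin 4) ℤ → ℂ}

/-- The value at the row `(a, b, c, d)`. -/
noncomputable def val (C : Cert) (Y : Matrix (Fin 4) (Fin 4) ℤ → ℂ) (a b c d : ℕ) : ℂ :=
  xval Y ((-1) ^ C.e) ![(a : ZMod C.N), (b : ZMod C.N), (c : ZMod C.N), (d : ZMod C.N)]

theorem val_coord (hN : 0 < C.N) (D a b c d : ℕ) :
    C.val Y (coord C.N D a b c d 0) (coord C.N D a b c d 1) (coord C.N D a b c d 2)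
      (coord C.N D a b c d 3) = xval Y ((-1) ^ C.e)
        (![(a : ZMod C.N), (b : ZMod C.N), (c : ZMod C.N), (d : ZMod C.N)] ᵥ*
          red C.N (digits D)) := by
  rw [val]
  congr 1
  funext j
  fin_cases j
  · exact cast_coord hN D a b c d 0
  · exact cast_coord hN D a b c d 1
  · exact cast_coord hN D a b c d 2
  · exact cast_coord hN D a b c d 3

theorem sign_mul_self : ((-1 : ℂ) ^ C.e) * (-1) ^ C.e = 1 := by
  rw [← mul_pow]; simp

theorem sign_eq {m n : ℕ} (h : m % 2 = n % 2) : (-1 : ℂ) ^ m = (-1) ^ n := by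
  rw [neg_one_pow_eq_pow_mod_two, h, ← neg_one_pow_eq_pow_mod_two]

theorem val_groupA (hN : 0 < C.N) (hY : IsLabelled C.N Y) (hH : IsHarmonic Y) {g : ℕ × ℕ × ℕ}
    (hg : g ∈ groupA) (a b c d : ℕ) :
    (-1) ^ (g.1 + C.e * g.2.1) * C.val Y (coord C.N g.2.2 a b 0 0 0) (coord C.N g.2.2 a b 0 0 1) c d
      = C.val Y a b c d := by
  obtain ⟨h1, h2, h3, h4, h5, h6, h7, h8, h9, h10, h11, h12⟩ := digits_groupA g hg
  refine Eq.trans ?_ (hY.xval_symm hH sign_mul_self (List.mem_append_left _ hg) _)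
  rw [val, pow_add, pow_mul, mul_assoc]
  congr 3
  have h0 := cast_coord hN g.2.2 a b 0 0 0
  have h0' := cast_coord hN g.2.2 a b 0 0 1
  funext j
  fin_cases j
  · refine h0.trans ?_
    simp [vecMul, dotProduct, Fin.sum_univ_four, red, h5, h7]
  · refine h0'.trans ?_
    simp [vecMul, dotProduct, Fin.sum_univ_four, red, h6, h8]
  · simp [vecMul, dotProduct, Fin.sum_univ_four, red, h1, h3, h9, h11]
  · simp [vecMul, dotProduct, Fin.sum_univ_four, red, h2, h4, h10, h12]

theorem val_groupB (hN : 0 < C.N) (hY : IsLabelled C.N Y) (hH : IsHarmonic Y) {g : ℕ × ℕ × ℕ}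
    (hg : g ∈ groupB) (a b c d : ℕ) :
    (-1) ^ (g.1 + C.e * g.2.1) * C.val Y a b (coord C.N g.2.2 0 0 c d 2) (coord C.N g.2.2 0 0 c d 3)
      = C.val Y a b c d := by
  obtain ⟨h1, h2, h3, h4, h5, h6, h7, h8, h9, h10, h11, h12⟩ := digits_groupB g hg
  refine Eq.trans ?_ (hY.xval_symm hH sign_mul_self (List.mem_append_right _ hg) _)
  rw [val, pow_add, pow_mul, mul_assoc]
  congr 3
  have h0 := cast_coord hN g.2.2 0 0 c d 2
  have h0' := cast_coord hN g.2.2 0 0 c d 3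
  funext j
  fin_cases j
  · simp [vecMul, dotProduct, Fin.sum_univ_four, red, h5, h7, h9, h11]
  · simp [vecMul, dotProduct, Fin.sum_univ_four, red, h6, h8, h10, h12]
  · refine h0.trans ?_
    simp [vecMul, dotProduct, Fin.sum_univ_four, red, h1, h3]
  · refine h0'.trans ?_
    simp [vecMul, dotProduct, Fin.sum_univ_four, red, h2, h4]

theorem eq_sign_mul {m n : ℕ} {x y : ℂ} (hmn : m % 2 = n % 2) (h : (-1) ^ m * x = y) :
    x = (-1) ^ n * y := by
  rw [← h, sign_eq hmn, ← mul_assoc, ← mul_pow]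
  simp

theorem eq_zero_of_sign {m : ℕ} {x : ℂ} (hm : m % 2 = 1) (h : (-1) ^ m * x = x) : x = 0 := by
  rw [sign_eq (n := 1) hm] at h
  linear_combination -h / 2

/-- The value at the representative of the `i`-th orbit of pairs. -/
noncomputable def valA (C : Cert) (Y : Matrix (Fin 4) (Fin 4) ℤ → ℂ) (i c d : ℕ) : ℂ :=
  Nat.rec 0 (fun _ _ => C.val Y (C.repA i 0 0).1 (C.repA i 0 0).2 c d) i

theorem val_eq_valA (hN : 0 < C.N) (hY : IsLabelled C.N Y) (hH : IsHarmonic Y) {a b : ℕ}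
    (h : C.checkA a b = true) (c d : ℕ) :
    C.orbA a b / 2 < C.V ∧ C.val Y a b c d = (-1) ^ C.orbA a b * C.valA Y (C.orbA a b / 2) c d := by
  simp only [checkA, forceNat_eq, Bool.and_eq_true, List.any_eq_true, Nat.blt_eq,
    Nat.beq_eq] at h
  obtain ⟨h0, g, hg, ⟨h1, h2⟩, h3⟩ := h
  refine ⟨h0, ?_⟩
  have h4 := C.val_groupA hN hY hH hg (C.repA (C.orbA a b / 2) a b).1
    (C.repA (C.orbA a b / 2) a b).2 c d
  rw [h1, h2] at h4
  rcases hi : C.orbA a b / 2 with _ | i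
  · rw [parity, hi] at h3
    rw [hi] at h4
    rw [eq_zero_of_sign h3 h4]
    simp [valA]
  · rw [parity, hi] at h3
    rw [hi] at h4
    exact eq_sign_mul h3 h4

/-- The value at the representatives of a pair of orbits of pairs. -/
noncomputable def valAB (C : Cert) (Y : Matrix (Fin 4) (Fin 4) ℤ → ℂ) (i j : ℕ) : ℂ :=
  Nat.rec 0 (fun _ _ => C.valA Y i (C.repB j 0 0).1 (C.repB j 0 0).2) j

theorem val_eq_valB (hN : 0 < C.N) (hY : IsLabelled C.N Y) (hH : IsHarmonic Y) {c d : ℕ}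
    (h : C.checkB c d = true) (i : ℕ) :
    C.orbB c d / 2 < C.W ∧
      C.valA Y i c d = (-1) ^ C.orbB c d * C.valAB Y i (C.orbB c d / 2) := by
  simp only [checkB, forceNat_eq, Bool.and_eq_true, List.any_eq_true, Nat.blt_eq,
    Nat.beq_eq] at h
  obtain ⟨h0, g, hg, ⟨h1, h2⟩, h3⟩ := h
  refine ⟨h0, ?_⟩
  rcases i with _ | i
  · rcases C.orbB c d / 2 with _ | j <;> simp [valAB, valA]
  have h4 := C.val_groupB hN hY hH hg (C.repA (i + 1) 0 0).1 (C.repA (i + 1) 0 0).2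
    (C.repB (C.orbB c d / 2) c d).1 (C.repB (C.orbB c d / 2) c d).2
  rw [h1, h2] at h4
  rcases hi : C.orbB c d / 2 with _ | j
  · rw [parity, hi] at h3
    rw [hi] at h4
    have h5 := eq_zero_of_sign h3 h4
    simpa [valAB, valA] using h5
  · rw [parity, hi] at h3
    rw [hi] at h4
    exact eq_sign_mul h3 h4

end Cert

end Voronoi

namespace Voronoi

open Matrix

namespace Cert

variable {C : Cert} {Y : Matrix (Fin 4) (Fin 4) ℤ → ℂ}

/-- The verification of the orbits of pairs. -/
def HasOrbits (C : Cert) : Prop :=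
  ∀ a < C.N, ∀ b < C.N, C.checkA a b = true ∧ C.checkB a b = true

/-- The `k`-th unknown value. -/
noncomputable def unk (C : Cert) (Y : Matrix (Fin 4) (Fin 4) ℤ → ℂ) (k : ℕ) : ℂ :=
  Nat.rec 0 (fun _ _ => C.valAB Y (C.repX k 0 0).1 (C.repX k 0 0).2) k

theorem valAB_of_mul_eq_zero {i j : ℕ} (h : i * j = 0) : C.valAB Y i j = 0 := by
  rcases Nat.mul_eq_zero.1 h with rfl | rfl
  · cases j <;> rfl
  · rfl

theorem valAB_of_mul_ne_zero {i j : ℕ} (h : i * j ≠ 0) :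
    C.valAB Y i j =
      C.val Y (C.repA i 0 0).1 (C.repA i 0 0).2 (C.repB j 0 0).1 (C.repB j 0 0).2 := by
  rcases i with _ | i
  · simp at h
  rcases j with _ | j
  · simp at h
  rfl

theorem val_eq_valAB (hN : 0 < C.N) (hY : IsLabelled C.N Y) (hH : IsHarmonic Y)
    (hC : C.HasOrbits) {a b c d : ℕ} (ha : a < C.N) (hb : b < C.N) (hc : c < C.N) (hd : d < C.N) :
    C.orbA a b / 2 < C.V ∧ C.orbB c d / 2 < C.W ∧ C.val Y a b c d =
      (-1) ^ (C.orbA a b + C.orbB c d) * C.valAB Y (C.orbA a b / 2) (C.orbB c d / 2) := by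
  obtain ⟨h1, h2⟩ := val_eq_valA hN hY hH (hC a ha b hb).1 c d
  obtain ⟨h3, h4⟩ := val_eq_valB hN hY hH (hC c hc d hd).2 (C.orbA a b / 2)
  exact ⟨h1, h3, by rw [h2, h4, pow_add, mul_assoc]⟩

theorem val_of_checkMul {r s : ℕ × ℕ} (h : C.checkMul r s = true) :
    C.val Y r.1 r.2 s.1 s.2 = 0 := by
  simp only [checkMul, List.any_eq_true, List.mem_range, Bool.and_eq_true, Nat.blt_eq,
    Nat.beq_eq] at h
  obtain ⟨u, hu, ⟨⟨⟨h0, h1⟩, h2⟩, h3⟩, h4⟩ := h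
  have key : ∀ x : ℕ, u * x % C.N = 0 → (u : ZMod C.N) * x = 0 := fun x hx => by
    rw [← Nat.cast_mul]
    exact (ZMod.natCast_eq_zero_iff _ _).2 (Nat.dvd_of_mod_eq_zero hx)
  refine xval_eq_zero_of_smul_eq_zero (c := (u : ZMod C.N)) (fun hc => ?_) ?_
  · exact absurd (Nat.le_of_dvd h0 ((ZMod.natCast_eq_zero_iff _ _).1 hc)) (by omega)
  · funext j
    fin_cases j <;> simp [key, h1, h2, h3, h4]

theorem val_mul (hY : IsLabelled C.N Y) {u : ℕ} (hu : Nat.gcd u C.N = 1) (a b c d : ℕ) :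
    C.val Y (u * a % C.N) (u * b % C.N) (u * c % C.N) (u * d % C.N) = C.val Y a b c d := by
  rw [val, val]
  refine Eq.trans ?_ (hY.xval_smul (ZMod.unitOfCoprime u hu) _)
  congr 1
  funext j
  fin_cases j <;> simp [Units.smul_def]

theorem valAB_eq_unk (hN : 0 < C.N) (hY : IsLabelled C.N Y) (hH : IsHarmonic Y)
    (hC : C.HasOrbits) {i j : ℕ} (h : C.check i j = true) :
    C.orb i j / 2 ≤ C.n ∧ C.valAB Y i j = (-1) ^ C.orb i j * C.unk Y (C.orb i j / 2) := by
  simp only [check, forceNat_eq, Bool.and_eq_true, Nat.ble_eq] at h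
  refine ⟨h.1, ?_⟩
  have h := h.2
  by_cases hij : i * j = 0
  · rw [hij] at h
    have h0 : C.orb i j / 2 = 0 := Nat.beq_eq.mp h
    rw [valAB_of_mul_eq_zero hij, h0]
    simp [unk]
  have h1 : (Nat.beq (C.orb i j / 2) 0 && C.checkMul (C.repA i 0 0) (C.repB j 0 0)) = true ∨
      C.checkUnit (C.repA i 0 0) (C.repB j 0 0) (C.repX (C.orb i j / 2) i j)
        (C.orb i j) = true := by
    obtain ⟨k, hk⟩ := Nat.exists_eq_succ_of_ne_zero hij
    rw [hk] at h
    exact Bool.or_eq_true_iff.mp h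
  rcases h1 with h1 | h1
  · simp only [Bool.and_eq_true, Nat.beq_eq] at h1
    rw [valAB_of_mul_ne_zero hij, val_of_checkMul h1.2, h1.1]
    simp [unk]
  · simp only [checkUnit, forceNat_eq, List.any_eq_true, List.mem_range, Bool.and_eq_true,
      Nat.beq_eq] at h1
    obtain ⟨u, -, hu, ⟨h2, h3⟩, h4⟩ := h1
    have h5 := (val_eq_valAB hN hY hH hC (Nat.mod_lt (u * (C.repA i 0 0).1) hN)
      (Nat.mod_lt (u * (C.repA i 0 0).2) hN) (Nat.mod_lt (u * (C.repB j 0 0).1) hN)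
      (Nat.mod_lt (u * (C.repB j 0 0).2) hN)).2.2
    rw [val_mul hY hu, ← valAB_of_mul_ne_zero hij, h2, h3] at h5
    rcases hk : C.orb i j / 2 with _ | k
    · rw [hk] at h5
      rw [parity, hk] at h4
      change C.valAB Y i j = _ * C.valAB Y i j at h5
      rw [eq_zero_of_sign h4 h5.symm]
      simp [unk]
    · rw [hk] at h5
      rw [parity, hk] at h4
      rw [h5, sign_eq h4]
      rfl

/-- The verification of the tables. -/
def HasTables (C : Cert) : Prop :=
  C.HasOrbits ∧ ∀ i < C.V, ∀ j < C.W, C.check i j = true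

/-- The code of the value at the row `(a, b, c, d)`. -/
def fullOrb (C : Cert) (a b c d : ℕ) : ℕ := C.orb (C.orbA a b / 2) (C.orbB c d / 2)

theorem val_eq_unk (hN : 0 < C.N) (hY : IsLabelled C.N Y) (hH : IsHarmonic Y)
    (hC : C.HasTables) {a b c d : ℕ} (ha : a < C.N) (hb : b < C.N) (hc : c < C.N) (hd : d < C.N) :
    C.fullOrb a b c d / 2 ≤ C.n ∧ C.val Y a b c d =
      (-1) ^ (C.orbA a b + C.orbB c d + C.fullOrb a b c d) * C.unk Y (C.fullOrb a b c d / 2) := by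
  obtain ⟨h1, h2, h3⟩ := val_eq_valAB hN hY hH hC.1 ha hb hc hd
  obtain ⟨h4, h5⟩ := valAB_eq_unk hN hY hH hC.1 (hC.2 _ h1 _ h2)
  exact ⟨h4, by rw [h3, h5, pow_add _ (_ + _), mul_assoc]; rfl⟩

/-- A linear combination of the unknown values is `v`, and its coefficients modulo `p` are the
digits of `S`. -/
def IsRel (C : Cert) (Y : Matrix (Fin 4) (Fin 4) ℤ → ℂ) (b S : ℕ) (v : ℂ) : Prop :=
  ∃ (f : ℕ → ℕ) (g : ℕ → ℤ), (∀ k, f k ≤ b) ∧ (∀ k, (f k : ZMod C.p) = g k) ∧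
    S = ∑ k ∈ Finset.range (C.n + 1), f k * 4294967296 ^ k ∧
    ∑ k ∈ Finset.range (C.n + 1), (g k : ℂ) * C.unk Y k = v

theorem IsRel.zero : C.IsRel Y 0 0 0 :=
  ⟨0, 0, by simp, by simp, by simp, by simp⟩

theorem IsRel.mono {b b' S : ℕ} {v : ℂ} (h : C.IsRel Y b S v) (hb : b ≤ b') : C.IsRel Y b' S v := by
  obtain ⟨f, g, h1, h2⟩ := h
  exact ⟨f, g, fun k => (h1 k).trans hb, h2⟩

theorem IsRel.add {b b' S S' : ℕ} {v v' : ℂ} (h : C.IsRel Y b S v) (h' : C.IsRel Y b' S' v') :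
    C.IsRel Y (b + b') (S + S') (v + v') := by
  obtain ⟨f, g, h1, h2, rfl, rfl⟩ := h
  obtain ⟨f', g', h1', h2', rfl, rfl⟩ := h'
  refine ⟨f + f', g + g', fun k => Nat.add_le_add (h1 k) (h1' k), fun k => ?_, ?_, ?_⟩
  · simp [h2, h2']
  · simp only [Pi.add_apply, add_mul, Finset.sum_add_distrib]
  · simp only [Pi.add_apply, Int.cast_add, add_mul, Finset.sum_add_distrib]

theorem IsRel.mul {b S : ℕ} {v : ℂ} (h : C.IsRel Y b S v) (c : ℕ) :
    C.IsRel Y (c * b) (c * S) (c * v) := by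
  obtain ⟨f, g, h1, h2, rfl, rfl⟩ := h
  refine ⟨fun k => c * f k, fun k => c * g k, fun k => Nat.mul_le_mul_left c (h1 k), fun k => ?_,
    ?_, ?_⟩
  · simp [h2]
  · simp only [Finset.mul_sum, mul_assoc]
  · simp only [Finset.mul_sum, Int.cast_mul, Int.cast_natCast, mul_assoc]

theorem isRel_single (hp : 1 < C.p) {k : ℕ} (hk : k ≤ C.n) (m : ℕ) :
    C.IsRel Y C.p ((1 + (C.p - 2) * (m % 2)) * 4294967296 ^ k) ((-1) ^ m * C.unk Y k) := by
  have h0 : k ∈ Finset.range (C.n + 1) := Finset.mem_range.2 (by omega)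
  refine ⟨fun i => if i = k then 1 + (C.p - 2) * (m % 2) else 0,
    fun i => if i = k then (-1) ^ m else 0, fun i => ?_, fun i => ?_, ?_, ?_⟩
  · rcases Nat.mod_two_eq_zero_or_one m with h | h <;> rw [h] <;> dsimp only <;> split_ifs <;> omega
  · dsimp only
    split_ifs
    · rw [neg_one_pow_eq_pow_mod_two]
      rcases Nat.mod_two_eq_zero_or_one m with h | h <;> rw [h]
      · simp
      · have h1 : 1 + (C.p - 2) * 1 + 1 = C.p := by omega
        have h2 := congrArg (Nat.cast (R := ZMod C.p)) h1
        rw [Nat.cast_add, ZMod.natCast_self, Nat.cast_one] at h2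
        rw [eq_neg_of_add_eq_zero_left h2]
        simp
    · simp
  · simp only [ite_mul, zero_mul]
    rw [Finset.sum_ite_eq' _ k, if_pos h0]
  · rw [Finset.sum_eq_single_of_mem k h0 fun i _ hi => by simp [hi]]
    simp

theorem isRel_term (hp : 1 < C.p) (hN : 0 < C.N) (hY : IsLabelled C.N Y) (hH : IsHarmonic Y)
    (hC : C.HasTables) (q : ℕ × ℕ × ℕ) (a b c d : ℕ) :
    C.IsRel Y C.p (C.term q a b c d) ((-1) ^ q.1 * (((-1) ^ C.e) ^ q.2.1 * xval Y ((-1) ^ C.e)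
      (![(a : ZMod C.N), (b : ZMod C.N), (c : ZMod C.N), (d : ZMod C.N)] ᵥ*
        red C.N (digits q.2.2)))) := by
  obtain ⟨h1, h2⟩ := val_eq_unk (Y := Y) hN hY hH hC
    (a := coord C.N q.2.2 a b c d 0) (b := coord C.N q.2.2 a b c d 1)
    (c := coord C.N q.2.2 a b c d 2) (d := coord C.N q.2.2 a b c d 3) (Nat.mod_lt _ hN)
    (Nat.mod_lt _ hN) (Nat.mod_lt _ hN) (Nat.mod_lt _ hN)
  rw [val_coord hN] at h2
  rw [h2]
  have h3 := isRel_single (Y := Y) hp h1 (q.1 + C.e * q.2.1 +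
    C.orbA (coord C.N q.2.2 a b c d 0) (coord C.N q.2.2 a b c d 1) +
    C.orbB (coord C.N q.2.2 a b c d 2) (coord C.N q.2.2 a b c d 3) +
    C.fullOrb (coord C.N q.2.2 a b c d 0) (coord C.N q.2.2 a b c d 1)
      (coord C.N q.2.2 a b c d 2) (coord C.N q.2.2 a b c d 3))
  simp only [term, forceNat_eq]
  convert h3 using 1
  · rfl
  · rw [← pow_mul]
    ring

theorem isRel_rel (hp : 1 < C.p) (hN : 0 < C.N) (hY : IsLabelled C.N Y) (hH : IsHarmonic Y)
    (hC : C.HasTables) (a b c d : ℕ) (T : List (ℕ × ℕ × ℕ)) :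
    C.IsRel Y (T.length * C.p) (C.rel a b c d T) (T.map fun q => (-1) ^ q.1 *
      (((-1) ^ C.e) ^ q.2.1 * xval Y ((-1) ^ C.e)
        (![(a : ZMod C.N), (b : ZMod C.N), (c : ZMod C.N), (d : ZMod C.N)] ᵥ*
          red C.N (digits q.2.2)))).sum := by
  induction T with
  | nil => simpa [rel] using IsRel.zero
  | cons q T ih =>
    rw [List.map_cons, List.sum_cons, rel, List.length_cons, Nat.succ_mul, Nat.add_comm _ C.p]
    exact (isRel_term hp hN hY hH hC q a b c d).add ih

theorem isRel_row (hp : 1 < C.p) (hN : 0 < C.N) (hY : IsLabelled C.N Y) (hH : IsHarmonic Y)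
    (hC : C.HasTables) (r : ℕ) : C.IsRel Y (200 * C.p) (C.row r) 0 := by
  rw [row]
  rcases r % 2 with _ | k
  · have h := isRel_rel hp hN hY hH hC (r / 2 / C.N / C.N / C.N) (r / 2 / C.N / C.N % C.N)
      (r / 2 / C.N % C.N) (r / 2 % C.N) bowX
    rw [hY.sum_eq_zero sign_mul_self detSigns_bowX hH.bow] at h
    exact h.mono (Nat.mul_le_mul_right _ (by decide +kernel))
  · have h := isRel_rel hp hN hY hH hC (r / 2 / C.N / C.N / C.N) (r / 2 / C.N / C.N % C.N)
      (r / 2 / C.N % C.N) (r / 2 % C.N) extraX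
    rw [hY.sum_eq_zero sign_mul_self detSigns_extraX hH.extra] at h
    exact h.mono (Nat.mul_le_mul_right _ (by decide +kernel))

theorem isRel_dot (hp : 1 < C.p) {b : ℕ} (l : List ℕ) (hl : ∀ S ∈ l, C.IsRel Y b S 0) (L : ℕ) :
    C.IsRel Y (l.length * (C.p * b)) (dot C.p L l) 0 := by
  induction l generalizing L with
  | nil => simpa [dot] using IsRel.zero
  | cons S l ih =>
    have h1 := ((hl S (by simp)).mul (L % C.p)).mono
      (Nat.mul_le_mul_right b (Nat.mod_lt L (by omega : 0 < C.p)).le)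
    have h2 := h1.add (ih (fun S hS => hl S (by simp [hS])) (L / C.p))
    rw [mul_zero, add_zero] at h2
    rw [dot, List.length_cons, Nat.succ_mul, Nat.add_comm _ (C.p * b)]
    exact h2

theorem digit_sum {B : ℕ} (n : ℕ) (f : ℕ → ℕ) (hf : ∀ k, f k < B) {i : ℕ} (hi : i < n) :
    (∑ k ∈ Finset.range n, f k * B ^ k) / B ^ i % B = f i := by
  induction n generalizing f i with
  | zero => omega
  | succ n ih =>
    have hB : 0 < B := (Nat.zero_le _).trans_lt (hf 0)
    have h1 : ∑ k ∈ Finset.range (n + 1), f k * B ^ k =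
        f 0 + B * ∑ k ∈ Finset.range n, f (k + 1) * B ^ k := by
      rw [Finset.sum_range_succ', Finset.mul_sum, Nat.add_comm]
      congr 1
      · simp
      · exact Finset.sum_congr rfl fun k _ => by ring
    rw [h1]
    rcases i with _ | i
    · rw [pow_zero, Nat.div_one, Nat.add_mul_mod_self_left, Nat.mod_eq_of_lt (hf 0)]
    · rw [pow_succ', ← Nat.div_div_eq_div_mul, Nat.add_mul_div_left _ _ hB,
        Nat.div_eq_of_lt (hf 0), Nat.zero_add]
      exact ih (fun k => f (k + 1)) (fun k => hf _) (by omega)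

theorem exists_row {l : List ℕ} {t : List ℕ} {i m : ℕ} (h : C.checkInverse l i t = true)
    (him : i ≤ m) (hm : m < C.n) : ∃ L, C.checkRow m (dot C.p L l) = true := by
  induction t generalizing i with
  | nil =>
    have := Nat.beq_eq.mp h
    omega
  | cons L t ih =>
    simp only [checkInverse, forceNat_eq, Bool.and_eq_true] at h
    rcases Nat.eq_or_lt_of_le him with rfl | h1
    · exact ⟨L, h.1⟩
    · exact ih h.2 h1

theorem unk_eq_zero (hp : 1 < C.p) (hN : 0 < C.N) (hY : IsLabelled C.N Y) (hH : IsHarmonic Y)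
    (hC : C.HasTables) (hb : 200 * C.rows.length * C.p * C.p < 4294967296)
    (hI : C.checkInverse (C.rows.map C.row) 0 C.inverse = true) {k : ℕ} (hk : k ≤ C.n) :
    C.unk Y k = 0 := by
  rcases k with _ | k
  · rfl
  have key : ∀ i : Fin C.n, ∃ g : ℕ → ℤ, (∀ j : Fin C.n, (g (j + 1) : ZMod C.p) =
      if i = j then 1 else 0) ∧ ∑ j : Fin C.n, (g (j + 1) : ℂ) * C.unk Y (j + 1) = 0 := by
    intro i
    obtain ⟨L, hL⟩ := exists_row hI (Nat.zero_le _) i.2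
    obtain ⟨f, g, h1, h2, h3, h4⟩ := isRel_dot (Y := Y) hp (C.rows.map C.row) (fun S hS => by
      obtain ⟨r, -, rfl⟩ := List.mem_map.1 hS
      exact isRel_row hp hN hY hH hC r) L
    refine ⟨g, fun j => ?_, ?_⟩
    · simp only [checkRow, List.all_eq_true, List.mem_range, Nat.beq_eq] at hL
      have h5 := hL j j.2
      have h6 : ∀ k, f k < 4294967296 := fun k => (h1 k).trans_lt <| by
        rw [List.length_map]
        refine lt_of_eq_of_lt ?_ hb
        ring
      have h7 := digit_sum (C.n + 1) f h6 (i := j + 1) (by omega)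
      rw [← h3] at h7
      have h8 : f (j + 1) % C.p = if i = j then 1 else 0 := by
        rw [← h7]
        refine h5.trans ?_
        split_ifs with hij
        · rw [hij, Nat.sub_self, Nat.add_zero]
          rfl
        · have h9 : (i : ℕ) ≠ j := fun h => hij (Fin.ext h)
          obtain ⟨m, hm⟩ := Nat.exists_eq_succ_of_ne_zero
            (show (i : ℕ) - j + (j - i) ≠ 0 by omega)
          rw [hm]
      rw [← h2, ← ZMod.natCast_mod, h8]
      split_ifs <;> simp
    · rw [Finset.sum_range_succ', ← Fin.sum_univ_eq_sum_range
        (fun j => (g (j + 1) : ℂ) * C.unk Y (j + 1))] at h4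
      simpa [unk] using h4
  choose G hG hG' using key
  let A : Matrix (Fin C.n) (Fin C.n) ℤ := fun i j => G i (j + 1)
  have hA : A.map (Int.castRingHom (ZMod C.p)) = 1 := by
    ext i j
    exact (hG i j).trans (one_apply).symm
  have hdet : (A.map (Int.castRingHom ℂ)).det ≠ 0 := by
    rw [← RingHom.mapMatrix_apply, ← RingHom.map_det]
    intro h0
    have h1 : A.det = 0 := by simpa using h0
    have h2 := congrArg det hA
    rw [← RingHom.mapMatrix_apply, ← RingHom.map_det, h1, det_one, map_zero] at h2
    have : Fact (1 < C.p) := ⟨hp⟩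
    exact zero_ne_one h2
  have hv := eq_zero_of_mulVec_eq_zero hdet (v := fun j => C.unk Y (j + 1)) <| by
    funext i
    exact hG' i
  exact congrFun hv ⟨k, hk⟩

theorem xval_eq_zero (hC : C.valid = true) (hY : IsLabelled C.N Y) (hH : IsHarmonic Y)
    (a : Fin 4 → ZMod C.N) : xval Y ((-1) ^ C.e) a = 0 := by
  simp only [valid, forceList_eq, Bool.and_eq_true, Nat.blt_eq, List.all_eq_true,
    List.mem_range] at hC
  obtain ⟨⟨⟨⟨⟨hp, hN⟩, hb⟩, h1⟩, h2⟩, h3⟩ := hC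
  have : NeZero C.N := ⟨hN.ne'⟩
  have h4 : C.HasTables := ⟨h1, h2⟩
  obtain ⟨h5, h6⟩ := val_eq_unk hN hY hH h4 (ZMod.val_lt (a 0)) (ZMod.val_lt (a 1))
    (ZMod.val_lt (a 2)) (ZMod.val_lt (a 3))
  rw [unk_eq_zero hp hN hY hH h4 hb h3 h5, mul_zero, val] at h6
  rw [← h6]
  congr 1
  funext j
  fin_cases j <;> simp

end Cert

end Voronoi

namespace Voronoi

/-- The certificate of level `2` and of sign `1`. -/
def cert2_0 : Cert where
  N := 2
  e := 0
  p := 3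
  n := 0
  V := 1
  W := 2
  tA := 0
  rA := 0
  tB := 3002000
  rB := 1000
  t2 := 0
  xs := 0
  rows := []
  inverse := []

theorem valid_cert2_0 : cert2_0.valid = true := by decide +kernel

/-- The certificate of level `2` and of sign `-1`. -/
def cert2_1 : Cert where
  N := 2
  e := 1
  p := 3
  n := 0
  V := 3
  W := 1
  tA := 4004004002
  rA := 1000000
  tB := 0
  rB := 0
  t2 := 0
  xs := 0
  rows := []
  inverse := []

theorem valid_cert2_1 : cert2_1.valid = true := by decide +kernel

/-- The certificate of level `3` and of sign `1`. -/
def cert3_0 : Cert where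
  N := 3
  e := 0
  p := 3
  n := 0
  V := 1
  W := 2
  tA := 0
  rA := 0
  tB := 3000000003002002000
  rB := 1000
  t2 := 0
  xs := 0
  rows := []
  inverse := []

theorem valid_cert3_0 : cert3_0.valid = true := by decide +kernel

/-- The certificate of level `3` and of sign `-1`. -/
def cert3_1 : Cert where
  N := 3
  e := 1
  p := 3
  n := 3
  V := 4
  W := 2
  tA := 6004004004006004004004002
  rA := 4001000000
  tB := 2003000003002000000000000
  rB := 4000
  t2 := 6000004000002000000000
  xs := 7005003000
  rows := [52, 18, 153]
  inverse := [6, 20, 2]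

theorem valid_cert3_1 : cert3_1.valid = true := by decide +kernel

/-- The certificate of level `4` and of sign `1`. -/
def cert4_0 : Cert where
  N := 4
  e := 0
  p := 3
  n := 0
  V := 1
  W := 4
  tA := 0
  rA := 0
  tB := 6000003007000007005000006000003002004002000
  rB := 6002001000
  t2 := 0
  xs := 0
  rows := []
  inverse := []

theorem valid_cert4_0 : cert4_0.valid = true := by decide +kernel

/-- The certificate of level `4` and of sign `-1`. -/
def cert4_1 : Cert where
  N := 4
  e := 1
  p := 5
  n := 4
  V := 5
  W := 2
  tA := 8008004004008006008006004008008004004006004002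
  rA := 5002001000000
  tB := 2000003000000000000000003000002000000000000000
  rB := 5000
  t2 := 8000006000004000002000000000
  xs := 9007005003000
  rows := [2, 176, 474, 427]
  inverse := [1, 125, 5, 525]

theorem valid_cert4_1 : cert4_1.valid = true := by decide +kernel

/-- The certificate of level `5` and of sign `1`. -/
def cert5_0 : Cert where
  N := 5
  e := 0
  p := 3
  n := 0
  V := 1
  W := 4
  tA := 0
  rA := 0
  tB := 6006000003007000000007005007000000007005000006006000003002004004002000
  rB := 7002001000
  t2 := 0
  xs := 0
  rows := []
  inverse := []

theorem valid_cert5_0 : cert5_0.valid = true := by decide +kernel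

/-- The certificate of level `5` and of sign `-1`. -/
def cert5_1 : Cert where
  N := 5
  e := 1
  p := 3
  n := 7
  V := 6
  W := 4
  tA := 8010008004004010010006008006008006010010006004008010008004004006006004002
  rA := 7006002001000000
  tB := 2004005003000004006007005000005007006004000003005004002000000000000000000
  rB := 12007006000
  t2 := 10013014000014012010000004007008000008006004000002000002000000000000000
  xs := 19018017011010009005000
  rows := [232, 794, 34, 979, 585, 925, 897]
  inverse := [9, 1459, 1216, 1730, 243, 1594, 1763]

theorem valid_cert5_1 : cert5_1.valid = true := by decide +kernel

/-- The certificate of level `6` and of sign `1`. -/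
def cert6_0 : Cert where
  N := 6
  e := 0
  p := 3
  n := 6
  V := 2
  W := 7
  tA := 2003000000000003000002000000000002003000003002000000000002000003000000000003002000000000000000000000000
  rA := 8000
  tB := 8010008000003009000012000009005011013000013011007009000012000009005000008010008000003002004006004002000
  rB := 15009008003002001000
  t2 := 12010008006004002000000000000000000000000
  xs := 13012011010009008000
  rows := [737, 1059, 1715, 1947, 2047, 715]
  inverse := [150, 161, 717, 9, 165, 180]

theorem valid_cert6_0 : cert6_0.valid = true := by decide +kernel

/-- The certificate of level `6` and of sign `-1`. -/
def cert6_1 : Cert where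
  N := 6
  e := 1
  p := 3
  n := 18
  V := 8
  W := 4
  tA := 10012012010004004012014012006010006012012008012012008010006012014012006004010012012010004004006008006004002
  rA := 14008007003002001000000
  tB := 2004000005003000004006000007005000000000000000000000005007000006004000003005000004002000000000000000000000
  rB := 14008007000
  t2 := 36034000032030028000026024022000020018016000000014012000010008006000000004002000000000000000
  xs := 30029027026025023022021019018017014013011010009006005000
  rows := [736, 2090, 1058, 46, 1608, 1226, 1640, 1582, 1734, 2568, 1086, 1740, 22, 737, 1059, 2151,
    1293, 2303]
  inverse := [531441, 54, 28698063, 258280331, 1950093, 1595799, 4783698, 122472, 59049, 13122,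
    143489071, 215274533, 12774276, 129140164, 86134370, 9567477, 1476, 729]

theorem valid_cert6_1 : cert6_1.valid = true := by decide +kernel

/-- The certificate of level `7` and of sign `1`. -/
def cert7_0 : Cert where
  N := 7
  e := 0
  p := 3
  n := 2
  V := 2
  W := 7
  tA := 2000003000000000003000000002000000000000000000000003002000002003000000000000000000000002000000003000000000003000002000000000000000000000000000
  rA := 9000
  tB := 8010010008000003009000012012000009005011013000000013011007011013000000013011007009000012012000009005000008010010008000003002004006006004002000
  rB := 17010009003002001000
  t2 := 4005004002002002000000000000000000000000
  xs := 11008000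
  rows := [763, 3797]
  inverse := [2, 3]

theorem valid_cert7_0 : cert7_0.valid = true := by decide +kernel

/-- The certificate of level `7` and of sign `-1`. -/
def cert7_1 : Cert where
  N := 7
  e := 1
  p := 3
  n := 16
  V := 9
  W := 7
  tA := 10012014012010004004012016016012006010006014016014008012012008012012008014016014008010006012016016012006004010012014012010004004006008008006004002
  rA := 16010009008003002001000000
  tB := 2004006007005003000004008010011009005000006010012013011007000007011013012010006000005009011010008004000003005007006004002000000000000000000000000
  rB := 24017016010009008000
  t2 := 24021018026023028000018022028021027024000030033030033032030000028026024022020018000006010016009015012000012009006014011016000016014012010008006000002005002005004002000000000000000000000000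
  xs := 44043041040039038037036020019018017016015009008000
  rows := [1784, 3124, 3528, 2950, 3830, 1636, 2022, 2328, 86, 1785, 3125, 2513, 1637, 3797, 3663,
    1333]
  inverse := [6561, 13131, 32989738, 20769293, 42913403, 21556885, 41713306, 21556882, 10137426,
    21713407, 41043869, 21536746, 40651416, 21930888, 1143022, 4429545]

theorem valid_cert7_1 : cert7_1.valid = true := by decide +kernel

/-- The certificate of level `8` and of sign `1`. -/
def cert8_0 : Cert where
  N := 8
  e := 0
  p := 3
  n := 8
  V := 3
  W := 11
  tA := 2004005003000000000003000000000002000000000005000000004000003002000004000005000005000004000002003000004000000005000000000002000000000003000000000003005004002000000000000000000000000000000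
  rA := 11010000
  tB := 10012014012010000003011000016018016000011005013017000020000017013007015019021000021019015009013017000020000017013007011000016018016000011005000010012014012010000003002004006008006004002000
  rB := 28020019012011010004003002001000
  t2 := 17000012016014012000011000010000009000004008006004000003000002000000000000000000000000000000000000
  xs := 29028027023018017016012000
  rows := [1638, 1363, 1191, 1639, 2353, 4089, 541, 6641]
  inverse := [4398, 914, 1474, 1465, 2142, 749, 736, 981]

theorem valid_cert8_0 : cert8_0.valid = true := by decide +kernel

/-- The certificate of level `8` and of sign `-1`. -/
def cert8_1 : Cert where
  N := 8
  e := 1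
  p := 5
  n := 32
  V := 11
  W := 7
  tA := 12014016016014012004004014018020018014006012006016020020016008014014008016018016010016018016010014014008016020020016008012006014018020018014006004012014016016014012004004006008010008006004002
  rA := 19018011010009004003002001000000
  tB := 2004006000007005003000004008010000011009005000006010012000013011007000000000000000000000000000007011013000012010006000005009011000010008004000003005007000006004002000000000000000000000000000
  rB := 27019018011010009000
  t2 := 32035038036041042000060063000064062060000052055058056054052000044047050048046044000042040038036034032000026029000030028026000008011014012017018000020023000024022020000018016014012010008000002005000006004002000000000000000000000000
  xs := 66065064060059058057053052051050048047046045044043038037036024023022020019018017016015010009008000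
  rows := [1638, 1980, 2352, 540, 640, 3052, 3944, 6172, 3208, 350, 5192, 6510, 3268, 7924, 3594,
    3932, 122, 7538, 3090, 38, 1363, 1191, 3053, 7587, 6511, 2871, 3933, 6053, 6107, 7539, 7327,
    3251]
  inverse := [2500, 57220458985625, 610351562500, 12898482045843265700101, 10389766980813238368792,
    23002936763102546931327, 18531407559352052981373, 10753449166217000031304,
    13332792675038771512543, 18531407559352490406348, 26459137064845728132, 10552311141342195468814,
    39062500, 19531625, 390625, 13245520033307625178208, 21085339370870711150020,
    3165007402932378925035, 10576926806720560721941, 10387296022150732581312,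
    22429196550893458987514, 22435305891553174140734, 8360821070996195537543,
    16265707979733941450070, 10546021380708793184425, 6099093537203859412553,
    18346333899827400446974, 15772148910648632881374, 18551504914146338125091,
    10572112857098152503182, 20106891720412146898, 18551504914146582265716]

theorem valid_cert8_1 : cert8_1.valid = true := by decide +kernel

/-- The certificate of level `10` and of sign `1`. -/
def cert10_0 : Cert where
  N := 10
  e := 0
  p := 5
  n := 30
  V := 5
  W := 16
  tA := 2004006007005003000000000003000008000009000002000000000005009000000008004000003002000007000000000006000005000004000006008009007000007009008006000004000005000006000000000007000002003000004008000000009005000000000002000009000008000003000000000003005007006004002000000000000000000000000000000000000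
  rA := 23014013012000
  tB := 12014016018016014012000003013000020022024022020000013005015021000026028026000021015007017023027000030000027023017009019025029031000031029025019011017023027000030000027023017009015021000026028026000021015007013000020022024022020000013005000012014016018016014012000003002004006008010008006004002000
  rB := 45035034025024023015014013012005004003002001000
  t2 := 55049043061052046059050044057041035033039037000060058056054052050048046044042040038036034032000024018012030023017028021015026010004002008006000030028026024022020018016014012010008006004002000000000000000000000000000000000000000000000000000
  xs := 63062061060059058057056055054053052051050049031030029028027026025024023022021020019018017000
  rows := [19756, 15694, 7263, 14119, 843, 19757, 14427, 15695, 18707, 11235, 8359, 9927, 9551, 541,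
    9095, 15625, 7447, 4807, 14737, 617, 16163, 1015, 6145, 4553, 9167, 3485, 739, 19375, 12701,
    1909]
  inverse := [321973989335248095309, 321934017301996274574, 321966913713774441811,
    61893765503164630517, 802995637867447017825, 46375945685043878, 25282855840551398,
    422485224055435443679, 473950021501980605712, 25107647003619376, 422495214382845958947,
    473924794381054678218, 422514160852045513425, 473935850258925274586, 289347891271980773716,
    214102181021005326231, 529743962456972876199, 872518295631561792017, 214131600440507203478,
    214100174837068809851, 843444283359275873445, 473943573385321556951, 40794052470857133,
    55347723253697255, 792015863290248810219, 318888079087953033839, 318941265564934032845,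
    688712142841751665814, 688707489543870774807, 39785523331846139]

theorem valid_cert10_0 : cert10_0.valid = true := by decide +kernel

/-- The certificate of level `10` and of sign `-1`. -/
def cert10_1 : Cert where
  N := 10
  e := 1
  p := 3
  n := 61
  V := 15
  W := 11
  tA := 14016018020020018016014004004016022024026024022016006014006018024028028024018008016016008020026028026020010018022018010020024024020012020024024020012018022018010020026028026020010016016008018024028028024018008014006016022024026024022016006004014016018020020018016014004004006008010012010008006004002
  rA := 33024023022014013012011005004003002001000000
  tB := 2004006008000009007005003000004010012014000015013011005000006012016018000019017013007000008014018020000021019015009000000000000000000000000000000000009015019021000020018014008000007013017019000018016012006000005011013015000014012010004000003005007009000008006004002000000000000000000000000000000000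
  rB := 44034033024023022014013012011000
  t2 := 58053050063056068060055067064000000113110000116000118115123120000098093090103096108100095107104000000122120000118000116114112110000108106104102100098096094092090000078073070083076088080075087084000088086084082080078076074072070000068066064062060058056054052050000048045042000046048046000044042000000031028000034000036033041038000016011008021014026018013025022000000040038000036000034032030028000026024022020018016014012010008000000005002000006000006000004002000000000000000000000000000000000000
  xs := 130129127125124123122120119118117116115114113112111098097096095094093092091090089087086085084083082081080079078071070068067042041039037036035034032031030029028027026025024023015013012000
  rows := [19540, 14118, 842, 19756, 15694, 11092, 18222, 14100, 540, 7446, 14044, 4806, 11692,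
    16162, 6144, 4552, 15622, 6352, 13852, 9338, 62, 9888, 9100, 3484, 8184, 3456, 8258, 14720,
    12516, 2388, 15220, 12700, 15600, 16200, 7263, 19757, 14427, 15695, 8359, 9927, 18223, 15625,
    7447, 14737, 4553, 15623, 6353, 18385, 5347, 13853, 14869, 9339, 9889, 3485, 3457, 4379, 9375,
    2833, 15875, 3645, 14343]
  inverse := [9265104431043606, 1853027162420643, 1853020188851841, 69451627792715172230089244,
    9537214132690300822425660646, 244630048154719586167872238, 9431444476778726327183128638,
    68905502402747321332544460055, 42635761843975764249339930925, 2219688708289335093520184830,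
    65220035541085816751137236022, 29503048050905390952211531939, 89218678088770606414147787694,
    68905502402747336583739430029, 28558783299603203763922237097, 17815514848991134843459184469,
    111000375251159840265697530709, 14422350062730669339291246959, 89218678088770606414147794255,
    96723416648337714966531334459, 4374, 617704777343556, 31381059609, 243,
    4725799423571821195263526281, 126508026387868265282996292912, 85264200444848979989287610614,
    8916206151954179344297232869, 93469631219930107006821269733, 116112032454362426917924056470,
    77192298019685867871088856961, 110491084068583086865531707555, 67368187305765277696625384272,
    13813174070262819074315796529, 47467262996664270335922513977, 7725906111303185672571837928,
    37170874555489483675268148166, 120993558976439656803553773264, 3698438257714870466291693217,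
    86328537761140564525573729045, 118466658059430959488294277819, 38864291004945571164652939167,
    97388907395994942565643208973, 48604416022799472360644130923, 4725772810442202491760433941,
    4190433451381255005440882989, 14763142995770605596885784458, 44717271162646757418988273331,
    79061960008026879165484210358, 52448573120220432949822301521, 96665679121085004834554435872,
    85264344367609843050998949809, 17889210836354023625895620409, 28669506317730222273078445168,
    119809682062813973021015719672, 50852405396059944022036894112, 82015712355135151239944961834,
    29710503170044246750772176734, 79647082229107989283413529161, 46999647969461958622204191922,
    124515778638907777626849099027]

theorem valid_cert10_1 : cert10_1.valid = true := by decide +kernel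

/-- The certificate of level `12` and of sign `1`. -/
def cert12_0 : Cert where
  N := 12
  e := 0
  p := 13
  n := 63
  V := 8
  W := 22
  tA := 2004006008009007005003000000000003000010012000013011000002000000000005011000014015000010004000003002000007013015000014012006000005000004000009000014015000008000007011010006000008012000013009000009013000012008000006010011007000008000015014000009000004000005000006012014000015013007000002003000004010000015014000011005000000000002000011013000012010000003000000000003005007009008006004002000000000000000000000000000000000000000000
  rA := 40028027017016015014000
  tB := 14016018020022020018016014000003015000024026028030028026024000015005017025000032034036034032000025017007019027033000038040038000033027019009021029035039000042000039035029021011023031037041043000043041037031023013021029035039000042000039035029021011019027033000038040038000033027019009017025000032034036034032000025017007015000024026028030028026024000015005000014016018020022020018016014000003002004006008010012010008006004002000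
  rB := 66054053042041040030029028027018017016015014006005004003002001000
  t2 := 64082061078059074072057068066084063081077071054044050048046052000120000119126117124000115000122120000118116114000110000112000110000022040019036017032030015026024042021039035029012002008006004010000109000104000102000000100000000108106104102100000099000000000098000097000092000090000000088000000096094092090088000087000000000086000084082080078076074072070068066064062060058056054052050048046044000042040038036034032030028026024022020018016014012010008006004002000000000000000000000000000000000000000000000000000000000000000000000
  xs := 150148144143141140139135133099098097096095089077076075074073067065064063062061060059058057056055054053052051050049048047046045043042041040039038037036035034033032031030029028027026025024023000
  rows := [27640, 30452, 20312, 27388, 40072, 10766, 7890, 20296, 31422, 18959, 32443, 27641, 25847,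
    9829, 25937, 4631, 30453, 33249, 20313, 15393, 27389, 33573, 33937, 7949, 20175, 30835, 8145,
    37873, 12077, 3983, 8923, 30649, 40073, 13005, 10767, 41309, 2585, 21697, 17163, 34831, 10957,
    13193, 7891, 15583, 21221, 14969, 18703, 10257, 11315, 28413, 31651, 9751, 20297, 31423, 6567,
    34755, 18517, 17225, 30355, 13167, 23191, 8239, 2111]
  inverse := [11687717346352980652308970894551289256972240983947334614817156940348258,
    14004040032110565185148140160845519977754528928143977775029155924436036,
    2405417135980517006922793517518189624098605830744061386321077741751886,
    7417164743903865069413783055012088441050534337154340870605132149874587,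
    4728638708769150567621667732882695245371050648183923220586012135801258,
    12661472035131390492825424476812411402765109522724281789688694560657263,
    12765779464787907138395346711258885434874892633552749076796712958225321,
    4643280985282965908271959798986921392544308466726933209206730555029100,
    1909790361233409371509798127932894057814404795255203945744565937058182,
    1161367015612895213212744080079166170005535881407729493550143418029205,
    8966483217332880915174740986374835378543788070913301119315003562809557,
    11607611875359007165098934211930575510315186477919500978619755822420793,
    754766160365296330656421724137438343382069220004677929473032524195946,
    4758523927554830419766492176273933493923104451708759529840514891491,
    849783707618105445621622144373788114268607573948192156862509468465943,
    5394832000994187356928993199803592278187848282024078533126933811063440,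
    2321115610860762345113636444056568769661992719122237638978864216448644,
    6649094975359523324938585978439107247592925072643731325972673227066892,
    506717347752130258361102239140060130887259583288332171119456334850801,
    4269730017734367722352992949013078243702334174532172645353920049387432,
    4325886158976114413233710730390814708416617121234419948158059498913851,
    2363113132767558055269472127341138808635950493447522772224473173535116,
    6302190150646904510371630031697594921069508734084234878694700200552264,
    11645372642664935077971347071072709289349742423907447321117972702514774,
    2364800405638791463442947320449216365560765658165728523271632549500913,
    10482571439828744107169215153483289504306432158326626010632193529852990,
    14962746278421265382825666395384612998454197601826750764484546551222703,
    12352314094748627903017294773653691503028494043237882967780297601917783,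
    5800923737610636227730120387600209169446911922588326573950727229506127,
    12765757621525030872634554006499761690014902468318678989232031663264890,
    6374077427182340555122943552389520668109311549526644604430325695424,
    3126301711374938355056424023944573407627195286750633675593482380469109,
    2825720882918276980725285923521475744708659775716957518641978448768187,
    6302866868041888053410925540478002358882377506895263006517386835988048,
    1661723037563942605098393176792479897047444332933116203962697083773296,
    5389155357175346841103435748924995487121296731744489008775415067381401,
    13927127671714071154490398771221987559091095149797914512895415163615232,
    1160295487527582133057476340080935062396326509266042643960870977197069,
    7765333416388565867855864912254521950064364347366054897124958002927316,
    10440986528322010907645123149527363892666490405574836300585089613126586,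
    13569384575286891820887682853216960342561965948276740995191750570895083,
    4288712446489751789588255155733371949590358919375487773019602206901807,
    8123467142228029917092572971692073578287299557773492199150096279007928,
    5802498402917591124442331903455745310728967420126997442400988160677515,
    5804067001519853404768421689098521648402864852600804669393427026952196,
    12765770246159503407733094078647472389416976998295898310580604269342283,
    6960669184257998261857093565594111216955078442736614683923284744192139,
    3484026091521360054613295641796890857575994634711146994781160639170810,
    9286930670137761740246053344984101145879769781632950860862861172419799,
    10446266781109322134873402433156929328021683333138316311806909141227845,
    13926065472013821463320508048365612188483244692108939357531880201732581,
    12763658124417905204441326435708235346803848584476768086710352308060522,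
    10446797943079123711209775605343877190828541658790158124185759041770583,
    2353167196013459248080120351646260872585010262034842341074212295980096,
    7312130642637868150931362038383543267689081696957505493181393388344459,
    6454975264142712226449351380694991525140687523500517705648576277423374,
    4373277888752118510258603129768092442257790056316519699096000165517441,
    9022192879100048797364592694708579391057393119678879155509676617258429,
    10179435069890900284156775486577169845691752571559401225030909966909506,
    3215125980943413224279035286679729492957368905041931121098961807023996,
    8823664954014511368108139915747935960186856795914048331851143608930140,
    552437249820906607349777653190341170294668746639054623424632787712637,
    12205918801374978578349433501790114169464202480473313782508193607204919]

theorem valid_cert12_0 : cert12_0.valid = true := by decide +kernel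

/-- The certificate of level `12` and of sign `-1`. -/
def cert12_1 : Cert where
  N := 12
  e := 1
  p := 13
  n := 134
  V := 20
  W := 16
  tA := 16018020022024024022020018016004004018026028030032030028026018006016006020028034036036034028020008018018008022030036038036030022010020026020010024032036036032024012022028028022012024030034030024014024030034030024014022028028022012024032036036032024012020026020010022030036038036030022010018018008020028034036036034028020008016006018026028030032030028026018006004016018020022024024022020018016004004006008010012014012010008006004002
  rA := 52040039029028027026017016015014013006005004003002001000000
  tB := 2004006008010000011009007005003000004012014016018000019017015013005000006014020022024000025023021015007000008016022026028000029027023017009000010018024028030000031029025019011000000000000000000000000000000000000000011019025029031000030028024018010000009017023027029000028026022016008000007015021023025000024022020014006000005013015017019000018016014012004000003005007009011000010008006004002000000000000000000000000000000000000000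
  rB := 65053052041040039029028027026017016015014013000
  t2 := 258265000262000268261000000000266264262260258000152159176156173170155166165162160179174169180000242249256246000000245254000252250248246244242000092099116096113110095106105102100119114109120000230237000234000240233000000000238236234232230000122129146126143140125136135132130149144139150000218225000222000228221000000000226224222220218000200207216204000214203212000210208206204202200000182189198186000196185194000192190188186184182000180178176174172170168166164162160158156154152000150148146144142140138136134132130128126124122000120118116114112110108106104102100098096094092000082089000086000000085000000000090088086084082000012019036016033030015026025022020039034029040000070077000074000080073000000000078076074072070000054061068058000000057066000064062060058056054000042049000046000052045000000000050048046044042000040038036034032030028026024022020018016014012000002009000006000000005000000000010008006004002000000000000000000000000000000000000000000000000000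
  xs := 314309308307306305285280278277276275274273250245244243242241218213212211210209205202200198197196195194193189186184182181180179178177175174173172171170169168167166165164163162161159158157156155154153152151150149148147146145143142141140139138137136135134133132131130129117116115114113090085084083082081077072070069068067066065058053052051050049047046045044043042041040039038037036035034033021020019018017000
  rows := [18958, 27640, 25846, 9828, 25936, 30452, 20312, 27388, 33936, 27790, 20174, 30834, 37872,
    12130, 3982, 30648, 40072, 13004, 10766, 21696, 34830, 40816, 13192, 7890, 22642, 21220, 19962,
    10256, 11314, 28412, 20296, 31422, 34754, 25902, 23190, 29236, 13128, 7598, 6644, 614, 1598,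
    6938, 16430, 28918, 14444, 21022, 3184, 16954, 8944, 28092, 31140, 3738, 16784, 14256, 792,
    32168, 23574, 19380, 17952, 29192, 7754, 10270, 13112, 32974, 6378, 14688, 7716, 18812, 30046,
    24380, 19584, 32072, 10094, 17488, 94, 122, 26312, 34848, 18959, 32443, 27641, 25847, 33249,
    15393, 27389, 7949, 12077, 3983, 40073, 13005, 10767, 41309, 17163, 40817, 7891, 14969, 18703,
    19963, 10257, 11315, 28413, 31651, 9751, 20297, 31423, 6567, 17225, 30355, 13167, 40293, 8239,
    30801, 7599, 27053, 26717, 28919, 36259, 31013, 24851, 25567, 15453, 41253, 8453, 30487, 7241,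
    19563, 19351, 31623, 19439, 17909, 26411, 4737, 40943, 38351]
  inverse :=
    [63893333827343500799701260068832627824143340623499727018723260295761790669908589122031,
    2432493916616177329847491596345853578312159477432781605431363274068624719689255304646,
    2108162277626199061360036597976119958413377383207146473552901179115535934347088677978,
    2108162277623650366166436704022821381527871025006629230912847673876871251817139441485,
    4216311306869717490336914978806537058684167224933256714420007234390154209448166146684,
    68065252381513873031184847551535737345949129425083985085291799596989776070398718641644422290793860122111299899172054295614668794710044405171536377202,
    62588033110017627431924445401790671072093290955941399236500628181212576071830495958158367201274796159849948461303008234086453278893201046439470953840,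
    137264418734117113691245770782365046431979237792086917889004377307034155544461311408316363969938133490417725798383751818039457448765865770990320682699,
    12152476711861577390273131549843627295890285364047943220488113405137083732335391764338630277919998752042812664693096876955022304362370902550486103721,
    127387451384385096484791879608723919467657613672333213638731737057845795800052665206999517788699310057582890053671174072783892780414995309844298063192,
    171339962910993601716091212837187738245200339475840160422915999022146286851580758731746172882064941869416767029137247614112040237377198414290872845206,
    154802507586837505512381828483860502427136478196651288150186941849150744192040398398960122574964559731296845122633808282183665694108959842942116999800,
    141633733588957809321571501526739816160301383971036609335627427635285225725438909030240712663928474945106767356041687932680808507724830550442972258001,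
    153716339394442709973216191014801947857239426401811692687014014947394253954959333421083161536825848387455216465901254155011051639545855842862955185985,
    120760339846339312687898063402628501438713065029659725036817846402315836597404229411910422966140903228387826359237525022316507501356220367089000566136,
    125187311122456814797521140071710157434993717071280320279487823390525197782221169405157305333981488544077429105364189760432316235973750935404154579743,
    118641366412266473771341284996380611588925087222333809298006179777266163113979356975474176739221584150964792726542654495659529388068382834389302929143,
    928908207060803051979387074156337406988474702412615794591560206674871249036547867269801356774502501813798731403395782069933482393604846028869371465,
    87882737564109019483280392395595336350749713577351484263596055072880032728008171170098113858786392632443861328026777276224820588326486658914781285898,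
    106553860963308442887781120290317383735798917990753297235294539600784352638403836356811738411804005853778800541066553320387253307999697869169500841440,
    171339962910993601716091212837187738245200339475840160422915999022146286851580758731746172882064941869416764891926312202683366095833543731804739446877,
    129561432518019814225026008055531217904535444493519594997570993649705173878935114154337801038843280277270683338189075293700043581696203795244333741081,
    142784719516732694425037140083911055181317497567579035605774991108700145856634080694245079680944911021715177290874087277260805260695620322073893752646,
    52703420589472813393499756341982872151879444545938209942361548471966756907288146020530219195724184555910822068476887540013253458505542006598394504268,
    43979646394351512622269779128900869605007004762847722669706176676928630183396758106050664787614744086816077200235771423045393417998999368664456739366,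
    170190977299350969248394072325020226336342734273572041748644621897080640781878472029035400864035497782957521661938156396296275272388847368034648853757,
    120760339846339312687898063402628501438713065029659725036817846402315836597404229411910422966140903228387826371883743575046854685625709448050456976777,
    146068384806217840103435743558074297891482409093754383434100426444352298141149420321956467846005102990191130913858916966195773554796323000631123492436,
    25330055502259143584293936443201796861626889044982638874965844587594557827390513311101889315948883422943939138780232601913490287248023276743883780690,
    28576795416957272776433539939585464258382825386812827517969245976765009955953275394341562679098724882993386853616554663344048602303086745684170574321,
    167975427856881962412153130999034645487195493735973016794741551911274960204398903010530597407454176930347455745725466815331479353317209147496229087151,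
    170190977299350969248394072325020226336342734273572041748644621897080640781878472029035399441899844032272674137179417559920602537654402521062952968068,
    11016792997041855239278713625492025483457800317005548270018322530762482249102218304286080697438836613308458505455054441746130010814417997937110400938,
    591123237965844177873931326492640713320689115067164532494732688097597559247413370684786302033652798885380321160944131229896726406304416239942337508,
    928908207060803051979387074156337406988474702412615794591560206674871249036547867269801356774500758425181459154251784514471995274165176507774006256,
    1603236625773472552655954604210720363940261686065752715451630253938774534243073257919114465662380764028544239833012214428835988208130780266001,
    337786558921669814687724378634559878184110063500415946773604991619223946953340907054675078544614926222727525927146926395056103478281795906866076927,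
    2291235366491837189163762807337263806788209415527950419421529667230379969041341322656260048392214122910083624009437039753352428710851113995274,
    844462639318011193270489085377228285611833129412477792070349092157543675612972151536334068563613741260347613176129710190459004965546342608173737195,
    591123237965844177873931326492640713320689115067164532494732688097597559247413370684767814270154039982362499297339258346151174858521405607895823551,
    542800770374370512771595361, 938747716992749539075610586559995395800254606364178,
    938747716992749539075610586559995396079831627833950,
    45963636253482569181890627797232976902843333989836204026,
    1312782736068991063642705605079304727731956004699501971717284,
    57117848046824955774488676379933662469688714790963301132592147591797722048712122156522052445320187274195399597286784485581869278811773805116162766961,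
    108744973183456105640170911795639200822084474054396091321824871603302271715065825225452060587411027571666610170144819427982601313693458925348687719696,
    158146666774237292324338705311611721905990411284037244422352515776537125700058919839819142098951211763996759713696801925677231336551777324260018563206,
    71400164966236648866283196937007159772852209847035311393558627371210585501478804124151916157478024307111682855737918481540963182009870035060760659048,
    180039193733287707247506456375742570268165040892947301046174244237285854091107738572112487555999757194937905125205966676786920799673572600617515239938,
    87873805338684152623058099338989945436239463453714774317833388757248374290531382915745557982434025646151193417878667138605089215329541648266174555795,
    144954398440643906028647468592498998732842467845393520099910873968447325640728781470182537057844015828811969630394992598395062501001299419167382127163,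
    149301460429703184065969884309139482012759693672350978362796692250345515173004261465689495523386581559948458572420879064741081034769122783046407511659,
    133957773881913305703143719640058596656946298437413417028085888032571080716661579408308002848796810545834841598069957818300975413073732805722281173819,
    171291948270894710542740494700187245075810446171364697669653014855625120445632812586623810961701080364705544586415767639565725708419754707430512272221,
    93388419639649530914348435229834371005963122819855764385472986115298757984509488589986570983673550778507749185310353429669648157060161236462741285350,
    81249384412588269276069125493737257235330160748520273589266612312577122684742795095601659832607125079646975589590059338047996968890102701000135646944,
    168893175743636580516259196145635158554492408060131983183406309782284826324168336875179672093216912922015078174460815998292965992567199627998786699,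
    53837479441387173638898012174158334873948553322261334110784122035238153835456781511037223569592229490708238448347971602263449915462138298666020519656,
    171322892123868247698043791938296726380206307676900421246367002026724884396880178239268481770925245572766468730867425697718830096650228608346549917369,
    29679125665424634431829486844154298032648653959125881498387769266988436042022796031935109750785365970808618347856863583108277484788660773038464313691,
    126325211850295451676478044524173955860113480680589009142039898207818388036545033258879928082289545722688426266736633738029798536670954150230805758321,
    126304591835275630900188567508232301095929644216286407997677798344835821735451466475121360964336439132880586799371834486668889138668069784635305486354,
    85702221194020066574946884148163127435454249083836932570991986697293339577474961298482560929613364559466730694988426591085844104494511155334608477518,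
    164730831209362207488618687250304217458027232364995823846416777216643932267885056250909925061169153957212149661323551441116288847338132381915724918356,
    27495201619945328284055917787835526216101227566255504210423216069097571666975969826541338871284793618455721018658342214005021958156891683555609822532,
    159202727521400652631326152010776252585874481547139153186919992672520720094471336126133943624173301804392032055209410022960692704422004682415319868220,
    63723669941649664895975360169020529164137013936942889862952785343460529999380785254456389738961253405115068972175856389452403317561624820989900153630,
    113076989095362834352811335977149769885484039617584826647563467626302938393744243744590145600538821847365081459171037359400560966628500772269813203821,
    64789600969536970329578592728320790371447942124002964956252105210011423900384575475888505503756796288760498588806217503947424834989578808312887199546,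
    122972798138485017720483039322190030179217625197416070469236333918534740866030958795304764652082920804887320971604731478345969951925058049833156722904,
    21991527042639501404501601180630187910824488025690791432974212683470019095300486553916040134185144140250549230983062228177683235574600484576830320398,
    337784973283822095373400837561649901868088977431900808906656603867857201768710209269267181373757966975400623010708068165238297873211683808325280206,
    138373152995630515446162691918193656382376765628971787018798635025400056517631888901765690791222755701295332894773323158967226303781974944626962623609,
    117471216406576840487146118429354369357222326591021307098019198122104011077638506555239769049706208954085950598338483865150253908310816468349261869458,
    171325388775686803420375276651185556555522789974442107413977443172093736460130487106753993960447143908623699925869718777614041592084531418705977576453,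
    88980405275718825124305151674105884522925063427675054600548535978796273360312966271525891614106949176959662170423324400688516494279162809892693839773,
    33003728018063624445305569470930782306517504618861105037817277577249822412265062433282607933948556160218534177053144189044640179449799553577250316783,
    74872330351704865973346958187178873197773209373633681992725732418697489091564500727666474746620221604385691592200755290479751919690324752345467092901,
    169131582025366689345492775313887500041576297131072298173046491228104801906862163138371025785123098194418765270976328719596578296388522381196405382725,
    95537537497827287952755871058645923635251533574930411722618207315262690308082832549277828586510196687929619277843777545274769194616113227391352741464,
    152624976878342043417256222326186272431971266625337746868413097641748203171012791091431885994513513188522744770912831590282388268138367740227368594170,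
    97741571770802436646576401975906804558191102818350697415081033509304778620464891927792845754541212296149558697535170553464853311677693802223583209754,
    80202580500457703834585814901526037718407536173532443741510253544409158255678649967902914207693773079481380629666966570613398143035482154975799924474,
    17609557733523420634170721018563468440408244998288815790799121656215843271488089600277657767019330814783915496518338384695683692520762614941522133744,
    157971486187915992851199703137367882813405410065816192849940272018048074102395281457645835029478137758681845941922874900628290494594426743449422522188,
    3345024325762047667883604137686312641016786306305141160885875463881193797509193188826795976394041841645533289012444386371015003976006805734551662454,
    760016864092945033439567838719197908275066433109041230171534058419566571035835462891114616988857876336391302485023432812052029965246973067477923555,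
    84447160276948544457772117593583236329208079885727581903233879818971442816526298538255818172046592951846185602127427011375523543996390849959031669,
    68063626629369657950370543926942890842083017963619380280928370780496781973741147096412064683086773052823754171952857118818939381798774282228115306537,
    17595813611411446482916355182402236170587748920648018023436764116451393381181075159290528320617552997937346784845438190736199747625147259709572670973,
    175664400836147487139425518936584743695650660120761847494999111272572277156440273827702060197358342550153984449098226245174501749007922545546523324849,
    7732467132334792858257962647651923759243813709592064129357615957151509043268350286319948129499329839741803894083754408245799763688725995627325779798,
    88896088816281946261844006120023178219947364672959481713548952550350899519193365848634250794272981633011301320572521451135627965334103962826506813273,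
    116401303201909046633998919757080899981146327683891278080412398747366639810872182743725483261669564072758349047219747355239325135103808946801720172940,
    152650025510764480738101846693649267892245131431239429804532410073518363747134684277089593832863527925170318248282640113642933739363048093919133523399,
    163581832312888881618374985849747557974595618287885197818794403501062688820331722198908727084319007802632351521033038239196789842128097376641022157337,
    110906366297472019647583549975455150163928779369311319927798803492559266119918087885575022551264754746451999421580759967994404694647105317669585345179,
    844461050081456303935615968935672394155195680757646392828630098605739252986734826220171368938062572425351967270008969109851516046936063064445874495,
    72503299663168867584313421575015552012337483166754881329264901650109547895679622122420122767452713941947151364118946265095151187961052889151262846905,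
    46174409594235507726654506197048883086126920437174405379979606133594105690117417201684900366642578773490156888861462905399470873858736949697160578865,
    81249383719572123971841548260499597579862049856343577104557829373539255797133607836981042491092565702934375259788069784263772668382850330719392337004,
    112001515820257598810973838901212937105506110250319730464081686519438642849236251017127291237921081724537568113113557804242653818986436669587712834656,
    93336889403381655920922561189796531900038080357682201277482070525409703086465256392141801409864353018015534407566056282307286410924164223720156906211,
    155911104635715162444821450512763712118256139307461836993837614908358364483618279486708209908753885327747353996777755790892616915042653850369806315327,
    36308920559724401417202393905707573406273023631237052877425849953653615279390689035077007173512322830604274221980098281679916413097095436549570769208,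
    31915323190671954537278200486329705597414732319593789619608874477600406012006829352982464867801137087938450027295883298166662142618154975923093511553,
    253338511406412523821454185858259884662428450635539412920469308410764125113895237611470403657034845888310115361418239124890384297052452073497126647,
    97740071140891842535773784981381983205144945489740654967660744609905695106716493311648122081132477720153278941566882843575934618961090221244835255563,
    147186831221899675239556451482882934182432368590028888104194753454097635711247963266539002803242445221370577240092327161002055212149793363468085837372,
    61519597915486855325005124076241768713207280275947309255221420930891531000282482210943095395340329132723326630963648464911954531645622785578609652481,
    147187331589623282919452902583765774933241074270453963932849801162833893049250302531027646584126097661702992551491691916848280842879690817101725219374,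
    97740072053350380445078506177259038711977724149421883623975950893524230098507657793713865918117647044464254138891719836487875590682746900251455101451,
    37370461866852102979319107466040523325396694865751089475843753859906520971792701640089943009834222069268955251140177292080494544770520884923938200613,
    58257017457257720408424517311704818965339861397230857416092425368091267451002604612745966041829093259932217294714224369913085242119583459110020271324,
    147187328861629913933315459362983302846654990600159764694440256474768460531436783607500344632512439776690903203304175668383252144605680438655676197936,
    97741572683380205445677353098372149016369649647317533465579324747826499074548090307910000432760820477829245575106601897367288686657943417222585643003,
    912577772445149107191716765221951609739246783629793889294944537783734460199965588225798867056159405910530045396053045357310360140464577436858,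
    36308920559724401417202393905707573406273023631237052877425849953653615279390688993890744036064162815661152534242393540557099075515080821648415113219,
    3346066460380214592214739290867305909878856415411193839884187792686598379894704871133599209272675362732411262029831093729355680461752414799606692498,
    79045965186408399964448713095528147263516537394564062284871132344898795679892822370276748511372938902876353002310665641138472111313306499859152949594,
    53822366241344087190433767593806379309582767719714030373068881613945133037617164118290430028042929673897919119231379007264276682136982526603129061301,
    174560695545294820484811364740537674618368207794106839526745329598196922264987932934682707742944468831240012521087298653766603354964069244205676299407,
    157042579354336528173667926224425316359237344185012634198216044846254655961536658033517776271611058600888265099659882292301625527568340646660701109552,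
    31915323190671954537278200486329705597414732319593789619608874477600406012006829352982464867801137087938450027295883298166662142618154673047986919300,
    29699773748210958045612107884114591963504800217819776699949276243206584299218385544375193349725610782881670969253101907791890803505551121872492761398,
    3346066460380214592214739290867305909878856415411193839884187792686598379894704871133599209272675362732411262104660789307641758475181344272751404987,
    506677912758579517770732029327265564626022724203798934410582902734584154321500246883693747635834431732006488808094476790266682044435889237183993783,
    506678813391467439108562759834982087474129829521254921671560373859187394637980309733170876879824344367944130709345770581846174290775869010832458471,
    1140318197072816203994451446486981165894364840648131203970510597507492867887491817902641519619725766903298539262275360473419755891890991884756,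
    84447388685845455387508819719108768104388467082371684212673642917040584267322271565245499491357315327992268576763368222009336060252497094755176444,
    2051852623999202926071226769990945210065847269406261286469982880757965253854858328449003962330252798470112703471513576539095537992423479061162,
    760015496329546525306019918593858395758047331763278856442174543647756257946504930432869803079747843057084941696953494010761962798594876106578673140,
    422232571506076357831872337945307714466212960962502405209596950245378623264091593266020225209230542491231764037269865248123596085904586294029516330]

theorem valid_cert12_1 : cert12_1.valid = true := by decide +kernel

end Voronoi

namespace Voronoi

open Matrix

instance finiteIndex_Gamma0 (N : ℕ) [NeZero N] : (Gamma0 N).FiniteIndex := by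
  refine Subgroup.finiteIndex_of_le
    (H := (SpecialLinearGroup.map (n := Fin 4) (Int.castRingHom (ZMod N))).ker) fun A hA j hj => ?_
  have h : ((A.1 3 j : ℤ) : ZMod N) = (1 : Matrix (Fin 4) (Fin 4) (ZMod N)) 3 j :=
    congrArg (fun B : SpecialLinearGroup (Fin 4) (ZMod N) => B.1 3 j) (MonoidHom.mem_ker.1 hA)
  rw [one_apply_ne hj.symm] at h
  exact (ZMod.intCast_zmod_eq_zero_iff_dvd _ _).1 h

theorem IsHarmonic.xval_eq_zero {Y : Matrix (Fin 4) (Fin 4) ℤ → ℂ} {N : ℕ} (hH : IsHarmonic Y)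
    (hY : IsLabelled N Y) {C : Cert} (hC : C.valid = true) (hN : C.N = N) (a : Fin 4 → ZMod N) :
    xval Y ((-1) ^ C.e) a = 0 := by
  subst hN
  exact Cert.xval_eq_zero hC hY hH a

theorem groupCohomology_eq_zero_of_valid {N : ℕ} {C C' : Cert} (hN : N ≠ 0) (hC : C.valid = true)
    (hC' : C'.valid = true) (h0 : C.e = 0) (h1 : C'.e = 1) (h2 : C.N = N) (h3 : C'.N = N)
    (x : groupCohomology (Rep.trivial ℂ (Gamma0 N) ℂ) 5) : x = 0 := by
  have : NeZero N := ⟨hN⟩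
  refine groupCohomology_five_eq_zero _
    (fun h hh hd hc => hh.eq_zero_of_std_zero hd fun M hM => ?_) x
  have hY := hh.isLabelled (std 0)
  have hH := hh.isHarmonic hd hc
  refine hY.eq_zero_of_xval (fun a => ?_) (fun a => ?_) hM
  · simpa [h0] using hH.xval_eq_zero hY hC h2 a
  · simpa [h1] using hH.xval_eq_zero hY hC' h3 a

end Voronoi

/-- `H^5(Γ₀(N), ℂ) = 0` for every `N ∈ {2, 3, 4, 5, 6, 7, 8, 10, 12}`. -/
theorem H5_Gamma0_eq_zero :
    ∀ N ∈ ({2, 3, 4, 5, 6, 7, 8, 10, 12} : Set ℕ),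
      ∀ x : groupCohomology (Rep.trivial ℂ (Gamma0 N) ℂ) 5, x = 0 := by
  rintro N (rfl | rfl | rfl | rfl | rfl | rfl | rfl | rfl | rfl)
  · exact Voronoi.groupCohomology_eq_zero_of_valid (by decide) Voronoi.valid_cert2_0
      Voronoi.valid_cert2_1 rfl rfl rfl rfl
  · exact Voronoi.groupCohomology_eq_zero_of_valid (by decide) Voronoi.valid_cert3_0
      Voronoi.valid_cert3_1 rfl rfl rfl rfl
  · exact Voronoi.groupCohomology_eq_zero_of_valid (by decide) Voronoi.valid_cert4_0
      Voronoi.valid_cert4_1 rfl rfl rfl rfl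
  · exact Voronoi.groupCohomology_eq_zero_of_valid (by decide) Voronoi.valid_cert5_0
      Voronoi.valid_cert5_1 rfl rfl rfl rfl
  · exact Voronoi.groupCohomology_eq_zero_of_valid (by decide) Voronoi.valid_cert6_0
      Voronoi.valid_cert6_1 rfl rfl rfl rfl
  · exact Voronoi.groupCohomology_eq_zero_of_valid (by decide) Voronoi.valid_cert7_0
      Voronoi.valid_cert7_1 rfl rfl rfl rfl
  · exact Voronoi.groupCohomology_eq_zero_of_valid (by decide) Voronoi.valid_cert8_0
      Voronoi.valid_cert8_1 rfl rfl rfl rfl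
  · exact Voronoi.groupCohomology_eq_zero_of_valid (by decide) Voronoi.valid_cert10_0
      Voronoi.valid_cert10_1 rfl rfl rfl rfl
  · exact Voronoi.groupCohomology_eq_zero_of_valid (by decide) Voronoi.valid_cert12_0
      Voronoi.valid_cert12_1 rfl rfl rfl rfl
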